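/- Let L_n be the number of leaves of the G-trie built from n random labelings, i.e. the number of words w in the G-trie such that no one-step extension w·(m,a) with m ∈ {1,…,M}, a ∈ {1,…,A} belongs to the G-trie. Then there exist a > 1 and continuous positive 1-periodic functions H_E, H_V : ℝ → ℝ such that E(L_n) = H_E(log_a n) n^ρ (1+o(1)); Var(L_n) = H_V(log_a n) n^ρ (1+o(1)) if p_j = 1/A for all j, and Var(L_n) = H_V(log_a n) n^{2ρ-1} (1+o(1)) otherwise; and (L_n - E(L_n))/sqrt(Var(L_n)) converges in distribution to the standard normal distribution N(0,1). -/

import Mathlib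

open MeasureTheory ProbabilityTheory Filter Topology

/-- A word `w` over `{1,…,M}×{1,…,A}` occurs in the labeling `L` of the infinite rooted
`M`-ary tree (nodes are identified with words over `Fin M`; the value of `L` on the root `[]`
is irrelevant) if along the path determined by the first components the labels are the
second components. -/
def Occurs {M A : ℕ} (L : List (Fin M) → Fin A) (w : List (Fin M × Fin A)) : Prop :=
  ∀ t : Fin w.length, L ((w.take (t.1 + 1)).map Prod.fst) = (w.get t).2

/-- The number of labelings among `Ls` in which the word `w` occurs. -/
noncomputable def occCount {M A n : ℕ} (Ls : Fin n → List (Fin M) → Fin A)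
    (w : List (Fin M × Fin A)) : ℕ :=
  Nat.card {i : Fin n // Occurs (Ls i) w}

/-- The G-trie built from the labelings `Ls`: all words occurring in at least two of them. -/
def GTrie {M A n : ℕ} (Ls : Fin n → List (Fin M) → Fin A) : Set (List (Fin M × Fin A)) :=
  {w | 2 ≤ occCount Ls w}

/-- The size of the G-trie built from the labelings `Ls` (as a real number). -/
noncomputable def gtrieSize {M A n : ℕ} (Ls : Fin n → List (Fin M) → Fin A) : ℝ :=
  (GTrie Ls).ncard

/-- `μL` is the distribution of a random labeling of the infinite rooted `M`-ary tree where
all labels are independent with `P(letter = j) = p j`: every finite cylinder set has the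
product probability. -/
def IsLabelingMeasure {M A : ℕ} (p : Fin A → ℝ) (μL : Measure (List (Fin M) → Fin A)) : Prop :=
  ∀ (s : Finset (List (Fin M))) (f : List (Fin M) → Fin A),
    μL {L | ∀ w ∈ s, L w = f w} = ∏ w ∈ s, ENNReal.ofReal (p (f w))

/-- The number of leaves of the G-trie built from `Ls`: words in the G-trie none of whose
one-step extensions belongs to the G-trie. -/
noncomputable def leafCount {M A n : ℕ} (Ls : Fin n → List (Fin M) → Fin A) : ℝ :=
  {w | w ∈ GTrie Ls ∧ ∀ (m : Fin M) (a : Fin A), w ++ [(m, a)] ∉ GTrie Ls}.ncard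

set_option linter.unusedVariables false

namespace GT

/-- comparison bound for renewal inequalities -/
theorem ren_bound {ι : Type*} [Fintype ι] (l q : ι → ℝ) (hq : ∀ i, 0 ≤ q i)
    (hqs : ∑ i, q i = 1) (lam Lam : ℝ) (hlam : 0 < lam) (hl : ∀ i, lam ≤ l i)
    (hL : ∀ i, l i ≤ Lam) (δ C : ℝ) (hδ : 0 < δ) (hC : 0 ≤ C) :
    ∃ K, 0 ≤ K ∧ ∀ (W : ℝ → ℝ) (y0 B : ℝ),
      (∀ y, y0 ≤ y → W y ≤ ∑ i, q i * W (y - l i) + C * Real.exp (-δ * y)) →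
      (∀ y, y0 - Lam ≤ y → y ≤ y0 → W y ≤ B) →
      ∀ y, y0 - Lam ≤ y → W y ≤ B + K * Real.exp (-δ * y0) := by
  have hk : 0 < Real.exp (δ * lam) - 1 := by
    have := Real.add_one_lt_exp (x := δ * lam) (by positivity)
    nlinarith [mul_pos hδ hlam]
  set κ := Real.exp (δ * lam) - 1 with hκ
  refine ⟨C / κ * Real.exp (δ * Lam), by positivity, ?_⟩
  intro W y0 B h1 h2
  set K' := C / κ with hK'
  have hK'0 : 0 ≤ K' := by positivity
  have key : ∀ n : ℕ, ∀ y, y0 - Lam ≤ y → y ≤ y0 + n * lam →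
      W y ≤ B + K' * (Real.exp (-δ * (y0 - Lam)) - Real.exp (-δ * y)) := by
    intro n
    induction n with
    | zero =>
      intro y hy1 hy2
      have := h2 y hy1 (by simpa using hy2)
      have h3 : Real.exp (-δ * y) ≤ Real.exp (-δ * (y0 - Lam)) := by
        apply Real.exp_le_exp.2; nlinarith
      nlinarith
    | succ n ih =>
      intro y hy1 hy2
      by_cases hy : y ≤ y0
      · have := h2 y hy1 hy
        have h3 : Real.exp (-δ * y) ≤ Real.exp (-δ * (y0 - Lam)) := by
          apply Real.exp_le_exp.2; nlinarith
        nlinarith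
      · push Not at hy
        refine (h1 y hy.le).trans ?_
        have h4 : ∀ i, q i * W (y - l i) ≤ q i * (B + K' * (Real.exp (-δ * (y0 - Lam)) -
            (1 + κ) * Real.exp (-δ * y))) := by
          intro i
          apply mul_le_mul_of_nonneg_left _ (hq i)
          refine (ih (y - l i) (by linarith [hL i]) (by push_cast at hy2; linarith [hl i])).trans ?_
          have : (1 + κ) * Real.exp (-δ * y) ≤ Real.exp (-δ * (y - l i)) := by
            rw [hκ, show (1 + (Real.exp (δ * lam) - 1)) = Real.exp (δ * lam) by ring, ← Real.exp_add]
            apply Real.exp_le_exp.2; nlinarith [hl i]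
          nlinarith
        refine (add_le_add_left (Finset.sum_le_sum fun i _ => h4 i) _).trans ?_
        rw [← Finset.sum_mul, hqs]
        have : C = K' * κ := by rw [hK']; field_simp
        rw [this]; ring_nf; rfl
  intro y hy
  obtain ⟨n, hn⟩ := exists_nat_ge ((y - y0) / lam)
  refine (key n y hy ?_).trans ?_
  · rw [div_le_iff₀ hlam] at hn; linarith
  · have : Real.exp (-δ * (y0 - Lam)) = Real.exp (δ * Lam) * Real.exp (-δ * y0) := by
      rw [← Real.exp_add]; ring_nf
    rw [this]
    have := Real.exp_pos (-δ * y)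
    nlinarith

/-- a function satisfying an approximate renewal equation -/
structure Ren {ι : Type*} [Fintype ι] (l q : ι → ℝ) (Z : ℝ → ℝ) (C δ y0 : ℝ) : Prop where
  hq : ∀ i, 0 < q i
  hqs : ∑ i, q i = 1
  hl : ∀ i, 0 < l i
  hδ : 0 < δ
  hC : 0 ≤ C
  hZ : Continuous Z
  h : ∀ y, y0 ≤ y → |Z y - ∑ i, q i * Z (y - l i)| ≤ C * Real.exp (-δ * y)

theorem exists_lam {ι : Type*} [Fintype ι] (l : ι → ℝ) (hl : ∀ i, 0 < l i) :
    ∃ lam Lam, 0 < lam ∧ 0 < Lam ∧ (∀ i, lam ≤ l i) ∧ (∀ i, l i ≤ Lam) := by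
  classical
  have h1 : ∀ i, l i ≤ 1 + ∑ j, l j := fun i => by
    have := Finset.single_le_sum (fun j _ => (hl j).le) (Finset.mem_univ i); linarith
  have h2 : ∀ i, (l i)⁻¹ ≤ 1 + ∑ j, (l j)⁻¹ := fun i => by
    have := Finset.single_le_sum (f := fun j => (l j)⁻¹)
      (fun j _ => (inv_pos.2 (hl j)).le) (Finset.mem_univ i)
    linarith
  have h3 : 0 ≤ ∑ j, (l j)⁻¹ := Finset.sum_nonneg fun j _ => (inv_pos.2 (hl j)).le
  have h4 : 0 ≤ ∑ j, l j := Finset.sum_nonneg fun j _ => (hl j).le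
  refine ⟨(1 + ∑ j, (l j)⁻¹)⁻¹, 1 + ∑ j, l j, by positivity, by positivity, ?_, h1⟩
  intro i
  rw [inv_le_comm₀ (by positivity) (hl i)]
  exact h2 i

variable {ι : Type*} [Fintype ι] {l q : ι → ℝ} {Z : ℝ → ℝ} {C δ y0 : ℝ}

theorem Ren.bdd (H : Ren l q Z C δ y0) : ∃ B, 0 ≤ B ∧ ∀ i y, y0 ≤ y → |Z y| ≤ B ∧ |Z (y - l i)| ≤ B := by
  obtain ⟨lam, Lam, h1, h1', h2, h3⟩ := exists_lam l H.hl
  obtain ⟨K, hK, hb⟩ := ren_bound l q (fun i => (H.hq i).le) H.hqs lam Lam h1 h2 h3 δ C H.hδ H.hC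
  obtain ⟨B, hB⟩ := (isCompact_Icc (a := y0 - Lam) (b := y0)).exists_bound_of_continuousOn H.hZ.continuousOn
  have := hb (fun y => |Z y|) y0 B ?_ ?_
  · have hall : ∀ y, y0 - Lam ≤ y → |Z y| ≤ max (B + K * Real.exp (-δ * y0)) 0 :=
      fun y hy => (this y hy).trans (le_max_left _ _)
    refine ⟨_, le_max_right _ _, fun i y hy => ⟨hall y (by linarith), hall _ (by linarith [h3 i])⟩⟩
  · intro y hy
    have h4 := H.h y hy
    have h5 : |∑ i, q i * Z (y - l i)| ≤ ∑ i, q i * |Z (y - l i)| := by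
      refine (Finset.abs_sum_le_sum_abs _ _).trans (le_of_eq ?_)
      refine Finset.sum_congr rfl fun i _ => ?_
      rw [abs_mul, abs_of_pos (H.hq i)]
    have := abs_sub_abs_le_abs_sub (Z y) (∑ i, q i * Z (y - l i))
    linarith
  · intro y hy1 hy2
    exact hB y ⟨hy1, hy2⟩

theorem Ren.unif (H : Ren l q Z C δ y0) (ε : ℝ) (hε : 0 < ε) :
    ∃ η, 0 < η ∧ ∀ y t, y0 ≤ y → 0 ≤ t → t ≤ η → |Z (y + t) - Z y| ≤ ε := by
  obtain ⟨lam, Lam, h1, h1', h2, h3⟩ := exists_lam l H.hl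
  obtain ⟨K, hK, hb⟩ := ren_bound l q (fun i => (H.hq i).le) H.hqs lam Lam h1 h2 h3 δ (2 * C) H.hδ
    (by linarith [H.hC])
  have ht : Tendsto (fun y => K * Real.exp (-δ * y)) atTop (𝓝 0) := by
    have : Tendsto (fun y => Real.exp (-δ * y)) atTop (𝓝 0) := by
      apply Real.tendsto_exp_atBot.comp
      exact tendsto_id.const_mul_atTop_of_neg (by linarith [H.hδ])
    simpa using this.const_mul K
  obtain ⟨y1, hy1, hy1'⟩ := ((ht.eventually (gt_mem_nhds (show 0 < ε / 2 by linarith))).and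
    (eventually_ge_atTop y0)).exists
  have huc := (isCompact_Icc (a := y0 - Lam) (b := y1 + 1)).uniformContinuousOn_of_continuous
    H.hZ.continuousOn
  rw [Metric.uniformContinuousOn_iff] at huc
  obtain ⟨η, hη, hu⟩ := huc (ε / 2) (by linarith)
  have hcomp : ∀ y t, y0 - Lam ≤ y → y ≤ y1 → 0 ≤ t → t ≤ min (η / 2) 1 → |Z (y + t) - Z y| ≤ ε / 2 := by
    intro y t hy hy' ht0 ht1
    have h5 : t ≤ η / 2 := ht1.trans (min_le_left _ _)
    have h6 : t ≤ 1 := ht1.trans (min_le_right _ _)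
    have := hu (y + t) ⟨by linarith, by linarith⟩ y ⟨by linarith, by linarith⟩
      (by rw [Real.dist_eq]; simp [abs_of_nonneg ht0]; linarith)
    rw [Real.dist_eq] at this
    exact this.le
  refine ⟨min (η / 2) 1, by positivity, ?_⟩
  intro y t hy ht0 ht1
  by_cases hyy : y ≤ y1
  · exact (hcomp y t (by linarith) hyy ht0 ht1).trans (by linarith)
  push Not at hyy
  have := hb (fun y => |Z (y + t) - Z y|) y1 (ε / 2) ?_ ?_ y (by linarith)
  · linarith
  · intro z hz
    have h4 := H.h z (by linarith)
    have h5 := H.h (z + t) (by linarith)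
    have h6 : Real.exp (-δ * (z + t)) ≤ Real.exp (-δ * z) := by
      apply Real.exp_le_exp.2; nlinarith [H.hδ]
    have h7 : |∑ i, q i * Z (z + t - l i) - ∑ i, q i * Z (z - l i)| ≤
        ∑ i, q i * |Z (z - l i + t) - Z (z - l i)| := by
      rw [← Finset.sum_sub_distrib]
      refine (Finset.abs_sum_le_sum_abs _ _).trans (le_of_eq ?_)
      refine Finset.sum_congr rfl fun i _ => ?_
      rw [← mul_sub, abs_mul, abs_of_pos (H.hq i)]
      ring_nf
    have h8 : C * Real.exp (-δ * (z + t)) ≤ C * Real.exp (-δ * z) :=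
      mul_le_mul_of_nonneg_left h6 H.hC
    rw [abs_le] at h4 h5 h7 ⊢
    constructor <;> linarith [h4.1, h4.2, h5.1, h5.2, h7.1, h7.2]
  · intro z hz1 hz2
    exact hcomp z t (by linarith) hz2 ht0 ht1

/-- integral of `f y - f (y - a)` -/
theorem int_shift (f : ℝ → ℝ) (hf : Continuous f) (a x y : ℝ) :
    ∫ s in x..y, (f s - f (s - a)) = (∫ s in (y - a)..y, f s) - ∫ s in (x - a)..x, f s := by
  have hi : ∀ u v, IntervalIntegrable f volume u v := fun u v => hf.intervalIntegrable u v
  have hg : Continuous fun s => f (s - a) := hf.comp (continuous_id.sub continuous_const)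
  rw [intervalIntegral.integral_sub (hi _ _) (hg.intervalIntegrable _ _)]
  rw [intervalIntegral.integral_comp_sub_right (fun s => f s) a]
  have h1 := intervalIntegral.integral_add_adjacent_intervals (hi (x - a) x) (hi x y)
  have h2 := intervalIntegral.integral_add_adjacent_intervals (hi (x - a) (y - a)) (hi (y - a) y)
  linarith

theorem int_exp_le (C δ x y : ℝ) (hδ : 0 < δ) (hC : 0 ≤ C) :
    ∫ s in x..y, C * Real.exp (-δ * s) ≤ C / δ * Real.exp (-δ * x) := by
  rw [intervalIntegral.integral_const_mul]
  have : ∫ s in x..y, Real.exp (-δ * s) = (Real.exp (-δ * x) - Real.exp (-δ * y)) / δ := by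
    have := intervalIntegral.integral_comp_mul_left (a := x) (b := y) (fun s => Real.exp s)
      (c := -δ) (by linarith)
    rw [this, integral_exp]; simp; field_simp; ring
  rw [this, mul_div_assoc', div_mul_eq_mul_div]
  apply div_le_div_of_nonneg_right _ hδ.le
  have := Real.exp_pos (-δ * y)
  nlinarith

theorem barbalat (f : ℝ → ℝ) (hf : Continuous f) (hf0 : ∀ y, 0 ≤ f y) (y0 K : ℝ)
    (hK : ∀ y, y0 ≤ y → ∫ s in y0..y, f s ≤ K)
    (hu : ∀ ε > 0, ∃ η, 0 < η ∧ ∀ y t, y0 ≤ y → 0 ≤ t → t ≤ η → f y ≤ f (y + t) + ε) :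
    Tendsto f atTop (𝓝 0) := by
  have hi : ∀ u v, IntervalIntegrable f volume u v := fun u v => hf.intervalIntegrable u v
  set F : ℝ → ℝ := fun y => ∫ s in y0..(max y y0), f s with hF
  have hmono : Monotone F := by
    intro a b hab
    simp only [hF]
    have := intervalIntegral.integral_add_adjacent_intervals (hi y0 (max a y0)) (hi (max a y0) (max b y0))
    rw [← this]
    have : 0 ≤ ∫ s in (max a y0)..(max b y0), f s :=
      intervalIntegral.integral_nonneg (max_le_max_right _ hab) (fun u _ => hf0 u)
    linarith
  have hlim : Tendsto F atTop (𝓝 (⨆ y, F y)) := by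
    apply tendsto_atTop_ciSup hmono
    refine ⟨K, ?_⟩
    rintro _ ⟨y, rfl⟩
    exact hK _ (le_max_right _ _)
  rw [Metric.tendsto_atTop]
  intro ε hε
  obtain ⟨η, hη, h⟩ := hu (ε / 2) (by linarith)
  have h1 : Tendsto (fun y => (F (y + η) - F y) / η) atTop (𝓝 0) := by
    have := ((hlim.comp (tendsto_atTop_add_const_right atTop η tendsto_id)).sub hlim).div_const η
    simpa using this
  obtain ⟨N, hN⟩ := eventually_atTop.1 (h1.eventually (gt_mem_nhds (show 0 < ε / 2 by linarith)))
  refine ⟨max N y0, fun y hy => ?_⟩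
  have hy0 : y0 ≤ y := (le_max_right _ _).trans hy
  have h2 := hN y ((le_max_left _ _).trans hy)
  have h3 : F (y + η) - F y = ∫ s in y..(y + η), f s := by
    simp only [hF]
    rw [max_eq_left hy0, max_eq_left (by linarith)]
    have := intervalIntegral.integral_add_adjacent_intervals (hi y0 y) (hi y (y + η))
    linarith
  have h4 : η * (f y - ε / 2) ≤ ∫ s in y..(y + η), f s := by
    have : ∫ s in y..(y + η), (f y - ε / 2) ≤ ∫ s in y..(y + η), f s := by
      apply intervalIntegral.integral_mono_on (by linarith) (by simp) (hi _ _)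
      intro s hs
      have := h y (s - y) hy0 (by linarith [hs.1]) (by linarith [hs.2])
      rw [add_sub_cancel] at this
      linarith
    rw [intervalIntegral.integral_const] at this
    simpa using this
  rw [h3, div_lt_iff₀ hη] at h2
  rw [Real.dist_eq, sub_zero, abs_of_nonneg (hf0 y)]
  nlinarith

theorem Ren.incr (H : Ren l q Z C δ y0) (i : ι) :
    Tendsto (fun y => Z (y + l i) - Z y) atTop (𝓝 0) := by
  obtain ⟨B, hB0, hB⟩ := H.bdd
  have hBi : ∀ y, y0 ≤ y → |Z y| ≤ B := fun y hy => (hB i y hy).1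
  set E : ℝ → ℝ := fun y => ∑ i, q i * (Z y - Z (y - l i)) ^ 2 with hE
  have hZs : ∀ j, Continuous fun y => Z (y - l j) := fun j =>
    H.hZ.comp (continuous_id.sub continuous_const)
  have hEc : Continuous E := by
    apply continuous_finsetSum
    intro j _
    exact ((H.hZ.sub (hZs j)).pow 2).const_smul (q j)
  have hE0 : ∀ y, 0 ≤ E y := fun y => Finset.sum_nonneg fun j _ =>
    mul_nonneg (H.hq j).le (sq_nonneg _)
  have hEle : ∀ y, y0 ≤ y → E y ≤ -(∑ j, q j * ((Z y) ^ 2 - (Z (y - l j)) ^ 2)) +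
      2 * B * C * Real.exp (-δ * y) := by
    intro y hy
    have h1 : E y = -(∑ j, q j * ((Z y) ^ 2 - (Z (y - l j)) ^ 2)) +
        2 * Z y * (Z y - ∑ j, q j * Z (y - l j)) := by
      have h2 : Z y = ∑ j, q j * Z y := by rw [← Finset.sum_mul, H.hqs, one_mul]
      have : (Z y - ∑ j, q j * Z (y - l j)) = ∑ j, q j * (Z y - Z (y - l j)) := by
        conv_lhs => rw [h2]
        rw [← Finset.sum_sub_distrib]
        refine Finset.sum_congr rfl fun j _ => by ring
      rw [this, Finset.mul_sum, ← Finset.sum_neg_distrib, ← Finset.sum_add_distrib, hE]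
      refine Finset.sum_congr rfl fun j _ => by ring
    rw [h1]
    have h3 : Z y * (Z y - ∑ j, q j * Z (y - l j)) ≤ B * (C * Real.exp (-δ * y)) := by
      refine (le_abs_self _).trans ?_
      rw [abs_mul]
      exact mul_le_mul (hBi y hy) (H.h y hy) (abs_nonneg _) hB0
    linarith
  have hZ2 : Continuous fun y => Z y ^ 2 := H.hZ.pow 2
  have hintgr : ∀ y, y0 ≤ y → ∫ s in y0..y, E s ≤
      (∑ j, q j * (B ^ 2 * l j)) + 2 * B * C / δ * Real.exp (-δ * y0) := by
    intro y hy
    have hc1 : ∀ j, Continuous fun s => q j * ((Z s) ^ 2 - (Z (s - l j)) ^ 2) := fun j =>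
      (hZ2.sub ((hZs j).pow 2)).const_smul (q j)
    have hc2 : Continuous fun s => 2 * B * C * Real.exp (-δ * s) := by fun_prop
    have h1 : ∫ s in y0..y, E s ≤ ∫ s in y0..y, (-(∑ j, q j * ((Z s) ^ 2 - (Z (s - l j)) ^ 2)) +
      2 * B * C * Real.exp (-δ * s)) := by
      apply intervalIntegral.integral_mono_on hy (hEc.intervalIntegrable _ _)
      · apply Continuous.intervalIntegrable
        exact (continuous_finsetSum _ fun j _ => hc1 j).neg.add hc2
      · intro s hs; exact hEle s hs.1
    refine h1.trans ?_
    have hc3 : Continuous fun s => -(∑ j, q j * ((Z s) ^ 2 - (Z (s - l j)) ^ 2)) :=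
      (continuous_finsetSum _ fun j _ => hc1 j).neg
    rw [intervalIntegral.integral_add (hc3.intervalIntegrable _ _) (hc2.intervalIntegrable _ _)]
    refine add_le_add ?_ (int_exp_le (2 * B * C) δ y0 y H.hδ (by have := H.hC; positivity))
    rw [intervalIntegral.integral_neg, intervalIntegral.integral_finsetSum
      (fun j _ => (hc1 j).intervalIntegrable _ _), ← Finset.sum_neg_distrib]
    refine Finset.sum_le_sum fun j _ => ?_
    rw [intervalIntegral.integral_const_mul, int_shift (fun s => Z s ^ 2) hZ2]
    have h2 : 0 ≤ ∫ s in (y - l j)..y, Z s ^ 2 :=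
      intervalIntegral.integral_nonneg (by linarith [H.hl j]) (fun u _ => sq_nonneg _)
    have h3 : ∫ s in (y0 - l j)..y0, Z s ^ 2 ≤ B ^ 2 * l j := by
      have : ∫ s in (y0 - l j)..y0, Z s ^ 2 ≤ ∫ s in (y0 - l j)..y0, B ^ 2 := by
        apply intervalIntegral.integral_mono_on (by linarith [H.hl j]) (hZ2.intervalIntegrable _ _) (by simp)
        intro s hs
        have := (hB j (s + l j) (by linarith [hs.1])).2
        rw [add_sub_cancel_right] at this
        exact sq_le_sq' (by linarith [(abs_le.1 this).1]) (abs_le.1 this).2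
      refine this.trans (le_of_eq ?_)
      simp; ring
    have := H.hq j
    nlinarith
  have hE1 : Tendsto E atTop (𝓝 0) := by
    obtain ⟨lam, Lam, _, hLam, _, hLl⟩ := exists_lam l H.hl
    refine barbalat E hEc hE0 (y0 + Lam)
      ((∑ j, q j * (B ^ 2 * l j)) + 2 * B * C / δ * Real.exp (-δ * y0)) (fun y hy => ?_) ?_
    · refine le_trans ?_ (hintgr y (by linarith))
      rw [← intervalIntegral.integral_add_adjacent_intervals (hEc.intervalIntegrable y0 (y0 + Lam))
        (hEc.intervalIntegrable (y0 + Lam) y)]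
      have : 0 ≤ ∫ s in y0..(y0 + Lam), E s :=
        intervalIntegral.integral_nonneg (by linarith) (fun u _ => hE0 u)
      linarith
    · intro ε hε
      obtain ⟨η, hη, hu⟩ := H.unif (ε / (8 * B + 1)) (by positivity)
      refine ⟨η, hη, fun y t hy ht ht' => ?_⟩
      have : E y - E (y + t) ≤ ∑ j, q j * ε := by
        rw [hE, ← Finset.sum_sub_distrib]
        refine Finset.sum_le_sum fun j _ => ?_
        rw [← mul_sub]
        apply mul_le_mul_of_nonneg_left _ (H.hq j).le
        have a1 := abs_le.1 (hu y t (by linarith) ht ht')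
        have a2 := abs_le.1 (hu (y - l j) t (by linarith [hLl j]) ht ht')
        have b1 := abs_le.1 (hB j y (by linarith)).1
        have b2 := abs_le.1 (hB j y (by linarith)).2
        have b3 := abs_le.1 (hB j (y + t) (by linarith)).1
        have b4 := abs_le.1 (hB j (y + t) (by linarith)).2
        rw [show y - l j + t = y + t - l j by ring] at a2
        set e' := ε / (8 * B + 1)
        have he : e' * (8 * B + 1) = ε := by simp only [e']; field_simp
        have he0 : 0 < e' := by positivity
        set u := Z y - Z (y - l j)
        set w := Z (y + t) - Z (y + t - l j)
        have h1 : |u - w| ≤ 2 * e' := by rw [abs_le]; constructor <;> simp only [u, w] <;> linarith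
        have h2 : |u + w| ≤ 4 * B := by rw [abs_le]; constructor <;> simp only [u, w] <;> linarith
        have h3 : u ^ 2 - w ^ 2 ≤ 2 * e' * (4 * B) := by
          rw [show u ^ 2 - w ^ 2 = (u - w) * (u + w) by ring]
          refine (le_abs_self _).trans ?_
          rw [abs_mul]
          exact mul_le_mul h1 h2 (abs_nonneg _) (by positivity)
        nlinarith
      rw [← Finset.sum_mul, H.hqs] at this
      linarith
  have h5 : Tendsto (fun y => (Z y - Z (y - l i)) ^ 2) atTop (𝓝 0) := by
    have : Tendsto (fun y => (q i)⁻¹ * E y) atTop (𝓝 0) := by simpa using hE1.const_mul (q i)⁻¹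
    refine squeeze_zero (fun y => sq_nonneg _) (fun y => ?_) this
    have h6 : q i * (Z y - Z (y - l i)) ^ 2 ≤ E y :=
      Finset.single_le_sum (f := fun j => q j * (Z y - Z (y - l j)) ^ 2)
        (fun j _ => mul_nonneg (H.hq j).le (sq_nonneg _)) (Finset.mem_univ i)
    have := H.hq i
    rw [inv_mul_eq_div, le_div_iff₀ this]; linarith
  have h6 : Tendsto (fun y => Z y - Z (y - l i)) atTop (𝓝 0) := by
    have := h5.sqrt
    simp only [Real.sqrt_sq_eq_abs, Real.sqrt_zero] at this
    exact tendsto_zero_iff_abs_tendsto_zero _ |>.2 this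
  have := h6.comp (tendsto_atTop_add_const_right atTop (l i) tendsto_id)
  simpa [Function.comp_def] using this

end GT

namespace GT

variable {ι : Type*} [Fintype ι] {l q : ι → ℝ} {Z : ℝ → ℝ} {C δ y0 : ℝ}

/-- asymptotic periods of `Z` -/
def asympPeriods (Z : ℝ → ℝ) : AddSubgroup ℝ where
  carrier := {t | Tendsto (fun y => Z (y + t) - Z y) atTop (𝓝 0)}
  zero_mem' := by simp
  add_mem' := by
    intro s t hs ht
    have h1 := (Tendsto.comp (g := fun y => Z (y + t) - Z y) ht
      (tendsto_atTop_add_const_right atTop s tendsto_id)).add hs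
    simp only [Function.comp_def, id, add_zero] at h1
    refine h1.congr fun y => ?_
    rw [add_assoc]; ring
  neg_mem' := by
    intro s hs
    have h1 := (Tendsto.comp (g := fun y => Z (y + s) - Z y) hs
      (tendsto_atTop_add_const_right atTop (-s) tendsto_id)).neg
    simp only [Function.comp_def, id, neg_zero] at h1
    refine h1.congr fun y => ?_
    rw [neg_add_cancel_right]; ring

theorem Ren.closure_le (H : Ren l q Z C δ y0) :
    AddSubgroup.closure (Set.range l) ≤ asympPeriods Z := by
  rw [AddSubgroup.closure_le]
  rintro _ ⟨i, rfl⟩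
  exact H.incr i

theorem Ren.dense_periods (H : Ren l q Z C δ y0)
    (hd : Dense (AddSubgroup.closure (Set.range l) : Set ℝ)) (t : ℝ) :
    Tendsto (fun y => Z (y + t) - Z y) atTop (𝓝 0) := by
  rw [Metric.tendsto_atTop]
  intro ε hε
  obtain ⟨η, hη, hu⟩ := H.unif (ε / 2) (by linarith)
  obtain ⟨g, hg1, hg2⟩ := hd.exists_between (show t - η < t by linarith)
  have hg : Tendsto (fun y => Z (y + g) - Z y) atTop (𝓝 0) := H.closure_le hg1
  rw [Metric.tendsto_atTop] at hg
  obtain ⟨N, hN⟩ := hg (ε / 2) (by linarith)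
  refine ⟨max N (y0 - g), fun y hy => ?_⟩
  have h1 := hN y ((le_max_left _ _).trans hy)
  have h2 := hu (y + g) (t - g) (by linarith [(le_max_right N (y0 - g)).trans hy])
    (by linarith [hg2.2]) (by linarith [hg2.1])
  rw [Real.dist_eq, sub_zero, abs_lt] at *
  rw [show y + g + (t - g) = y + t by ring, abs_le] at h2
  constructor <;> linarith [h1.1, h1.2, h2.1, h2.2]

theorem tendsto_exp_neg (K δ : ℝ) (hδ : 0 < δ) :
    Tendsto (fun y => K * Real.exp (-δ * y)) atTop (𝓝 0) := by
  have : Tendsto (fun y => Real.exp (-δ * y)) atTop (𝓝 0) := by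
    apply Real.tendsto_exp_atBot.comp
    exact tendsto_id.const_mul_atTop_of_neg (by linarith)
  simpa using this.const_mul K

theorem Ren.dense_case [Nonempty ι] (H : Ren l q Z C δ y0)
    (hd : Dense (AddSubgroup.closure (Set.range l) : Set ℝ)) :
    ∃ c, Tendsto Z atTop (𝓝 c) := by
  obtain ⟨B, hB0, hB⟩ := H.bdd
  obtain ⟨lam, Lam, h1, h1', h2, h3⟩ := exists_lam l H.hl
  have hZi : ∀ u v, IntervalIntegrable Z volume u v := fun u v => H.hZ.intervalIntegrable u v
  set m := ∑ i, q i * l i with hm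
  have hm0 : 0 < m := Finset.sum_pos (fun i _ => mul_pos (H.hq i) (H.hl i)) Finset.univ_nonempty
  set J : ℝ → ℝ := fun y => ∑ i, q i * ∫ s in (y - l i)..y, Z s with hJ
  have hJd : ∀ x y, y0 ≤ x → x ≤ y → |J y - J x| ≤ C / δ * Real.exp (-δ * x) := by
    intro x y hx hxy
    have hc1 : ∀ j, Continuous fun s => q j * (Z s - Z (s - l j)) := fun j => by
      have : Continuous fun s => Z (s - l j) := H.hZ.comp (continuous_id.sub continuous_const)
      exact (H.hZ.sub this).const_smul (q j)
    have e1 : J y - J x = ∫ s in x..y, ∑ j, q j * (Z s - Z (s - l j)) := by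
      rw [intervalIntegral.integral_finsetSum (fun j _ => (hc1 j).intervalIntegrable _ _), hJ,
        ← Finset.sum_sub_distrib]
      refine Finset.sum_congr rfl fun j _ => ?_
      rw [intervalIntegral.integral_const_mul, int_shift Z H.hZ]; ring
    rw [e1]
    refine le_trans ?_ (int_exp_le C δ x y H.hδ H.hC)
    have := intervalIntegral.norm_integral_le_of_norm_le (a := x) (b := y) (μ := volume)
      (f := fun s => ∑ j, q j * (Z s - Z (s - l j)))
      (g := fun s => C * Real.exp (-δ * s)) hxy ?_ ?_
    · exact this
    · refine ae_of_all _ fun s hs => ?_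
      have h4 := H.h s (by linarith [hs.1])
      rw [Real.norm_eq_abs]
      convert h4 using 2
      simp_rw [mul_sub]
      rw [Finset.sum_sub_distrib, ← Finset.sum_mul, H.hqs, one_mul]
    · apply Continuous.intervalIntegrable; fun_prop
  obtain ⟨c, hc⟩ : ∃ c, Tendsto J atTop (𝓝 c) := by
    apply cauchy_map_iff_exists_tendsto.1
    rw [Metric.cauchy_iff]
    refine ⟨by infer_instance, fun ε hε => ?_⟩
    obtain ⟨x, hx, hx'⟩ := (((tendsto_exp_neg (C / δ) δ H.hδ).eventually
      (gt_mem_nhds (show 0 < ε / 2 by linarith))).and (eventually_ge_atTop y0)).exists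
    refine ⟨Set.image J (Set.Ici x), image_mem_map (Ici_mem_atTop x), ?_⟩
    rintro _ ⟨u, hu, rfl⟩ _ ⟨v, hv, rfl⟩
    have a1 := abs_le.1 (hJd x u hx' hu)
    have a2 := abs_le.1 (hJd x v hx' hv)
    rw [Real.dist_eq, abs_lt]; constructor <;> linarith [a1.1, a1.2, a2.1, a2.2]
  have hJZ : Tendsto (fun y => J y - m * Z y) atTop (𝓝 0) := by
    have e2 : ∀ y, J y - m * Z y = ∑ i, q i * ∫ s in (-l i)..0, (Z (y + s) - Z y) := by
      intro y
      rw [hJ, hm, Finset.sum_mul, ← Finset.sum_sub_distrib]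
      refine Finset.sum_congr rfl fun i _ => ?_
      have : Continuous fun s => Z (y + s) := H.hZ.comp (by fun_prop)
      rw [intervalIntegral.integral_sub (this.intervalIntegrable _ _) (by simp),
        intervalIntegral.integral_comp_add_left (fun s => Z s) y]
      simp [sub_eq_add_neg]; ring
    simp_rw [e2]
    have hz : (0 : ℝ) = ∑ i, q i * ∫ s in (-l i)..0, (0 : ℝ) := by simp
    conv => arg 3; rw [hz]
    refine tendsto_finsetSum _ fun i _ => ?_
    apply Tendsto.const_mul
    apply intervalIntegral.tendsto_integral_filter_of_dominated_convergence (fun _ => 2 * B)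
    · filter_upwards with y
      have : Continuous fun s => Z (y + s) - Z y := (H.hZ.comp (by fun_prop)).sub continuous_const
      exact this.aestronglyMeasurable
    · filter_upwards [eventually_ge_atTop (y0 + Lam)] with y hy
      refine ae_of_all _ fun s hs => ?_
      rw [Set.uIoc_of_le (by linarith [H.hl i])] at hs
      have b1 := abs_le.1 (hB i y (by linarith)).1
      have b2 := abs_le.1 (hB i (y + s) (by linarith [hs.1, h3 i])).1
      rw [Real.norm_eq_abs, abs_le]; constructor <;> linarith [b1.1, b1.2, b2.1, b2.2]
    · simp
    · refine ae_of_all _ fun s _ => H.dense_periods hd s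
  refine ⟨c / m, ?_⟩
  have := (hc.sub hJZ).div_const m
  rw [sub_zero] at this
  refine this.congr fun y => ?_
  field_simp; ring

theorem Ren.lattice_case [Nonempty ι] (H : Ren l q Z C δ y0) (h : ℝ) (hh : 0 < h) (N : ι → ℕ)
    (hN : ∀ i, l i = N i * h) (hS : h ∈ asympPeriods Z) :
    ∃ G : ℝ → ℝ, Continuous G ∧ (∀ y, G (y + h) = G y) ∧
      Tendsto (fun y => Z y - G y) atTop (𝓝 0) := by
  set J : ℝ → ℝ := fun y => ∑ i, q i * ∑ k ∈ Finset.range (N i), Z (y - k * h) with hJ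
  have hJc : Continuous J := by
    refine continuous_finsetSum _ fun i _ => continuous_const.mul ?_
    exact continuous_finsetSum _ fun k _ => H.hZ.comp (by fun_prop)
  set m : ℝ := ∑ i, q i * N i with hm
  have hN0 : ∀ i, (0 : ℝ) < N i := fun i => by
    have := H.hl i
    rw [hN i] at this
    exact pos_of_mul_pos_left this hh.le
  have hm0 : 0 < m := Finset.sum_pos (fun i _ => mul_pos (H.hq i) (hN0 i)) Finset.univ_nonempty
  have hstep : ∀ y, y0 ≤ y + h → |J (y + h) - J y| ≤ C * Real.exp (-δ * (y + h)) := by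
    intro y hy
    have e1 : J (y + h) - J y = Z (y + h) - ∑ i, q i * Z (y + h - l i) := by
      have : Z (y + h) = ∑ i, q i * Z (y + h) := by rw [← Finset.sum_mul, H.hqs, one_mul]
      rw [this, hJ, ← Finset.sum_sub_distrib, ← Finset.sum_sub_distrib]
      refine Finset.sum_congr rfl fun i _ => ?_
      rw [← mul_sub, ← mul_sub, hN i]
      congr 1
      have e2 : ∀ k : ℕ, Z (y - k * h) = Z (y + h - (k + 1 : ℕ) * h) := fun k => by
        push_cast; ring_nf
      simp_rw [e2]
      rw [← Finset.sum_sub_distrib, Finset.sum_range_sub' (fun k : ℕ => Z (y + h - k * h))]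
      simp
    rw [e1]; exact H.h _ hy
  set r := Real.exp (-δ * h) with hr
  have hr1 : r < 1 := by rw [hr, Real.exp_lt_one_iff]; nlinarith [H.hδ]
  have hr0 : 0 < r := Real.exp_pos _
  have hgeo : ∀ y, y0 ≤ y → ∀ n : ℕ, dist (J (y + n * h)) (J (y + (n + 1 : ℕ) * h)) ≤
      C * Real.exp (-δ * y) * r ^ n := by
    intro y hy n
    have hnh : 0 ≤ n * h := by positivity
    rw [dist_comm, Real.dist_eq]
    have := hstep (y + n * h) (by linarith)
    rw [show y + n * h + h = y + (n + 1 : ℕ) * h by push_cast; ring] at this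
    refine this.trans ?_
    rw [mul_assoc, hr, ← Real.exp_nat_mul, ← Real.exp_add]
    apply mul_le_mul_of_nonneg_left _ H.hC
    apply Real.exp_le_exp.2
    push_cast
    nlinarith [H.hδ, mul_pos H.hδ hh]
  have hG1 : ∀ y, y0 ≤ y → ∃ g, Tendsto (fun n : ℕ => J (y + n * h)) atTop (𝓝 g) ∧
      |J y - g| ≤ C / (1 - r) * Real.exp (-δ * y) := by
    intro y hy
    obtain ⟨g, hg⟩ := cauchySeq_tendsto_of_complete
      (cauchySeq_of_le_geometric r _ hr1 (hgeo y hy))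
    refine ⟨g, hg, ?_⟩
    have := dist_le_of_le_geometric_of_tendsto₀ r _ hr1 (hgeo y hy) hg
    rw [Real.dist_eq] at this
    simp only [Nat.cast_zero, zero_mul, add_zero] at this
    refine this.trans (le_of_eq ?_)
    ring
  have hG2 : ∀ y, ∃ g, Tendsto (fun n : ℕ => J (y + n * h)) atTop (𝓝 g) := by
    intro y
    obtain ⟨k, hk⟩ := exists_nat_ge ((y0 - y) / h)
    rw [div_le_iff₀ hh] at hk
    obtain ⟨g, hg, -⟩ := hG1 (y + k * h) (by linarith)
    refine ⟨g, (tendsto_add_atTop_iff_nat k).1 ?_⟩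
    refine hg.congr fun n => ?_
    push_cast; ring_nf
  choose G hG using hG2
  have hGb : ∀ y, y0 ≤ y → |J y - G y| ≤ C / (1 - r) * Real.exp (-δ * y) := by
    intro y hy
    obtain ⟨g, hg, hb⟩ := hG1 y hy
    rw [tendsto_nhds_unique (hG y) hg]; exact hb
  have hper : ∀ y, G (y + h) = G y := by
    intro y
    have h1 := (tendsto_add_atTop_iff_nat 1).2 (hG y)
    refine tendsto_nhds_unique (hG (y + h)) (h1.congr fun n => ?_)
    push_cast; ring_nf
  have hpern : ∀ (n : ℕ) y, G (y + n * h) = G y := by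
    intro n
    induction n with
    | zero => simp
    | succ n ih => intro y; rw [← ih y, ← hper (y + n * h)]; push_cast; ring_nf
  have hGc : Continuous G := by
    rw [continuous_iff_continuousAt]
    intro x
    apply continuousAt_of_locally_uniform_approx_of_continuousAt
    intro u hu
    obtain ⟨ε, hε, hu⟩ := Metric.mem_uniformity_dist.1 hu
    obtain ⟨x1, hx1, hx1'⟩ := (((tendsto_exp_neg (C / (1 - r)) δ H.hδ).eventually
      (gt_mem_nhds hε)).and (eventually_ge_atTop y0)).exists
    obtain ⟨k, hk⟩ := exists_nat_ge ((x1 - (x - 1)) / h)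
    rw [div_le_iff₀ hh] at hk
    refine ⟨Set.Ici (x - 1), Ici_mem_nhds (by linarith), fun y => J (y + k * h),
      (hJc.comp (by fun_prop)).continuousAt, fun y hy => hu ?_⟩
    have hy' : x - 1 ≤ y := hy
    have h3 := hGb (y + k * h) (by linarith)
    rw [hpern] at h3
    rw [dist_comm, Real.dist_eq]
    refine (h3.trans ?_).trans_lt hx1
    have := H.hC
    have : 0 ≤ C / (1 - r) := div_nonneg H.hC (by linarith)
    apply mul_le_mul_of_nonneg_left _ this
    apply Real.exp_le_exp.2
    nlinarith [H.hδ]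
  have hJG : Tendsto (fun y => J y - G y) atTop (𝓝 0) := by
    apply squeeze_zero_norm' _ (tendsto_exp_neg (C / (1 - r)) δ H.hδ)
    filter_upwards [eventually_ge_atTop y0] with y hy using hGb y hy
  have hJZ : Tendsto (fun y => J y - m * Z y) atTop (𝓝 0) := by
    have e2 : ∀ y, J y - m * Z y = ∑ i, q i * ∑ k ∈ Finset.range (N i), (Z (y - k * h) - Z y) := by
      intro y
      rw [hJ, hm, Finset.sum_mul, ← Finset.sum_sub_distrib]
      refine Finset.sum_congr rfl fun i _ => ?_
      rw [Finset.sum_sub_distrib]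
      simp; ring
    simp_rw [e2]
    have hz : (0 : ℝ) = ∑ i, q i * ∑ k ∈ Finset.range (N i), (0 : ℝ) := by simp
    conv => arg 3; rw [hz]
    refine tendsto_finsetSum _ fun i _ => Tendsto.const_mul _ ?_
    refine tendsto_finsetSum _ fun k _ => ?_
    have : -(k • h) ∈ asympPeriods Z := neg_mem (nsmul_mem hS k)
    have h1 : Tendsto (fun y => Z (y + -(k • h)) - Z y) atTop (𝓝 0) := this
    simpa [sub_eq_add_neg] using h1
  refine ⟨fun y => G y / m, hGc.div_const m, fun y => by simp [hper], ?_⟩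
  have := (hJG.sub hJZ).div_const m
  simp only [sub_zero, zero_div] at this
  refine this.congr fun y => ?_
  field_simp; ring

theorem renewal [Nonempty ι] (l : ι → ℝ) (hl : ∀ i, 0 < l i) :
    ∃ h : ℝ, 0 < h ∧ ∀ (q : ι → ℝ) (Z : ℝ → ℝ) (C δ y0 : ℝ), Ren l q Z C δ y0 →
      ∃ G : ℝ → ℝ, Continuous G ∧ (∀ y, G (y + h) = G y) ∧ (∀ i y, G (y + l i) = G y) ∧
        Tendsto (fun y => Z y - G y) atTop (𝓝 0) := by
  rcases AddSubgroup.dense_or_cyclic (AddSubgroup.closure (Set.range l)) with hd | ⟨g, hg⟩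
  · refine ⟨1, one_pos, fun q Z C δ y0 H => ?_⟩
    obtain ⟨c, hc⟩ := H.dense_case hd
    refine ⟨fun _ => c, continuous_const, fun _ => rfl, fun _ _ => rfl, ?_⟩
    simpa using hc.sub_const c
  · have hmem : ∀ i, ∃ k : ℤ, k * g = l i := by
      intro i
      have : l i ∈ AddSubgroup.closure (Set.range l) := AddSubgroup.subset_closure ⟨i, rfl⟩
      rw [hg, AddSubgroup.mem_closure_singleton] at this
      simpa using this
    choose K hK using hmem
    have hN : ∀ i, l i = (K i).natAbs * |g| := by
      intro i
      rw [Nat.cast_natAbs, Int.cast_abs, ← abs_mul, hK i, abs_of_pos (hl i)]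
    have hg0 : 0 < |g| := by
      have i := Classical.arbitrary ι
      have := hl i
      rw [hN i] at this
      exact pos_of_mul_pos_right this (by positivity)
    refine ⟨|g|, hg0, fun q Z C δ y0 H => ?_⟩
    have hS : |g| ∈ asympPeriods Z := by
      have : g ∈ asympPeriods Z := by
        apply H.closure_le
        rw [hg]; exact AddSubgroup.subset_closure rfl
      rcases abs_choice g with h | h
      · rw [h]; exact this
      · rw [h]; exact neg_mem this
    obtain ⟨G, h1, h2, h3⟩ := H.lattice_case |g| hg0 (fun i => (K i).natAbs) hN hS
    refine ⟨G, h1, h2, fun i y => ?_, h3⟩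
    have hpern : ∀ (n : ℕ) y, G (y + n * |g|) = G y := by
      intro n
      induction n with
      | zero => simp
      | succ n ih => intro y; rw [← ih y, ← h2 (y + n * |g|)]; push_cast; ring_nf
    rw [hN i, hpern]

end GT

namespace GT

/-- expectation of `f` under the binomial law with parameters `n`, `p` -/
noncomputable def Bn (p : ℝ) : ℕ → (ℕ → ℝ) → ℝ
  | 0, f => f 0
  | n + 1, f => p * Bn p n (fun k => f (k + 1)) + (1 - p) * Bn p n f

section
variable {p : ℝ}

theorem Bn_zero (f : ℕ → ℝ) : Bn p 0 f = f 0 := rfl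
theorem Bn_succ (n : ℕ) (f : ℕ → ℝ) :
    Bn p (n + 1) f = p * Bn p n (fun k => f (k + 1)) + (1 - p) * Bn p n f := rfl

theorem Bn_add (n : ℕ) (f g : ℕ → ℝ) : Bn p n (fun k => f k + g k) = Bn p n f + Bn p n g := by
  induction n generalizing f g with
  | zero => rfl
  | succ n ih => simp only [Bn_succ, ih (fun k => f (k + 1)) (fun k => g (k + 1)), ih f g]; ring

theorem Bn_mul (n : ℕ) (c : ℝ) (f : ℕ → ℝ) : Bn p n (fun k => c * f k) = c * Bn p n f := by
  induction n generalizing f with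
  | zero => rfl
  | succ n ih => simp only [Bn_succ, ih (fun k => f (k + 1)), ih f]; ring

theorem Bn_const (n : ℕ) (c : ℝ) : Bn p n (fun _ => c) = c := by
  induction n with
  | zero => rfl
  | succ n ih => simp only [Bn_succ, ih]; ring

theorem Bn_neg (n : ℕ) (f : ℕ → ℝ) : Bn p n (fun k => - f k) = - Bn p n f := by
  have := Bn_mul (p := p) n (-1) f
  simpa using this

theorem Bn_sub (n : ℕ) (f g : ℕ → ℝ) : Bn p n (fun k => f k - g k) = Bn p n f - Bn p n g := by
  simp only [sub_eq_add_neg, Bn_add, Bn_neg]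

theorem Bn_sum {ι : Type*} (s : Finset ι) (n : ℕ) (f : ι → ℕ → ℝ) :
    Bn p n (fun k => ∑ i ∈ s, f i k) = ∑ i ∈ s, Bn p n (f i) := by
  classical
  induction s using Finset.induction_on with
  | empty => simp [Bn_const]
  | insert i s hi ih => simp only [Finset.sum_insert hi, Bn_add, ih]

theorem Bn_mono (h0 : 0 ≤ p) (h1 : p ≤ 1) (n : ℕ) (f g : ℕ → ℝ) (h : ∀ k, k ≤ n → f k ≤ g k) :
    Bn p n f ≤ Bn p n g := by
  induction n generalizing f g with
  | zero => exact h 0 le_rfl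
  | succ n ih =>
    simp only [Bn_succ]
    have a1 := ih (fun k => f (k + 1)) (fun k => g (k + 1)) (fun k hk => h _ (by omega))
    have a2 := ih f g (fun k hk => h _ (by omega))
    have : 0 ≤ 1 - p := by linarith
    gcongr

theorem Bn_congr (n : ℕ) (f g : ℕ → ℝ) (h : ∀ k, k ≤ n → f k = g k) :
    Bn p n f = Bn p n g := by
  induction n generalizing f g with
  | zero => exact h 0 le_rfl
  | succ n ih =>
    simp only [Bn_succ]
    rw [ih (fun k => f (k + 1)) (fun k => g (k + 1)) (fun k hk => h _ (by omega)),
      ih f g (fun k hk => h _ (by omega))]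

theorem Bn_nonneg (h0 : 0 ≤ p) (h1 : p ≤ 1) (n : ℕ) (f : ℕ → ℝ) (h : ∀ k, k ≤ n → 0 ≤ f k) :
    0 ≤ Bn p n f := by
  have := Bn_mono h0 h1 n (fun _ => 0) f h
  rwa [Bn_const] at this

theorem Bn_abs (h0 : 0 ≤ p) (h1 : p ≤ 1) (n : ℕ) (f : ℕ → ℝ) :
    |Bn p n f| ≤ Bn p n (fun k => |f k|) := by
  rw [abs_le, ← Bn_neg]
  exact ⟨Bn_mono h0 h1 n _ _ fun k _ => neg_abs_le _, Bn_mono h0 h1 n _ _ fun k _ => le_abs_self _⟩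

/-- the term `N = n` -/
theorem Bn_self (h0 : 0 ≤ p) (h1 : p ≤ 1) (n : ℕ) (f g : ℕ → ℝ) (h : ∀ k, k < n → f k ≤ g k) :
    Bn p n f ≤ Bn p n g + p ^ n * (f n - g n) := by
  induction n generalizing f g with
  | zero => simp [Bn_zero]
  | succ n ih =>
    simp only [Bn_succ]
    have a1 := ih (fun k => f (k + 1)) (fun k => g (k + 1)) (fun k hk => h _ (by omega))
    have a2 := Bn_mono h0 h1 n f g (fun k hk => h _ (by omega))
    have : 0 ≤ 1 - p := by linarith
    have b1 := mul_le_mul_of_nonneg_left a1 h0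
    have b2 := mul_le_mul_of_nonneg_left a2 this
    rw [pow_succ]
    nlinarith

theorem Bn_diff (n : ℕ) (f : ℕ → ℝ) :
    Bn p (n + 1) f - Bn p n f = p * Bn p n (fun k => f (k + 1) - f k) := by
  rw [Bn_succ, Bn_sub]; ring

theorem Bn_exp (n : ℕ) (t : ℝ) : Bn p n (fun k => Real.exp (t * k)) = (1 - p + p * Real.exp t) ^ n := by
  induction n with
  | zero => simp [Bn_zero]
  | succ n ih =>
    rw [Bn_succ]
    have : (fun k : ℕ => Real.exp (t * ((k + 1 : ℕ) : ℝ))) =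
        fun k : ℕ => Real.exp t * Real.exp (t * k) := by
      ext k; rw [← Real.exp_add]; push_cast; ring_nf
    rw [this, Bn_mul, ih]; ring

theorem exp_le_quad {x : ℝ} (hx : |x| ≤ 1) : Real.exp x ≤ 1 + x + x ^ 2 := by
  have := abs_le.1 (Real.abs_exp_sub_one_sub_id_le hx)
  linarith [this.2]

theorem Bn_mgf (h0 : 0 ≤ p) (h1 : p ≤ 1) (n : ℕ) (t : ℝ) (ht : |t| ≤ 1) :
    Bn p n (fun k => Real.exp (t * (k - n * p))) ≤ Real.exp (n * t ^ 2) := by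
  have e1 : (fun k : ℕ => Real.exp (t * (k - n * p))) =
      fun k : ℕ => Real.exp (-(t * p)) ^ n * Real.exp (t * k) := by
    ext k; rw [← Real.exp_nat_mul, ← Real.exp_add]; ring_nf
  rw [e1, Bn_mul, Bn_exp, ← mul_pow, Real.exp_nat_mul]
  have hp' : 0 ≤ 1 - p := by linarith
  have e2 : Real.exp (-(t * p)) * (1 - p + p * Real.exp t) =
      (1 - p) * Real.exp (-(t * p)) + p * Real.exp (t * (1 - p)) := by
    rw [show t * (1 - p) = -(t * p) + t by ring, Real.exp_add]; ring
  rw [e2]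
  apply pow_le_pow_left₀ (by positivity)
  have b1 : Real.exp (-(t * p)) ≤ 1 + -(t * p) + (-(t * p)) ^ 2 := by
    apply exp_le_quad; rw [abs_neg, abs_mul, abs_of_nonneg h0]; nlinarith [abs_nonneg t]
  have b2 : Real.exp (t * (1 - p)) ≤ 1 + (t * (1 - p)) + (t * (1 - p)) ^ 2 := by
    apply exp_le_quad; rw [abs_mul, abs_of_nonneg hp']; nlinarith [abs_nonneg t]
  have b3 := mul_le_mul_of_nonneg_left b1 hp'
  have b4 := mul_le_mul_of_nonneg_left b2 h0
  have b5 : t ^ 2 + 1 ≤ Real.exp (t ^ 2) := Real.add_one_le_exp _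
  have b6 : p * (1 - p) * t ^ 2 ≤ t ^ 2 := by
    have : p * (1 - p) ≤ 1 := by nlinarith
    nlinarith [sq_nonneg t]
  nlinarith

end

/-- `n + 1` as a real number -/
noncomputable def br (n : ℕ) : ℝ := (n : ℝ) + 1

theorem br_pos (n : ℕ) : 0 < br n := by unfold br; positivity
theorem one_le_br (n : ℕ) : 1 ≤ br n := by unfold br; simp
theorem br_mono {m n : ℕ} (h : m ≤ n) : br m ≤ br n := by unfold br; gcongr

/-- normalized fluctuation -/
noncomputable def Wf (p : ℝ) (n N : ℕ) : ℝ := 1 + |(N : ℝ) - n * p| / √(br n)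

theorem one_le_W (p : ℝ) (n N : ℕ) : 1 ≤ Wf p n N := by
  unfold Wf
  have : 0 ≤ |(N : ℝ) - n * p| / √(br n) := by positivity
  linarith

theorem abs_le_W (p : ℝ) (n N : ℕ) : 1 + |(N : ℝ) - n * p| ≤ √(br n) * Wf p n N := by
  unfold Wf
  have h : 1 ≤ √(br n) := by rw [Real.one_le_sqrt]; exact one_le_br n
  have : √(br n) * (1 + |(N : ℝ) - n * p| / √(br n)) = √(br n) + |(N : ℝ) - n * p| := by
    field_simp
  rw [this]; linarith

theorem Bn_W (J : ℕ) : ∃ C, 0 < C ∧ ∀ p : ℝ, 0 ≤ p → p ≤ 1 → ∀ n,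
    Bn p n (fun N => Wf p n N ^ J) ≤ C := by
  refine ⟨J.factorial * Real.exp 1 * (2 * Real.exp 1), by positivity, fun p h0 h1 n => ?_⟩
  have hs : 1 ≤ √(br n) := by rw [Real.one_le_sqrt]; exact one_le_br n
  have hs0 : 0 < √(br n) := by linarith
  set t := 1 / √(br n) with ht
  have ht0 : 0 < t := by positivity
  have ht1 : t ≤ 1 := by rw [ht, div_le_one hs0]; exact hs
  have htn : n * t ^ 2 ≤ 1 := by
    rw [ht, div_pow, Real.sq_sqrt (br_pos n).le, one_pow, mul_one_div, div_le_one (br_pos n)]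
    unfold br; linarith
  have a1 := (Bn_mgf h0 h1 n t (by rw [abs_of_pos ht0]; exact ht1)).trans (Real.exp_le_exp.2 htn)
  have a2 := (Bn_mgf h0 h1 n (-t) (by rw [abs_neg, abs_of_pos ht0]; exact ht1)).trans
    (Real.exp_le_exp.2 (show (n : ℝ) * (-t) ^ 2 ≤ 1 by rw [neg_sq]; exact htn))
  have a3 : ∀ N : ℕ, Wf p n N ^ J ≤ (J.factorial * Real.exp 1) *
      (Real.exp (t * (N - n * p)) + Real.exp (-t * (N - n * p))) := by
    intro N
    have hW := one_le_W p n N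
    have b1 := Real.pow_div_factorial_le_exp (Wf p n N) (by linarith) J
    rw [div_le_iff₀ (by positivity)] at b1
    have b2 : Real.exp (Wf p n N) = Real.exp 1 * Real.exp |t * (N - n * p)| := by
      rw [← Real.exp_add, abs_mul, abs_of_pos ht0, Wf, ht]; ring_nf
    have b3 : Real.exp |t * (N - n * p)| ≤
        Real.exp (t * (N - n * p)) + Real.exp (-t * (N - n * p)) := by
      rcases abs_choice (t * (N - n * p)) with h | h
      · rw [h]; linarith [Real.exp_pos (-t * (N - n * p))]
      · rw [h, ← neg_mul]; linarith [Real.exp_pos (t * (N - n * p))]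
    calc _ ≤ _ := b1
      _ = (J.factorial * Real.exp 1) * Real.exp |t * (N - n * p)| := by rw [b2]; ring
      _ ≤ _ := by gcongr
  refine (Bn_mono h0 h1 n _ _ fun N _ => a3 N).trans ?_
  rw [Bn_mul, Bn_add]
  gcongr
  linarith

theorem br_le_W {p : ℝ} (h0 : 0 < p) (h1 : p ≤ 1) (n N : ℕ) :
    p ^ 2 / 4 * br n ≤ br N * Wf p n N ^ 2 := by
  have hW := one_le_W p n N
  have hW2 : 1 ≤ Wf p n N ^ 2 := one_le_pow₀ hW
  have hN := one_le_br N
  have hp2 : p ^ 2 ≤ p := by nlinarith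
  by_cases h : (n : ℝ) * p / 2 ≤ N
  · have : p ^ 2 / 4 * br n ≤ br N := by
      unfold br at *; nlinarith
    nlinarith
  · push Not at h
    have hab : (n : ℝ) * p / 2 ≤ |(N : ℝ) - n * p| := by
      rw [abs_sub_comm]; refine le_trans ?_ (le_abs_self _); linarith
    have h2 : 1 + (n * p / 2) ^ 2 / br n ≤ Wf p n N ^ 2 := by
      unfold Wf
      have h3 : (n * p / 2) ^ 2 / br n ≤ (|(N : ℝ) - n * p| / √(br n)) ^ 2 := by
        rw [div_pow |(N : ℝ) - n * p|, Real.sq_sqrt (br_pos n).le]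
        have := br_pos n
        gcongr
      have : 0 ≤ |(N : ℝ) - n * p| / √(br n) := by positivity
      nlinarith
    have h4 : p ^ 2 / 4 * br n ≤ 1 + (n * p / 2) ^ 2 / br n := by
      have hb := br_pos n
      rw [← sub_nonneg]
      have : 1 + (n * p / 2) ^ 2 / br n - p ^ 2 / 4 * br n =
          (4 * br n + n ^ 2 * p ^ 2 - p ^ 2 * (br n) ^ 2) / (4 * br n) := by
        field_simp
        ring
      rw [this]
      apply div_nonneg _ (by positivity)
      unfold br
      have : p ^ 2 ≤ 1 := by nlinarith
      have hn : (0 : ℝ) ≤ n := by positivity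
      nlinarith
    nlinarith

/-- comparison of powers of `N` with powers of `n` -/
theorem br_rpow_le {p : ℝ} (h0 : 0 < p) (h1 : p ≤ 1) (σ : ℝ) : ∃ C, 0 < C ∧ ∃ J : ℕ, ∀ n N M : ℕ,
    M ≤ n → p ^ 2 / 4 * br n ≤ br M * Wf p n N ^ 2 → br M ^ σ ≤ C * br n ^ σ * Wf p n N ^ J := by
  by_cases hσ : 0 ≤ σ
  · refine ⟨1, one_pos, 0, fun n N M hM _ => ?_⟩
    simpa using Real.rpow_le_rpow (br_pos M).le (br_mono hM) hσ
  · push Not at hσ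
    obtain ⟨J, hJ⟩ := exists_nat_ge (2 * -σ)
    refine ⟨(p ^ 2 / 4) ^ σ, by positivity, J, fun n N M hM h => ?_⟩
    have hW := one_le_W p n N
    have hbn := br_pos n
    have hbM := br_pos M
    have h2 : p ^ 2 / 4 * br n / Wf p n N ^ 2 ≤ br M := by
      rw [div_le_iff₀ (by positivity)]; exact h
    have h3 := Real.rpow_le_rpow_of_nonpos (by positivity) h2 hσ.le
    refine h3.trans ?_
    rw [Real.div_rpow (by positivity) (by positivity), Real.mul_rpow (by positivity) hbn.le,
      div_eq_mul_inv, ← Real.rpow_neg (by positivity)]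
    gcongr
    rw [← Real.rpow_natCast, ← Real.rpow_natCast, ← Real.rpow_mul (by linarith)]
    apply Real.rpow_le_rpow_of_exponent_le hW
    push_cast; linarith

theorem br_rpow_le_W {p : ℝ} (h0 : 0 < p) (h1 : p ≤ 1) (σ : ℝ) : ∃ C, 0 < C ∧ ∃ J : ℕ, ∀ n N : ℕ,
    N ≤ n → br N ^ σ ≤ C * br n ^ σ * Wf p n N ^ J := by
  obtain ⟨C, hC, J, h⟩ := br_rpow_le h0 h1 σ
  exact ⟨C, hC, J, fun n N hN => h n N N hN (br_le_W h0 h1 n N)⟩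

end GT

namespace GT

theorem abs_diff_le_aux (f : ℕ → ℝ) (D : ℝ) (m N : ℕ) (hmN : m ≤ N)
    (h : ∀ k, m ≤ k → k < N → |f (k + 1) - f k| ≤ D) : |f N - f m| ≤ (N - m) * D := by
  induction N, hmN using Nat.le_induction with
  | base => simp
  | succ N hN ih =>
    have a1 := ih fun k h1 h2 => h k h1 (by omega)
    have a2 := h N hN (by omega)
    have : f (N + 1) - f m = (f (N + 1) - f N) + (f N - f m) := by ring
    rw [this]
    refine (abs_add_le _ _).trans ?_
    push_cast; linarith

theorem abs_diff_le (f : ℕ → ℝ) (D : ℝ) (m N : ℕ)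
    (h : ∀ k, min m N ≤ k → k < max m N → |f (k + 1) - f k| ≤ D) :
    |f N - f m| ≤ |(N : ℝ) - m| * D := by
  rcases le_total m N with hm | hm
  · rw [abs_of_nonneg (a := (N : ℝ) - m) (by rw [sub_nonneg]; exact_mod_cast hm)]
    apply abs_diff_le_aux f D m N hm
    intro k h1 h2; exact h k (by simp [h1, hm]) (by simp [h2, hm])
  · rw [abs_sub_comm, abs_sub_comm (N : ℝ), abs_of_nonneg (a := (m : ℝ) - N) (by rw [sub_nonneg]; exact_mod_cast hm)]
    apply abs_diff_le_aux f D N m hm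
    intro k h1 h2; exact h k (by simp [h1, hm]) (by simp [h2, hm])

/-- the reference point -/
noncomputable def fl (p : ℝ) (n : ℕ) : ℕ := ⌊(n : ℝ) * p⌋₊

theorem fl_le {p : ℝ} (h0 : 0 ≤ p) (n : ℕ) : (fl p n : ℝ) ≤ n * p := Nat.floor_le (by positivity)
theorem lt_fl {p : ℝ} (n : ℕ) : n * p < (fl p n : ℝ) + 1 := Nat.lt_floor_add_one _
theorem fl_le_n {p : ℝ} (h0 : 0 ≤ p) (h1 : p ≤ 1) (n : ℕ) : fl p n ≤ n := by
  have := fl_le h0 n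
  have : (fl p n : ℝ) ≤ n := this.trans (by have : (0:ℝ) ≤ n := by positivity
                                            nlinarith)
  exact_mod_cast this

theorem br_fl {p : ℝ} (h0 : 0 < p) (h1 : p ≤ 1) (n : ℕ) : p / 2 * br n ≤ br (fl p n) := by
  have := lt_fl (p := p) n
  have h2 : (0 : ℝ) ≤ fl p n := by positivity
  unfold br; nlinarith

theorem abs_sub_fl {p : ℝ} (h0 : 0 ≤ p) (n N : ℕ) :
    |(N : ℝ) - fl p n| ≤ √(br n) * Wf p n N := by
  refine le_trans ?_ (abs_le_W p n N)
  have a1 := fl_le h0 n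
  have a2 := lt_fl (p := p) n
  have a3 := abs_le.1 (le_refl |(N : ℝ) - n * p|)
  rw [abs_le]; constructor <;> linarith [a3.1, a3.2]

/-- bound of powers between `N` and the reference point -/
theorem between {p : ℝ} (h0 : 0 < p) (h1 : p ≤ 1) (σ : ℝ) : ∃ C, 0 < C ∧ ∃ J : ℕ, ∀ n N k : ℕ,
    N ≤ n → min (fl p n) N ≤ k → k ≤ max (fl p n) N → br k ^ σ ≤ C * br n ^ σ * Wf p n N ^ J := by
  obtain ⟨C, hC, J, h⟩ := br_rpow_le h0 h1 σ
  refine ⟨C, hC, J, fun n N k hN hk1 hk2 => h n N k (hk2.trans (max_le (fl_le_n h0.le h1 n) hN)) ?_⟩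
  have hW : 1 ≤ Wf p n N ^ 2 := one_le_pow₀ (one_le_W p n N)
  rcases min_le_iff.1 hk1 with h2 | h2
  · have a1 := br_fl h0 h1 n
    have a2 := br_mono h2
    have a3 := br_pos n
    have a4 := br_pos k
    calc p ^ 2 / 4 * br n ≤ p / 2 * br n := mul_le_mul_of_nonneg_right (by nlinarith) a3.le
      _ ≤ br k := a1.trans a2
      _ ≤ _ := by nlinarith
  · exact (br_le_W h0 h1 n N).trans (by have := br_mono h2; gcongr)

theorem smooth1 {p : ℝ} (h0 : 0 < p) (h1 : p ≤ 1) (σ : ℝ) : ∃ C, 0 < C ∧ ∃ J : ℕ,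
    ∀ (f : ℕ → ℝ) (K : ℝ), 0 ≤ K → (∀ k, |f (k + 1) - f k| ≤ K * br k ^ σ) →
    ∀ n N, N ≤ n → |f N - f (fl p n)| ≤ K * (C * br n ^ (σ + 1 / 2) * Wf p n N ^ J) := by
  obtain ⟨C, hC, J, h⟩ := between h0 h1 σ
  refine ⟨C, hC, J + 1, fun f K hK hf n N hN => ?_⟩
  have a1 := abs_diff_le f (K * (C * br n ^ σ * Wf p n N ^ J)) (fl p n) N fun k hk1 hk2 =>
    (hf k).trans (mul_le_mul_of_nonneg_left (h n N k hN hk1 hk2.le) hK)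
  have hW := one_le_W p n N
  have hb := br_pos n
  refine a1.trans ?_
  refine (mul_le_mul_of_nonneg_right (abs_sub_fl h0.le n N) (by positivity)).trans (le_of_eq ?_)
  rw [Real.rpow_add hb, ← Real.sqrt_eq_rpow, pow_succ]; ring

theorem smooth2 {p : ℝ} (h0 : 0 < p) (h1 : p ≤ 1) (σ : ℝ) : ∃ C, 0 < C ∧ ∃ J : ℕ,
    ∀ (f : ℕ → ℝ) (K : ℝ), 0 ≤ K → (∀ k, |(f (k + 2) - f (k + 1)) - (f (k + 1) - f k)| ≤ K * br k ^ σ) →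
    ∀ n N, N ≤ n → |f N - f (fl p n) - (f (fl p n + 1) - f (fl p n)) * (N - fl p n)| ≤
      K * (C * br n ^ (σ + 1) * Wf p n N ^ J) := by
  obtain ⟨C, hC, J, h⟩ := between h0 h1 σ
  refine ⟨C, hC, J + 2, fun f K hK hf n N hN => ?_⟩
  set D := K * (C * br n ^ σ * Wf p n N ^ J) with hD
  set m := fl p n with hm
  have hW := one_le_W p n N
  have hb := br_pos n
  have hD0 : 0 ≤ D := by positivity
  have hd : ∀ k, min m N ≤ k → k ≤ max m N → |(f (k + 1) - f k) - (f (m + 1) - f m)| ≤ |(N : ℝ) - m| * D := by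
    intro k hk1 hk2
    have a1 := abs_diff_le (fun k => f (k + 1) - f k) D m k fun j hj1 hj2 =>
      (hf j).trans (mul_le_mul_of_nonneg_left (h n N j hN (by omega) (by omega)) hK)
    refine a1.trans (mul_le_mul_of_nonneg_right ?_ hD0)
    rcases le_total m N with hmN | hmN
    · rw [min_eq_left hmN] at hk1
      rw [max_eq_right hmN] at hk2
      have b1 : (m : ℝ) ≤ k := by exact_mod_cast hk1
      have b2 : (k : ℝ) ≤ N := by exact_mod_cast hk2
      rw [abs_of_nonneg (by linarith), abs_of_nonneg (by linarith)]; linarith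
    · rw [min_eq_right hmN] at hk1
      rw [max_eq_left hmN] at hk2
      have b1 : (N : ℝ) ≤ k := by exact_mod_cast hk1
      have b2 : (k : ℝ) ≤ m := by exact_mod_cast hk2
      rw [abs_of_nonpos (by linarith), abs_of_nonpos (by linarith)]; linarith
  have a2 := abs_diff_le (fun k => f k - (f (m + 1) - f m) * k) (|(N : ℝ) - m| * D) m N fun k hk1 hk2 => by
    refine le_trans (le_of_eq ?_) (hd k hk1 hk2.le)
    congr 1; push_cast; ring
  have a3 : f N - f m - (f (m + 1) - f m) * (N - m) =
      (f N - (f (m + 1) - f m) * N) - (f m - (f (m + 1) - f m) * m) := by ring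
  rw [a3]
  refine a2.trans ?_
  have a4 := abs_sub_fl h0.le n N
  calc |(N : ℝ) - m| * (|(N : ℝ) - m| * D) ≤ (√(br n) * Wf p n N) * ((√(br n) * Wf p n N) * D) := by
        gcongr
    _ = (√(br n) ^ 2) * Wf p n N ^ 2 * D := by ring
    _ = _ := by
      rw [Real.sq_sqrt hb.le, hD, Real.rpow_add_one hb.ne', pow_add]; ring

/-- expectation of a smooth sequence -/
theorem Bn_smooth {p : ℝ} (h0 : 0 < p) (h1 : p ≤ 1) (σ : ℝ) : ∃ C, 0 < C ∧
    ∀ (f : ℕ → ℝ) (K : ℝ), 0 ≤ K → (∀ k, |f (k + 1) - f k| ≤ K * br k ^ σ) →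
    ∀ n, |Bn p n f - f (fl p n)| ≤ K * C * br n ^ (σ + 1 / 2) := by
  obtain ⟨C, hC, J, h⟩ := smooth1 h0 h1 σ
  obtain ⟨C', hC', hW⟩ := Bn_W J
  refine ⟨C * C', by positivity, fun f K hK hf n => ?_⟩
  have hb := br_pos n
  have a1 : Bn p n f - f (fl p n) = Bn p n (fun N => f N - f (fl p n)) := by rw [Bn_sub, Bn_const]
  rw [a1]
  refine (Bn_abs h0.le h1 n _).trans ?_
  refine (Bn_mono h0.le h1 n _ _ fun N hN => h f K hK hf n N hN).trans ?_
  rw [Bn_mul, Bn_mul]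
  calc K * (C * br n ^ (σ + 1 / 2) * Bn p n (fun N => Wf p n N ^ J)) ≤
      K * (C * br n ^ (σ + 1 / 2) * C') := by gcongr; exact hW p h0.le h1 n
    _ = _ := by ring

theorem rpow_diff_le (s : ℝ) : ∃ C, 0 < C ∧ ∀ x y : ℝ, 0 < x → 0 < y →
    |y ^ s - x ^ s| ≤ C * (max (x ^ (s - 1)) (y ^ (s - 1))) * |y - x| := by
  refine ⟨|s| + 1, by positivity, fun x y hx hy => ?_⟩
  have key : ∀ x y : ℝ, 0 < x → x ≤ y → |y ^ s - x ^ s| ≤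
      (|s| + 1) * (max (x ^ (s - 1)) (y ^ (s - 1))) * |y - x| := by
    intro x y hx hxy
    have := Convex.norm_image_sub_le_of_norm_hasDerivWithin_le (f := fun z : ℝ => z ^ s)
      (f' := fun z => s * z ^ (s - 1)) (s := Set.Icc x y)
      (C := (|s| + 1) * (max (x ^ (s - 1)) (y ^ (s - 1)))) (x := x) (y := y) ?_ ?_ (convex_Icc x y)
      (Set.left_mem_Icc.2 hxy) (Set.right_mem_Icc.2 hxy)
    · simpa [Real.norm_eq_abs] using this
    · intro z hz
      exact (Real.hasDerivAt_rpow_const (Or.inl (by linarith [hz.1]))).hasDerivWithinAt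
    · intro z hz
      have hz0 : 0 < z := by linarith [hz.1]
      rw [Real.norm_eq_abs, abs_mul, abs_of_pos (Real.rpow_pos_of_pos hz0 _)]
      have : z ^ (s - 1) ≤ max (x ^ (s - 1)) (y ^ (s - 1)) := by
        rcases le_total 0 (s - 1) with h | h
        · exact le_max_of_le_right (Real.rpow_le_rpow hz0.le hz.2 h)
        · exact le_max_of_le_left (Real.rpow_le_rpow_of_nonpos hx hz.1 h)
      have h5 := Real.rpow_pos_of_pos hz0 (s - 1)
      have := abs_nonneg s
      gcongr
      linarith
  rcases le_total x y with h | h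
  · exact key x y hx h
  · rw [abs_sub_comm, max_comm, abs_sub_comm y x]; exact key y x hy h

theorem br_rpow_diff (s : ℝ) : ∃ C, 0 < C ∧ ∀ k : ℕ, |br (k + 1) ^ s - br k ^ s| ≤ C * br k ^ (s - 1) := by
  obtain ⟨C, hC, h⟩ := rpow_diff_le s
  refine ⟨C * (2 ^ |s - 1|), by positivity, fun k => ?_⟩
  refine (h (br k) (br (k + 1)) (br_pos _) (br_pos _)).trans ?_
  have e1 : |br (k + 1) - br k| = 1 := by unfold br; push_cast; simp
  rw [e1, mul_one, mul_assoc]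
  have hb := br_pos k
  have h2 : (1 : ℝ) ≤ 2 ^ |s - 1| := Real.one_le_rpow (by norm_num) (abs_nonneg _)
  have hpos := Real.rpow_pos_of_pos hb (s - 1)
  gcongr
  apply max_le
  · nlinarith
  · rcases le_total 0 (s - 1) with h | h
    · rw [abs_of_nonneg h, ← Real.mul_rpow (by norm_num) hb.le]
      apply Real.rpow_le_rpow (br_pos _).le _ h
      unfold br; push_cast; linarith [show (0:ℝ) ≤ k by positivity]
    · have := Real.rpow_le_rpow_of_nonpos hb (br_mono (Nat.le_succ k)) h
      exact this.trans (by nlinarith)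

/-- expectation of powers -/
theorem Bn_rpow {p : ℝ} (h0 : 0 < p) (h1 : p ≤ 1) (s : ℝ) : ∃ C, 0 < C ∧
    ∀ n, |Bn p n (fun k => br k ^ s) - p ^ s * br n ^ s| ≤ C * br n ^ (s - 1 / 2) := by
  obtain ⟨C1, hC1, h1'⟩ := br_rpow_diff s
  obtain ⟨C2, hC2, h2⟩ := Bn_smooth h0 h1 (s - 1)
  obtain ⟨C3, hC3, h3⟩ := rpow_diff_le s
  refine ⟨C1 * C2 + C3 * ((p / 2) ^ (s - 1) + 1 + p ^ (s - 1)), by positivity, fun n => ?_⟩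
  have hb := br_pos n
  have a1 := h2 (fun k => br k ^ s) C1 hC1.le h1' n
  rw [show s - 1 + 1 / 2 = s - 1 / 2 by ring] at a1
  have hx : 0 < p * br n := by positivity
  have a2 := h3 (p * br n) (br (fl p n)) hx (br_pos _)
  rw [Real.mul_rpow h0.le hb.le] at a2
  have a3 : |br (fl p n) - p * br n| ≤ 1 := by
    have b1 := fl_le h0.le n
    have b2 := lt_fl (p := p) n
    unfold br; rw [abs_le]; constructor <;> nlinarith
  have a4 : max ((p * br n) ^ (s - 1)) (br (fl p n) ^ (s - 1)) ≤
      ((p / 2) ^ (s - 1) + 1 + p ^ (s - 1)) * br n ^ (s - 1 / 2) := by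
    have c1 : br n ^ (s - 1) ≤ br n ^ (s - 1 / 2) :=
      Real.rpow_le_rpow_of_exponent_le (one_le_br n) (by linarith)
    have c2 : 0 < br n ^ (s - 1) := Real.rpow_pos_of_pos hb _
    have c3 : 0 < p ^ (s - 1) := Real.rpow_pos_of_pos h0 _
    have c4 : 0 < (p / 2) ^ (s - 1) := Real.rpow_pos_of_pos (by linarith) _
    apply max_le
    · rw [Real.mul_rpow h0.le hb.le]
      nlinarith
    · rcases le_total 0 (s - 1) with h | h
      · have := Real.rpow_le_rpow (br_pos _).le (br_mono (fl_le_n h0.le h1 n)) h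
        nlinarith
      · have := Real.rpow_le_rpow_of_nonpos (by positivity) (br_fl h0 h1 n) h
        rw [Real.mul_rpow (by positivity) hb.le] at this
        nlinarith
  have a5 : |br (fl p n) ^ s - p ^ s * br n ^ s| ≤
      C3 * (((p / 2) ^ (s - 1) + 1 + p ^ (s - 1)) * br n ^ (s - 1 / 2)) := by
    refine a2.trans ?_
    calc _ ≤ C3 * (((p / 2) ^ (s - 1) + 1 + p ^ (s - 1)) * br n ^ (s - 1 / 2)) * 1 := by gcongr
      _ = _ := by ring
  have := abs_sub_le (Bn p n (fun k => br k ^ s)) (br (fl p n) ^ s) (p ^ s * br n ^ s)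
  nlinarith

end GT

namespace GT

section
variable {ι : Type*} [Fintype ι]

/-- weighted sum of binomial expectations -/
noncomputable def TT (c p : ι → ℝ) (n : ℕ) (f : ℕ → ℝ) : ℝ := ∑ i, c i * Bn (p i) n f

variable {c p : ι → ℝ}

theorem TT_mono (hc : ∀ i, 0 ≤ c i) (hp : ∀ i, 0 < p i ∧ p i < 1) (n : ℕ) (f g : ℕ → ℝ)
    (h : ∀ k, k ≤ n → f k ≤ g k) : TT c p n f ≤ TT c p n g :=
  Finset.sum_le_sum fun i _ =>
    mul_le_mul_of_nonneg_left (Bn_mono (hp i).1.le (hp i).2.le n f g h) (hc i)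

theorem TT_add (n : ℕ) (f g : ℕ → ℝ) : TT c p n (fun k => f k + g k) = TT c p n f + TT c p n g := by
  simp only [TT, Bn_add, mul_add, Finset.sum_add_distrib]

theorem TT_mul (n : ℕ) (a : ℝ) (f : ℕ → ℝ) : TT c p n (fun k => a * f k) = a * TT c p n f := by
  simp only [TT, Bn_mul, Finset.mul_sum]
  exact Finset.sum_congr rfl fun i _ => by ring

theorem TT_sub (n : ℕ) (f g : ℕ → ℝ) : TT c p n (fun k => f k - g k) = TT c p n f - TT c p n g := by
  simp only [TT, Bn_sub, mul_sub, Finset.sum_sub_distrib]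

theorem TT_abs (hc : ∀ i, 0 ≤ c i) (hp : ∀ i, 0 < p i ∧ p i < 1) (n : ℕ) (f : ℕ → ℝ) :
    |TT c p n f| ≤ TT c p n (fun k => |f k|) := by
  refine (Finset.abs_sum_le_sum_abs _ _).trans (Finset.sum_le_sum fun i _ => ?_)
  rw [abs_mul, abs_of_nonneg (hc i)]
  exact mul_le_mul_of_nonneg_left (Bn_abs (hp i).1.le (hp i).2.le n f) (hc i)

theorem cmp (hc : ∀ i, 0 ≤ c i) (hp : ∀ i, 0 < p i ∧ p i < 1) (g φ τ : ℕ → ℝ) (n0 : ℕ)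
    (hself : ∀ n, n0 ≤ n → ∑ i, c i * p i ^ n < 1)
    (h1 : ∀ n, n0 ≤ n → g n ≤ TT c p n g + τ n)
    (h2 : ∀ n, n0 ≤ n → TT c p n φ + τ n ≤ φ n)
    (h3 : ∀ n, n < n0 → g n ≤ φ n) : ∀ n, g n ≤ φ n := by
  intro n
  induction n using Nat.strong_induction_on with
  | _ n ih =>
    by_cases hn : n < n0
    · exact h3 n hn
    push Not at hn
    have a1 : TT c p n g ≤ TT c p n φ + (∑ i, c i * p i ^ n) * (g n - φ n) := by
      unfold TT
      rw [Finset.sum_mul, ← Finset.sum_add_distrib]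
      refine Finset.sum_le_sum fun i _ => ?_
      rw [mul_assoc, ← mul_add]
      exact mul_le_mul_of_nonneg_left (Bn_self (hp i).1.le (hp i).2.le n g φ ih) (hc i)
    have a2 := h1 n hn
    have a3 := h2 n hn
    have a4 := hself n hn
    by_contra hcon
    push Not at hcon
    nlinarith

theorem self_lt (hp : ∀ i, 0 < p i ∧ p i < 1) (c : ι → ℝ) :
    ∃ n0, ∀ n, n0 ≤ n → ∑ i, c i * p i ^ n < 1 := by
  have : Tendsto (fun n : ℕ => ∑ i, c i * p i ^ n) atTop (𝓝 (∑ i, c i * 0)) := by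
    refine tendsto_finsetSum _ fun i _ => Tendsto.const_mul _ ?_
    exact tendsto_pow_atTop_nhds_zero_of_lt_one (hp i).1.le (hp i).2
  simp only [mul_zero, Finset.sum_const_zero] at this
  exact eventually_atTop.1 (this.eventually (gt_mem_nhds one_pos))

theorem tendsto_br : Tendsto br atTop atTop :=
  tendsto_atTop_add_const_right _ _ tendsto_natCast_atTop_atTop

theorem br_small (α : ℝ) (hα : 0 < α) (C ε : ℝ) (hε : 0 < ε) :
    ∃ n0, ∀ n, n0 ≤ n → C * br n ^ (-α) ≤ ε := by
  have : Tendsto (fun n => C * br n ^ (-α)) atTop (𝓝 0) := by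
    simpa using ((tendsto_rpow_neg_atTop hα).comp tendsto_br).const_mul C
  exact eventually_atTop.1 ((this.eventually (gt_mem_nhds hε)).mono fun _ h => h.le)

/-- comparing two powers with a small factor -/
theorem br_small' (s α : ℝ) (hα : 0 < α) (C ε : ℝ) (hε : 0 < ε) :
    ∃ n0, ∀ n, n0 ≤ n → C * br n ^ (s - α) ≤ ε * br n ^ s := by
  obtain ⟨n0, h⟩ := br_small α hα C ε hε
  refine ⟨n0, fun n hn => ?_⟩
  rw [sub_eq_add_neg, add_comm, Real.rpow_add (br_pos n), ← mul_assoc]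
  exact mul_le_mul_of_nonneg_right (h n hn) (Real.rpow_nonneg (br_pos n).le _)

theorem TT_rpow (hc : ∀ i, 0 ≤ c i) (hp : ∀ i, 0 < p i ∧ p i < 1) (s : ℝ) :
    ∃ C, 0 < C ∧ ∀ n, |TT c p n (fun k => br k ^ s) - (∑ i, c i * p i ^ s) * br n ^ s| ≤
      C * br n ^ (s - 1 / 2) := by
  choose C hC h using fun i => Bn_rpow (hp i).1 (hp i).2.le s
  refine ⟨∑ i, c i * C i + 1, ?_, fun n => ?_⟩
  · have : 0 ≤ ∑ i, c i * C i := Finset.sum_nonneg fun i _ => mul_nonneg (hc i) (hC i).le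
    linarith
  · unfold TT
    have hb := Real.rpow_pos_of_pos (br_pos n) (s - 1 / 2)
    rw [Finset.sum_mul, ← Finset.sum_sub_distrib]
    refine (Finset.abs_sum_le_sum_abs _ _).trans ?_
    have : ∑ i, |c i * Bn (p i) n (fun k => br k ^ s) - c i * p i ^ s * br n ^ s| ≤
        ∑ i, c i * C i * br n ^ (s - 1 / 2) := by
      refine Finset.sum_le_sum fun i _ => ?_
      rw [mul_assoc, mul_assoc, ← mul_sub, abs_mul, abs_of_nonneg (hc i)]
      exact mul_le_mul_of_nonneg_left (h i n) (hc i)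
    refine this.trans ?_
    rw [← Finset.sum_mul]
    nlinarith

theorem init_bound (g : ℕ → ℝ) (φ : ℕ → ℝ) (hφ : ∀ n, 0 < φ n) (n0 : ℕ) :
    ∃ K, 0 < K ∧ ∀ n, n < n0 → g n ≤ K * φ n := by
  refine ⟨∑ n ∈ Finset.range n0, |g n| / φ n + 1, ?_, fun n hn => ?_⟩
  · have : 0 ≤ ∑ n ∈ Finset.range n0, |g n| / φ n :=
      Finset.sum_nonneg fun i _ => div_nonneg (abs_nonneg _) (hφ i).le
    linarith
  · have := Finset.single_le_sum (f := fun n => |g n| / φ n)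
      (fun i _ => div_nonneg (abs_nonneg _) (hφ i).le) (Finset.mem_range.2 hn)
    rw [← div_le_iff₀ (hφ n)]
    have h2 : g n / φ n ≤ |g n| / φ n := div_le_div_of_nonneg_right (le_abs_self _) (hφ n).le
    linarith

/-- strict supersolutions give power bounds -/
theorem sup_bound (hc : ∀ i, 0 ≤ c i) (hp : ∀ i, 0 < p i ∧ p i < 1) (s : ℝ)
    (hs : ∑ i, c i * p i ^ s < 1) (g : ℕ → ℝ) (C : ℝ) (n0 : ℕ)
    (h : ∀ n, n0 ≤ n → |g n| ≤ TT c p n (fun k => |g k|) + C * br n ^ s) :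
    ∃ C', 0 < C' ∧ ∀ n, |g n| ≤ C' * br n ^ s := by
  obtain ⟨C1, hC1, hT⟩ := TT_rpow hc hp s
  set θ := ∑ i, c i * p i ^ s with hθ
  obtain ⟨n1, hn1⟩ := self_lt hp c
  obtain ⟨n2, hn2⟩ := br_small' s (1 / 2) (by norm_num) C1 ((1 - θ) / 2) (by linarith)
  set m := max n0 (max n1 n2) with hm
  obtain ⟨K, hK, hini⟩ := init_bound (fun n => |g n|) (fun n => br n ^ s)
    (fun n => Real.rpow_pos_of_pos (br_pos n) s) m
  set K' := max K (2 * C / (1 - θ)) with hK'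
  have hK'0 : 0 < K' := lt_max_of_lt_left hK
  refine ⟨K', hK'0, ?_⟩
  refine cmp hc hp (fun n => |g n|) (fun n => K' * br n ^ s) (fun n => C * br n ^ s) m
    (fun n hn => hn1 n (by omega)) (fun n hn => h n (by omega)) (fun n hn => ?_) (fun n hn => ?_)
  · have hb := Real.rpow_pos_of_pos (br_pos n) s
    rw [TT_mul]
    have a1 := (abs_le.1 (hT n)).2
    have a2 := hn2 n (by omega)
    have a3 : TT c p n (fun k => br k ^ s) ≤ (1 + θ) / 2 * br n ^ s := by linarith
    have a4 : C ≤ K' * ((1 - θ) / 2) := by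
      have := le_max_right K (2 * C / (1 - θ))
      rw [← hK', div_le_iff₀ (by linarith)] at this
      linarith
    have a5 := mul_le_mul_of_nonneg_left a3 hK'0.le
    have a6 := mul_le_mul_of_nonneg_right a4 hb.le
    nlinarith
  · refine (hini n hn).trans (mul_le_mul_of_nonneg_right (le_max_left _ _) ?_)
    exact (Real.rpow_pos_of_pos (br_pos n) s).le

theorem small_bound (hc : ∀ i, 0 ≤ c i) (hp : ∀ i, 0 < p i ∧ p i < 1) (r : ℝ)
    (hr : ∑ i, c i * p i ^ r < 1) (w : ℕ → ℝ)
    (h : ∀ ε, 0 < ε → ∃ n0, ∀ n, n0 ≤ n → |w n| ≤ TT c p n (fun k => |w k|) + ε * br n ^ r) :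
    Tendsto (fun n => w n / br n ^ r) atTop (𝓝 0) := by
  obtain ⟨η, hη, hη1⟩ : ∃ η : ℝ, 0 < η ∧ ∑ i, c i * p i ^ (r - η) < 1 := by
    have : Continuous fun η : ℝ => ∑ i, c i * p i ^ (r - η) := by
      refine continuous_finsetSum _ fun i _ => continuous_const.mul ?_
      exact Continuous.rpow continuous_const (by fun_prop) fun _ => Or.inl (hp i).1.ne'
    have h0 : ∀ᶠ η in 𝓝 (0 : ℝ), ∑ i, c i * p i ^ (r - η) < 1 :=
      this.continuousAt.eventually (gt_mem_nhds (by simpa using hr))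
    have h1 := (h0.filter_mono nhdsWithin_le_nhds).and (self_mem_nhdsWithin (s := Set.Ioi (0:ℝ)))
    obtain ⟨η, a, b⟩ := h1.exists
    exact ⟨η, b, a⟩
  obtain ⟨C1, hC1, hT1⟩ := TT_rpow hc hp r
  obtain ⟨C2, hC2, hT2⟩ := TT_rpow hc hp (r - η)
  set θ := ∑ i, c i * p i ^ r with hθ
  set θ' := ∑ i, c i * p i ^ (r - η) with hθ'
  obtain ⟨n1, hn1⟩ := self_lt hp c
  obtain ⟨n2, hn2⟩ := br_small' r (1 / 2) (by norm_num) C1 ((1 - θ) / 2) (by linarith)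
  obtain ⟨n3, hn3⟩ := br_small' (r - η) (1 / 2) (by norm_num) C2 (1 - θ') (by linarith)
  have key : ∀ ε, 0 < ε → ∃ K, 0 < K ∧ ∀ n, |w n| ≤ ε * br n ^ r + K * br n ^ (r - η) := by
    intro ε hε
    obtain ⟨n0, hn0⟩ := h (ε * ((1 - θ) / 2)) (by have : 0 < 1 - θ := by linarith
                                                  positivity)
    set m := max n0 (max n1 (max n2 n3)) with hm
    obtain ⟨K, hK, hini⟩ := init_bound (fun n => |w n|) (fun n => br n ^ (r - η))
      (fun n => Real.rpow_pos_of_pos (br_pos n) _) m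
    refine ⟨K, hK, ?_⟩
    refine cmp hc hp (fun n => |w n|) (fun n => ε * br n ^ r + K * br n ^ (r - η))
      (fun n => ε * ((1 - θ) / 2) * br n ^ r) m
      (fun n hn => hn1 n (by omega)) (fun n hn => hn0 n (by omega)) (fun n hn => ?_) (fun n hn => ?_)
    · rw [TT_add, TT_mul, TT_mul]
      have a1 := (abs_le.1 (hT1 n)).2
      have a2 := hn2 n (by omega)
      have a3 : TT c p n (fun k => br k ^ r) ≤ (1 + θ) / 2 * br n ^ r := by linarith
      have b1 := (abs_le.1 (hT2 n)).2
      have b2 := hn3 n (by omega)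
      have b3 : TT c p n (fun k => br k ^ (r - η)) ≤ br n ^ (r - η) := by linarith
      have a5 := mul_le_mul_of_nonneg_left a3 hε.le
      have a6 := mul_le_mul_of_nonneg_left b3 hK.le
      nlinarith
    · have := hini n hn
      have hb := Real.rpow_pos_of_pos (br_pos n) r
      nlinarith
  rw [Metric.tendsto_atTop]
  intro ε hε
  obtain ⟨K, hK, hw⟩ := key (ε / 2) (by linarith)
  obtain ⟨n0, hn0⟩ := br_small' r η hη K (ε / 4) (by linarith)
  refine ⟨n0, fun n hn => ?_⟩
  have hb := Real.rpow_pos_of_pos (br_pos n) r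
  rw [Real.dist_eq, sub_zero, abs_div, abs_of_pos hb, div_lt_iff₀ hb]
  have := hw n
  have := hn0 n hn
  nlinarith

theorem lower_bound [Nonempty ι] (hc : ∀ i, 0 < c i) (hp : ∀ i, 0 < p i ∧ p i < 1) (s : ℝ)
    (hs : ∑ i, c i * p i ^ s = 1) (f : ℕ → ℝ) (n0 : ℕ) (hf0 : ∀ n, 0 ≤ f n)
    (hf1 : ∀ n, n0 ≤ n → 0 < f n) (h : ∀ n, n0 ≤ n → TT c p n f ≤ f n) :
    ∃ k, 0 < k ∧ ∀ n, n0 ≤ n → k * br n ^ s ≤ f n := by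
  have hc' : ∀ i, 0 ≤ c i := fun i => (hc i).le
  obtain ⟨C1, hC1, hT1⟩ := TT_rpow hc' hp s
  obtain ⟨C2, hC2, hT2⟩ := TT_rpow hc' hp (s - 1 / 4)
  obtain ⟨C3, hC3, hT3⟩ := TT_rpow hc' hp (s - 1 / 2)
  set θ' := ∑ i, c i * p i ^ (s - 1 / 4) with hθ'
  have hθ1 : 1 < θ' := by
    rw [← hs, hθ']
    refine Finset.sum_lt_sum_of_nonempty Finset.univ_nonempty fun i _ => ?_
    apply mul_lt_mul_of_pos_left _ (hc i)
    exact Real.rpow_lt_rpow_of_exponent_gt (hp i).1 (hp i).2 (by linarith)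
  set θ2 := ∑ i, c i * p i ^ (s - 1 / 2) with hθ2
  obtain ⟨D, hD, hcut⟩ := init_bound (fun n => br n ^ s + br n ^ (s - 1 / 4))
    (fun n => br n ^ (s - 1 / 2)) (fun n => Real.rpow_pos_of_pos (br_pos n) _) n0
  set φ : ℕ → ℝ := fun n => if n < n0 then 0 else br n ^ s + br n ^ (s - 1 / 4) with hφ
  have hpos : ∀ n (t : ℝ), 0 < br n ^ t := fun n t => Real.rpow_pos_of_pos (br_pos n) t
  have hφl : ∀ n, br n ^ s + br n ^ (s - 1 / 4) - D * br n ^ (s - 1 / 2) ≤ φ n := by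
    intro n
    simp only [hφ]
    split_ifs with hn
    · have := hcut n hn; linarith
    · have := mul_pos hD (hpos n (s - 1 / 2)); linarith
  obtain ⟨n1, hn1⟩ := self_lt hp c
  obtain ⟨n2, hn2⟩ := br_small' (s - 1 / 4) (1 / 4) (by norm_num) (C1 + C2 + D * (|θ2| + C3))
    (θ' - 1) (by linarith)
  set m := max n0 (max n1 n2) with hm
  obtain ⟨K, hK, hini⟩ := init_bound φ (fun n => if n < n0 then 1 else f n)
    (fun n => by split_ifs with hn; exact one_pos; exact hf1 n (by omega)) m
  have key : ∀ n, φ n ≤ K * f n := by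
    refine cmp hc' hp φ (fun n => K * f n) (fun n => 0) m (fun n hn => hn1 n (by omega))
      (fun n hn => ?_) (fun n hn => ?_) (fun n hn => ?_)
    · have e1 : φ n = br n ^ s + br n ^ (s - 1 / 4) := by simp only [hφ]; rw [if_neg (by omega)]
      rw [add_zero, e1]
      refine le_trans ?_ (TT_mono hc' hp n _ _ fun k _ => hφl k)
      rw [TT_sub, TT_add, TT_mul]
      have a1 := (abs_le.1 (hT1 n)).1
      have a2 := (abs_le.1 (hT2 n)).1
      have a3 := (abs_le.1 (hT3 n)).2
      rw [hs] at a1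
      have a4 := hn2 n (by omega)
      rw [show s - 1 / 4 - 1 / 4 = s - 1 / 2 by ring] at a4
      have a5 : br n ^ (s - 1 / 4 - 1 / 2) ≤ br n ^ (s - 1 / 2) :=
        Real.rpow_le_rpow_of_exponent_le (one_le_br n) (by linarith)
      have a6 : br n ^ (s - 1 / 2 - 1 / 2) ≤ br n ^ (s - 1 / 2) :=
        Real.rpow_le_rpow_of_exponent_le (one_le_br n) (by linarith)
      have a7 : TT c p n (fun k => br k ^ (s - 1 / 2)) ≤ (|θ2| + C3) * br n ^ (s - 1 / 2) := by
        have := hpos n (s - 1 / 2)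
        nlinarith [le_abs_self θ2]
      have a8 := mul_le_mul_of_nonneg_left a7 hD.le
      nlinarith
    · rw [add_zero, TT_mul]
      exact mul_le_mul_of_nonneg_left (h n (by omega)) hK.le
    · by_cases h' : n < n0
      · simp only [hφ, if_pos h']; exact mul_nonneg hK.le (hf0 n)
      · have := hini n hn
        simpa only [if_neg h'] using this
  refine ⟨K⁻¹, inv_pos.2 hK, fun n hn => ?_⟩
  have := key n
  simp only [hφ] at this
  rw [if_neg (by omega)] at this
  rw [inv_mul_le_iff₀ hK]
  linarith [hpos n (s - 1 / 4)]

end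
end GT

namespace GT

/-- piecewise linear interpolation of a sequence -/
noncomputable def interp (f : ℕ → ℝ) (x : ℝ) : ℝ :=
  f 0 + ∑ k ∈ Finset.range ⌈x⌉₊, (f (k + 1) - f k) * min (max (x - k) 0) 1

theorem interp_eq (f : ℕ → ℝ) (x : ℝ) (K : ℕ) (hK : x ≤ K) :
    interp f x = f 0 + ∑ k ∈ Finset.range K, (f (k + 1) - f k) * min (max (x - k) 0) 1 := by
  unfold interp
  congr 1
  apply Finset.sum_subset
  · intro k hk
    have := Nat.ceil_le.2 hK
    simp only [Finset.mem_range] at *; omega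
  · intro k _ hk
    simp only [Finset.mem_range, not_lt] at hk
    have : x ≤ k := Nat.ceil_le.1 hk
    rw [max_eq_right (by linarith)]; simp

theorem interp_cont (f : ℕ → ℝ) : Continuous (interp f) := by
  rw [continuous_iff_continuousAt]
  intro x
  obtain ⟨K, hK⟩ := exists_nat_gt x
  have h1 : ContinuousAt (fun x : ℝ => f 0 + ∑ k ∈ Finset.range K,
      (f (k + 1) - f k) * min (max (x - k) 0) 1) x := by
    apply Continuous.continuousAt
    fun_prop
  refine h1.congr ?_
  filter_upwards [Iio_mem_nhds hK] with y hy
  exact (interp_eq f y K (le_of_lt hy)).symm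

theorem interp_floor (f : ℕ → ℝ) (x : ℝ) (hx : 0 ≤ x) :
    interp f x = f ⌊x⌋₊ + (f (⌊x⌋₊ + 1) - f ⌊x⌋₊) * (x - ⌊x⌋₊) := by
  have h1 := Nat.floor_le hx
  have h2 := Nat.lt_floor_add_one x
  set m := ⌊x⌋₊
  rw [interp_eq f x (m + 1) (by push_cast; exact h2.le), Finset.sum_range_succ]
  have e1 : ∑ k ∈ Finset.range m, (f (k + 1) - f k) * min (max (x - k) 0) 1 =
      ∑ k ∈ Finset.range m, (f (k + 1) - f k) := by
    refine Finset.sum_congr rfl fun k hk => ?_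
    have : (k : ℝ) + 1 ≤ m := by exact_mod_cast Finset.mem_range.1 hk
    rw [max_eq_left (by linarith), min_eq_right (by linarith), mul_one]
  rw [e1, Finset.sum_range_sub, max_eq_left (by linarith), min_eq_left (by linarith)]; ring

theorem interp_nat (f : ℕ → ℝ) (n : ℕ) : interp f n = f n := by
  rw [interp_floor f n (by positivity)]; simp

variable {ι : Type*} [Fintype ι]

/-- comparison of the interpolation at `x p` with the expectation -/
theorem interp_Bn {p : ℝ} (h0 : 0 < p) (h1 : p ≤ 1) (σ : ℝ) : ∃ C, 0 < C ∧
    ∀ (f : ℕ → ℝ) (K : ℝ), 0 ≤ K → (∀ k, |f (k + 1) - f k| ≤ K * br k ^ σ) →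
    ∀ x : ℝ, 0 ≤ x → |Bn p ⌊x⌋₊ f - interp f (x * p)| ≤ K * C * br ⌊x⌋₊ ^ (σ + 1 / 2) := by
  obtain ⟨C1, hC1, hB⟩ := Bn_smooth h0 h1 σ
  set c2 : ℝ := max 1 ((p / 2) ^ σ) with hc2
  have hc20 : 0 < c2 := lt_max_of_lt_left one_pos
  refine ⟨C1 + 2 * (c2 * 2 ^ |σ|), by positivity, fun f K hK hf x hx => ?_⟩
  set n := ⌊x⌋₊ with hn
  have hb := br_pos n
  have a1 := hB f K hK hf n
  have hn1 : (n : ℝ) ≤ x := Nat.floor_le hx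
  have hn2 : x < n + 1 := Nat.lt_floor_add_one x
  have hxp : 0 ≤ x * p := by positivity
  have hj1 := Nat.floor_le hxp
  have hj2 := Nat.lt_floor_add_one (x * p)
  set j := ⌊x * p⌋₊ with hj
  set m := fl p n with hm
  have hm1 : (m : ℝ) ≤ n * p := fl_le h0.le n
  have hm2 : (n : ℝ) * p < m + 1 := lt_fl n
  have hmj : m ≤ j := Nat.floor_mono (by gcongr)
  have hjm : j ≤ m + 1 := by
    have : (j : ℝ) < m + 2 := by nlinarith
    have : j < m + 2 := by exact_mod_cast this
    omega
  have hmn : m ≤ n := fl_le_n h0.le h1 n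
  have hbd : ∀ k, m ≤ k → k ≤ m + 1 → |f (k + 1) - f k| ≤ K * (c2 * 2 ^ |σ| * br n ^ (σ + 1 / 2)) := by
    intro k hk1 hk2
    refine (hf k).trans (mul_le_mul_of_nonneg_left ?_ hK)
    have d1 : br n ^ σ ≤ br n ^ (σ + 1 / 2) :=
      Real.rpow_le_rpow_of_exponent_le (one_le_br n) (by linarith)
    have hσ1 : (1 : ℝ) ≤ 2 ^ |σ| := Real.one_le_rpow (by norm_num) (abs_nonneg _)
    have d4 : br k ^ σ ≤ c2 * 2 ^ |σ| * br n ^ σ := by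
      rcases le_total 0 σ with h | h
      · have : br k ≤ 2 * br n := by
          have : (k : ℝ) ≤ n + 1 := by exact_mod_cast (by omega : k ≤ n + 1)
          unfold br; linarith [show (0:ℝ) ≤ n by positivity]
        have := Real.rpow_le_rpow (br_pos k).le this h
        rw [Real.mul_rpow (by norm_num) hb.le] at this
        rw [abs_of_nonneg h]
        have h3 : (0:ℝ) < 2 ^ σ * br n ^ σ := by positivity
        have := le_max_left 1 ((p / 2) ^ σ)
        nlinarith
      · have := Real.rpow_le_rpow_of_nonpos (by positivity) ((br_fl h0 h1 n).trans (br_mono hk1)) h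
        rw [Real.mul_rpow (by positivity) hb.le] at this
        refine this.trans ?_
        have h3 : (0:ℝ) < br n ^ σ := by positivity
        apply mul_le_mul_of_nonneg_right _ h3.le
        have := le_max_right 1 ((p / 2) ^ σ)
        nlinarith
    refine d4.trans (by gcongr)
  have a2 : |f j - f m| ≤ K * (c2 * 2 ^ |σ| * br n ^ (σ + 1 / 2)) := by
    rcases (by omega : j = m ∨ j = m + 1) with h | h
    · rw [h]; simp; positivity
    · rw [h]; exact hbd m le_rfl (by omega)
  have a3 : |interp f (x * p) - f j| ≤ K * (c2 * 2 ^ |σ| * br n ^ (σ + 1 / 2)) := by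
    rw [interp_floor f _ hxp, ← hj, add_sub_cancel_left, abs_mul]
    have := hbd j hmj hjm
    have h5 : |x * p - j| ≤ 1 := by rw [abs_le]; constructor <;> linarith
    nlinarith [abs_nonneg (f (j + 1) - f j), abs_nonneg (x * p - j)]
  rw [abs_le] at *
  constructor <;> nlinarith [a1.1, a1.2, a2.1, a2.2, a3.1, a3.2]

/-- renewal theorem for sequences -/
theorem ren_seq [Nonempty ι] (p : ι → ℝ) (hp : ∀ i, 0 < p i ∧ p i < 1) :
    ∃ h : ℝ, 0 < h ∧ ∀ (c : ι → ℝ), (∀ i, 0 < c i) → ∀ (s δ C : ℝ) (n0 : ℕ) (f : ℕ → ℝ),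
      ∑ i, c i * p i ^ s = 1 → 0 < δ → 0 ≤ C →
      (∀ n, n0 ≤ n → |f n - TT c p n f| ≤ C * br n ^ (s - δ)) →
      (∀ n, |f (n + 1) - f n| ≤ C * br n ^ (s - δ - 1 / 2)) →
      ∃ G : ℝ → ℝ, Continuous G ∧ (∀ y, G (y + h) = G y) ∧ (∀ i y, G (y + -Real.log (p i)) = G y) ∧
        Tendsto (fun n : ℕ => f n / (n : ℝ) ^ s - G (Real.log n)) atTop (𝓝 0) := by
  obtain ⟨h, hh, hren⟩ := renewal (fun i => -Real.log (p i))
    (fun i => by have := Real.log_neg (hp i).1 (hp i).2; linarith)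
  refine ⟨h, hh, fun c hc s δ C n0 f hs hδ hC h1 h2 => ?_⟩
  choose Ci hCi hI using fun i => interp_Bn (hp i).1 (hp i).2.le (s - δ - 1 / 2)
  set D := ∑ i, c i * (C * Ci i) with hD
  have hD0 : 0 ≤ D := Finset.sum_nonneg fun i _ =>
    mul_nonneg (hc i).le (mul_nonneg hC (hCi i).le)
  -- main estimate
  have hmain : ∀ x : ℝ, (n0 : ℝ) + 1 ≤ x → |interp f x - ∑ i, c i * interp f (x * p i)| ≤
      ((2 * C + D) * 2 ^ |s - δ|) * x ^ (s - δ) := by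
    intro x hx
    have hn0 : (0 : ℝ) ≤ n0 := by positivity
    have hx0 : 0 ≤ x := by linarith
    set n := ⌊x⌋₊ with hn
    have hn1 : (n : ℝ) ≤ x := Nat.floor_le hx0
    have hn2 : x < n + 1 := Nat.lt_floor_add_one x
    have hnn : n0 ≤ n := Nat.le_floor (by linarith)
    have b1 := h1 n hnn
    have hb := br_pos n
    have b2 : |interp f x - f n| ≤ C * br n ^ (s - δ) := by
      rw [interp_floor f _ hx0, ← hn, add_sub_cancel_left, abs_mul]
      have c1 := h2 n
      have c2 : br n ^ (s - δ - 1 / 2) ≤ br n ^ (s - δ) :=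
        Real.rpow_le_rpow_of_exponent_le (one_le_br n) (by linarith)
      have h5 : |x - n| ≤ 1 := by rw [abs_le]; constructor <;> linarith
      have c3 := mul_le_mul_of_nonneg_left c2 hC
      nlinarith [abs_nonneg (f (n + 1) - f n), abs_nonneg (x - n)]
    have b3 : |TT c p n f - ∑ i, c i * interp f (x * p i)| ≤ D * br n ^ (s - δ) := by
      rw [TT, ← Finset.sum_sub_distrib, hD, Finset.sum_mul]
      refine (Finset.abs_sum_le_sum_abs _ _).trans (Finset.sum_le_sum fun i _ => ?_)
      have := hI i f C hC h2 x hx0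
      rw [← hn, sub_add_cancel] at this
      rw [← mul_sub, abs_mul, abs_of_pos (hc i), mul_assoc]
      exact mul_le_mul_of_nonneg_left this (hc i).le
    have b4 : br n ^ (s - δ) ≤ 2 ^ |s - δ| * x ^ (s - δ) := by
      have hxp : 0 < x := by linarith
      rcases le_total 0 (s - δ) with h' | h'
      · rw [abs_of_nonneg h', ← Real.mul_rpow (by norm_num) hx0]
        apply Real.rpow_le_rpow hb.le _ h'
        unfold br; linarith
      · have : x ≤ br n := by unfold br; linarith
        have := Real.rpow_le_rpow_of_nonpos hxp this h'
        have hσ1 : (1 : ℝ) ≤ 2 ^ |s - δ| := Real.one_le_rpow (by norm_num) (abs_nonneg _)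
        have : 0 < x ^ (s - δ) := Real.rpow_pos_of_pos hxp _
        nlinarith
    have b5 : |interp f x - ∑ i, c i * interp f (x * p i)| ≤ (2 * C + D) * br n ^ (s - δ) := by
      rw [abs_le] at *
      constructor <;> linarith [b1.1, b1.2, b2.1, b2.2, b3.1, b3.2]
    refine b5.trans ?_
    rw [mul_assoc]
    exact mul_le_mul_of_nonneg_left b4 (by linarith)
  set Z : ℝ → ℝ := fun y => Real.exp (-s * y) * interp f (Real.exp y) with hZ
  have hR : Ren (fun i => -Real.log (p i)) (fun i => c i * p i ^ s) Z
      ((2 * C + D) * 2 ^ |s - δ|) δ (Real.log (n0 + 1)) := by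
    refine ⟨fun i => mul_pos (hc i) (Real.rpow_pos_of_pos (hp i).1 _), hs, fun i => ?_, hδ,
      by positivity, ?_, ?_⟩
    · have := Real.log_neg (hp i).1 (hp i).2; linarith
    · exact (Real.continuous_exp.comp (by fun_prop)).mul ((interp_cont f).comp Real.continuous_exp)
    · intro y hy
      have hx : (n0 : ℝ) + 1 ≤ Real.exp y := (Real.log_le_iff_le_exp (by positivity)).1 hy
      have e1 : Z y - ∑ i, c i * p i ^ s * Z (y - -Real.log (p i)) = Real.exp (-s * y) *
          (interp f (Real.exp y) - ∑ i, c i * interp f (Real.exp y * p i)) := by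
        rw [mul_sub, Finset.mul_sum]
        congr 1
        refine Finset.sum_congr rfl fun i _ => ?_
        simp only [hZ]
        have hpi := (hp i).1
        rw [sub_neg_eq_add, Real.exp_add, Real.exp_log hpi, mul_add, Real.exp_add,
          Real.rpow_def_of_pos hpi]
        have : Real.exp (Real.log (p i) * s) * Real.exp (-s * Real.log (p i)) = 1 := by
          rw [← Real.exp_add]; ring_nf; exact Real.exp_zero
        linear_combination (c i * Real.exp (-s * y) * interp f (Real.exp y * p i)) * this
      rw [e1, abs_mul, abs_of_pos (Real.exp_pos _)]
      refine (mul_le_mul_of_nonneg_left (hmain _ hx) (Real.exp_pos _).le).trans (le_of_eq ?_)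
      rw [← Real.exp_mul]
      have : Real.exp (-δ * y) = Real.exp (-s * y) * Real.exp (y * (s - δ)) := by
        rw [← Real.exp_add]; ring_nf
      rw [this]; ring
  obtain ⟨G, g1, g2, g3, g4⟩ := hren _ Z _ _ _ hR
  refine ⟨G, g1, g2, g3, ?_⟩
  have := g4.comp (Real.tendsto_log_atTop.comp tendsto_natCast_atTop_atTop)
  refine this.congr' ?_
  filter_upwards [eventually_gt_atTop 0] with n hn
  have hn' : (0 : ℝ) < n := by exact_mod_cast hn
  simp only [Function.comp_def, hZ]
  rw [Real.exp_log hn', interp_nat, Real.rpow_def_of_pos hn', div_eq_mul_inv, ← Real.exp_neg]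
  ring_nf

end GT

namespace GT

/-- finite weighted expectation -/
noncomputable def Ex {Ω V : Type*} [Fintype Ω] [AddCommMonoid V] [Module ℝ V] (w : Ω → ℝ)
    (F : Ω → V) : V := ∑ x, w x • F x

/-- probability weights -/
def IsW {Ω : Type*} [Fintype Ω] (w : Ω → ℝ) : Prop := (∀ x, 0 ≤ w x) ∧ ∑ x, w x = 1

/-- product weights -/
noncomputable def pw {ι Ω : Type*} [Fintype ι] (w : Ω → ℝ) (x : ι → Ω) : ℝ := ∏ i, w (x i)

section
variable {Ω : Type*} [Fintype Ω] {w : Ω → ℝ}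

section
variable {V : Type*} [AddCommGroup V] [Module ℝ V]

theorem Ex_add (F G : Ω → V) : Ex w (fun x => F x + G x) = Ex w F + Ex w G := by
  simp [Ex, Finset.sum_add_distrib]

theorem Ex_neg (F : Ω → V) : Ex w (fun x => - F x) = - Ex w F := by
  simp [Ex]

theorem Ex_sub (F G : Ω → V) : Ex w (fun x => F x - G x) = Ex w F - Ex w G := by
  simp [Ex, smul_sub]

theorem Ex_sum {κ : Type*} (s : Finset κ) (F : κ → Ω → V) :
    Ex w (fun x => ∑ k ∈ s, F k x) = ∑ k ∈ s, Ex w (F k) := by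
  simp only [Ex, Finset.smul_sum]; rw [Finset.sum_comm]

theorem Ex_const (hw : IsW w) (c : V) : Ex w (fun _ => c) = c := by
  simp only [Ex, ← Finset.sum_smul, hw.2, one_smul]

end

theorem Ex_mul (c : ℝ) (F : Ω → ℝ) : Ex w (fun x => c * F x) = c * Ex w F := by
  simp only [Ex, smul_eq_mul, Finset.mul_sum]; exact Finset.sum_congr rfl fun x _ => by ring

theorem Ex_mulc (c : ℂ) (F : Ω → ℂ) : Ex w (fun x => c * F x) = c * Ex w F := by
  simp only [Ex, Finset.mul_sum, mul_smul_comm]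

theorem Ex_mono (hw : IsW w) (F G : Ω → ℝ) (h : ∀ x, F x ≤ G x) : Ex w F ≤ Ex w G :=
  Finset.sum_le_sum fun x _ => mul_le_mul_of_nonneg_left (h x) (hw.1 x)

theorem Ex_nonneg (hw : IsW w) (F : Ω → ℝ) (h : ∀ x, 0 ≤ F x) : 0 ≤ Ex w F :=
  Finset.sum_nonneg fun x _ => mul_nonneg (hw.1 x) (h x)

theorem Ex_norm {V : Type*} [NormedAddCommGroup V] [NormedSpace ℝ V] (hw : IsW w) (F : Ω → V) :
    ‖Ex w F‖ ≤ Ex w (fun x => ‖F x‖) := by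
  refine (norm_sum_le _ _).trans (le_of_eq ?_)
  simp only [Ex, norm_smul, smul_eq_mul, Real.norm_eq_abs]
  exact Finset.sum_congr rfl fun x _ => by rw [abs_of_nonneg (hw.1 x)]

theorem Ex_abs (hw : IsW w) (F : Ω → ℝ) : |Ex w F| ≤ Ex w (fun x => |F x|) := by
  simpa using Ex_norm hw F

/-- variance -/
noncomputable def Vr (w : Ω → ℝ) (F : Ω → ℝ) : ℝ := Ex w (fun x => (F x - Ex w F) ^ 2)

theorem Vr_nonneg (hw : IsW w) (F : Ω → ℝ) : 0 ≤ Vr w F := Ex_nonneg hw _ fun x => sq_nonneg _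

theorem Vr_eq (hw : IsW w) (F : Ω → ℝ) : Vr w F = Ex w (fun x => F x ^ 2) - Ex w F ^ 2 := by
  unfold Vr
  have : (fun x => (F x - Ex w F) ^ 2) = fun x => (F x ^ 2 - 2 * Ex w F * F x) + Ex w F ^ 2 := by
    funext x; ring
  rw [this, Ex_add, Ex_sub, Ex_mul, Ex_const hw]; ring

theorem Ex_sq_le (hw : IsW w) (F : Ω → ℝ) : Ex w F ^ 2 ≤ Ex w (fun x => F x ^ 2) := by
  have := Vr_nonneg hw F; rw [Vr_eq hw] at this; linarith

theorem Ex_abs_le_sqrt (hw : IsW w) (F : Ω → ℝ) : Ex w (fun x => |F x|) ≤ √(Ex w (fun x => F x ^ 2)) := by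
  apply Real.le_sqrt_of_sq_le
  simpa using Ex_sq_le hw (fun x => |F x|)

theorem Vr_le (hw : IsW w) (F : Ω → ℝ) (c : ℝ) : Vr w F ≤ Ex w (fun x => (F x - c) ^ 2) := by
  have h : (fun x => (F x - c) ^ 2) = fun x => (F x ^ 2 - 2 * c * F x) + c ^ 2 := by
    funext x; ring
  rw [h, Ex_add, Ex_sub, Ex_mul, Ex_const hw, Vr_eq hw]
  nlinarith [sq_nonneg (Ex w F - c)]

theorem Ex_cs (hw : IsW w) (F G : Ω → ℝ) :
    |Ex w (fun x => F x * G x)| ≤ √(Ex w (fun x => F x ^ 2)) * √(Ex w (fun x => G x ^ 2)) := by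
  rw [← Real.sqrt_mul (Ex_nonneg hw _ fun x => sq_nonneg _)]
  apply Real.abs_le_sqrt
  have := Finset.sum_mul_sq_le_sq_mul_sq Finset.univ (fun x => √(w x) * F x) (fun x => √(w x) * G x)
  have e1 : ∀ x, √(w x) * F x * (√(w x) * G x) = w x • (F x * G x) := fun x => by
    have := Real.mul_self_sqrt (hw.1 x)
    rw [smul_eq_mul]; linear_combination (F x * G x) * this
  have e2 : ∀ (H : Ω → ℝ) x, (√(w x) * H x) ^ 2 = w x • (H x ^ 2) := fun H x => by
    rw [mul_pow, Real.sq_sqrt (hw.1 x), smul_eq_mul]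
  simp only [e1, e2] at this
  exact this

section
variable {ι : Type*} [Fintype ι] [DecidableEq ι]

theorem Ex_pw_prod {R : Type*} [CommRing R] [Algebra ℝ R] (f : ι → Ω → R) :
    Ex (pw w) (fun x : ι → Ω => ∏ i, f i (x i)) = ∏ i, Ex w (f i) := by
  simp only [Ex, pw, Finset.prod_univ_sum, Fintype.piFinset_univ]
  refine Finset.sum_congr rfl fun x _ => ?_
  simp only [Algebra.smul_def, Finset.prod_mul_distrib, map_prod]

theorem isW_pw (hw : IsW w) : IsW (pw w : (ι → Ω) → ℝ) := by
  refine ⟨fun x => Finset.prod_nonneg fun i _ => hw.1 _, ?_⟩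
  have := Ex_pw_prod (w := w) (R := ℝ) (fun (_ : ι) _ => 1)
  simpa [Ex, hw.2] using this

theorem Ex_pw_one (hw : IsW w) (i : ι) (f : Ω → ℝ) :
    Ex (pw w) (fun x : ι → Ω => f (x i)) = Ex w f := by
  have := Ex_pw_prod (w := w) (R := ℝ) (fun (j : ι) y => if j = i then f y else 1)
  have e : (fun x : ι → Ω => ∏ j, (if j = i then f (x j) else 1)) = fun x => f (x i) := by
    funext x; simp
  rw [e] at this
  rw [this, Finset.prod_eq_single i]
  · simp
  · intro j _ hj; simp only [hj, if_false]; exact Ex_const hw 1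
  · simp

theorem Ex_pw_two (hw : IsW w) (i k : ι) (hik : i ≠ k) (f g : Ω → ℝ) :
    Ex (pw w) (fun x : ι → Ω => f (x i) * g (x k)) = Ex w f * Ex w g := by
  have := Ex_pw_prod (w := w) (R := ℝ)
    (fun (j : ι) y => (if j = i then f y else 1) * (if j = k then g y else 1))
  have e : (fun x : ι → Ω => ∏ j, ((if j = i then f (x j) else 1) * (if j = k then g (x j) else 1)))
      = fun x => f (x i) * g (x k) := by
    funext x; rw [Finset.prod_mul_distrib]; simp
  rw [e] at this
  rw [this, ← Finset.mul_prod_erase _ _ (Finset.mem_univ i),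
    ← Finset.mul_prod_erase _ _ (Finset.mem_erase.2 ⟨hik.symm, Finset.mem_univ k⟩), Finset.prod_eq_one]
  · simp [hik, hik.symm]
  · intro j hj
    simp only [Finset.mem_erase] at hj
    simp only [hj.1, hj.2.1, if_false, mul_one]; exact Ex_const hw 1

theorem Vr_pw_sum (hw : IsW w) (f : Ω → ℝ) :
    Vr (pw w) (fun x : ι → Ω => ∑ i, f (x i)) = Fintype.card ι * Vr w f := by
  have e1 : Ex (pw w) (fun x : ι → Ω => ∑ i, f (x i)) = ∑ i : ι, Ex w f := by
    rw [Ex_sum]; simp only [Ex_pw_one hw]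
  unfold Vr
  rw [e1]
  have e2 : (fun x : ι → Ω => (∑ i, f (x i) - ∑ i : ι, Ex w f) ^ 2) =
      fun x => ∑ i, ∑ j, (f (x i) - Ex w f) * (f (x j) - Ex w f) := by
    funext x; rw [← Finset.sum_sub_distrib, sq, Finset.sum_mul_sum]
  rw [e2, Ex_sum]
  have hz : Ex w (fun x => f x - Ex w f) = 0 := by rw [Ex_sub, Ex_const hw, sub_self]
  have e3 : ∀ i : ι, Ex (pw w) (fun x : ι → Ω => ∑ j, (f (x i) - Ex w f) * (f (x j) - Ex w f)) =
      Ex w (fun x => (f x - Ex w f) ^ 2) := by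
    intro i
    rw [Ex_sum, Finset.sum_eq_single i]
    · rw [← Ex_pw_one hw i (fun x => (f x - Ex w f) ^ 2)]; congr 1; funext x; ring
    · intro j _ hj
      rw [Ex_pw_two hw i j hj.symm (fun y => f y - Ex w f) (fun y => f y - Ex w f), hz]; simp
    · simp
  simp [e3]

end

theorem Ex_cons {V : Type*} [AddCommMonoid V] [Module ℝ V] (n : ℕ) (F : (Fin (n + 1) → Ω) → V) :
    Ex (pw w) F = Ex w (fun a => Ex (pw w) (fun y : Fin n → Ω => F (Fin.cons a y))) := by
  unfold Ex
  rw [← (Fin.consEquiv (fun _ : Fin (n + 1) => Ω)).sum_comp, Fintype.sum_prod_type]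
  refine Finset.sum_congr rfl fun a _ => ?_
  rw [Finset.smul_sum]
  refine Finset.sum_congr rfl fun y _ => ?_
  simp [pw, Fin.prod_univ_succ, Fin.consEquiv, mul_smul]

theorem Ex_nil {V : Type*} [AddCommMonoid V] [Module ℝ V] (F : (Fin 0 → Ω) → V) :
    Ex (pw w) F = F Fin.elim0 := by
  unfold Ex
  rw [Fintype.sum_unique]; simp [pw]; congr 1

end

/-- letter counts -/
def cnt {A n : ℕ} (y : Fin n → Fin A) (a : Fin A) : ℕ := (Finset.univ.filter fun i => y i = a).card

section
variable {A : ℕ} {p : Fin A → ℝ}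

theorem cnt_cons {n : ℕ} (y : Fin n → Fin A) (a b : Fin A) :
    cnt (Fin.cons b y : Fin (n + 1) → Fin A) a = cnt y a + if b = a then 1 else 0 := by
  simp only [cnt, Finset.card_filter, Fin.sum_univ_succ, Fin.cons_zero, Fin.cons_succ]; ring

theorem cnt_le {n : ℕ} (y : Fin n → Fin A) (a : Fin A) : cnt y a ≤ n := by
  simpa [cnt] using Finset.card_filter_le (Finset.univ : Finset (Fin n)) (fun i => y i = a)

theorem cnt_sum {n : ℕ} (y : Fin n → Fin A) : ∑ a, cnt y a = n := by
  have := Finset.card_eq_sum_card_fiberwise (f := y) (s := Finset.univ) (t := Finset.univ) (by simp)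
  simpa [cnt] using this.symm

theorem Ex_cnt (hp : IsW p) (a : Fin A) (n : ℕ) (f : ℕ → ℝ) :
    Ex (pw p) (fun y : Fin n → Fin A => f (cnt y a)) = Bn (p a) n f := by
  induction n generalizing f with
  | zero => rw [Ex_nil]; simp [cnt, Bn]
  | succ n ih =>
    rw [Ex_cons, Bn_succ]
    simp only [cnt_cons]
    unfold Ex at *
    rw [← Finset.add_sum_erase _ _ (Finset.mem_univ a)]
    have h1 : ∀ x ∈ Finset.univ.erase a, p x • ∑ y : Fin n → Fin A, pw p y • f (cnt y a + if x = a then 1 else 0)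
        = p x • Bn (p a) n f := by
      intro x hx
      have : x ≠ a := (Finset.mem_erase.1 hx).1
      simp only [this, if_false, add_zero, ih]
    rw [Finset.sum_congr rfl h1, ← Finset.sum_smul]
    have h2 : ∑ x ∈ Finset.univ.erase a, p x = 1 - p a := by
      rw [← hp.2, ← Finset.add_sum_erase _ _ (Finset.mem_univ a)]; ring
    simp only [if_true, h2, smul_eq_mul]
    rw [← ih (fun k => f (k + 1))]
    simp only [smul_eq_mul]

/-- sum over the letters of a word as a function of the counts -/
theorem sum_cnt {n : ℕ} (y : Fin n → Fin A) (g : Fin A → ℝ) :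
    ∑ i, g (y i) = ∑ a, (cnt y a : ℝ) * g a := by
  rw [← Finset.sum_fiberwise (s := Finset.univ) (g := y)]
  refine Finset.sum_congr rfl fun a _ => ?_
  rw [Finset.sum_congr rfl (g := fun _ => g a)]
  · simp [cnt]
  · intro i hi; rw [(Finset.mem_filter.1 hi).2]

end

end GT

namespace GT

section
variable {M A : ℕ} {p : Fin A → ℝ}

theorem lab_one {μL : Measure (List (Fin M) → Fin A)} (hμL : IsLabelingMeasure p μL)
    (u : List (Fin M)) (a : Fin A) : μL {L | L u = a} = ENNReal.ofReal (p a) := by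
  have := hμL {u} (fun _ => a)
  simpa using this

theorem lab_indep {μL : Measure (List (Fin M) → Fin A)} [IsProbabilityMeasure μL]
    (hμL : IsLabelingMeasure p μL) :
    iIndepFun (fun (u : List (Fin M)) (L : List (Fin M) → Fin A) => L u) μL := by
  classical
  rw [iIndepFun_iff_finset]
  intro S
  change iIndepFun (fun (i : S) (L : List (Fin M) → Fin A) => L i) μL
  rw [iIndepFun_iff_map_fun_eq_pi_map (f := fun (i : S) (L : List (Fin M) → Fin A) => L i)
    (fun i => (measurable_pi_apply (i : List (Fin M))).aemeasurable)]
  have hmeas : Measurable (fun (ω : List (Fin M) → Fin A) (i : S) => ω i) := by fun_prop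
  have : IsProbabilityMeasure (Measure.map (fun (ω : List (Fin M) → Fin A) (i : S) => ω i) μL) :=
    Measure.isProbabilityMeasure_map hmeas.aemeasurable
  have hA : Nonempty (Fin A) := by
    obtain ⟨L⟩ : Nonempty (List (Fin M) → Fin A) := nonempty_of_isProbabilityMeasure μL
    exact ⟨L []⟩
  refine Measure.ext_of_singleton fun z => ?_
  rw [Measure.pi_singleton]
  change Measure.map (fun (ω : List (Fin M) → Fin A) (i : S) => ω i) μL {z} = _
  rw [Measure.map_apply hmeas (measurableSet_singleton z)]
  have h2 := hμL S (fun u => if h : u ∈ S then z ⟨u, h⟩ else Classical.arbitrary _)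
  have e1 : (fun (ω : List (Fin M) → Fin A) (i : S) => ω i) ⁻¹' {z} =
      {L | ∀ w ∈ S, L w = (fun u => if h : u ∈ S then z ⟨u, h⟩ else Classical.arbitrary _) w} := by
    ext L
    simp only [Set.mem_preimage, Set.mem_singleton_iff, Set.mem_ofPred_eq, funext_iff, Subtype.forall]
    refine forall_congr' fun u => forall_congr' fun h => ?_
    simp [h]
  rw [e1, h2, ← Finset.prod_coe_sort]
  refine Finset.prod_congr rfl fun i _ => ?_
  change _ = Measure.map (fun L : List (Fin M) → Fin A => L i) μL {z i}
  rw [Measure.map_apply (measurable_pi_apply _) (measurableSet_singleton _)]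
  rw [dif_pos i.2]
  exact (lab_one hμL _ _).symm

/-- a family of independent random letters with law `p` -/
structure IsLab {Ω : Type*} [MeasurableSpace Ω] (p : Fin A → ℝ) (P : Measure Ω) {I : Type*}
    (ξ : I → List (Fin M) → Ω → Fin A) : Prop where
  meas : ∀ i u, Measurable (ξ i u)
  ind : iIndepFun (fun (q : I × List (Fin M)) => ξ q.1 q.2) P
  law : ∀ i u a, P {ω | ξ i u ω = a} = ENNReal.ofReal (p a)

theorem isLab_pi {μL : Measure (List (Fin M) → Fin A)} [IsProbabilityMeasure μL]
    (hμL : IsLabelingMeasure p μL) (n : ℕ) :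
    IsLab p (Measure.pi fun _ : Fin n => μL) (fun (i : Fin n) u Ls => Ls i u) := by
  refine ⟨fun i u => by fun_prop, ?_, fun i u a => ?_⟩
  · refine iIndepFun_uncurry' (X := fun (i : Fin n) u (Ls : Fin n → List (Fin M) → Fin A) => Ls i u)
      (fun i u => by fun_prop) ?_ fun i => ?_
    · exact iIndepFun_pi (X := fun (_ : Fin n) (L : List (Fin M) → Fin A) => L)
        fun i => aemeasurable_id
    · have h := lab_indep hμL
      have e : Measure.map (fun Ls : Fin n → List (Fin M) → Fin A => Ls i) (Measure.pi fun _ : Fin n => μL) = μL :=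
        (measurePreserving_eval (fun _ : Fin n => μL) i).map_eq
      rw [iIndepFun_iff_measure_inter_preimage_eq_mul] at h ⊢
      intro S sets hs
      have h3 := h S hs
      rw [← e] at h3
      rw [Measure.map_apply (by fun_prop)] at h3
      · simp only [Set.preimage_iInter] at h3
        rw [show (⋂ u ∈ S, (fun Ls : Fin n → List (Fin M) → Fin A => Ls i u) ⁻¹' sets u) =
          ⋂ u ∈ S, (fun Ls : Fin n → List (Fin M) → Fin A => Ls i) ⁻¹' ((fun L => L u) ⁻¹' sets u) from rfl, h3]
        refine Finset.prod_congr rfl fun u hu => ?_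
        rw [Measure.map_apply (by fun_prop) ((measurable_pi_apply u) (hs u hu))]; rfl
      · exact MeasurableSet.biInter S.countable_toSet fun u hu => (measurable_pi_apply u) (hs u hu)
  · have hms : MeasurableSet {L : List (Fin M) → Fin A | L u = a} :=
      measurableSet_eq_fun (measurable_pi_apply u) measurable_const
    have := (measurePreserving_eval (fun _ : Fin n => μL) i).measure_preimage
      (s := {L | L u = a}) hms.nullMeasurableSet
    rw [lab_one hμL] at this
    exact this

end
end GT

namespace GT

section
variable {M A : ℕ} {p : Fin A → ℝ}

/-- truncated leaf count -/
noncomputable def XX {n : ℕ} : ℕ → Finset (Fin n) → (Fin n → List (Fin M) → Fin A) → ℝ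
  | 0, _, _ => 0
  | k + 1, J, L =>
    (if 2 ≤ J.card ∧ ∀ q : Fin M × Fin A, (J.filter fun i => L i [q.1] = q.2).card ≤ 1 then 1 else 0) +
      ∑ q : Fin M × Fin A, XX k (J.filter fun i => L i [q.1] = q.2) (fun i u => L i (q.1 :: u))

theorem XX_congr {n : ℕ} (k : ℕ) (J : Finset (Fin n)) (L L' : Fin n → List (Fin M) → Fin A)
    (h : ∀ i ∈ J, ∀ u : List (Fin M), u ≠ [] → u.length ≤ k → L i u = L' i u) :
    XX k J L = XX k J L' := by
  induction k generalizing J L L' with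
  | zero => rfl
  | succ k ih =>
    have hf : ∀ q : Fin M × Fin A, (J.filter fun i => L i [q.1] = q.2) = J.filter fun i => L' i [q.1] = q.2 := by
      intro q
      refine Finset.filter_congr fun i hi => ?_
      rw [h i hi [q.1] (by simp) (by simp)]
    simp only [XX, hf]
    congr 1
    refine Finset.sum_congr rfl fun q _ => ih _ _ _ fun i hi u hu hk => ?_
    exact h i (Finset.mem_filter.1 hi).1 _ (by simp) (by simpa using hk)

/-- the toll -/
noncomputable def bb {n : ℕ} (x : Fin M → Fin n → Fin A) : ℝ :=
  if 2 ≤ n ∧ ∀ q : Fin M × Fin A, cnt (x q.1) q.2 ≤ 1 then 1 else 0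

/-- one step of the recursion for the laws -/
noncomputable def step (M : ℕ) (p : Fin A → ℝ) (lam : ℕ → Measure ℝ) (n : ℕ) : Measure ℝ :=
  ∑ x : Fin M → Fin n → Fin A, ENNReal.ofReal (pw (pw p) x) •
    Measure.map (fun y : Fin M × Fin A → ℝ => bb x + ∑ q, y q)
      (Measure.pi fun q : Fin M × Fin A => lam (cnt (x q.1) q.2))

/-- law of the truncated leaf count -/
noncomputable def nuk (M : ℕ) (p : Fin A → ℝ) : ℕ → ℕ → Measure ℝ
  | 0 => fun _ => Measure.dirac 0
  | k + 1 => step M p (nuk M p k)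

/-- lists of bounded length -/
noncomputable def Lk (M k : ℕ) : Finset (List (Fin M)) := (List.finite_length_le (Fin M) k).toFinset

theorem mem_Lk {k : ℕ} {u : List (Fin M)} : u ∈ Lk M k ↔ u.length ≤ k := by simp [Lk]

variable {Ω : Type*} [MeasurableSpace Ω] {P : Measure Ω} {n : ℕ}

theorem XX_factor {ξ : Fin n → List (Fin M) → Ω → Fin A} (a0 : Fin A) (k : ℕ) (J : Finset (Fin n)) (m : Fin M)
    (S : Finset (Fin n × List (Fin M)))
    (hS : ∀ i ∈ J, ∀ u : List (Fin M), u ≠ [] → u.length ≤ k → (i, m :: u) ∈ S) :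
    ∃ G : (S → Fin A) → ℝ, Measurable G ∧
      ∀ ω, XX k J (fun i u => ξ i (m :: u) ω) = G (fun s => ξ s.1.1 s.1.2 ω) := by
  classical
  refine ⟨fun z => XX k J (fun i u => if h : (i, m :: u) ∈ S then z ⟨_, h⟩ else a0),
    measurable_of_countable _, fun ω => ?_⟩
  refine XX_congr _ _ _ _ fun i hi u hu hk => ?_
  rw [dif_pos (hS i hi u hu hk)]

theorem isLab_shift {ξ : Fin n → List (Fin M) → Ω → Fin A} (h : IsLab p P ξ) (m : Fin M) :
    IsLab p P (fun i u => ξ i (m :: u)) := by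
  refine ⟨fun i u => h.meas _ _, ?_, fun i u a => h.law _ _ _⟩
  exact h.ind.precomp (g := fun q : Fin n × List (Fin M) => (q.1, m :: q.2))
    (fun a b hab => by simpa [Prod.ext_iff] using hab)

theorem XX_meas {ξ : Fin n → List (Fin M) → Ω → Fin A} (h : IsLab p P ξ) (k : ℕ) (J : Finset (Fin n)) :
    Measurable (fun ω => XX k J (fun i u => ξ i u ω)) := by
  rcases isEmpty_or_nonempty (Fin n) with he | ⟨⟨i0⟩⟩
  · have : ∀ ω ω', XX k J (fun i u => ξ i u ω) = XX k J (fun i u => ξ i u ω') := fun ω ω' =>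
      XX_congr _ _ _ _ fun i => (he.false i).elim
    exact measurable_const' this
  rcases isEmpty_or_nonempty Ω with he | ⟨⟨ω0⟩⟩
  · exact measurable_of_countable _
  classical
  let S : Finset (Fin n × List (Fin M)) := Finset.univ ×ˢ Lk M k
  let G : (S → Fin A) → ℝ := fun z => XX k J (fun i u => if h : (i, u) ∈ S then z ⟨_, h⟩ else ξ i0 [] ω0)
  have hG : Measurable G := measurable_of_countable _
  have e : (fun ω => XX k J (fun i u => ξ i u ω)) = fun ω => G (fun s => ξ s.1.1 s.1.2 ω) := by
    funext ω
    refine XX_congr _ _ _ _ fun i hi u hu hk => ?_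
    rw [dif_pos (by simp [S, mem_Lk, hk])]
  rw [e]
  exact hG.comp (measurable_pi_lambda (fun ω (s : S) => ξ s.1.1 s.1.2 ω) fun s => h.meas _ _)

end
end GT

namespace GT

theorem block_indep {Ω ι κ β : Type*} [MeasurableSpace Ω] [MeasurableSpace β] [DecidableEq ι] {P : Measure Ω}
    {f : ι → Ω → β} (hf : iIndepFun f P) (hm : ∀ i, Measurable (f i)) (S : κ → Finset ι)
    (hd : ∀ q q', q ≠ q' → Disjoint (S q) (S q')) :
    iIndepFun (fun q ω (s : S q) => f s ω) P := by
  classical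
  have := hf.isProbabilityMeasure
  rw [iIndepFun_iff_measure_inter_preimage_eq_mul]
  intro Q
  induction Q using Finset.induction_on with
  | empty => intro sets _; simp
  | insert q Q hq ih =>
    intro sets hs
    rw [Finset.set_biInter_insert, Finset.prod_insert hq, ← ih fun i hi => hs i (Finset.mem_insert_of_mem hi)]
    have hdis : Disjoint (S q) (Q.biUnion S) := by
      rw [Finset.disjoint_biUnion_right]
      intro q' hq'
      exact hd _ _ fun h => hq (h ▸ hq')
    have ind := hf.indepFun_finset (S q) (Q.biUnion S) hdis hm
    have hmem : ∀ q' : Q, ∀ s : S q', (s : ι) ∈ Q.biUnion S := fun q' s =>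
      Finset.mem_biUnion.2 ⟨q', q'.2, s.2⟩
    let B : Set (Q.biUnion S → β) := ⋂ q' : Q, (fun z (s : S q') => z ⟨s, hmem q' s⟩) ⁻¹' sets q'
    have hB : MeasurableSet B := by
      refine MeasurableSet.iInter fun q' => ?_
      exact (measurable_pi_lambda _ fun s => measurable_pi_apply _) (hs _ (Finset.mem_insert_of_mem q'.2))
    have e : (⋂ q' ∈ Q, (fun ω (s : S q') => f s ω) ⁻¹' sets q') =
        (fun ω (i : Q.biUnion S) => f i ω) ⁻¹' B := by
      ext ω; simp [B]
    rw [e]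
    exact ind.measure_inter_preimage_eq_mul _ _ (hs q (Finset.mem_insert_self _ _)) hB

section
variable {M A : ℕ} {p : Fin A → ℝ}
variable {Ω : Type*} [MeasurableSpace Ω] {P : Measure Ω} {n : ℕ}

/-- independence of the subtree counts for a fixed first level -/
theorem XX_indep {ξ : Fin n → List (Fin M) → Ω → Fin A} (h : IsLab p P ξ) (a0 : Fin A) (k : ℕ)
    (J : Fin M × Fin A → Finset (Fin n)) (hJ : ∀ m a a', a ≠ a' → Disjoint (J (m, a)) (J (m, a'))) :
    iIndepFun (fun (q : Fin M × Fin A) ω => XX k (J q) (fun i u => ξ i (q.1 :: u) ω)) P := by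
  classical
  let S : Fin M × Fin A → Finset (Fin n × List (Fin M)) := fun q => J q ×ˢ (Lk M k).image (fun u => q.1 :: u)
  have hS : ∀ q q', q ≠ q' → Disjoint (S q) (S q') := by
    rintro ⟨m, a⟩ ⟨m', a'⟩ hne
    simp only [S, Finset.disjoint_product]
    by_cases hm : m = m'
    · subst hm
      exact Or.inl (hJ m a a' fun h => hne (by rw [h]))
    · right
      rw [Finset.disjoint_left]
      rintro u hu hu'
      obtain ⟨v, _, rfl⟩ := Finset.mem_image.1 hu
      obtain ⟨v', _, h'⟩ := Finset.mem_image.1 hu'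
      simp only [List.cons.injEq] at h'
      exact hm h'.1.symm
  choose G hG hG' using fun q : Fin M × Fin A => XX_factor (ξ := ξ) a0 k (J q) q.1 (S q) (by
    intro i hi u hu hk
    simp only [S, Finset.mem_product, Finset.mem_image]
    exact ⟨hi, u, mem_Lk.2 hk, rfl⟩)
  have := (block_indep h.ind (fun q => h.meas _ _) S hS).comp G hG
  refine this.congr fun q => ?_
  filter_upwards with ω
  exact (hG' q ω).symm

/-- independence of the first level and the rest -/
theorem XX_indep0 {ξ : Fin n → List (Fin M) → Ω → Fin A} (h : IsLab p P ξ) (a0 : Fin A) (k : ℕ)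
    (J : Fin M × Fin A → Finset (Fin n)) :
    IndepFun (fun ω (s : Fin M × Fin n) => ξ s.2 [s.1] ω)
      (fun ω (q : Fin M × Fin A) => XX k (J q) (fun i u => ξ i (q.1 :: u) ω)) P := by
  classical
  let S0 : Finset (Fin n × List (Fin M)) := Finset.univ ×ˢ (Finset.univ.image fun m : Fin M => [m])
  let S1 : Finset (Fin n × List (Fin M)) := Finset.univ ×ˢ ((Lk M (k + 1)).filter fun u => 2 ≤ u.length)
  have hd : Disjoint S0 S1 := by
    simp only [S0, S1, Finset.disjoint_product]
    right
    rw [Finset.disjoint_left]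
    rintro u hu hu'
    obtain ⟨v, _, rfl⟩ := Finset.mem_image.1 hu
    simp at hu'
  have ind := h.ind.indepFun_finset S0 S1 hd (fun q => h.meas _ _)
  choose G hG hG' using fun q : Fin M × Fin A => XX_factor (ξ := ξ) a0 k (J q) q.1 S1 (by
    intro i hi u hu hk
    have : 1 ≤ u.length := List.length_pos_iff.2 hu
    simp only [S1, Finset.mem_product, Finset.mem_filter, mem_Lk, List.length_cons, Finset.mem_univ, true_and]
    omega)
  have := ind.comp (φ := fun z (s : Fin M × Fin n) => z ⟨(s.2, [s.1]), by simp [S0]⟩)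
    (ψ := fun z q => G q z) (measurable_pi_lambda _ fun s => measurable_pi_apply _)
    (measurable_pi_lambda _ fun q => hG q)
  have e : (fun ω (q : Fin M × Fin A) => XX k (J q) (fun i u => ξ i (q.1 :: u) ω)) =
      (fun z q => G q z) ∘ fun ω (s : S1) => ξ s.1.1 s.1.2 ω := by
    funext ω q; exact hG' q ω
  rw [e]
  exact this

/-- probability of a given first level -/
theorem first_level {ξ : Fin n → List (Fin M) → Ω → Fin A} (h : IsLab p P ξ) (hp : IsW p)
    (J : Finset (Fin n)) (y : Fin M → J → Fin A) :
    P {ω | ∀ (m : Fin M) (i : J), ξ i [m] ω = y m i} = ENNReal.ofReal (pw (pw p) y) := by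
  have := h.ind.precomp (g := fun s : Fin M × J => ((s.2 : Fin n), [s.1])) (fun a b hab => by
    simp only [Prod.mk.injEq, List.cons.injEq, and_true] at hab
    exact Prod.ext hab.2 (Subtype.ext hab.1))
  have h2 := this.measure_inter_preimage_eq_mul Finset.univ (sets := fun s => {y s.1 s.2})
    (fun _ _ => measurableSet_singleton _)
  have e : {ω | ∀ (m : Fin M) (i : J), ξ i [m] ω = y m i} =
      ⋂ s ∈ (Finset.univ : Finset (Fin M × J)), (fun ω => ξ s.2 [s.1] ω) ⁻¹' {y s.1 s.2} := by
    ext ω; simp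
  rw [e, h2]
  simp only [pw]
  rw [ENNReal.ofReal_prod_of_nonneg fun m _ => Finset.prod_nonneg fun i _ => hp.1 _, Fintype.prod_prod_type]
  refine Finset.prod_congr rfl fun m _ => ?_
  rw [ENNReal.ofReal_prod_of_nonneg fun i _ => hp.1 _]
  exact Finset.prod_congr rfl fun i _ => h.law _ _ _

theorem isProb_step (hp : IsW p) (lam : ℕ → Measure ℝ) (hl : ∀ n, IsProbabilityMeasure (lam n)) (n : ℕ) :
    IsProbabilityMeasure (step M p lam n) := by
  constructor
  unfold step
  have hW : IsW (pw (pw p) : (Fin M → Fin n → Fin A) → ℝ) := isW_pw (isW_pw hp)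
  have h1 : ∀ x : Fin M → Fin n → Fin A, IsProbabilityMeasure
    (Measure.map (fun y : Fin M × Fin A → ℝ => bb x + ∑ q, y q)
      (Measure.pi fun q : Fin M × Fin A => lam (cnt (x q.1) q.2))) := fun x =>
    Measure.isProbabilityMeasure_map (by fun_prop)
  simp only [Measure.coe_finsetSum, Finset.sum_apply, Measure.smul_apply, smul_eq_mul,
    measure_univ, mul_one]
  rw [← ENNReal.ofReal_sum_of_nonneg fun x _ => hW.1 x, hW.2, ENNReal.ofReal_one]

theorem isProb_nuk (hp : IsW p) (k n : ℕ) : IsProbabilityMeasure (nuk M p k n) := by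
  induction k generalizing n with
  | zero => unfold nuk; infer_instance
  | succ k ih => exact isProb_step hp _ ih n

theorem XX_law (hp : IsW p) {ξ : Fin n → List (Fin M) → Ω → Fin A} (h : IsLab p P ξ) (a0 : Fin A) (k : ℕ)
    (J : Finset (Fin n)) :
    Measure.map (fun ω => XX k J (fun i u => ξ i u ω)) P = nuk M p k J.card := by
  classical
  have hP := h.ind.isProbabilityMeasure
  induction k generalizing ξ J with
  | zero =>
    simp only [XX, nuk, Measure.map_const, measure_univ, one_smul]
  | succ k ih =>
    have hX := XX_meas h (k + 1) J
    ext B hB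
    rw [Measure.map_apply hX hB]
    set X := fun ω => XX (k + 1) J (fun i u => ξ i u ω) with hXdef
    -- first level
    let T : Ω → (Fin M → J → Fin A) := fun ω m i => ξ i [m] ω
    have hT : Measurable T := measurable_pi_lambda _ fun m => measurable_pi_lambda _ fun i => h.meas _ _
    have h1 : P (X ⁻¹' B) = ∑ y : Fin M → J → Fin A, P (X ⁻¹' B ∩ T ⁻¹' {y}) := by
      have := sum_measure_preimage_singleton (μ := P.restrict (X ⁻¹' B)) Finset.univ (f := T)
        (fun y _ => hT (measurableSet_singleton y))
      simp only [Finset.coe_univ, Set.preimage_univ, Measure.restrict_apply_univ] at this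
      rw [← this]
      refine Finset.sum_congr rfl fun y _ => ?_
      rw [Measure.restrict_apply (hT (measurableSet_singleton y)), Set.inter_comm]
    let e : J ≃ Fin J.card := J.equivFin
    have h2 : ∀ y : Fin M → J → Fin A, P (X ⁻¹' B ∩ T ⁻¹' {y}) =
        (ENNReal.ofReal (pw (pw p) (fun m i => y m (e.symm i))) •
        Measure.map (fun z : Fin M × Fin A → ℝ => bb (fun m i => y m (e.symm i)) + ∑ q, z q)
      (Measure.pi fun q : Fin M × Fin A => nuk M p k (cnt (fun i => y q.1 (e.symm i)) q.2))) B := by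
      intro y
      let JJ : Fin M × Fin A → Finset (Fin n) := fun q =>
        (Finset.univ.filter fun i : J => y q.1 i = q.2).map (Function.Embedding.subtype _)
      have hcard : ∀ q, (JJ q).card = cnt (fun i => y q.1 (e.symm i)) q.2 := by
        intro q
        simp only [JJ, Finset.card_map, cnt]
        refine Finset.card_equiv e fun i => ?_
        simp
      have hJJ : ∀ ω, T ω = y → ∀ q : Fin M × Fin A, (J.filter fun i => ξ i [q.1] ω = q.2) = JJ q := by
        intro ω hω q
        ext i
        simp only [Finset.mem_filter, JJ, Finset.mem_map, Finset.mem_univ, true_and,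
          Function.Embedding.coe_subtype, Subtype.exists, exists_and_right, exists_eq_right]
        constructor
        · rintro ⟨hi, hq⟩; exact ⟨hi, by rw [← hω]; exact hq⟩
        · rintro ⟨hi, hq⟩; exact ⟨hi, by rw [← hω] at hq; exact hq⟩
      set Z := fun ω (q : Fin M × Fin A) => XX k (JJ q) (fun i u => ξ i (q.1 :: u) ω) with hZ
      have hZm : ∀ q, Measurable fun ω => Z ω q := fun q => XX_meas (isLab_shift h q.1) k (JJ q)
      have hZlaw : Measure.map Z P =
          Measure.pi fun q : Fin M × Fin A => nuk M p k (cnt (fun i => y q.1 (e.symm i)) q.2) := by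
        have := (XX_indep h a0 k JJ (by
          intro m a a' hne
          rw [Finset.disjoint_left]
          intro i hi hi'
          simp only [JJ, Finset.mem_map, Finset.mem_filter, Finset.mem_univ, true_and,
            Function.Embedding.coe_subtype, Subtype.exists, exists_and_right, exists_eq_right] at hi hi'
          obtain ⟨h1, h2⟩ := hi
          obtain ⟨h1', h2'⟩ := hi'
          exact hne (h2.symm.trans h2'))).map_fun_eq_pi_map (fun q => (hZm q).aemeasurable)
        rw [hZ, this]
        congr 1
        funext q
        rw [ih (isLab_shift h q.1) (JJ q), hcard]
      let c : ℝ := bb (fun m i => y m (e.symm i))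
      have hc : ∀ ω, T ω = y → X ω = c + ∑ q, Z ω q := by
        intro ω hω
        simp only [hXdef, XX, hJJ ω hω, hcard, c, bb, hZ]
      have hset : X ⁻¹' B ∩ T ⁻¹' {y} = T ⁻¹' {y} ∩ Z ⁻¹' ((fun z : Fin M × Fin A → ℝ => c + ∑ q, z q) ⁻¹' B) := by
        ext ω
        simp only [Set.mem_inter_iff, Set.mem_preimage, Set.mem_singleton_iff]
        constructor
        · rintro ⟨hx, hy⟩; exact ⟨hy, by rw [← hc ω hy]; exact hx⟩
        · rintro ⟨hy, hx⟩; exact ⟨by rw [hc ω hy]; exact hx, hy⟩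
      have hφ : Measurable (fun z : Fin M × Fin A → ℝ => c + ∑ q, z q) := by fun_prop
      have hind := (XX_indep0 h a0 k JJ).comp
        (φ := fun z (m : Fin M) (i : J) => z (m, (i : Fin n))) (ψ := id)
        (measurable_pi_lambda _ fun m => measurable_pi_lambda _ fun i => measurable_pi_apply _) measurable_id
      have hind2 : IndepFun T Z P := hind
      rw [hset, hind2.measure_inter_preimage_eq_mul _ _ (measurableSet_singleton y) (hφ hB)]
      rw [Measure.smul_apply, ← hZlaw, Measure.map_map hφ (measurable_pi_lambda _ hZm),
        Measure.map_apply (hφ.comp (measurable_pi_lambda _ hZm)) hB, smul_eq_mul]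
      congr 1
      have e1 : T ⁻¹' {y} = {ω | ∀ (m : Fin M) (i : J), ξ i [m] ω = y m i} := by
        ext ω; simp [T, funext_iff]
      rw [e1, first_level h hp J y]
      congr 1
      simp only [pw]
      refine Finset.prod_congr rfl fun m _ => ?_
      exact (Equiv.prod_comp e.symm (fun i => p (y m i))).symm
    rw [h1]
    simp only [h2, nuk, step, Measure.coe_finsetSum, Finset.sum_apply]
    exact Equiv.sum_comp (Equiv.arrowCongr (Equiv.refl (Fin M)) (Equiv.arrowCongr e (Equiv.refl (Fin A))))
      (fun x : Fin M → Fin J.card → Fin A => (ENNReal.ofReal (pw (pw p) x) •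
        Measure.map (fun z : Fin M × Fin A → ℝ => bb x + ∑ q, z q)
      (Measure.pi fun q : Fin M × Fin A => nuk M p k (cnt (x q.1) q.2))) B)

end
end GT

namespace GT

section
variable {M A n : ℕ}

theorem occurs_nil (L : List (Fin M) → Fin A) : Occurs L [] := fun t => t.elim0

theorem occurs_cons (L : List (Fin M) → Fin A) (q : Fin M × Fin A) (w : List (Fin M × Fin A)) :
    Occurs L (q :: w) ↔ L [q.1] = q.2 ∧ Occurs (fun u => L (q.1 :: u)) w := by
  unfold Occurs
  simp only [List.length_cons]
  rw [Fin.forall_fin_succ]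
  simp

open Classical in
/-- number of labelings in `J` in which the word occurs -/
noncomputable def cO (J : Finset (Fin n)) (L : Fin n → List (Fin M) → Fin A) (w : List (Fin M × Fin A)) : ℕ :=
  (J.filter fun i => Occurs (L i) w).card

theorem cO_nil (J : Finset (Fin n)) (L : Fin n → List (Fin M) → Fin A) : cO J L [] = J.card := by
  simp [cO, occurs_nil]

theorem cO_cons (J : Finset (Fin n)) (L : Fin n → List (Fin M) → Fin A) (q : Fin M × Fin A)
    (w : List (Fin M × Fin A)) : cO J L (q :: w) =
      cO (J.filter fun i => L i [q.1] = q.2) (fun i u => L i (q.1 :: u)) w := by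
  unfold cO
  rw [Finset.filter_filter]
  congr 1
  ext i
  simp only [Finset.mem_filter, occurs_cons]

/-- leaf words -/
def isLf (J : Finset (Fin n)) (L : Fin n → List (Fin M) → Fin A) (w : List (Fin M × Fin A)) : Prop :=
  2 ≤ cO J L w ∧ ∀ q, ¬ 2 ≤ cO J L (w ++ [q])

open Classical in
/-- leaf words of bounded length -/
noncomputable def FF : ℕ → Finset (Fin n) → (Fin n → List (Fin M) → Fin A) → Finset (List (Fin M × Fin A))
  | 0, _, _ => ∅
  | k + 1, J, L =>
    (if 2 ≤ J.card ∧ ∀ q : Fin M × Fin A, (J.filter fun i => L i [q.1] = q.2).card ≤ 1 then {[]} else ∅) ∪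
      Finset.univ.biUnion fun q : Fin M × Fin A =>
        (FF k (J.filter fun i => L i [q.1] = q.2) (fun i u => L i (q.1 :: u))).image (fun w => q :: w)

theorem mem_FF (k : ℕ) (J : Finset (Fin n)) (L : Fin n → List (Fin M) → Fin A) (w : List (Fin M × Fin A)) :
    w ∈ FF k J L ↔ w.length < k ∧ isLf J L w := by
  classical
  induction k generalizing J L w with
  | zero => simp [FF]
  | succ k ih =>
    simp only [FF, Finset.mem_union, Finset.mem_biUnion, Finset.mem_univ, true_and, Finset.mem_image, ih]
    cases w with
    | nil =>
      have h1 : ∀ q, cO J L [q] = (J.filter fun i => L i [q.1] = q.2).card := fun q => by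
        rw [cO_cons, cO_nil]
      simp only [isLf, cO_nil, List.nil_append, h1, List.length_nil]
      split_ifs with hc
      · simp; exact ⟨hc.1, fun a b => hc.2 (a, b)⟩
      · simp; intro h2; by_contra h3; push Not at h3
        exact hc ⟨h2, fun q => h3 q.1 q.2⟩
    | cons q w =>
      have h1 : isLf J L (q :: w) ↔
          isLf (J.filter fun i => L i [q.1] = q.2) (fun i u => L i (q.1 :: u)) w := by
        simp only [isLf, List.cons_append, cO_cons]
      rw [h1]
      constructor
      · rintro (h | ⟨q', w', h, he⟩)
        · split_ifs at h <;> simp at h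
        · simp only [List.cons.injEq] at he
          obtain ⟨rfl, rfl⟩ := he
          exact ⟨by simpa using h.1, h.2⟩
      · rintro ⟨h, h'⟩
        exact Or.inr ⟨q, w, ⟨by simpa using h, h'⟩, rfl⟩

theorem card_FF (k : ℕ) (J : Finset (Fin n)) (L : Fin n → List (Fin M) → Fin A) :
    ((FF k J L).card : ℝ) = XX k J L := by
  classical
  induction k generalizing J L with
  | zero => simp [FF, XX]
  | succ k ih =>
    simp only [FF, XX]
    rw [Finset.card_union_of_disjoint, Finset.card_biUnion]
    · push_cast
      congr 1
      · split_ifs <;> simp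
      · refine Finset.sum_congr rfl fun q _ => ?_
        rw [Finset.card_image_of_injective _ (List.cons_injective), ih]
    · intro q _ q' _ hne
      change Disjoint _ _
      rw [Finset.disjoint_left]
      intro w hw hw'
      obtain ⟨v, _, rfl⟩ := Finset.mem_image.1 hw
      obtain ⟨v', _, h'⟩ := Finset.mem_image.1 hw'
      simp only [List.cons.injEq] at h'
      exact hne h'.1.symm
    · rw [Finset.disjoint_left]
      intro w hw hw'
      simp only [Finset.mem_biUnion, Finset.mem_image] at hw'
      obtain ⟨q, _, v, _, rfl⟩ := hw'
      split_ifs at hw <;> simp at hw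

theorem leafCount_eq (L : Fin n → List (Fin M) → Fin A) :
    leafCount L = ({w | isLf Finset.univ L w}.ncard : ℝ) := by
  classical
  have h : ∀ w, occCount L w = cO Finset.univ L w := fun w => by
    unfold occCount cO; rw [Nat.card_eq_fintype_card, Fintype.card_subtype]
  unfold leafCount isLf
  congr 2
  ext w
  simp only [GTrie, Set.mem_ofPred_eq, h, Prod.forall]

theorem XX_nonneg (k : ℕ) (J : Finset (Fin n)) (L : Fin n → List (Fin M) → Fin A) : 0 ≤ XX k J L := by
  rw [← card_FF]; positivity

theorem XX_mono (J : Finset (Fin n)) (L : Fin n → List (Fin M) → Fin A) : Monotone fun k => XX k J L := by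
  intro k k' hk
  simp only [← card_FF, Nat.cast_le]
  refine Finset.card_le_card fun w hw => ?_
  rw [mem_FF] at hw ⊢
  exact ⟨hw.1.trans_le hk, hw.2⟩

/-- if the truncated counts are bounded they are eventually equal to the leaf count -/
theorem XX_eventually (L : Fin n → List (Fin M) → Fin A) (C : ℝ) (hC : ∀ k, XX k Finset.univ L ≤ C) :
    ∀ᶠ k in atTop, XX k Finset.univ L = leafCount L := by
  have hfin : {w | isLf Finset.univ L w}.Finite := by
    by_contra hinf
    obtain ⟨N, hN⟩ := exists_nat_gt C
    obtain ⟨t, ht, hc⟩ := Set.Infinite.exists_subset_card_eq hinf N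
    obtain ⟨k, hk⟩ : ∃ k, ∀ w ∈ t, w.length < k :=
      ⟨t.sup List.length + 1, fun w hw => Nat.lt_succ_of_le (Finset.le_sup (f := List.length) hw)⟩
    have h1 : t ⊆ FF k Finset.univ L := fun w hw => (mem_FF _ _ _ _).2 ⟨hk w hw, ht hw⟩
    have h2 := Finset.card_le_card h1
    have h3 := hC k
    rw [← card_FF] at h3
    have : (N : ℝ) ≤ (FF k Finset.univ L).card := by exact_mod_cast hc ▸ h2
    linarith
  obtain ⟨k0, hk0⟩ : ∃ k, ∀ w ∈ hfin.toFinset, w.length < k :=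
    ⟨hfin.toFinset.sup List.length + 1, fun w hw => Nat.lt_succ_of_le (Finset.le_sup (f := List.length) hw)⟩
  filter_upwards [eventually_ge_atTop k0] with k hk
  rw [leafCount_eq, ← card_FF, Set.ncard_eq_toFinset_card _ hfin]
  congr 2
  ext w
  rw [mem_FF, Set.Finite.mem_toFinset, Set.mem_ofPred_eq]
  constructor
  · exact fun h => h.2
  · exact fun h => ⟨(hk0 w ((Set.Finite.mem_toFinset hfin).2 h)).trans_le hk, h⟩

end
end GT

namespace GT

section
variable {Ω : Type*} [MeasurableSpace Ω] {P : Measure Ω} [IsProbabilityMeasure P]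

theorem int_pow {X : Ω → ℝ} (h : MemLp X 4 P) (k : ℕ) (hk : k ≤ 4) : Integrable (fun ω => X ω ^ k) P := by
  have h1 : MemLp X (k : ENNReal) P := h.mono_exponent (by
    have : (k : ENNReal) ≤ ((4 : ℕ) : ENNReal) := by exact_mod_cast hk
    simpa using this)
  rcases Nat.eq_zero_or_pos k with rfl | hk0
  · simp
  have h2 := h1.integrable_norm_pow hk0.ne'
  refine h2.mono' ((h.aestronglyMeasurable.aemeasurable.pow_const k).aestronglyMeasurable) ?_
  filter_upwards with ω
  simp

theorem memLp_of_pow {X : Ω → ℝ} (hm : Measurable X) (h : Integrable (fun ω => X ω ^ 4) P) : MemLp X 4 P := by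
  have := (MeasureTheory.integrable_norm_rpow_iff (f := X) (μ := P) (p := 4) hm.aestronglyMeasurable (by norm_num) (by norm_num)).1 (by
    refine h.congr ?_
    filter_upwards with ω
    simp only [Real.norm_eq_abs]
    rw [show (ENNReal.toReal 4) = ((4 : ℕ) : ℝ) by norm_num, Real.rpow_natCast, Even.pow_abs (by decide)])
  exact this

theorem indep_sum {ι : Type*} [DecidableEq ι] {Y : ι → Ω → ℝ} (hm : ∀ i, Measurable (Y i)) (hi : iIndepFun Y P)
    (h4 : ∀ i, MemLp (Y i) 4 P) (h0 : ∀ i, ∫ ω, Y i ω ∂P = 0) (s : Finset ι) :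
    ∫ ω, (∑ i ∈ s, Y i ω) ∂P = 0 ∧
    ∫ ω, (∑ i ∈ s, Y i ω) ^ 2 ∂P = ∑ i ∈ s, ∫ ω, Y i ω ^ 2 ∂P ∧
    ∫ ω, (∑ i ∈ s, Y i ω) ^ 4 ∂P ≤ ∑ i ∈ s, ∫ ω, Y i ω ^ 4 ∂P + 3 * (∑ i ∈ s, ∫ ω, Y i ω ^ 2 ∂P) ^ 2 := by
  induction s using Finset.induction_on with
  | empty => simp
  | insert j s hj ih =>
    obtain ⟨i1, i2, i4⟩ := ih
    have hind : IndepFun (fun ω => ∑ i ∈ s, Y i ω) (Y j) P := by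
      have := hi.indepFun_finsetSum_of_notMem hm hj
      convert this using 1
      funext ω; simp
    have hS4 : MemLp (fun ω => ∑ i ∈ s, Y i ω) 4 P := memLp_finsetSum _ fun i _ => h4 i
    have hSm : Measurable (fun ω => ∑ i ∈ s, Y i ω) := Finset.measurable_sum _ fun i _ => hm i
    set S : Ω → ℝ := fun ω => ∑ i ∈ s, Y i ω with hS
    have hprod : ∀ a b : ℕ, IndepFun (fun ω => S ω ^ a) (fun ω => Y j ω ^ b) P := fun a b =>
      hind.comp (φ := fun x : ℝ => x ^ a) (ψ := fun x : ℝ => x ^ b) (by fun_prop) (by fun_prop)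
    have hintgr : ∀ a b : ℕ, a ≤ 4 → b ≤ 4 → Integrable (fun ω => S ω ^ a * Y j ω ^ b) P := fun a b ha hb =>
      (hprod a b).integrable_mul (int_pow hS4 a ha) (int_pow (h4 j) b hb)
    have hval : ∀ a b : ℕ, a ≤ 4 → b ≤ 4 → ∫ ω, S ω ^ a * Y j ω ^ b ∂P = (∫ ω, S ω ^ a ∂P) * ∫ ω, Y j ω ^ b ∂P :=
      fun a b ha hb => (hprod a b).integral_mul_eq_mul_integral
        (int_pow hS4 a ha).aestronglyMeasurable (int_pow (h4 j) b hb).aestronglyMeasurable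
    have e1 : ∀ ω, ∑ i ∈ insert j s, Y i ω = Y j ω + S ω := fun ω => Finset.sum_insert hj
    simp only [e1, Finset.sum_insert hj]
    have hY1 : Integrable (Y j) P := by simpa using int_pow (h4 j) 1 (by norm_num)
    have hS1 : Integrable S P := by simpa using int_pow hS4 1 (by norm_num)
    refine ⟨?_, ?_, ?_⟩
    · rw [integral_add hY1 hS1, h0, i1, add_zero]
    · have : ∀ ω, (Y j ω + S ω) ^ 2 = Y j ω ^ 2 + 2 * (S ω ^ 1 * Y j ω ^ 1) + S ω ^ 2 := fun ω => by ring
      simp only [this]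
      have s1 : Integrable (fun ω => Y j ω ^ 2 + 2 * (S ω ^ 1 * Y j ω ^ 1)) P :=
        (int_pow (h4 j) 2 (by norm_num)).add ((hintgr 1 1 (by norm_num) (by norm_num)).const_mul 2)
      rw [integral_add s1
        (int_pow hS4 2 (by norm_num)), integral_add (int_pow (h4 j) 2 (by norm_num))
        ((hintgr 1 1 (by norm_num) (by norm_num)).const_mul 2), integral_const_mul, hval 1 1 (by norm_num) (by norm_num), i2]
      simp [h0]
    · have : ∀ ω, (Y j ω + S ω) ^ 4 = Y j ω ^ 4 + (4 * (S ω ^ 1 * Y j ω ^ 3) + (6 * (S ω ^ 2 * Y j ω ^ 2) +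
          (4 * (S ω ^ 3 * Y j ω ^ 1) + S ω ^ 4))) := fun ω => by ring
      simp only [this]
      have t1 := (hintgr 1 3 (by norm_num) (by norm_num)).const_mul 4
      have t2 := (hintgr 2 2 (by norm_num) (by norm_num)).const_mul 6
      have t3 := (hintgr 3 1 (by norm_num) (by norm_num)).const_mul 4
      have t4 := int_pow hS4 4 le_rfl
      have s3 : Integrable (fun ω => 4 * (S ω ^ 3 * Y j ω ^ 1) + S ω ^ 4) P := t3.add t4
      have s2 : Integrable (fun ω => 6 * (S ω ^ 2 * Y j ω ^ 2) + (4 * (S ω ^ 3 * Y j ω ^ 1) + S ω ^ 4)) P := t2.add s3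
      have s1 : Integrable (fun ω => 4 * (S ω ^ 1 * Y j ω ^ 3) + (6 * (S ω ^ 2 * Y j ω ^ 2) +
          (4 * (S ω ^ 3 * Y j ω ^ 1) + S ω ^ 4))) P := t1.add s2
      rw [integral_add (int_pow (h4 j) 4 le_rfl) s1, integral_add t1 s2, integral_add t2 s3, integral_add t3 t4]
      simp only [integral_const_mul]
      rw [hval 1 3 (by norm_num) (by norm_num), hval 2 2 (by norm_num) (by norm_num), hval 3 1 (by norm_num) (by norm_num), i2]
      simp only [pow_one, h0, i1]
      nlinarith [sq_nonneg (∫ ω, Y j ω ^ 2 ∂P)]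

end

/-- mean -/
noncomputable def mE (l : Measure ℝ) : ℝ := ∫ x, x ∂l
/-- variance -/
noncomputable def mV (l : Measure ℝ) : ℝ := ∫ x, (x - mE l) ^ 2 ∂l
/-- fourth central moment -/
noncomputable def mK (l : Measure ℝ) : ℝ := ∫ x, (x - mE l) ^ 4 ∂l

/-- probability measure with a fourth moment -/
structure Gd (l : Measure ℝ) : Prop where
  prob : IsProbabilityMeasure l
  mem : MemLp (fun x : ℝ => x) 4 l

theorem mV_nonneg (l : Measure ℝ) : 0 ≤ mV l := integral_nonneg fun x => sq_nonneg _
theorem mK_nonneg (l : Measure ℝ) : 0 ≤ mK l := integral_nonneg fun x => by positivity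

theorem Gd.cent {l : Measure ℝ} (h : Gd l) (c : ℝ) : MemLp (fun x : ℝ => x - c) 4 l := by
  have := h.prob
  exact h.mem.sub (memLp_const c)

theorem pow4_le (η : ℝ) (hη : 0 < η) : ∃ C : ℝ, 0 ≤ C ∧ ∀ a b : ℝ, (a + b) ^ 4 ≤ (1 + η) * a ^ 4 + C * b ^ 4 := by
  -- if |b| ≤ t|a| then (1+t)^4 a^4, else (1+1/t)^4 b^4
  obtain ⟨t, ht0, ht⟩ : ∃ t : ℝ, 0 < t ∧ (1 + t) ^ 4 ≤ 1 + η := by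
    have : Tendsto (fun t : ℝ => (1 + t) ^ 4) (𝓝[>] 0) (𝓝 ((1 + 0) ^ 4)) := by
      refine Tendsto.mono_left ?_ nhdsWithin_le_nhds
      exact Continuous.tendsto (by fun_prop) 0
    have h1 := this.eventually_le_const (u := 1 + η) (by norm_num; exact hη)
    obtain ⟨t, h, h'⟩ := (h1.and self_mem_nhdsWithin).exists
    exact ⟨t, h', h⟩
  refine ⟨(1 + 1 / t) ^ 4, by positivity, fun a b => ?_⟩
  have hab : (a + b) ^ 4 ≤ (|a| + |b|) ^ 4 := by
    rw [← Even.pow_abs (by decide : Even 4) (a + b)]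
    exact pow_le_pow_left₀ (abs_nonneg _) (abs_add_le a b) 4
  rcases le_total |b| (t * |a|) with h | h
  · have : (|a| + |b|) ^ 4 ≤ ((1 + t) * |a|) ^ 4 := pow_le_pow_left₀ (by positivity) (by linarith) 4
    rw [mul_pow, Even.pow_abs (by decide : Even 4)] at this
    have h3 : (1 + t) ^ 4 * a ^ 4 ≤ (1 + η) * a ^ 4 := mul_le_mul_of_nonneg_right ht (by positivity)
    have h4 : 0 ≤ (1 + 1 / t) ^ 4 * b ^ 4 := by positivity
    linarith
  · have h2 : |a| ≤ 1 / t * |b| := by rw [div_mul_eq_mul_div, le_div_iff₀ ht0]; linarith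
    have : (|a| + |b|) ^ 4 ≤ ((1 + 1 / t) * |b|) ^ 4 := pow_le_pow_left₀ (by positivity) (by linarith) 4
    rw [mul_pow, Even.pow_abs (by decide : Even 4)] at this
    have h4 : 0 ≤ (1 + η) * a ^ 4 := by positivity
    linarith

end GT

namespace GT

section
variable {ι : Type*} [Fintype ι] {m : ι → Measure ℝ}

theorem pi_memLp (hm : ∀ q, Gd (m q)) (b : ℝ) : MemLp (fun y : ι → ℝ => b + ∑ q, y q) 4 (Measure.pi m) := by
  have := fun q => (hm q).prob
  refine (memLp_const b).add (memLp_finsetSum _ fun q _ => ?_)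
  exact (hm q).mem.comp_measurePreserving (measurePreserving_eval m q)

theorem pi_eval (hm : ∀ q, Gd (m q)) (q : ι) (f : ℝ → ℝ) (hf : Measurable f) :
    ∫ y : ι → ℝ, f (y q) ∂(Measure.pi m) = ∫ z, f z ∂(m q) := by
  have := fun q => (hm q).prob
  rw [← (measurePreserving_eval m q).map_eq, integral_map (measurable_pi_apply q).aemeasurable hf.aestronglyMeasurable]

theorem pi_moments [DecidableEq ι] (hm : ∀ q, Gd (m q)) :
    ∫ y : ι → ℝ, (∑ q, (y q - mE (m q))) ∂(Measure.pi m) = 0 ∧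
    ∫ y : ι → ℝ, (∑ q, (y q - mE (m q))) ^ 2 ∂(Measure.pi m) = ∑ q, mV (m q) ∧
    ∫ y : ι → ℝ, (∑ q, (y q - mE (m q))) ^ 4 ∂(Measure.pi m) ≤ ∑ q, mK (m q) + 3 * (∑ q, mV (m q)) ^ 2 := by
  have hP := fun q => (hm q).prob
  have hi : iIndepFun (fun q (y : ι → ℝ) => y q - mE (m q)) (Measure.pi m) :=
    iIndepFun_pi (X := fun q (z : ℝ) => z - mE (m q)) fun q => by fun_prop
  have key := indep_sum (P := Measure.pi m) (Y := fun q (y : ι → ℝ) => y q - mE (m q)) (fun q => by fun_prop) hi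
    (fun q => ((hm q).cent _).comp_measurePreserving (measurePreserving_eval m q))
    (fun q => by
      rw [pi_eval hm q (fun z => z - mE (m q)) (by fun_prop), integral_sub, integral_const]
      · simp [mE]
      · simpa using int_pow (hm q).mem 1 (by norm_num)
      · exact integrable_const _) Finset.univ
  have e2 : ∀ q, ∫ y : ι → ℝ, (y q - mE (m q)) ^ 2 ∂(Measure.pi m) = mV (m q) := fun q =>
    pi_eval hm q (fun z => (z - mE (m q)) ^ 2) (by fun_prop)
  have e4 : ∀ q, ∫ y : ι → ℝ, (y q - mE (m q)) ^ 4 ∂(Measure.pi m) = mK (m q) := fun q =>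
    pi_eval hm q (fun z => (z - mE (m q)) ^ 4) (by fun_prop)
  simp only [e2, e4] at key
  exact key

theorem pi_mean [DecidableEq ι] (hm : ∀ q, Gd (m q)) (b : ℝ) :
    ∫ y : ι → ℝ, (b + ∑ q, y q) ∂(Measure.pi m) = b + ∑ q, mE (m q) := by
  have hP := fun q => (hm q).prob
  have h1 := (pi_moments hm).1
  have e : ∀ y : ι → ℝ, b + ∑ q, y q = (b + ∑ q, mE (m q)) + ∑ q, (y q - mE (m q)) := fun y => by
    rw [Finset.sum_sub_distrib]; ring
  rw [integral_congr_ae (Eventually.of_forall e), integral_add (integrable_const _), h1]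
  · simp
  · refine integrable_finsetSum _ fun q _ => ?_
    have := ((hm q).cent (mE (m q))).comp_measurePreserving (measurePreserving_eval m q)
    simpa using int_pow this 1 (by norm_num)

theorem pi_Smem (hm : ∀ q, Gd (m q)) : MemLp (fun y : ι → ℝ => ∑ q, (y q - mE (m q))) 4 (Measure.pi m) := by
  have hP := fun q => (hm q).prob
  exact memLp_finsetSum _ fun q _ => ((hm q).cent (mE (m q))).comp_measurePreserving (measurePreserving_eval m q)

theorem pi_var [DecidableEq ι] (hm : ∀ q, Gd (m q)) (b E : ℝ) :
    ∫ y : ι → ℝ, (b + ∑ q, y q - E) ^ 2 ∂(Measure.pi m) = ∑ q, mV (m q) + (b + ∑ q, mE (m q) - E) ^ 2 := by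
  have hP := fun q => (hm q).prob
  obtain ⟨h1, h2, -⟩ := pi_moments hm
  set δ := b + ∑ q, mE (m q) - E with hδ
  have e : ∀ y : ι → ℝ, (b + ∑ q, y q - E) ^ 2 = (∑ q, (y q - mE (m q))) ^ 2 + (2 * δ * ∑ q, (y q - mE (m q)) + δ ^ 2) := fun y => by
    rw [Finset.sum_sub_distrib, hδ]; ring
  simp only [e]
  have i1 : Integrable (fun y : ι → ℝ => ∑ q, (y q - mE (m q))) (Measure.pi m) := by
    simpa using int_pow (pi_Smem hm) 1 (by norm_num)
  have i2 : Integrable (fun y : ι → ℝ => 2 * δ * ∑ q, (y q - mE (m q)) + δ ^ 2) (Measure.pi m) :=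
    (i1.const_mul _).add (integrable_const _)
  rw [integral_add (int_pow (pi_Smem hm) 2 (by norm_num)) i2, integral_add (i1.const_mul _) (integrable_const _),
    integral_const_mul, h1, h2]
  simp

theorem pi_four [DecidableEq ι] (hm : ∀ q, Gd (m q)) (b E η C : ℝ) (hη : 0 < η)
    (hC : ∀ a b : ℝ, (a + b) ^ 4 ≤ (1 + η) * a ^ 4 + C * b ^ 4) :
    ∫ y : ι → ℝ, (b + ∑ q, y q - E) ^ 4 ∂(Measure.pi m) ≤
      (1 + η) * (∑ q, mK (m q) + 3 * (∑ q, mV (m q)) ^ 2) + C * (b + ∑ q, mE (m q) - E) ^ 4 := by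
  have hP := fun q => (hm q).prob
  obtain ⟨-, -, h4⟩ := pi_moments hm
  set δ := b + ∑ q, mE (m q) - E with hδ
  have e : ∀ y : ι → ℝ, (b + ∑ q, y q - E) ^ 4 ≤ (1 + η) * (∑ q, (y q - mE (m q))) ^ 4 + C * δ ^ 4 := fun y => by
    refine le_trans (le_of_eq ?_) (hC _ _)
    rw [Finset.sum_sub_distrib, hδ]; ring
  have i4 := int_pow (pi_Smem hm) 4 le_rfl
  refine (integral_mono_of_nonneg (Eventually.of_forall fun y => by positivity)
    ((i4.const_mul (1 + η)).add (integrable_const (C * δ ^ 4))) (Eventually.of_forall e)).trans ?_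
  have i5 : Integrable (fun y : ι → ℝ => (1 + η) * (∑ q, (y q - mE (m q))) ^ 4) (Measure.pi m) := i4.const_mul (1 + η)
  have := integral_add i5 (integrable_const (μ := Measure.pi m) (C * δ ^ 4))
  rw [integral_const_mul] at this
  have h5 : ∫ (x : ι → ℝ), C * δ ^ 4 ∂(Measure.pi m) = C * δ ^ 4 := by simp
  rw [h5] at this
  refine (le_of_eq this).trans ?_
  have := mul_le_mul_of_nonneg_left h4 (by linarith : 0 ≤ 1 + η)
  linarith

theorem pi_char (hm : ∀ q, IsProbabilityMeasure (m q)) (b θ : ℝ) :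
    ∫ y : ι → ℝ, Complex.exp (θ * (b + ∑ q, y q : ℝ) * Complex.I) ∂(Measure.pi m) =
      Complex.exp (θ * b * Complex.I) * ∏ q, charFun (m q) θ := by
  have e : ∀ y : ι → ℝ, Complex.exp (θ * (b + ∑ q, y q : ℝ) * Complex.I) =
      Complex.exp (θ * b * Complex.I) * ∏ q, Complex.exp (θ * y q * Complex.I) := fun y => by
    rw [← Complex.exp_sum, ← Complex.exp_add]
    congr 1
    push_cast
    rw [mul_add, add_mul, Finset.mul_sum, Finset.sum_mul]
  simp only [e, charFun_apply_real]
  rw [integral_const_mul]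
  congr 1
  exact integral_fintype_prod_eq_prod (fun (q : ι) (z : ℝ) => Complex.exp (θ * z * Complex.I))

end

section
variable {M A : ℕ} {p : Fin A → ℝ}

theorem step_integral {V : Type*} [NormedAddCommGroup V] [NormedSpace ℝ V] (hp : IsW p)
    (lam : ℕ → Measure ℝ) (hl : ∀ n, IsProbabilityMeasure (lam n)) (n : ℕ) (F : ℝ → V) (hF : StronglyMeasurable F)
    (hi : ∀ x : Fin M → Fin n → Fin A, Integrable (fun y : Fin M × Fin A → ℝ => F (bb x + ∑ q, y q))
      (Measure.pi fun q : Fin M × Fin A => lam (cnt (x q.1) q.2))) :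
    Integrable F (step M p lam n) ∧ ∫ z, F z ∂(step M p lam n) = Ex (pw (pw p)) fun x : Fin M → Fin n → Fin A =>
      ∫ y : Fin M × Fin A → ℝ, F (bb x + ∑ q, y q) ∂(Measure.pi fun q : Fin M × Fin A => lam (cnt (x q.1) q.2)) := by
  have hw : IsW (pw (pw p) : (Fin M → Fin n → Fin A) → ℝ) := isW_pw (isW_pw hp)
  have hmeas : ∀ x : Fin M → Fin n → Fin A, Measurable (fun y : Fin M × Fin A → ℝ => bb x + ∑ q, y q) :=
    fun x => by fun_prop
  have hintgr : ∀ x : Fin M → Fin n → Fin A, Integrable F (ENNReal.ofReal (pw (pw p) x) •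
    Measure.map (fun y : Fin M × Fin A → ℝ => bb x + ∑ q, y q)
      (Measure.pi fun q : Fin M × Fin A => lam (cnt (x q.1) q.2))) := fun x =>
    Integrable.smul_measure ((integrable_map_measure hF.aestronglyMeasurable (hmeas x).aemeasurable).2 (hi x)) (by simp)
  unfold step
  refine ⟨(integrable_finsetSum_measure).2 fun x _ => hintgr x, ?_⟩
  rw [integral_finsetSum_measure fun x _ => hintgr x]
  unfold Ex
  refine Finset.sum_congr rfl fun x _ => ?_
  rw [integral_smul_measure, integral_map (hmeas x).aemeasurable hF.aestronglyMeasurable,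
    ENNReal.toReal_ofReal (hw.1 x)]

theorem step_gd (hp : IsW p) (lam : ℕ → Measure ℝ) (hl : ∀ n, Gd (lam n)) (n : ℕ) : Gd (step M p lam n) := by
  have hP := isProb_step (M := M) hp lam (fun n => (hl n).prob) n
  refine ⟨hP, memLp_of_pow measurable_id ?_⟩
  refine (step_integral hp lam (fun n => (hl n).prob) n (fun z => z ^ 4) (by fun_prop) fun x => ?_).1
  have : ∀ n, IsProbabilityMeasure (lam n) := fun n => (hl n).prob
  exact int_pow (pi_memLp (fun q => hl _) (bb x)) 4 le_rfl

/-- the conditional mean -/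
noncomputable def cm (e : ℕ → ℝ) {n : ℕ} (x : Fin M → Fin n → Fin A) : ℝ :=
  bb x + ∑ q : Fin M × Fin A, e (cnt (x q.1) q.2)

theorem step_mean (hp : IsW p) (lam : ℕ → Measure ℝ) (hl : ∀ n, Gd (lam n)) (n : ℕ) :
    mE (step M p lam n) = Ex (pw (pw p)) (fun x : Fin M → Fin n → Fin A => cm (fun n => mE (lam n)) x) := by
  have : ∀ n, IsProbabilityMeasure (lam n) := fun n => (hl n).prob
  unfold mE
  rw [(step_integral hp lam this n (fun z => z) (by fun_prop) fun x => ?_).2]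
  · congr 1
    funext x
    rw [pi_mean (fun q => hl _)]; rfl
  · simpa using int_pow (pi_memLp (fun q => hl _) (bb x)) 1 (by norm_num)

theorem step_var (hp : IsW p) (lam : ℕ → Measure ℝ) (hl : ∀ n, Gd (lam n)) (n : ℕ) :
    mV (step M p lam n) = Ex (pw (pw p)) (fun x : Fin M → Fin n → Fin A =>
        ∑ q : Fin M × Fin A, mV (lam (cnt (x q.1) q.2))) +
      Vr (pw (pw p)) (fun x : Fin M → Fin n → Fin A => cm (fun n => mE (lam n)) x) := by
  have : ∀ n, IsProbabilityMeasure (lam n) := fun n => (hl n).prob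
  rw [Vr, ← Ex_add, mV, step_mean hp lam hl n]
  rw [(step_integral hp lam this n (fun z => (z - Ex (pw (pw p)) (fun x : Fin M → Fin n → Fin A =>
    cm (fun n => mE (lam n)) x)) ^ 2) (by fun_prop) fun x => ?_).2]
  · congr 1
    funext x
    rw [pi_var (fun q => hl _)]; rfl
  · exact int_pow ((pi_memLp (fun q => hl _) (bb x)).sub (memLp_const _)) 2 (by norm_num)

theorem step_four (hp : IsW p) (lam : ℕ → Measure ℝ) (hl : ∀ n, Gd (lam n)) (n : ℕ) (η C : ℝ) (hη : 0 < η)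
    (hC : ∀ a b : ℝ, (a + b) ^ 4 ≤ (1 + η) * a ^ 4 + C * b ^ 4) :
    mK (step M p lam n) ≤ Ex (pw (pw p)) (fun x : Fin M → Fin n → Fin A =>
        (1 + η) * (∑ q : Fin M × Fin A, mK (lam (cnt (x q.1) q.2)) +
          3 * (∑ q : Fin M × Fin A, mV (lam (cnt (x q.1) q.2))) ^ 2) +
        C * (cm (fun n => mE (lam n)) x - mE (step M p lam n)) ^ 4) := by
  have : ∀ n, IsProbabilityMeasure (lam n) := fun n => (hl n).prob
  have hw : IsW (pw (pw p) : (Fin M → Fin n → Fin A) → ℝ) := isW_pw (isW_pw hp)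
  set E := mE (step M p lam n) with hE
  rw [mK, ← hE]
  rw [(step_integral hp lam this n (fun z => (z - E) ^ 4) (by fun_prop) fun x => ?_).2]
  · exact Ex_mono hw _ _ fun x => pi_four (fun q => hl _) _ _ _ _ hη hC
  · exact int_pow ((pi_memLp (fun q => hl _) (bb x)).sub (memLp_const _)) 4 le_rfl

theorem step_char (hp : IsW p) (lam : ℕ → Measure ℝ) (hl : ∀ n, IsProbabilityMeasure (lam n)) (n : ℕ) (θ : ℝ) :
    charFun (step M p lam n) θ = Ex (pw (pw p)) (fun x : Fin M → Fin n → Fin A =>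
      Complex.exp (θ * bb x * Complex.I) * ∏ q : Fin M × Fin A, charFun (lam (cnt (x q.1) q.2)) θ) := by
  rw [charFun_apply_real, (step_integral hp lam hl n (fun z : ℝ => Complex.exp (θ * z * Complex.I)) (by fun_prop) fun x => ?_).2]
  · congr 1
    funext x
    exact pi_char (fun q => hl _) _ _
  · refine Integrable.mono' (integrable_const 1) (by fun_prop) (Eventually.of_forall fun y => ?_)
    rw [← Complex.ofReal_mul, Complex.norm_exp_ofReal_mul_I]

theorem Ex_cnts (hp : IsW p) (n : ℕ) (f : ℕ → ℝ) :
    Ex (pw (pw p)) (fun x : Fin M → Fin n → Fin A => ∑ q : Fin M × Fin A, f (cnt (x q.1) q.2)) =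
      TT (fun _ => (M : ℝ)) p n f := by
  rw [Ex_sum, Fintype.sum_prod_type]
  have : ∀ m a, Ex (pw (pw p)) (fun x : Fin M → Fin n → Fin A => f (cnt (x (m, a).1) (m, a).2)) = Bn (p a) n f := by
    intro m a
    rw [← Ex_cnt hp a n f]
    exact Ex_pw_one (isW_pw hp) m (fun y : Fin n → Fin A => f (cnt y a))
  simp only [this, TT]
  simp [Finset.mul_sum]

end
end GT

namespace GT

theorem supk {ι : Type*} [Fintype ι] {c p : ι → ℝ} (hc : ∀ i, 0 ≤ c i) (hp : ∀ i, 0 < p i ∧ p i < 1)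
    (hs : ∀ n, 2 ≤ n → ∑ i, c i * p i ^ n < 1) (a : ℕ → ℕ → ℝ) (h0 : ∀ n, a 0 n ≤ 0)
    (h1 : ∀ k n, n < 2 → a k n ≤ 0)
    (h : ∀ n, ∃ D, ∀ k, a (k + 1) n ≤ TT c p n (a k) + D) : ∀ n, ∃ B, ∀ k m, m ≤ n → a k m ≤ B := by
  intro n
  induction n with
  | zero => exact ⟨0, fun k m hm => h1 k m (by omega)⟩
  | succ n ih =>
    obtain ⟨B0, hB0⟩ := ih
    rcases lt_or_ge (n + 1) 2 with hn | hn
    · exact ⟨0, fun k m hm => h1 k m (by omega)⟩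
    obtain ⟨D, hD⟩ := h (n + 1)
    set B' := max B0 0
    have hB'0 : 0 ≤ B' := le_max_right _ _
    set σ := ∑ i, c i * p i ^ (n + 1) with hσ
    have hσ1 : σ < 1 := hs _ hn
    set Y := ((∑ i, c i) * B' + |D|) / (1 - σ) with hY
    have hcs : 0 ≤ ∑ i, c i := Finset.sum_nonneg fun i _ => hc i
    have hY0 : 0 ≤ Y := div_nonneg (by positivity) (by linarith)
    have hYe : Y * (1 - σ) = (∑ i, c i) * B' + |D| := div_mul_cancel₀ _ (by linarith)
    have key : ∀ k, a k (n + 1) ≤ B' + Y := by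
      intro k
      induction k with
      | zero => exact (h0 _).trans (by positivity)
      | succ k ihk =>
        refine (hD k).trans ?_
        have h2 : TT c p (n + 1) (a k) ≤ (∑ i, c i) * B' + Y * σ := by
          unfold TT
          rw [hσ, Finset.sum_mul, Finset.mul_sum, ← Finset.sum_add_distrib]
          refine Finset.sum_le_sum fun i _ => ?_
          have h3 := Bn_self (hp i).1.le (hp i).2.le (n + 1) (a k) (fun _ => B')
            (fun m hm => (hB0 k m (by omega)).trans (le_max_left _ _))
          rw [Bn_const] at h3
          have h4 : p i ^ (n + 1) * (a k (n + 1) - B') ≤ p i ^ (n + 1) * Y :=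
            mul_le_mul_of_nonneg_left (by linarith) (pow_nonneg (hp i).1.le _)
          have := mul_le_mul_of_nonneg_left (h3.trans (add_le_add_right h4 B')) (hc i)
          linarith
        have := le_abs_self D
        nlinarith
    refine ⟨B' + Y, fun k m hm => ?_⟩
    rcases Nat.lt_or_ge m (n + 1) with hm' | hm'
    · exact (hB0 k m (by omega)).trans ((le_max_left _ _).trans (by linarith))
    · rw [show m = n + 1 by omega]; exact key k

section
variable {M A : ℕ} {p : Fin A → ℝ}

theorem gd_dirac (c : ℝ) : Gd (Measure.dirac c) := by
  refine ⟨inferInstance, ?_⟩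
  exact memLp_of_pow measurable_id (integrable_dirac (by simp))

theorem mom_dirac : mE (Measure.dirac 0) = 0 ∧ mV (Measure.dirac 0) = 0 ∧ mK (Measure.dirac 0) = 0 := by
  have : mE (Measure.dirac 0) = 0 := by simp [mE]
  refine ⟨this, ?_, ?_⟩
  · simp [mV, this]
  · simp [mK, this]

theorem gd_nuk (hp : IsW p) (k n : ℕ) : Gd (nuk M p k n) := by
  induction k generalizing n with
  | zero => exact gd_dirac 0
  | succ k ih => exact step_gd hp _ ih n

theorem isLf_small {n : ℕ} (hn : n < 2) (L : Fin n → List (Fin M) → Fin A) (w : List (Fin M × Fin A)) :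
    ¬ isLf Finset.univ L w := by
  intro h
  have h1 := h.1
  have h2 : cO Finset.univ L w ≤ n := by
    classical
    unfold cO; exact (Finset.card_filter_le _ _).trans (by simp)
  omega

theorem XX_small {n : ℕ} (hn : n < 2) (k : ℕ) (L : Fin n → List (Fin M) → Fin A) : XX k Finset.univ L = 0 := by
  rw [← card_FF]
  have : FF k Finset.univ L = ∅ := by
    ext w; rw [mem_FF]; simp [isLf_small hn]
  simp [this]

theorem leaf_small {n : ℕ} (hn : n < 2) (L : Fin n → List (Fin M) → Fin A) : leafCount L = 0 := by
  rw [leafCount_eq]; simp [isLf_small hn]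

theorem bb_nonneg {n : ℕ} (x : Fin M → Fin n → Fin A) : 0 ≤ bb x := by unfold bb; split_ifs <;> norm_num
theorem bb_le {n : ℕ} (x : Fin M → Fin n → Fin A) : bb x ≤ 1 := by unfold bb; split_ifs <;> norm_num

theorem cm_bound {n : ℕ} (e : ℕ → ℝ) (B : ℝ) (h0 : ∀ m, 0 ≤ e m) (h : ∀ m, m ≤ n → e m ≤ B) (x : Fin M → Fin n → Fin A) :
    0 ≤ cm e x ∧ cm e x ≤ 1 + M * A * B := by
  unfold cm
  constructor
  · exact add_nonneg (bb_nonneg x) (Finset.sum_nonneg fun q _ => h0 _)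
  · have : ∑ q : Fin M × Fin A, e (cnt (x q.1) q.2) ≤ ∑ q : Fin M × Fin A, B :=
      Finset.sum_le_sum fun q _ => h _ (cnt_le _ _)
    simp at this
    linarith [bb_le x]

variable {μL : Measure (List (Fin M) → Fin A)} [IsProbabilityMeasure μL]

theorem nuk_small (hp : IsW p) (hμL : IsLabelingMeasure p μL) (a0 : Fin A) (k n : ℕ) (hn : n < 2) :
    nuk M p k n = Measure.dirac 0 := by
  have := XX_law hp (isLab_pi hμL n) a0 k Finset.univ
  simp only [Finset.card_univ, Fintype.card_fin] at this
  rw [← this]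
  simp [XX_small hn]

theorem nuk_mean_nonneg (hp : IsW p) (k n : ℕ) : 0 ≤ mE (nuk M p k n) := by
  induction k generalizing n with
  | zero => simp [nuk, mE]
  | succ k ih =>
    rw [nuk, step_mean hp _ (gd_nuk hp k)]
    exact Ex_nonneg (isW_pw (isW_pw hp)) _ fun x => add_nonneg (bb_nonneg x) (Finset.sum_nonneg fun q _ => ih _)

theorem pow_sum_lt (hp : ∀ a, 0 < p a ∧ p a < 1) (c : ℝ) (hc0 : 0 ≤ c) (hc : c * ∑ a, p a ^ 2 < 1) (n : ℕ) (hn : 2 ≤ n) :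
    ∑ a, c * p a ^ n < 1 := by
  refine lt_of_le_of_lt ?_ hc
  rw [Finset.mul_sum]
  exact Finset.sum_le_sum fun a _ => mul_le_mul_of_nonneg_left
    (pow_le_pow_of_le_one (hp a).1.le (hp a).2.le hn) hc0

theorem exists_eta (s : ℝ) (hs : s < 1) : ∃ η : ℝ, 0 < η ∧ (1 + η) * s < 1 := by
  have : Tendsto (fun t : ℝ => (1 + t) * s) (𝓝[>] 0) (𝓝 ((1 + 0) * s)) := by
    refine Tendsto.mono_left ?_ nhdsWithin_le_nhds
    exact Continuous.tendsto (by fun_prop) 0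
  obtain ⟨t, h, h'⟩ := ((this.eventually_lt_const (u := 1) (by simpa using hs)).and self_mem_nhdsWithin).exists
  exact ⟨t, h', h⟩

theorem nuk_moments (hw : IsW p) (hp : ∀ a, 0 < p a ∧ p a < 1) (hM : (M : ℝ) * ∑ a, p a ^ 2 < 1)
    (hμL : IsLabelingMeasure p μL) (a0 : Fin A) (n : ℕ) :
    ∃ B, ∀ k m, m ≤ n → mE (nuk M p k m) ≤ B ∧ mV (nuk M p k m) ≤ B ∧ mK (nuk M p k m) ≤ B := by
  have hWW : ∀ n, IsW (pw (pw p) : (Fin M → Fin n → Fin A) → ℝ) := fun n => isW_pw (isW_pw hw)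
  have hE := supk (c := fun _ : Fin A => (M : ℝ)) (p := p) (fun _ => Nat.cast_nonneg M) hp
    (fun n hn => pow_sum_lt hp _ (Nat.cast_nonneg M) hM n hn) (fun k n => mE (nuk M p k n))
    (fun n => le_of_eq mom_dirac.1) (fun k n hn => by rw [nuk_small hw hμL a0 k n hn]; exact le_of_eq mom_dirac.1)
    (fun n => ⟨1, fun k => by
      rw [nuk, step_mean hw _ (gd_nuk hw k)]
      unfold cm
      rw [Ex_add, Ex_cnts hw n (fun m => mE (nuk M p k m)), add_comm]
      have := Ex_mono (hWW n) _ _ (fun x => bb_le x)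
      rw [Ex_const (hWW n)] at this
      linarith⟩)
  have hδ : ∀ n, ∃ D, 0 ≤ D ∧ ∀ k (x : Fin M → Fin n → Fin A),
      |cm (fun m => mE (nuk M p k m)) x - mE (nuk M p (k + 1) n)| ≤ D := by
    intro n
    obtain ⟨B, hB⟩ := hE n
    have hB0 : 0 ≤ B := (nuk_mean_nonneg hw 0 0).trans (hB 0 0 (Nat.zero_le _))
    refine ⟨1 + M * A * B, by positivity, fun k x => ?_⟩
    have hb := fun x : Fin M → Fin n → Fin A => cm_bound (fun m => mE (nuk M p k m)) B
      (fun m => nuk_mean_nonneg hw k m) (fun m hm => hB k m hm) x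
    rw [nuk, step_mean hw _ (gd_nuk hw k)]
    have h1 := Ex_mono (hWW n) _ _ (fun x => (hb x).2)
    rw [Ex_const (hWW n)] at h1
    have h2 := Ex_nonneg (hWW n) _ (fun x => (hb x).1)
    rw [abs_le]
    constructor <;> linarith [(hb x).1, (hb x).2]
  have hV := supk (c := fun _ : Fin A => (M : ℝ)) (p := p) (fun _ => Nat.cast_nonneg M) hp
    (fun n hn => pow_sum_lt hp _ (Nat.cast_nonneg M) hM n hn) (fun k n => mV (nuk M p k n))
    (fun n => le_of_eq mom_dirac.2.1) (fun k n hn => by rw [nuk_small hw hμL a0 k n hn]; exact le_of_eq mom_dirac.2.1)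
    (fun n => by
      obtain ⟨D, hD0, hD⟩ := hδ n
      refine ⟨D ^ 2, fun k => ?_⟩
      rw [nuk, step_var hw _ (gd_nuk hw k), Ex_cnts hw n (fun m => mV (nuk M p k m))]
      have := Ex_mono (hWW n) (fun x => (cm (fun m => mE (nuk M p k m)) x - mE (nuk M p (k + 1) n)) ^ 2) (fun _ => D ^ 2)
        (fun x => by rw [← sq_abs]; exact pow_le_pow_left₀ (abs_nonneg _) (hD k x) 2)
      rw [Ex_const (hWW n)] at this
      have h2 := Vr_le (hWW n) (fun x => cm (fun m => mE (nuk M p k m)) x) (mE (nuk M p (k + 1) n))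
      linarith)
  obtain ⟨η, hη0, hη⟩ := exists_eta _ hM
  obtain ⟨C, hC0, hC⟩ := pow4_le η hη0
  have hK := supk (c := fun _ : Fin A => (1 + η) * (M : ℝ)) (p := p) (fun _ => by positivity) hp
    (fun n hn => pow_sum_lt hp _ (by positivity) (by rwa [mul_assoc]) n hn) (fun k n => mK (nuk M p k n))
    (fun n => le_of_eq mom_dirac.2.2) (fun k n hn => by rw [nuk_small hw hμL a0 k n hn]; exact le_of_eq mom_dirac.2.2)
    (fun n => by
      obtain ⟨D, hD0, hD⟩ := hδ n
      obtain ⟨B, hB⟩ := hV n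
      refine ⟨(1 + η) * (3 * (M * A * B) ^ 2) + C * D ^ 4, fun k => ?_⟩
      have h1 := step_four (M := M) hw _ (gd_nuk (M := M) hw k) n η C hη0 hC
      refine h1.trans ?_
      have h2 : ∀ x : Fin M → Fin n → Fin A, (1 + η) * (∑ q : Fin M × Fin A, mK (nuk M p k (cnt (x q.1) q.2)) +
          3 * (∑ q : Fin M × Fin A, mV (nuk M p k (cnt (x q.1) q.2))) ^ 2) +
        C * (cm (fun n => mE (nuk M p k n)) x - mE (step M p (nuk M p k) n)) ^ 4 ≤
        (1 + η) * (∑ q : Fin M × Fin A, mK (nuk M p k (cnt (x q.1) q.2))) +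
          ((1 + η) * (3 * (M * A * B) ^ 2) + C * D ^ 4) := by
        intro x
        have a1 : 0 ≤ ∑ q : Fin M × Fin A, mV (nuk M p k (cnt (x q.1) q.2)) := Finset.sum_nonneg fun q _ => mV_nonneg _
        have a2 : ∑ q : Fin M × Fin A, mV (nuk M p k (cnt (x q.1) q.2)) ≤ M * A * B := by
          have : ∑ q : Fin M × Fin A, mV (nuk M p k (cnt (x q.1) q.2)) ≤ ∑ q : Fin M × Fin A, B :=
            Finset.sum_le_sum fun q _ => hB k _ (cnt_le _ _)
          simpa using this
        have a3 := pow_le_pow_left₀ a1 a2 2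
        have a4 : (cm (fun n => mE (nuk M p k n)) x - mE (step M p (nuk M p k) n)) ^ 4 ≤ D ^ 4 := by
          rw [← Even.pow_abs (by decide : Even 4)]
          exact pow_le_pow_left₀ (abs_nonneg _) (hD k x) 4
        have a5 := mul_le_mul_of_nonneg_left a3 (by positivity : 0 ≤ (1 + η) * 3)
        have a6 := mul_le_mul_of_nonneg_left a4 hC0
        linarith
      refine (Ex_mono (hWW n) _ _ h2).trans ?_
      rw [Ex_add, Ex_mul, Ex_const (hWW n), Ex_cnts hw n (fun m => mK (nuk M p k m))]
      simp only [TT, Finset.mul_sum, mul_assoc]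
      exact le_rfl)
  obtain ⟨B1, h1⟩ := hE n
  obtain ⟨B2, h2⟩ := hV n
  obtain ⟨B3, h3⟩ := hK n
  exact ⟨max B1 (max B2 B3), fun k m hm => ⟨(h1 k m hm).trans (le_max_left _ _),
    (h2 k m hm).trans ((le_max_left _ _).trans (le_max_right _ _)),
    (h3 k m hm).trans ((le_max_right _ _).trans (le_max_right _ _))⟩⟩

end
end GT

namespace GT

section
variable {M A : ℕ} {p : Fin A → ℝ} {μL : Measure (List (Fin M) → Fin A)} [IsProbabilityMeasure μL]

theorem raw4 {l : Measure ℝ} (h : Gd l) (C : ℝ) (hC : ∀ a b : ℝ, (a + b) ^ 4 ≤ (1 + 1) * a ^ 4 + C * b ^ 4) :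
    ∫ z, z ^ 4 ∂l ≤ 2 * mK l + C * mE l ^ 4 := by
  have := h.prob
  have i4 := int_pow (h.cent (mE l)) 4 le_rfl
  have i5 : Integrable (fun z => 2 * (z - mE l) ^ 4 + C * mE l ^ 4) l := (i4.const_mul 2).add (integrable_const _)
  refine (integral_mono_of_nonneg (Eventually.of_forall fun z => by positivity) i5
    (Eventually.of_forall fun z => ?_)).trans (le_of_eq ?_)
  · have := hC (z - mE l) (mE l)
    simp only [sub_add_cancel] at this
    dsimp only
    linarith
  · rw [integral_add (i4.const_mul 2) (integrable_const _), integral_const_mul]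
    simp [mK]

theorem XX_meas' (hμL : IsLabelingMeasure p μL) (k n : ℕ) :
    Measurable (fun L : Fin n → List (Fin M) → Fin A => XX k Finset.univ L) :=
  XX_meas (isLab_pi hμL n) k Finset.univ

theorem XX_law' (hw : IsW p) (hμL : IsLabelingMeasure p μL) (a0 : Fin A) (k n : ℕ) :
    Measure.map (fun L : Fin n → List (Fin M) → Fin A => XX k Finset.univ L) (Measure.pi fun _ => μL) = nuk M p k n := by
  have := XX_law hw (isLab_pi hμL n) a0 k Finset.univ
  simpa using this

theorem leaf_ae (hw : IsW p) (hp : ∀ a, 0 < p a ∧ p a < 1) (hM : (M : ℝ) * ∑ a, p a ^ 2 < 1)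
    (hμL : IsLabelingMeasure p μL) (a0 : Fin A) (n : ℕ) :
    (∀ᵐ L ∂(Measure.pi fun _ : Fin n => μL), ∀ᶠ k in atTop, XX k Finset.univ L = leafCount L) ∧
    AEMeasurable (fun L : Fin n → List (Fin M) → Fin A => leafCount L) (Measure.pi fun _ : Fin n => μL) ∧
    Integrable (fun L : Fin n → List (Fin M) → Fin A => leafCount L ^ 4) (Measure.pi fun _ : Fin n => μL) := by
  set Q := (Measure.pi fun _ : Fin n => μL) with hQ
  obtain ⟨C, hC0, hC⟩ := pow4_le 1 one_pos
  obtain ⟨B, hB⟩ := nuk_moments hw hp hM hμL a0 n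
  have hm := fun k => XX_meas' (M := M) (A := A) hμL k n
  have h1 : ∀ k, ∫ L, XX k Finset.univ L ^ 4 ∂Q ≤ 2 * B + C * B ^ 4 := by
    intro k
    have e : ∫ L, XX k Finset.univ L ^ 4 ∂Q = ∫ z, z ^ 4 ∂(nuk M p k n) := by
      rw [← XX_law' hw hμL a0 k n, integral_map (hm k).aemeasurable (by fun_prop)]
    rw [e]
    refine (raw4 (gd_nuk hw k n) C hC).trans ?_
    have := hB k n le_rfl
    have h2 := pow_le_pow_left₀ (nuk_mean_nonneg hw k n) this.1 4
    have h3 := mul_le_mul_of_nonneg_left h2 hC0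
    linarith [this.2.2]
  have hintgr : ∀ k, Integrable (fun L => XX k Finset.univ L ^ 4) Q := by
    intro k
    have := (gd_nuk (M := M) hw k n).prob
    have h := int_pow (gd_nuk (M := M) hw k n).mem 4 le_rfl
    rw [← XX_law' hw hμL a0 k n] at h
    exact (integrable_map_measure (by fun_prop) (hm k).aemeasurable).1 h
  have h2 : ∫⁻ L, ⨆ k, ENNReal.ofReal (XX k Finset.univ L ^ 4) ∂Q ≤ ENNReal.ofReal (2 * B + C * B ^ 4) := by
    rw [lintegral_iSup]
    · refine iSup_le fun k => ?_
      rw [← ofReal_integral_eq_lintegral_ofReal (hintgr k) (Eventually.of_forall fun L => by positivity)]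
      exact ENNReal.ofReal_le_ofReal (h1 k)
    · exact fun k => ((hm k).pow_const 4).ennreal_ofReal
    · intro k k' hk L
      exact ENNReal.ofReal_le_ofReal (pow_le_pow_left₀ (XX_nonneg _ _ _) (XX_mono _ _ hk) 4)
  have h3 : ∀ᵐ L ∂Q, ⨆ k, ENNReal.ofReal (XX k Finset.univ L ^ 4) < ⊤ := by
    refine ae_lt_top' ?_ (ne_of_lt (h2.trans_lt ENNReal.ofReal_lt_top))
    exact (Measurable.iSup fun k => ((hm k).pow_const 4).ennreal_ofReal).aemeasurable
  have h4 : ∀ᵐ L ∂Q, ∀ᶠ k in atTop, XX k Finset.univ L = leafCount L := by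
    filter_upwards [h3] with L hL
    refine XX_eventually L (1 + (⨆ k, ENNReal.ofReal (XX k Finset.univ L ^ 4)).toReal) fun k => ?_
    have h5 := (ENNReal.toReal_mono hL.ne (le_iSup (fun k => ENNReal.ofReal (XX k Finset.univ L ^ 4)) k))
    have h0 := XX_nonneg k Finset.univ L
    rw [ENNReal.toReal_ofReal (by positivity)] at h5
    have : XX k Finset.univ L ≤ 1 + XX k Finset.univ L ^ 4 := by
      nlinarith [sq_nonneg (XX k Finset.univ L ^ 2 - 1 / 2), sq_nonneg (XX k Finset.univ L - 1 / 2)]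
    linarith
  have h5 : AEMeasurable (fun L : Fin n → List (Fin M) → Fin A => leafCount L) Q := by
    refine aemeasurable_of_tendsto_metrizable_ae atTop (fun k => (hm k).aemeasurable) ?_
    filter_upwards [h4] with L hL
    exact tendsto_const_nhds.congr' (hL.mono fun k hk => hk.symm)
  refine ⟨h4, h5, (h5.pow_const 4).aestronglyMeasurable, ?_⟩
  rw [hasFiniteIntegral_iff_ofReal (Eventually.of_forall fun L => by positivity)]
  refine lt_of_le_of_lt (lintegral_mono_ae ?_) (h2.trans_lt ENNReal.ofReal_lt_top)
  filter_upwards [h4] with L hL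
  obtain ⟨k, hk⟩ := hL.exists
  rw [← hk]
  exact le_iSup (fun k => ENNReal.ofReal (XX k Finset.univ L ^ 4)) k

/-- law of the leaf count -/
noncomputable def nu (μL : Measure (List (Fin M) → Fin A)) (n : ℕ) : Measure ℝ :=
  Measure.map (fun L : Fin n → List (Fin M) → Fin A => leafCount L) (Measure.pi fun _ => μL)

theorem nu_gd (hw : IsW p) (hp : ∀ a, 0 < p a ∧ p a < 1) (hM : (M : ℝ) * ∑ a, p a ^ 2 < 1)
    (hμL : IsLabelingMeasure p μL) (a0 : Fin A) (n : ℕ) : Gd (nu μL n) := by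
  obtain ⟨h1, h2, h3⟩ := leaf_ae hw hp hM hμL a0 n
  have hP : IsProbabilityMeasure (nu μL n) := Measure.isProbabilityMeasure_map h2
  refine ⟨hP, memLp_of_pow measurable_id ?_⟩
  exact (integrable_map_measure (by fun_prop) h2).2 h3

theorem nu_char (hw : IsW p) (hp : ∀ a, 0 < p a ∧ p a < 1) (hM : (M : ℝ) * ∑ a, p a ^ 2 < 1)
    (hμL : IsLabelingMeasure p μL) (a0 : Fin A) (n : ℕ) (θ : ℝ) :
    Tendsto (fun k => charFun (nuk M p k n) θ) atTop (𝓝 (charFun (nu μL n) θ)) := by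
  obtain ⟨h1, h2, h3⟩ := leaf_ae hw hp hM hμL a0 n
  have e : ∀ k, charFun (nuk M p k n) θ = ∫ L : Fin n → List (Fin M) → Fin A,
      Complex.exp (θ * XX k Finset.univ L * Complex.I) ∂(Measure.pi fun _ => μL) := fun k => by
    rw [← XX_law' hw hμL a0 k n, charFun_apply_real, integral_map (XX_meas' hμL k n).aemeasurable (by fun_prop)]
  have e' : charFun (nu μL n) θ = ∫ L : Fin n → List (Fin M) → Fin A,
      Complex.exp (θ * leafCount L * Complex.I) ∂(Measure.pi fun _ => μL) := by
    rw [nu, charFun_apply_real, integral_map h2 (by fun_prop)]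
  simp only [e, e']
  refine tendsto_integral_of_dominated_convergence (fun _ => 1) (fun k => ?_) (integrable_const 1) (fun k => ?_) ?_
  · have := XX_meas' (M := M) (A := A) hμL k n
    exact (Measurable.aestronglyMeasurable (by fun_prop))
  · filter_upwards with L
    rw [← Complex.ofReal_mul, Complex.norm_exp_ofReal_mul_I]
  · filter_upwards [h1] with L hL
    exact tendsto_const_nhds.congr' (hL.mono fun k hk => by dsimp only; rw [hk])

theorem nu_step (hw : IsW p) (hp : ∀ a, 0 < p a ∧ p a < 1) (hM : (M : ℝ) * ∑ a, p a ^ 2 < 1)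
    (hμL : IsLabelingMeasure p μL) (a0 : Fin A) (n : ℕ) : nu μL n = step M p (nu μL) n := by
  have hP : ∀ n, IsProbabilityMeasure (nu μL n) := fun n => (nu_gd hw hp hM hμL a0 n).prob
  have := isProb_step (M := M) hw (nu μL) hP n
  refine Measure.ext_of_charFun ?_
  funext θ
  refine tendsto_nhds_unique ((nu_char hw hp hM hμL a0 n θ).comp (tendsto_add_atTop_nat 1)) ?_
  rw [step_char hw _ hP]
  have e : (fun k => charFun (nuk M p k n) θ) ∘ (fun k => k + 1) = fun k => Ex (pw (pw p)) (fun x : Fin M → Fin n → Fin A =>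
      Complex.exp (θ * bb x * Complex.I) * ∏ q : Fin M × Fin A, charFun (nuk M p k (cnt (x q.1) q.2)) θ) := by
    funext k
    exact step_char hw _ (fun n => isProb_nuk hw k n) n θ
  rw [e]
  unfold Ex
  refine tendsto_finsetSum _ fun x _ => Tendsto.const_smul (Tendsto.const_mul _ ?_) _
  exact tendsto_finsetProd _ fun q _ => nu_char hw hp hM hμL a0 _ θ

theorem nu_small (n : ℕ) (hn : n < 2) : nu μL n = Measure.dirac 0 := by
  unfold nu
  simp [leaf_small hn]

theorem nu_nonneg (n : ℕ) : 0 ≤ mE (nu μL n) := by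
  unfold mE nu
  by_cases h : AEMeasurable (fun L : Fin n → List (Fin M) → Fin A => leafCount L) (Measure.pi fun _ => μL)
  · rw [integral_map h (by fun_prop)]
    exact integral_nonneg fun L => by unfold leafCount; positivity
  · rw [Measure.map_of_not_aemeasurable h]; simp

end
end GT

namespace GT

/-- the standing assumptions on the parameters and the laws of the leaf counts -/
structure Sys (M : ℕ) {A : ℕ} (p : Fin A → ℝ) (ρ : ℝ) (l : ℕ → Measure ℝ) : Prop where
  hM1 : 1 ≤ M
  hA : 2 ≤ A
  hw : IsW p
  hp : ∀ a, 0 < p a ∧ p a < 1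
  hM : (M : ℝ) * ∑ a, p a ^ 2 < 1
  hρ : (M : ℝ) * ∑ a, p a ^ ρ = 1
  gd : ∀ n, Gd (l n)
  st : ∀ n, l n = step M p l n
  small : ∀ n, n < 2 → l n = Measure.dirac 0

/-- mean sequence -/
noncomputable def ee (l : ℕ → Measure ℝ) (n : ℕ) : ℝ := mE (l n)
/-- difference of means -/
noncomputable def dd (l : ℕ → Measure ℝ) (n : ℕ) : ℝ := ee l (n + 1) - ee l n
/-- variance sequence -/
noncomputable def vv (l : ℕ → Measure ℝ) (n : ℕ) : ℝ := mV (l n)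
/-- fourth moment sequence -/
noncomputable def kk (l : ℕ → Measure ℝ) (n : ℕ) : ℝ := mK (l n)

/-- all letter counts at most one -/
noncomputable def gdw {A n : ℕ} (y : Fin n → Fin A) : ℝ := if ∀ a, cnt y a ≤ 1 then 1 else 0
/-- its probability -/
noncomputable def bet {A : ℕ} (p : Fin A → ℝ) (n : ℕ) : ℝ := Ex (pw p) (fun y : Fin n → Fin A => gdw y)
/-- expected toll -/
noncomputable def bbe (M : ℕ) {A : ℕ} (p : Fin A → ℝ) (n : ℕ) : ℝ :=
  Ex (pw (pw p)) (fun x : Fin M → Fin n → Fin A => bb x)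

section
variable {M A : ℕ} {p : Fin A → ℝ} {ρ : ℝ} {l : ℕ → Measure ℝ}

theorem gdw_big {n : ℕ} (hn : A < n) (y : Fin n → Fin A) : gdw y = 0 := by
  unfold gdw
  rw [if_neg]
  intro h
  have := cnt_sum y
  have h2 : ∑ a, cnt y a ≤ ∑ a : Fin A, 1 := Finset.sum_le_sum fun a _ => h a
  simp at h2; omega

theorem bb_eq {n : ℕ} (hn : 2 ≤ n) (x : Fin M → Fin n → Fin A) : bb x = ∏ m, gdw (x m) := by
  unfold bb gdw
  by_cases h : ∀ q : Fin M × Fin A, cnt (x q.1) q.2 ≤ 1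
  · rw [if_pos ⟨hn, h⟩]
    symm
    exact Finset.prod_eq_one fun m _ => if_pos fun a => h (m, a)
  · rw [if_neg fun h' => h h'.2]
    push Not at h
    obtain ⟨q, hq⟩ := h
    symm
    refine Finset.prod_eq_zero (Finset.mem_univ q.1) (if_neg fun h' => ?_)
    have := h' q.2; omega

theorem bbe_eq (n : ℕ) (hn : 2 ≤ n) : bbe M p n = bet p n ^ M := by
  unfold bbe
  simp only [bb_eq hn]
  rw [Ex_pw_prod (fun (_ : Fin M) (y : Fin n → Fin A) => gdw y)]
  simp [bet]

theorem bbe_small (n : ℕ) (hn : n < 2) : bbe M p n = 0 := by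
  unfold bbe
  have : ∀ x : Fin M → Fin n → Fin A, bb x = 0 := fun x => by
    unfold bb
    exact if_neg fun h => by omega
  simp [this, Ex]

theorem bb_big (hM1 : 1 ≤ M) {n : ℕ} (hA : 2 ≤ A) (hn : A < n) (x : Fin M → Fin n → Fin A) : bb x = 0 := by
  rw [bb_eq (by omega)]
  exact Finset.prod_eq_zero (Finset.mem_univ (⟨0, by omega⟩ : Fin M)) (gdw_big hn _)

theorem bbe_big (hM1 : 1 ≤ M) {n : ℕ} (hA : 2 ≤ A) (hn : A < n) : bbe M p n = 0 := by
  simp [bbe, bb_big hM1 hA hn, Ex]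

theorem gdw_nonneg {n : ℕ} (y : Fin n → Fin A) : 0 ≤ gdw y ∧ gdw y ≤ 1 := by
  unfold gdw; split_ifs <;> norm_num

theorem bet_01 (hw : IsW p) (n : ℕ) : 0 ≤ bet p n ∧ bet p n ≤ 1 := by
  refine ⟨Ex_nonneg (isW_pw hw) _ fun y => (gdw_nonneg y).1, ?_⟩
  have := Ex_mono (isW_pw hw) _ _ fun y : Fin n → Fin A => (gdw_nonneg y).2
  rwa [Ex_const (isW_pw hw)] at this

theorem bet_diff (hw : IsW p) (n : ℕ) : bet p (n + 1) ≤ bet p n ∧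
    bet p n - bet p (n + 1) ≤ ∑ a, p a * Bn (p a) n (fun k => if k = 1 then 1 else 0) := by
  have hW : IsW (pw p : (Fin n → Fin A) → ℝ) := isW_pw hw
  have key : ∀ (a : Fin A) (y : Fin n → Fin A), gdw (Fin.cons a y : Fin (n + 1) → Fin A) ≤ gdw y ∧
      gdw y - gdw (Fin.cons a y : Fin (n + 1) → Fin A) ≤ if cnt y a = 1 then 1 else 0 := by
    intro a y
    have hle : ∀ b, cnt y b ≤ cnt (Fin.cons a y : Fin (n + 1) → Fin A) b := fun b => by
      rw [cnt_cons]; omega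
    by_cases h1 : ∀ b, cnt y b ≤ 1
    · by_cases h2 : ∀ b, cnt (Fin.cons a y : Fin (n + 1) → Fin A) b ≤ 1
      · unfold gdw; rw [if_pos h1, if_pos h2]; split_ifs <;> norm_num
      · have h3 : cnt y a = 1 := by
          push Not at h2
          obtain ⟨b, hb⟩ := h2
          rw [cnt_cons] at hb
          have := h1 b
          split_ifs at hb with hab
          · subst hab; omega
          · omega
        unfold gdw; rw [if_pos h1, if_neg h2, if_pos h3]; norm_num
    · have h2 : ¬ ∀ b, cnt (Fin.cons a y : Fin (n + 1) → Fin A) b ≤ 1 := fun h => h1 fun b => (hle b).trans (h b)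
      unfold gdw; rw [if_neg h1, if_neg h2]; split_ifs <;> norm_num
  have e1 : bet p (n + 1) = Ex p (fun a => Ex (pw p) (fun y : Fin n → Fin A => gdw (Fin.cons a y : Fin (n + 1) → Fin A))) :=
    Ex_cons n _
  have e2 : bet p n = Ex p (fun a => bet p n) := (Ex_const hw _).symm
  constructor
  · rw [e1, e2]
    exact Ex_mono hw _ _ fun a => Ex_mono hW _ _ fun y => (key a y).1
  · rw [e1]; nth_rewrite 1 [e2]
    rw [← Ex_sub]
    have : ∑ a, p a * Bn (p a) n (fun k => if k = 1 then 1 else 0) =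
        Ex p (fun a => Bn (p a) n (fun k => if k = 1 then 1 else 0)) := rfl
    rw [this]
    refine Ex_mono hw _ _ fun a => ?_
    rw [← Ex_cnt hw a n (fun k => if k = 1 then 1 else 0), bet, ← Ex_sub]
    exact Ex_mono hW _ _ fun y => (key a y).2

theorem pow_diff_le (M : ℕ) (a b : ℝ) (hb : 0 ≤ b) (hba : b ≤ a) (ha : a ≤ 1) : a ^ M - b ^ M ≤ M * (a - b) := by
  induction M with
  | zero => simp
  | succ M ih =>
    have h1 : b ^ M ≤ 1 := pow_le_one₀ hb (hba.trans ha)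
    have h2 : 0 ≤ b ^ M := pow_nonneg hb M
    have h3 : b ^ M ≤ a ^ M := pow_le_pow_left₀ hb hba M
    have : a ^ (M + 1) - b ^ (M + 1) = a * (a ^ M - b ^ M) + b ^ M * (a - b) := by ring
    rw [this]; push_cast
    have h4 : a * (a ^ M - b ^ M) ≤ a ^ M - b ^ M := by nlinarith
    nlinarith

theorem Sys.b_diff (S : Sys M p ρ l) (n : ℕ) (hn : 2 ≤ n) :
    bbe M p n - bbe M p (n + 1) ≤ M * ∑ a, p a * Bn (p a) n (fun k => if k = 1 then 1 else 0) := by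
  rw [bbe_eq n hn, bbe_eq (n + 1) (by omega)]
  obtain ⟨h1, h2⟩ := bet_diff S.hw n
  refine (pow_diff_le M _ _ (bet_01 S.hw _).1 h1 (bet_01 S.hw n).2).trans ?_
  exact mul_le_mul_of_nonneg_left h2 (Nat.cast_nonneg M)

theorem Sys.e_small (S : Sys M p ρ l) (n : ℕ) (hn : n < 2) : ee l n = 0 := by
  unfold ee; rw [S.small n hn]; exact mom_dirac.1

theorem Sys.v_small (S : Sys M p ρ l) (n : ℕ) (hn : n < 2) : vv l n = 0 := by
  unfold vv; rw [S.small n hn]; exact mom_dirac.2.1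

theorem Sys.e_eq (S : Sys M p ρ l) (n : ℕ) :
    ee l n = Ex (pw (pw p)) (fun x : Fin M → Fin n → Fin A => cm (ee l) x) := by
  have := step_mean (M := M) S.hw l S.gd n
  rw [← S.st n] at this
  exact this

theorem Sys.e_rec (S : Sys M p ρ l) (n : ℕ) : ee l n = TT (fun _ => (M : ℝ)) p n (ee l) + bbe M p n := by
  rw [S.e_eq n]
  unfold cm
  rw [Ex_add, Ex_cnts S.hw n (ee l), add_comm]; rfl

theorem Sys.v_rec (S : Sys M p ρ l) (n : ℕ) : vv l n = TT (fun _ => (M : ℝ)) p n (vv l) +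
    Vr (pw (pw p)) (fun x : Fin M → Fin n → Fin A => cm (ee l) x) := by
  have := step_var (M := M) S.hw l S.gd n
  rw [← S.st n] at this
  rw [vv, this, Ex_cnts S.hw n (fun m => mV (l m))]; rfl

theorem TT_diff {ι : Type*} [Fintype ι] (c p : ι → ℝ) (n : ℕ) (f : ℕ → ℝ) :
    TT c p (n + 1) f - TT c p n f = TT (fun i => c i * p i) p n (fun k => f (k + 1) - f k) := by
  unfold TT
  rw [← Finset.sum_sub_distrib]
  refine Finset.sum_congr rfl fun i _ => ?_
  rw [← mul_sub, Bn_diff]; ring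

theorem Sys.d_rec (S : Sys M p ρ l) (n : ℕ) :
    dd l n = TT (fun a => (M : ℝ) * p a) p n (dd l) + (bbe M p (n + 1) - bbe M p n) := by
  have h := TT_diff (fun _ => (M : ℝ)) p n (ee l)
  unfold dd at *
  rw [S.e_rec (n + 1), S.e_rec n]
  linarith

theorem Sys.M_pos (S : Sys M p ρ l) : (0 : ℝ) < M := by exact_mod_cast S.hM1

theorem Sys.self (S : Sys M p ρ l) (n : ℕ) (hn : 2 ≤ n) : ∑ a, (M : ℝ) * p a ^ n < 1 :=
  pow_sum_lt S.hp _ S.M_pos.le S.hM n hn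

theorem Sys.e_two (S : Sys M p ρ l) : 1 ≤ ee l 2 := by
  have h := S.e_rec 2
  have h0 := S.e_small 0 (by norm_num)
  have h1 := S.e_small 1 (by norm_num)
  have e : ∀ a, Bn (p a) 2 (ee l) = p a ^ 2 * ee l 2 := fun a => by
    simp [Bn, h0, h1]; ring
  have e1 : ∀ a : Fin A, Bn (p a) 1 (fun k => if k = 1 then (1 : ℝ) else 0) = p a := fun a => by simp [Bn]
  simp only [TT, e] at h
  have hb : 1 - M * ∑ a, p a ^ 2 ≤ bbe M p 2 := by
    rw [bbe_eq 2 le_rfl]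
    have h2 := (bet_diff S.hw 1).2
    have h3 : bet p 1 = 1 := by
      have : ∀ y : Fin 1 → Fin A, gdw y = 1 := fun y => if_pos fun a => cnt_le y a
      unfold bet; simp only [this]; exact Ex_const (isW_pw S.hw) _
    have h4 := pow_diff_le M 1 (bet p 2) (bet_01 S.hw 2).1 (bet_01 S.hw 2).2 le_rfl
    have h5 : ∑ a, p a * Bn (p a) 1 (fun k => if k = 1 then (1 : ℝ) else 0) = ∑ a, p a ^ 2 :=
      Finset.sum_congr rfl fun a _ => by rw [e1]; ring
    rw [h5, h3] at h2
    have h6 := mul_le_mul_of_nonneg_left h2 S.M_pos.le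
    rw [one_pow] at h4
    linarith
  have e3 : ∑ a, (M : ℝ) * (p a ^ 2 * ee l 2) = (M * ∑ a, p a ^ 2) * ee l 2 := by
    rw [Finset.mul_sum, Finset.sum_mul]; exact Finset.sum_congr rfl fun a _ => by ring
  rw [e3] at h
  have := S.hM
  nlinarith

theorem Sys.d_one (S : Sys M p ρ l) : 1 ≤ dd l 1 := by
  unfold dd; rw [S.e_small 1 (by norm_num)]; simpa using S.e_two

theorem Sys.d_zero (S : Sys M p ρ l) : dd l 0 = 0 := by
  unfold dd; rw [S.e_small 1 (by norm_num), S.e_small 0 (by norm_num)]; simp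

theorem Sys.d_low (S : Sys M p ρ l) (n : ℕ) (hn : 2 ≤ n) (h : ∀ k, k < n → 0 ≤ dd l k) :
    M * ∑ a, p a * Bn (p a) n (fun k => if k = 1 then 1 else 0) + (∑ a, M * p a ^ (n + 1)) * dd l n
      ≤ TT (fun a => (M : ℝ) * p a) p n (dd l) := by
  unfold TT
  rw [Finset.mul_sum, Finset.sum_mul, ← Finset.sum_add_distrib]
  refine Finset.sum_le_sum fun a _ => ?_
  have := Bn_self (S.hp a).1.le (S.hp a).2.le n (fun k => if k = 1 then (1 : ℝ) else 0) (dd l) (fun k hk => by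
    split_ifs with h1
    · rw [h1]; exact S.d_one
    · exact h k hk)
  rw [if_neg (by omega)] at this
  have h3 := mul_le_mul_of_nonneg_left this (mul_nonneg S.M_pos.le (S.hp a).1.le)
  rw [pow_succ]
  linarith

theorem Sys.d_nonneg (S : Sys M p ρ l) (n : ℕ) : 0 ≤ dd l n := by
  induction n using Nat.strong_induction_on with
  | _ n ih =>
    rcases Nat.lt_or_ge n 2 with hn | hn
    · interval_cases n
      · exact S.d_zero.ge
      · linarith [S.d_one]
    have h1 := S.d_low n hn ih
    have h2 := S.d_rec n
    have h3 := S.b_diff n hn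
    have h4 := S.self (n + 1) (by omega)
    nlinarith

theorem Sys.d_pos (S : Sys M p ρ l) (n : ℕ) (hn : A < n) : 0 < dd l n := by
  have hA := S.hA
  have h1 := S.d_low n (by omega) (fun k _ => S.d_nonneg k)
  have h2 := S.d_rec n
  rw [bbe_big S.hM1 S.hA hn, bbe_big S.hM1 S.hA (by omega : A < n + 1)] at h2
  have h4 := S.self (n + 1) (by omega)
  have h5 : 0 < M * ∑ a, p a * Bn (p a) n (fun k => if k = 1 then 1 else 0) := by
    refine mul_pos S.M_pos (Finset.sum_pos (fun a _ => mul_pos (S.hp a).1 ?_) ⟨⟨0, by omega⟩, Finset.mem_univ _⟩)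
    have : ∀ n : ℕ, 0 < Bn (p a) n (fun k => if k = 0 then 1 else 0) ∧ (0 < n → 0 < Bn (p a) n (fun k => if k = 1 then 1 else 0)) := by
      intro n
      have hpa := S.hp a
      induction n with
      | zero => simp [Bn]
      | succ n ih =>
        have h0 : 0 ≤ Bn (p a) n (fun k => if k = 1 then 1 else 0) :=
          Bn_nonneg hpa.1.le hpa.2.le n _ fun k _ => by split_ifs <;> norm_num
        constructor
        · rw [Bn_succ]
          simp only [Nat.add_eq_zero_iff, one_ne_zero, and_false, if_false, Bn_const]
          have := mul_pos (by linarith [hpa.2] : 0 < 1 - p a) ih.1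
          linarith
        · intro _
          rw [Bn_succ]
          simp only [Nat.add_eq_right]
          have h1 := mul_pos hpa.1 ih.1
          have := mul_nonneg (by linarith [hpa.2] : 0 ≤ 1 - p a) h0
          linarith
    exact (this n).2 (by omega)
  have := S.d_nonneg n
  nlinarith

end
end GT

namespace GT

theorem per_unif (G : ℝ → ℝ) (h : ℝ) (hh : 0 < h) (hG : Continuous G) (hp : ∀ y, G (y + h) = G y) :
    UniformContinuous G := by
  have hper : Function.Periodic G h := hp
  have hu := isCompact_Icc.uniformContinuousOn_of_continuous (s := Set.Icc (-h) (2 * h)) hG.continuousOn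
  rw [Metric.uniformContinuousOn_iff] at hu
  rw [Metric.uniformContinuous_iff]
  intro ε hε
  obtain ⟨δ, hδ, H⟩ := hu ε hε
  refine ⟨min δ h, lt_min hδ hh, fun {x y} hxy => ?_⟩
  have h1 := toIcoMod_mem_Ico hh 0 x
  have e1 : toIcoMod hh 0 x = x - toIcoDiv hh 0 x • h := rfl
  set k := toIcoDiv hh 0 x
  rw [e1] at h1
  rw [← hper.sub_zsmul_eq k (x := x), ← hper.sub_zsmul_eq k (x := y)]
  rw [Real.dist_eq] at hxy
  have hx2 := lt_of_lt_of_le hxy (min_le_right _ _)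
  rw [abs_lt] at hx2
  obtain ⟨h3, h4⟩ := h1
  refine H _ ⟨by linarith, by linarith⟩ _ ⟨by linarith, by linarith⟩ ?_
  rw [Real.dist_eq]
  have : x - k • h - (y - k • h) = x - y := by ring
  rw [this]
  exact lt_of_lt_of_le hxy (min_le_left _ _)

theorem per_bdd (G : ℝ → ℝ) (h : ℝ) (hh : 0 < h) (hG : Continuous G) (hp : ∀ y, G (y + h) = G y) :
    ∃ B, 0 < B ∧ ∀ y, |G y| ≤ B := by
  have hper : Function.Periodic G h := hp
  obtain ⟨B, hB⟩ := isCompact_Icc.exists_bound_of_continuousOn (s := Set.Icc 0 h) hG.continuousOn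
  refine ⟨|B| + 1, by positivity, fun y => ?_⟩
  obtain ⟨z, hz, e⟩ := hper.exists_mem_Ico₀ hh y
  rw [e]
  have := hB z ⟨hz.1, hz.2.le⟩
  rw [Real.norm_eq_abs] at this
  linarith [le_abs_self B]

/-- periodic power asymptotics of a sequence -/
structure Asy {ι : Type*} (p : ι → ℝ) (h s : ℝ) (f : ℕ → ℝ) (G : ℝ → ℝ) : Prop where
  hh : 0 < h
  cont : Continuous G
  per : ∀ y, G (y + h) = G y
  perp : ∀ i y, G (y + -Real.log (p i)) = G y
  lim : Tendsto (fun n : ℕ => f n / (n : ℝ) ^ s - G (Real.log n)) atTop (𝓝 0)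

/-- the conclusion of the renewal theorem -/
structure RenH {ι : Type*} [Fintype ι] (p : ι → ℝ) (h : ℝ) : Prop where
  hh : 0 < h
  ren : ∀ (c : ι → ℝ), (∀ i, 0 < c i) → ∀ (s δ C : ℝ) (n0 : ℕ) (f : ℕ → ℝ),
      ∑ i, c i * p i ^ s = 1 → 0 < δ → 0 ≤ C →
      (∀ n, n0 ≤ n → |f n - TT c p n f| ≤ C * br n ^ (s - δ)) →
      (∀ n, |f (n + 1) - f n| ≤ C * br n ^ (s - δ - 1 / 2)) → ∃ G : ℝ → ℝ, Asy p h s f G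

theorem exists_renH {ι : Type*} [Fintype ι] [Nonempty ι] (p : ι → ℝ) (hp : ∀ i, 0 < p i ∧ p i < 1) :
    ∃ h, RenH p h := by
  obtain ⟨h, hh, H⟩ := ren_seq p hp
  refine ⟨h, hh, fun c hc s δ C n0 f h1 h2 h3 h4 h5 => ?_⟩
  obtain ⟨G, a, b, c, d⟩ := H c hc s δ C n0 f h1 h2 h3 h4 h5
  exact ⟨G, hh, a, b, c, d⟩

section
variable {ι : Type*} {p : ι → ℝ} {h s : ℝ} {f : ℕ → ℝ} {G : ℝ → ℝ}

theorem Asy.ev_bound (a : Asy p h s f G) : ∃ C, 0 < C ∧ ∀ᶠ n : ℕ in atTop, |f n / (n : ℝ) ^ s| ≤ C := by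
  obtain ⟨B, hB, hG⟩ := per_bdd G h a.hh a.cont a.per
  refine ⟨B + 1, by linarith, ?_⟩
  have := a.lim.abs
  rw [abs_zero] at this
  filter_upwards [this.eventually (gt_mem_nhds one_pos)] with n hn
  have h2 := hG (Real.log n)
  have h3 : f n / (n : ℝ) ^ s = (f n / (n : ℝ) ^ s - G (Real.log n)) + G (Real.log n) := by ring
  rw [h3]
  exact (abs_add_le _ _).trans (by linarith)

theorem br_div_lim (s : ℝ) : Tendsto (fun n : ℕ => br n ^ s / (n : ℝ) ^ s) atTop (𝓝 1) := by
  have h1 : Tendsto (fun n : ℕ => 1 + 1 / (n : ℝ)) atTop (𝓝 (1 + 0)) :=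
    tendsto_const_nhds.add tendsto_one_div_atTop_nhds_zero_nat
  rw [add_zero] at h1
  have h2 : Tendsto (fun n : ℕ => (1 + 1 / (n : ℝ)) ^ s) atTop (𝓝 (1 ^ s)) :=
    (Real.continuousAt_rpow_const 1 s (Or.inl one_ne_zero)).tendsto.comp h1
  rw [Real.one_rpow] at h2
  refine h2.congr' ?_
  filter_upwards [eventually_gt_atTop 0] with n hn
  have hn' : (0 : ℝ) < n := by exact_mod_cast hn
  rw [← Real.div_rpow (br_pos n).le hn'.le]
  congr 1
  unfold br; field_simp

theorem Asy.bound (a : Asy p h s f G) : ∃ C, 0 < C ∧ ∀ n, |f n| ≤ C * br n ^ s := by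
  obtain ⟨C, hC, h1⟩ := a.ev_bound
  have h2 := (br_div_lim s).eventually (lt_mem_nhds (by norm_num : (1 / 2 : ℝ) < 1))
  obtain ⟨n0, h3⟩ := eventually_atTop.1 ((h1.and h2).and (eventually_gt_atTop 0))
  obtain ⟨K, hK, h4⟩ := init_bound (fun n => |f n|) (fun n => br n ^ s) (fun n => Real.rpow_pos_of_pos (br_pos n) s) n0
  refine ⟨max K (2 * C), lt_max_of_lt_left hK, fun n => ?_⟩
  have hb := Real.rpow_pos_of_pos (br_pos n) s
  rcases Nat.lt_or_ge n n0 with hn | hn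
  · exact (h4 n hn).trans (mul_le_mul_of_nonneg_right (le_max_left _ _) hb.le)
  · obtain ⟨⟨h5, h6⟩, h7⟩ := h3 n hn
    have hn' : (0 : ℝ) < (n : ℝ) ^ s := Real.rpow_pos_of_pos (by exact_mod_cast h7) s
    rw [abs_div, abs_of_pos hn', div_le_iff₀ hn'] at h5
    rw [lt_div_iff₀ hn'] at h6
    refine h5.trans (le_trans ?_ (mul_le_mul_of_nonneg_right (le_max_right _ _) hb.le))
    nlinarith

theorem Asy.real (a : Asy p h s f G) :
    Tendsto (fun t : ℝ => f ⌊t⌋₊ / t ^ s - G (Real.log t)) atTop (𝓝 0) := by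
  have fl1 : Tendsto (fun t : ℝ => ⌊t⌋₊) atTop atTop := tendsto_nat_floor_atTop
  have h1 : Tendsto (fun t : ℝ => (⌊t⌋₊ : ℝ) / t) atTop (𝓝 1) := tendsto_nat_floor_div_atTop
  have h2 : Tendsto (fun t : ℝ => ((⌊t⌋₊ : ℝ) / t) ^ s) atTop (𝓝 1) := by
    have := (Real.continuousAt_rpow_const 1 s (Or.inl one_ne_zero)).tendsto.comp h1
    rwa [Real.one_rpow] at this
  have h3 : Tendsto (fun t : ℝ => Real.log ((⌊t⌋₊ : ℝ) / t)) atTop (𝓝 0) := by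
    have := (Real.continuousAt_log (one_ne_zero)).tendsto.comp h1
    rwa [Real.log_one] at this
  have h4 : Tendsto (fun t : ℝ => f ⌊t⌋₊ / (⌊t⌋₊ : ℝ) ^ s - G (Real.log ⌊t⌋₊)) atTop (𝓝 0) := a.lim.comp fl1
  have h5 : Tendsto (fun t : ℝ => G (Real.log ⌊t⌋₊) - G (Real.log t)) atTop (𝓝 0) := by
    have hu := per_unif G h a.hh a.cont a.per
    rw [Metric.uniformContinuous_iff] at hu
    rw [Metric.tendsto_nhds]
    intro ε hε
    obtain ⟨δ, hδ, H⟩ := hu ε hε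
    rw [Metric.tendsto_nhds] at h3
    filter_upwards [h3 δ hδ, eventually_ge_atTop 1] with t ht ht1
    rw [Real.dist_eq, sub_zero, ← Real.dist_eq]
    refine H ?_
    rw [Real.dist_eq, ← Real.log_div]
    · rwa [Real.dist_eq, sub_zero] at ht
    · have : 0 < ⌊t⌋₊ := Nat.floor_pos.2 ht1
      positivity
    · positivity
  obtain ⟨C, hC, hb⟩ := a.ev_bound
  have hb' := fl1.eventually hb
  have h6 : Tendsto (fun t : ℝ => f ⌊t⌋₊ / (⌊t⌋₊ : ℝ) ^ s * (((⌊t⌋₊ : ℝ) / t) ^ s - 1)) atTop (𝓝 0) := by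
    refine squeeze_zero_norm' (a := fun t : ℝ => C * |((⌊t⌋₊ : ℝ) / t) ^ s - 1|) ?_ ?_
    · filter_upwards [hb'] with t ht
      rw [norm_mul, Real.norm_eq_abs, Real.norm_eq_abs]
      exact mul_le_mul_of_nonneg_right ht (abs_nonneg _)
    · have := ((h2.sub_const 1).abs).const_mul C
      simpa using this
  have := (h6.add h4).add h5
  simp only [add_zero] at this
  refine this.congr' ?_
  filter_upwards [eventually_ge_atTop 1] with t ht
  have h7 : (0 : ℝ) < ⌊t⌋₊ := by exact_mod_cast Nat.floor_pos.2 ht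
  have h8 : 0 < (⌊t⌋₊ : ℝ) ^ s := Real.rpow_pos_of_pos h7 s
  have h9 : 0 < t ^ s := Real.rpow_pos_of_pos (by linarith) s
  rw [Real.div_rpow h7.le (by linarith)]
  field_simp
  ring

/-- comparison of the values at `n p_a` and `n` -/
theorem Asy.fl_lim (a : Asy p h s f G) (i : ι) (hp : 0 < p i) :
    Tendsto (fun n : ℕ => (f (fl (p i) n) - p i ^ s * f n) / (n : ℝ) ^ s) atTop (𝓝 0) := by
  have h1 : Tendsto (fun n : ℕ => (n : ℝ) * p i) atTop atTop :=
    tendsto_natCast_atTop_atTop.atTop_mul_const hp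
  have h2 := ((a.real.comp h1).const_mul (p i ^ s)).sub (a.lim.const_mul (p i ^ s))
  simp only [mul_zero, sub_zero] at h2
  refine h2.congr' ?_
  filter_upwards [eventually_gt_atTop 0] with n hn
  have hn' : (0 : ℝ) < n := by exact_mod_cast hn
  have e1 : G (Real.log (n * p i)) = G (Real.log n) := by
    rw [Real.log_mul hn'.ne' hp.ne', ← a.perp i (Real.log n + Real.log (p i))]
    congr 1; ring
  have h8 : 0 < (n : ℝ) ^ s := Real.rpow_pos_of_pos hn' s
  have h9 : 0 < p i ^ s := Real.rpow_pos_of_pos hp s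
  simp only [Function.comp]
  rw [e1, Real.mul_rpow hn'.le hp.le]
  unfold fl
  field_simp
  ring

theorem Asy.pos (a : Asy p h s f G) (k : ℝ) (hk : 0 < k) (n0 : ℕ) (hf : ∀ n, n0 ≤ n → k * br n ^ s ≤ f n) (y : ℝ) :
    k ≤ G y := by
  have fl1 : Tendsto (fun t : ℝ => ⌊t⌋₊) atTop atTop := tendsto_nat_floor_atTop
  have h1 : Tendsto (fun j : ℕ => Real.exp (y + j * h)) atTop atTop := by
    refine Real.tendsto_exp_atTop.comp (tendsto_atTop_add_const_left _ _ ?_)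
    exact tendsto_natCast_atTop_atTop.atTop_mul_const a.hh
  have h2 := a.lim.comp (fl1.comp h1)
  have hper : Function.Periodic G h := a.per
  have h3 := a.real.comp h1
  have e : ∀ j : ℕ, G (Real.log (Real.exp (y + j * h))) = G y := fun j => by
    rw [Real.log_exp]; exact hper.nat_mul j y
  have h4 : Tendsto (fun j : ℕ => f ⌊Real.exp (y + j * h)⌋₊ / Real.exp (y + j * h) ^ s) atTop (𝓝 (G y)) := by
    have := h3.add_const (G y)
    rw [zero_add] at this
    refine this.congr fun j => ?_
    simp only [Function.comp]; rw [e]; ring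
  have h5 : Tendsto (fun t : ℝ => k * (br ⌊t⌋₊ ^ s / (⌊t⌋₊ : ℝ) ^ s * ((⌊t⌋₊ : ℝ) / t) ^ s)) atTop (𝓝 k) := by
    have h1 : Tendsto (fun t : ℝ => (⌊t⌋₊ : ℝ) / t) atTop (𝓝 1) := tendsto_nat_floor_div_atTop
    have h2 : Tendsto (fun t : ℝ => ((⌊t⌋₊ : ℝ) / t) ^ s) atTop (𝓝 1) := by
      have := (Real.continuousAt_rpow_const 1 s (Or.inl one_ne_zero)).tendsto.comp h1
      rwa [Real.one_rpow] at this
    have := (((br_div_lim s).comp fl1).mul h2).const_mul k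
    simpa using this
  refine le_of_tendsto_of_tendsto (h5.comp h1) h4 ?_
  filter_upwards [(fl1.comp h1).eventually (eventually_ge_atTop n0), h1.eventually (eventually_ge_atTop 1)] with j hj hj1
  simp only [Function.comp] at hj ⊢
  have h6 := hf _ hj
  set t := Real.exp (y + j * h)
  have h7 : (0 : ℝ) < ⌊t⌋₊ := by exact_mod_cast Nat.floor_pos.2 hj1
  have h8 : 0 < (⌊t⌋₊ : ℝ) ^ s := Real.rpow_pos_of_pos h7 s
  have h9 : 0 < t ^ s := Real.rpow_pos_of_pos (by linarith) s
  rw [Real.div_rpow h7.le (by linarith)]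
  have : k * (br ⌊t⌋₊ ^ s / (⌊t⌋₊ : ℝ) ^ s * ((⌊t⌋₊ : ℝ) ^ s / t ^ s)) = k * br ⌊t⌋₊ ^ s / t ^ s := by
    field_simp
  rw [this]
  exact div_le_div_of_nonneg_right h6 h9.le
end

section
variable {M A : ℕ} {p : Fin A → ℝ} {ρ : ℝ} {l : ℕ → Measure ℝ}

theorem Sys.ne (S : Sys M p ρ l) : Nonempty (Fin A) := ⟨⟨0, by have := S.hA; omega⟩⟩

theorem Sys.sum_lt (S : Sys M p ρ l) (s : ℝ) (hs : ρ < s) : (M : ℝ) * ∑ a, p a ^ s < 1 := by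
  have := S.ne
  rw [← S.hρ]
  refine mul_lt_mul_of_pos_left (Finset.sum_lt_sum_of_nonempty Finset.univ_nonempty fun a _ => ?_) S.M_pos
  exact Real.rpow_lt_rpow_of_exponent_gt (S.hp a).1 (S.hp a).2 hs

theorem Sys.sum_gt (S : Sys M p ρ l) (s : ℝ) (hs : s < ρ) : 1 < (M : ℝ) * ∑ a, p a ^ s := by
  have := S.ne
  rw [← S.hρ]
  refine mul_lt_mul_of_pos_left (Finset.sum_lt_sum_of_nonempty Finset.univ_nonempty fun a _ => ?_) S.M_pos
  exact Real.rpow_lt_rpow_of_exponent_gt (S.hp a).1 (S.hp a).2 hs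

theorem Sys.sum_one (S : Sys M p ρ l) : ∑ a, p a ^ (1 : ℝ) = 1 := by
  simp only [Real.rpow_one]; exact S.hw.2

theorem Sys.M_ge (S : Sys M p ρ l) : (1 : ℝ) ≤ M := by exact_mod_cast S.hM1

theorem Sys.ρ_ge (S : Sys M p ρ l) : 1 ≤ ρ := by
  by_contra h
  push Not at h
  have := S.sum_lt 1 h
  rw [S.sum_one] at this
  linarith [S.M_ge]

theorem Sys.ρ_lt (S : Sys M p ρ l) : ρ < 2 := by
  by_contra h
  push Not at h
  have h1 := S.hM
  have e : ∑ a, p a ^ 2 = ∑ a, p a ^ (2 : ℝ) := Finset.sum_congr rfl fun a _ => (Real.rpow_two _).symm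
  rw [e] at h1
  rcases h.eq_or_lt with h2 | h2
  · have := S.hρ; rw [← h2] at this; linarith
  · linarith [S.sum_gt 2 h2]

theorem Sys.M_one (S : Sys M p ρ l) (h : ρ = 1) : (M : ℝ) = 1 := by
  have := S.hρ
  rw [h, S.sum_one] at this; linarith

theorem Sys.wsum (S : Sys M p ρ l) (s : ℝ) : ∑ a, (M : ℝ) * p a ^ s = M * ∑ a, p a ^ s := by
  rw [Finset.mul_sum]

theorem Sys.wsum1 (S : Sys M p ρ l) (s : ℝ) : ∑ a, ((M : ℝ) * p a) * p a ^ s = M * ∑ a, p a ^ (s + 1) := by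
  rw [Finset.mul_sum]
  refine Finset.sum_congr rfl fun a _ => ?_
  rw [Real.rpow_add (S.hp a).1, Real.rpow_one]; ring

theorem Sys.wsum2 (S : Sys M p ρ l) (s : ℝ) : ∑ a, ((M : ℝ) * p a * p a) * p a ^ s = M * ∑ a, p a ^ (s + 2) := by
  rw [Finset.mul_sum]
  refine Finset.sum_congr rfl fun a _ => ?_
  rw [Real.rpow_add (S.hp a).1, Real.rpow_two]; ring

theorem Sys.c0 (S : Sys M p ρ l) : ∀ a : Fin A, 0 < (M : ℝ) := fun _ => S.M_pos
theorem Sys.c1 (S : Sys M p ρ l) : ∀ a : Fin A, 0 < (M : ℝ) * p a := fun a => mul_pos S.M_pos (S.hp a).1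
theorem Sys.c2 (S : Sys M p ρ l) : ∀ a : Fin A, 0 < (M : ℝ) * p a * p a := fun a => mul_pos (S.c1 a) (S.hp a).1

/-- second differences of the mean -/
theorem Sys.d2_bound (S : Sys M p ρ l) (ε : ℝ) (hε : 0 < ε) :
    ∃ C, 0 < C ∧ ∀ n, |dd l (n + 1) - dd l n| ≤ C * br n ^ (ρ - 2 + ε) := by
  refine sup_bound (fun a => (S.c2 a).le) S.hp (ρ - 2 + ε) ?_ (fun n => dd l (n + 1) - dd l n) 0 (A + 1) fun n hn => ?_
  · rw [S.wsum2]; exact S.sum_lt _ (by linarith)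
  · have h1 := TT_diff (fun a => (M : ℝ) * p a) p n (dd l)
    have h2 := S.d_rec n
    have h3 := S.d_rec (n + 1)
    rw [bbe_big S.hM1 S.hA (by omega), bbe_big S.hM1 S.hA (by omega : A < n)] at h2
    rw [bbe_big S.hM1 S.hA (by omega), bbe_big S.hM1 S.hA (by omega : A < n + 1)] at h3
    have h4 : dd l (n + 1) - dd l n = TT (fun a => (M : ℝ) * p a * p a) p n (fun k => dd l (k + 1) - dd l k) := by
      rw [← h1]; linarith
    have h5 := TT_abs (fun a => (S.c2 a).le) S.hp n (fun k => dd l (k + 1) - dd l k)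
    rw [← h4] at h5
    linarith

theorem Sys.d_asy (S : Sys M p ρ l) {h : ℝ} (R : RenH p h) : ∃ G, Asy p h (ρ - 1) (dd l) G := by
  obtain ⟨C, hC, H⟩ := S.d2_bound (1 / 4) (by norm_num)
  refine R.ren (fun a => (M : ℝ) * p a) S.c1 (ρ - 1) (1 / 4) C (A + 1) (dd l) ?_ (by norm_num) hC.le (fun n hn => ?_) fun n => ?_
  · rw [S.wsum1, sub_add_cancel]; exact S.hρ
  · have h2 := S.d_rec n
    rw [bbe_big S.hM1 S.hA (by omega), bbe_big S.hM1 S.hA (by omega : A < n)] at h2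
    have : dd l n - TT (fun a => (M : ℝ) * p a) p n (dd l) = 0 := by linarith
    rw [this, abs_zero]
    exact mul_nonneg hC.le (Real.rpow_nonneg (br_pos n).le _)
  · refine (H n).trans (le_of_eq ?_)
    congr 2; ring

theorem Sys.d_bound (S : Sys M p ρ l) : ∃ C, 0 < C ∧ ∀ n, |dd l n| ≤ C * br n ^ (ρ - 1) := by
  have := S.ne
  obtain ⟨h, R⟩ := exists_renH p S.hp
  obtain ⟨G, a⟩ := S.d_asy R
  exact a.bound

theorem Sys.d_lower (S : Sys M p ρ l) : ∃ k, 0 < k ∧ ∀ n, A + 1 ≤ n → k * br n ^ (ρ - 1) ≤ dd l n := by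
  have := S.ne
  refine lower_bound S.c1 S.hp (ρ - 1) ?_ (dd l) (A + 1) S.d_nonneg (fun n hn => S.d_pos n (by omega)) fun n hn => ?_
  · rw [S.wsum1, sub_add_cancel]; exact S.hρ
  · have h2 := S.d_rec n
    rw [bbe_big S.hM1 S.hA (by omega), bbe_big S.hM1 S.hA (by omega : A < n)] at h2
    linarith

theorem Sys.e_asy (S : Sys M p ρ l) {h : ℝ} (R : RenH p h) : ∃ G, Asy p h ρ (ee l) G ∧ ∀ y, 0 < G y := by
  have := S.ne
  obtain ⟨C, hC, H⟩ := S.d_bound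
  have key : ∀ n, A + 1 ≤ n → ee l n = TT (fun _ => (M : ℝ)) p n (ee l) := fun n hn => by
    have := S.e_rec n
    rw [bbe_big S.hM1 S.hA (by omega)] at this; linarith
  obtain ⟨G, a⟩ := R.ren (fun _ => (M : ℝ)) S.c0 ρ (1 / 2) C (A + 1) (ee l) (by rw [S.wsum]; exact S.hρ) (by norm_num) hC.le
    (fun n hn => by
      rw [← key n hn, sub_self, abs_zero]
      exact mul_nonneg hC.le (Real.rpow_nonneg (br_pos n).le _))
    (fun n => by
      refine (H n).trans (le_of_eq ?_)
      congr 2; ring)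
  have mono : Monotone (ee l) := monotone_nat_of_le_succ fun n => by
    have := S.d_nonneg n; unfold dd at this; linarith
  have e0 := S.e_small 0 (by norm_num)
  obtain ⟨k, hk, h⟩ := lower_bound S.c0 S.hp ρ (by rw [S.wsum]; exact S.hρ) (ee l) (A + 1)
    (fun n => by rw [← e0]; exact mono (Nat.zero_le n))
    (fun n hn => by have := S.e_two; have h2 : ee l 2 ≤ ee l n := mono (by have := S.hA; omega)
                    linarith)
    (fun n hn => (key n hn).ge)
  exact ⟨G, a, fun y => lt_of_lt_of_le hk (a.pos k hk _ h y)⟩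

end
end GT

namespace GT

/-- sum over letters of a function of the counts -/
noncomputable def SS {A n : ℕ} (f : ℕ → ℝ) (y : Fin n → Fin A) : ℝ := ∑ a, f (cnt y a)
/-- control functional -/
noncomputable def ZZ {A n : ℕ} (p : Fin A → ℝ) (J : ℕ) (y : Fin n → Fin A) : ℝ := ∑ a, Wf (p a) n (cnt y a) ^ J
/-- slopes -/
noncomputable def gg {A : ℕ} (p : Fin A → ℝ) (l : ℕ → Measure ℝ) (n : ℕ) (a : Fin A) : ℝ := dd l (fl (p a) n)
/-- mean slope -/
noncomputable def gb {A : ℕ} (p : Fin A → ℝ) (l : ℕ → Measure ℝ) (n : ℕ) : ℝ := Ex p (gg p l n)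
/-- variance of the slopes -/
noncomputable def QQ {A : ℕ} (p : Fin A → ℝ) (l : ℕ → Measure ℝ) (n : ℕ) : ℝ := Vr p (gg p l n)
/-- centered toll -/
noncomputable def Xc {A n : ℕ} (p : Fin A → ℝ) (l : ℕ → Measure ℝ) (y : Fin n → Fin A) : ℝ :=
  SS (ee l) y - Ex (pw p) (fun y : Fin n → Fin A => SS (ee l) y)
/-- its linearization -/
noncomputable def Lc {A n : ℕ} (p : Fin A → ℝ) (l : ℕ → Measure ℝ) (y : Fin n → Fin A) : ℝ :=
  ∑ i, (gg p l n (y i) - gb p l n)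
/-- variance of the one-tree toll -/
noncomputable def Tv {A : ℕ} (p : Fin A → ℝ) (l : ℕ → Measure ℝ) (n : ℕ) : ℝ :=
  Vr (pw p) (fun y : Fin n → Fin A => SS (ee l) y)

structure Par (M : ℕ) {A : ℕ} (p : Fin A → ℝ) (ρ : ℝ) (l : ℕ → Measure ℝ) (r δ : ℝ) : Prop extends Sys M p ρ l where
  hrρ : ρ ≤ r
  hδ : 0 < δ
  hδ4 : δ ≤ 1 / 4
  hrδ : ρ - 1 + 2 * δ ≤ r / 2
  hD : ∃ C, 0 < C ∧ ∀ n a b, |gg p l n a - gg p l n b| ≤ C * br n ^ ((r - 1) / 2)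

theorem br_le_of (n : ℕ) {x y : ℝ} (h : x ≤ y) : br n ^ x ≤ br n ^ y :=
  Real.rpow_le_rpow_of_exponent_le (one_le_br n) h

theorem br_rpow_pos (n : ℕ) (x : ℝ) : 0 < br n ^ x := Real.rpow_pos_of_pos (br_pos n) x

section
variable {M A : ℕ} {p : Fin A → ℝ} {ρ : ℝ} {l : ℕ → Measure ℝ} {r δ : ℝ}

theorem one_le_ZZ (hA : 2 ≤ A) {n : ℕ} (J : ℕ) (y : Fin n → Fin A) : 1 ≤ ZZ p J y := by
  have h : ∀ a, 1 ≤ Wf (p a) n (cnt y a) ^ J := fun a => one_le_pow₀ (one_le_W _ _ _)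
  have := Finset.single_le_sum (f := fun a => Wf (p a) n (cnt y a) ^ J)
    (fun a _ => zero_le_one.trans (h a)) (Finset.mem_univ (⟨0, by omega⟩ : Fin A))
  exact (h _).trans this

theorem W_le_ZZ {n : ℕ} {J K : ℕ} (h : K ≤ J) (y : Fin n → Fin A) (a : Fin A) : Wf (p a) n (cnt y a) ^ K ≤ ZZ p J y := by
  have h0 : ∀ a, 0 ≤ Wf (p a) n (cnt y a) ^ J := fun a => zero_le_one.trans (one_le_pow₀ (one_le_W _ _ _))
  have := Finset.single_le_sum (f := fun a => Wf (p a) n (cnt y a) ^ J) (fun a _ => h0 a) (Finset.mem_univ a)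
  exact (pow_le_pow_right₀ (one_le_W _ _ _) h).trans this

theorem ZZ_mono {n : ℕ} {J K : ℕ} (h : K ≤ J) (y : Fin n → Fin A) : ZZ p K y ≤ ZZ p J y :=
  Finset.sum_le_sum fun a _ => pow_le_pow_right₀ (one_le_W _ _ _) h

theorem ZZ_mom (hw : IsW p) (hp : ∀ a, 0 < p a ∧ p a < 1) (J : ℕ) : ∃ C, 0 < C ∧ ∀ n, Ex (pw p) (fun y : Fin n → Fin A => ZZ p J y) ≤ C := by
  obtain ⟨C, hC, h⟩ := Bn_W J
  refine ⟨A * C + 1, by positivity, fun n => ?_⟩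
  unfold ZZ
  rw [Ex_sum]
  have : ∑ a, Ex (pw p) (fun y : Fin n → Fin A => Wf (p a) n (cnt y a) ^ J) ≤ ∑ a : Fin A, C := by
    refine Finset.sum_le_sum fun a _ => ?_
    rw [Ex_cnt hw a n (fun k => Wf (p a) n k ^ J)]
    exact h (p a) (hp a).1.le (hp a).2.le n
  simp at this
  linarith

theorem ZZ_pow_mom (hw : IsW p) (hp : ∀ a, 0 < p a ∧ p a < 1) (J k : ℕ) :
    ∃ C, 0 < C ∧ ∀ n, Ex (pw p) (fun y : Fin n → Fin A => ZZ p J y ^ (k + 1)) ≤ C := by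
  obtain ⟨C, hC, h⟩ := ZZ_mom hw hp (J * (k + 1))
  refine ⟨(A : ℝ) ^ k * C + 1, by positivity, fun n => ?_⟩
  have key : ∀ y : Fin n → Fin A, ZZ p J y ^ (k + 1) ≤ (A : ℝ) ^ k * ZZ p (J * (k + 1)) y := fun y => by
    have h0 : ∀ a, 0 ≤ Wf (p a) n (cnt y a) ^ J := fun a => zero_le_one.trans (one_le_pow₀ (one_le_W _ _ _))
    have h1 := pow_sum_le_card_mul_sum_pow (s := Finset.univ) (fun a _ => h0 a) k
    unfold ZZ
    simp only [pow_mul]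
    simpa using h1
  have := Ex_mono (isW_pw hw) _ _ key
  rw [Ex_mul] at this
  have h2 := mul_le_mul_of_nonneg_left (h n) (by positivity : 0 ≤ (A : ℝ) ^ k)
  linarith

theorem Sys.Lc_eq (S : Sys M p ρ l) {n : ℕ} (y : Fin n → Fin A) :
    Lc p l y = ∑ a, (gg p l n a - gb p l n) * (cnt y a - n * p a) := by
  unfold Lc
  rw [sum_cnt y (fun a => gg p l n a - gb p l n)]
  have : ∑ a, (gg p l n a - gb p l n) * (n * p a) = 0 := by
    have e : ∑ a, (gg p l n a - gb p l n) * (n * p a) = n * (∑ a, p a * gg p l n a) - n * gb p l n * ∑ a, p a := by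
      rw [Finset.mul_sum, Finset.mul_sum, ← Finset.sum_sub_distrib]
      exact Finset.sum_congr rfl fun a _ => by ring
    rw [e, S.hw.2]
    have : gb p l n = ∑ a, p a * gg p l n a := rfl
    rw [← this]; ring
  have e2 : ∑ a, (gg p l n a - gb p l n) * (cnt y a - n * p a) =
      ∑ a, (cnt y a : ℝ) * (gg p l n a - gb p l n) - ∑ a, (gg p l n a - gb p l n) * (n * p a) := by
    rw [← Finset.sum_sub_distrib]
    exact Finset.sum_congr rfl fun a _ => by ring
  rw [e2, this, sub_zero]

theorem Sys.gb_close (S : Sys M p ρ l) {n : ℕ} {D : ℝ} (h : ∀ a b, |gg p l n a - gg p l n b| ≤ D) (a : Fin A) :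
    |gg p l n a - gb p l n| ≤ D := by
  have e : gg p l n a - gb p l n = Ex p (fun b => gg p l n a - gg p l n b) := by
    rw [Ex_sub, Ex_const S.hw]; rfl
  rw [e]
  refine (Ex_abs S.hw _).trans ((Ex_mono S.hw _ _ (h a)).trans (Ex_const S.hw D).le)

theorem Sys.gb_Lc (S : Sys M p ρ l) (n : ℕ) : Ex (pw p) (fun y : Fin n → Fin A => Lc p l y) = 0 := by
  unfold Lc
  rw [Ex_sum]
  refine Finset.sum_eq_zero fun i _ => ?_
  rw [Ex_pw_one S.hw i (fun a => gg p l n a - gb p l n), Ex_sub, Ex_const S.hw]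
  exact sub_self _

theorem Sys.Lc_var (S : Sys M p ρ l) (n : ℕ) : Ex (pw p) (fun y : Fin n → Fin A => Lc p l y ^ 2) = n * QQ p l n := by
  have h := Vr_pw_sum (ι := Fin n) S.hw (fun a => gg p l n a - gb p l n)
  have h1 : Vr (pw p) (fun y : Fin n → Fin A => Lc p l y) = Ex (pw p) (fun y : Fin n → Fin A => Lc p l y ^ 2) := by
    rw [Vr_eq (isW_pw S.hw), S.gb_Lc]; ring
  have h2 : Vr p (fun a => gg p l n a - gb p l n) = QQ p l n := by
    rw [Vr_eq S.hw, Ex_sub, Ex_const S.hw]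
    unfold QQ Vr gb; ring
  rw [h2] at h
  rw [← h1]
  unfold Lc
  rw [h]; simp

theorem Sys.Xc_mean (S : Sys M p ρ l) (n : ℕ) : Ex (pw p) (fun y : Fin n → Fin A => Xc p l y) = 0 := by
  unfold Xc
  rw [Ex_sub, Ex_const (isW_pw S.hw), sub_self]

theorem Tv_eq (n : ℕ) : Tv p l n = Ex (pw p) (fun y : Fin n → Fin A => Xc p l y ^ 2) := rfl

/-- linearization of the toll -/
theorem Par.lin (P : Par M p ρ l r δ) : ∃ C, 0 < C ∧ ∃ J : ℕ, ∀ n (y : Fin n → Fin A),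
    |Xc p l y - Lc p l y| ≤ C * br n ^ (r / 2 - δ) * ZZ p J y ∧
    |Lc p l y| ≤ C * br n ^ (r / 2) * ZZ p J y ∧ |Xc p l y| ≤ C * br n ^ (r / 2) * ZZ p J y := by
  have S := P.toSys
  have hW : ∀ n, IsW (pw p : (Fin n → Fin A) → ℝ) := fun n => isW_pw S.hw
  obtain ⟨C1, hC1, h1⟩ := S.d2_bound δ P.hδ
  choose C2 hC2 J2 h2 using fun a => smooth2 (S.hp a).1 (S.hp a).2.le (ρ - 2 + δ)
  obtain ⟨C3, hC3, h3⟩ := P.hD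
  set J := ∑ a, J2 a + 1 with hJ
  have hJa : ∀ a, J2 a ≤ J := fun a => (Finset.single_le_sum (f := J2) (fun _ _ => Nat.zero_le _) (Finset.mem_univ a)).trans (Nat.le_succ _)
  obtain ⟨C4, hC4, h4⟩ := ZZ_mom S.hw S.hp J
  set K := ∑ a, C1 * C2 a with hK
  have hK0 : 0 ≤ K := Finset.sum_nonneg fun a _ => mul_nonneg hC1.le (hC2 a).le
  -- the remainder
  have hR : ∀ n (y : Fin n → Fin A), |SS (ee l) y - ∑ a, (ee l (fl (p a) n) + gg p l n a * (cnt y a - fl (p a) n))| ≤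
      K * br n ^ (r / 2 - δ) * ZZ p J y := by
    intro n y
    unfold SS
    rw [← Finset.sum_sub_distrib]
    refine (Finset.abs_sum_le_sum_abs _ _).trans ?_
    rw [hK, Finset.sum_mul, Finset.sum_mul]
    refine Finset.sum_le_sum fun a _ => ?_
    have := h2 a (ee l) C1 hC1.le h1 n (cnt y a) (cnt_le y a)
    have e : ee l (cnt y a) - (ee l (fl (p a) n) + gg p l n a * (cnt y a - fl (p a) n)) =
      ee l (cnt y a) - ee l (fl (p a) n) - (ee l (fl (p a) n + 1) - ee l (fl (p a) n)) * (cnt y a - fl (p a) n) := by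
      unfold gg dd; ring
    rw [e]
    refine this.trans ?_
    have h5 : br n ^ (ρ - 2 + δ + 1) ≤ br n ^ (r / 2 - δ) := br_le_of n (by linarith [P.hrδ])
    have h6 := W_le_ZZ (p := p) (hJa a) y a
    have h7 : 0 ≤ Wf (p a) n (cnt y a) ^ J2 a := zero_le_one.trans (one_le_pow₀ (one_le_W _ _ _))
    have h8 := mul_le_mul h5 h6 h7 (br_rpow_pos n _).le
    have h9 := mul_le_mul_of_nonneg_left h8 (mul_nonneg hC1.le (hC2 a).le)
    calc _ = C1 * C2 a * (br n ^ (ρ - 2 + δ + 1) * Wf (p a) n (cnt y a) ^ J2 a) := by ring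
      _ ≤ _ := h9
      _ = _ := by ring
  have hL : ∀ n (y : Fin n → Fin A), |Lc p l y| ≤ (A * C3) * br n ^ (r / 2) * ZZ p J y := by
    intro n y
    rw [S.Lc_eq]
    refine (Finset.abs_sum_le_sum_abs _ _).trans ?_
    have : ∀ a ∈ Finset.univ, |(gg p l n a - gb p l n) * (cnt y a - n * p a)| ≤ C3 * br n ^ (r / 2) * ZZ p J y := by
      intro a _
      rw [abs_mul]
      have h5 := S.gb_close (h3 n) a
      have h6 := abs_le_W (p a) n (cnt y a)
      have h7 := W_le_ZZ (p := p) (by omega : 1 ≤ J) y a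
      rw [pow_one] at h7
      have h8 : |(cnt y a : ℝ) - n * p a| ≤ √(br n) * ZZ p J y :=
        (by linarith : |(cnt y a : ℝ) - n * p a| ≤ √(br n) * Wf (p a) n (cnt y a)).trans
          (mul_le_mul_of_nonneg_left h7 (Real.sqrt_nonneg _))
      refine (mul_le_mul h5 h8 (abs_nonneg _) (mul_nonneg hC3.le (br_rpow_pos n _).le)).trans (le_of_eq ?_)
      rw [Real.sqrt_eq_rpow]
      have : br n ^ (r / 2) = br n ^ ((r - 1) / 2) * br n ^ ((1 : ℝ) / 2) := by
        rw [← Real.rpow_add (br_pos n)]; congr 1; ring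
      rw [this]; ring
    refine (Finset.sum_le_sum this).trans (le_of_eq ?_)
    simp; ring
  have hX : ∀ n (y : Fin n → Fin A), |Xc p l y - Lc p l y| ≤ (K * (1 + C4)) * br n ^ (r / 2 - δ) * ZZ p J y := by
    intro n y
    set Rf : (Fin n → Fin A) → ℝ := fun y => SS (ee l) y - ∑ a, (ee l (fl (p a) n) + gg p l n a * (cnt y a - fl (p a) n)) with hRf
    have e1 : ∀ y : Fin n → Fin A, SS (ee l) y - Lc p l y = Rf y + (∑ a, (ee l (fl (p a) n) + (gg p l n a * (n * p a - fl (p a) n)) + gb p l n * (cnt y a - n * p a))) := by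
      intro y
      rw [hRf, S.Lc_eq]
      have : ∀ u v w z : ℝ, v + z = w → u - v = u - w + z := fun u v w z h => by linarith
      refine this _ _ _ _ ?_
      rw [← Finset.sum_add_distrib]
      exact Finset.sum_congr rfl fun a _ => by ring
    have e2 : ∀ y : Fin n → Fin A, ∑ a, (ee l (fl (p a) n) + (gg p l n a * (n * p a - fl (p a) n)) + gb p l n * (cnt y a - n * p a)) =
        ∑ a, (ee l (fl (p a) n) + (gg p l n a * (n * p a - fl (p a) n))) := by
      intro y
      rw [Finset.sum_add_distrib, ← Finset.mul_sum, Finset.sum_sub_distrib, ← Finset.mul_sum, S.hw.2]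
      have := cnt_sum y
      have : ∑ a, (cnt y a : ℝ) = n := by exact_mod_cast this
      rw [this]; ring
    set c := ∑ a, (ee l (fl (p a) n) + (gg p l n a * (n * p a - fl (p a) n)))
    have e3 : ∀ y : Fin n → Fin A, SS (ee l) y = Rf y + c + Lc p l y := fun y => by
      have := e1 y; rw [e2 y] at this; linarith
    have e4 : Ex (pw p) (fun y : Fin n → Fin A => SS (ee l) y) = Ex (pw p) Rf + c := by
      simp only [e3]
      rw [Ex_add, Ex_add, Ex_const (hW n), S.gb_Lc]; ring
    have e5 : Xc p l y - Lc p l y = Rf y - Ex (pw p) Rf := by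
      unfold Xc; rw [e4, e3 y]; ring
    rw [e5]
    have h5 : |Ex (pw p) Rf| ≤ K * br n ^ (r / 2 - δ) * C4 := by
      refine (Ex_abs (hW n) _).trans ((Ex_mono (hW n) _ _ (hR n)).trans ?_)
      rw [Ex_mul]
      exact mul_le_mul_of_nonneg_left (h4 n) (mul_nonneg hK0 (br_rpow_pos n _).le)
    have h6 := hR n y
    have h7 := one_le_ZZ (p := p) S.hA J y
    have h8 : K * br n ^ (r / 2 - δ) * C4 ≤ K * br n ^ (r / 2 - δ) * C4 * ZZ p J y :=
      le_mul_of_one_le_right (mul_nonneg (mul_nonneg hK0 (br_rpow_pos n _).le) hC4.le) h7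
    have := abs_sub (Rf y) (Ex (pw p) Rf)
    have e9 : (K * (1 + C4)) * br n ^ (r / 2 - δ) * ZZ p J y = K * br n ^ (r / 2 - δ) * ZZ p J y + K * br n ^ (r / 2 - δ) * C4 * ZZ p J y := by ring
    rw [e9]
    linarith
  have hz : ∀ n (y : Fin n → Fin A), 0 ≤ ZZ p J y := fun n y => zero_le_one.trans (one_le_ZZ S.hA J y)
  have hq : 0 ≤ K * (1 + C4) := mul_nonneg hK0 (by linarith)
  have hq2 : 0 ≤ A * C3 := by positivity
  refine ⟨K * (1 + C4) + A * C3 + 1, by linarith, J, fun n y => ⟨?_, ?_, ?_⟩⟩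
  · refine (hX n y).trans (mul_le_mul_of_nonneg_right (mul_le_mul_of_nonneg_right (by linarith) (br_rpow_pos n _).le) (hz n y))
  · refine (hL n y).trans (mul_le_mul_of_nonneg_right (mul_le_mul_of_nonneg_right (by linarith) (br_rpow_pos n _).le) (hz n y))
  · have h5 := hX n y
    have h6 := hL n y
    have h7 : br n ^ (r / 2 - δ) ≤ br n ^ (r / 2) := br_le_of n (by linarith [P.hδ])
    have h8 : |Xc p l y| ≤ |Xc p l y - Lc p l y| + |Lc p l y| := by
      have := abs_add_le (Xc p l y - Lc p l y) (Lc p l y)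
      rwa [sub_add_cancel] at this
    have h9 : (K * (1 + C4)) * br n ^ (r / 2 - δ) * ZZ p J y ≤ (K * (1 + C4)) * br n ^ (r / 2) * ZZ p J y :=
      mul_le_mul_of_nonneg_right (mul_le_mul_of_nonneg_left h7 hq) (hz n y)
    have h10 : 0 ≤ br n ^ (r / 2) * ZZ p J y := mul_nonneg (br_rpow_pos n _).le (hz n y)
    nlinarith

theorem sq_le_of_abs {x c z : ℝ} (h : |x| ≤ c * z) : x ^ 2 ≤ c ^ 2 * z ^ 2 := by
  rw [← sq_abs, ← mul_pow]; exact pow_le_pow_left₀ (abs_nonneg _) h 2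

theorem br_sq (n : ℕ) (s : ℝ) : (br n ^ s) ^ 2 = br n ^ (2 * s) := by
  rw [← Real.rpow_natCast, ← Real.rpow_mul (br_pos n).le]; congr 1; push_cast; ring

theorem br_mul (n : ℕ) (s t : ℝ) : br n ^ s * br n ^ t = br n ^ (s + t) := (Real.rpow_add (br_pos n) s t).symm

/-- size of the toll variance -/
theorem Par.T_bound (P : Par M p ρ l r δ) : ∃ C, 0 < C ∧ ∀ n, Tv p l n ≤ C * br n ^ r ∧
    |Tv p l n - n * QQ p l n| ≤ C * br n ^ (r - δ) := by
  have S := P.toSys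
  have hW : ∀ n, IsW (pw p : (Fin n → Fin A) → ℝ) := fun n => isW_pw S.hw
  obtain ⟨C, hC, J, h⟩ := P.lin
  obtain ⟨C2, hC2, h2⟩ := ZZ_pow_mom S.hw S.hp J 1
  refine ⟨2 * C ^ 2 * C2, by positivity, fun n => ⟨?_, ?_⟩⟩
  · rw [Tv_eq]
    have : ∀ y : Fin n → Fin A, Xc p l y ^ 2 ≤ C ^ 2 * br n ^ r * ZZ p J y ^ 2 := fun y => by
      have := sq_le_of_abs (h n y).2.2
      rw [mul_pow, br_sq] at this
      convert this using 4; ring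
    refine (Ex_mono (hW n) _ _ this).trans ?_
    rw [Ex_mul]
    have h5 := mul_le_mul_of_nonneg_left (h2 n) (by have := br_rpow_pos n r; positivity : 0 ≤ C ^ 2 * br n ^ r)
    have : 0 ≤ C ^ 2 * br n ^ r * C2 := by have := br_rpow_pos n r; positivity
    simp only [Nat.reduceAdd] at h5
    linarith
  · rw [Tv_eq, ← S.Lc_var, ← Ex_sub]
    refine (Ex_abs (hW n) _).trans ?_
    have : ∀ y : Fin n → Fin A, |Xc p l y ^ 2 - Lc p l y ^ 2| ≤ 2 * C ^ 2 * br n ^ (r - δ) * ZZ p J y ^ 2 := fun y => by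
      obtain ⟨h5, h6, h7⟩ := h n y
      have e : Xc p l y ^ 2 - Lc p l y ^ 2 = (Xc p l y - Lc p l y) * (Xc p l y + Lc p l y) := by ring
      rw [e, abs_mul]
      have h8 : |Xc p l y + Lc p l y| ≤ 2 * (C * br n ^ (r / 2) * ZZ p J y) := (abs_add_le _ _).trans (by linarith)
      refine (mul_le_mul h5 h8 (abs_nonneg _) ((abs_nonneg _).trans h5)).trans (le_of_eq ?_)
      have : br n ^ (r - δ) = br n ^ (r / 2 - δ) * br n ^ (r / 2) := by rw [br_mul]; congr 1; ring
      rw [this]; ring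
    refine (Ex_mono (hW n) _ _ this).trans ?_
    rw [Ex_mul]
    have h5 := mul_le_mul_of_nonneg_left (h2 n) (by have := br_rpow_pos n (r - δ); positivity : 0 ≤ 2 * C ^ 2 * br n ^ (r - δ))
    simp only [Nat.reduceAdd] at h5
    linarith

end
end GT

namespace GT
section
variable {M A : ℕ} {p : Fin A → ℝ} {ρ : ℝ} {l : ℕ → Measure ℝ} {r δ : ℝ}

theorem Sys.cm_eq (S : Sys M p ρ l) {n : ℕ} (hn : A < n) (x : Fin M → Fin n → Fin A) :
    cm (ee l) x = ∑ m, SS (ee l) (x m) := by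
  unfold cm SS
  rw [bb_big S.hM1 S.hA hn, zero_add, Fintype.sum_prod_type]

theorem Sys.t_eq (S : Sys M p ρ l) {n : ℕ} (hn : A < n) :
    Vr (pw (pw p)) (fun x : Fin M → Fin n → Fin A => cm (ee l) x) = M * Tv p l n := by
  simp only [S.cm_eq hn]
  rw [Vr_pw_sum (isW_pw S.hw) (fun y : Fin n → Fin A => SS (ee l) y)]
  simp [Tv]

theorem Sys.v_rec' (S : Sys M p ρ l) {n : ℕ} (hn : A < n) :
    vv l n = TT (fun _ => (M : ℝ)) p n (vv l) + M * Tv p l n := by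
  rw [← S.t_eq hn]; exact S.v_rec n

theorem Vr_shift {Ω : Type*} [Fintype Ω] {w : Ω → ℝ} (hw : IsW w) (F : Ω → ℝ) (c : ℝ) :
    Vr w F = Ex w (fun x => (F x - c) ^ 2) - (Ex w (fun x => F x - c)) ^ 2 := by
  have h : (fun x => (F x - c) ^ 2) = fun x => (F x ^ 2 - 2 * c * F x) + c ^ 2 := by
    funext x; ring
  rw [h, Ex_add, Ex_sub, Ex_mul, Ex_const hw, Vr_eq hw, Ex_sub, Ex_const hw]
  ring

theorem SS_cons {n : ℕ} (f : ℕ → ℝ) (a : Fin A) (y : Fin n → Fin A) :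
    SS f (Fin.cons a y : Fin (n + 1) → Fin A) = SS f y + (f (cnt y a + 1) - f (cnt y a)) := by
  unfold SS
  rw [← sub_eq_iff_eq_add', ← Finset.sum_sub_distrib, Finset.sum_eq_single a]
  · rw [cnt_cons]; simp
  · intro b _ hb
    rw [cnt_cons, if_neg (Ne.symm hb)]; simp
  · simp

theorem Par.T_diff (P : Par M p ρ l r δ) : ∃ C, 0 < C ∧ ∀ n, |Tv p l (n + 1) - Tv p l n| ≤ C * br n ^ (r - δ - 1 / 2) := by
  have S := P.toSys
  have hw := S.hw
  have hW : ∀ n, IsW (pw p : (Fin n → Fin A) → ℝ) := fun n => isW_pw S.hw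
  obtain ⟨C, hC, J0, h⟩ := P.lin
  obtain ⟨C1, hC1, h1⟩ := S.d2_bound δ P.hδ
  choose C2 hC2 J2 h2 using fun a => smooth1 (S.hp a).1 (S.hp a).2.le (ρ - 2 + δ)
  obtain ⟨C3, hC3, h3⟩ := P.hD
  set J := ∑ a, J2 a + J0 with hJ
  have hJa : ∀ a, J2 a ≤ J := fun a => (Finset.single_le_sum (f := J2) (fun _ _ => Nat.zero_le _) (Finset.mem_univ a)).trans (Nat.le_add_right _ _)
  obtain ⟨C4, hC4, h4⟩ := ZZ_pow_mom S.hw S.hp J 1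
  set K := ∑ a, C1 * C2 a with hK
  have hK0 : 0 ≤ K := Finset.sum_nonneg fun a _ => mul_nonneg hC1.le (hC2 a).le
  have hz : ∀ n (y : Fin n → Fin A), 1 ≤ ZZ p J y := fun n y => one_le_ZZ S.hA J y
  have hX : ∀ n (y : Fin n → Fin A), |Xc p l y| ≤ C * br n ^ (r / 2) * ZZ p J y := fun n y =>
    (h n y).2.2.trans (mul_le_mul_of_nonneg_left (ZZ_mono (Nat.le_add_left _ _) y) (mul_nonneg hC.le (br_rpow_pos n _).le))
  have hd : ∀ n (y : Fin n → Fin A) a, |dd l (cnt y a) - gg p l n a| ≤ K * br n ^ (r / 2 - δ - 1 / 2) * ZZ p J y := by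
    intro n y a
    refine (h2 a (dd l) C1 hC1.le h1 n (cnt y a) (cnt_le y a)).trans ?_
    have h5 : br n ^ (ρ - 2 + δ + 1 / 2) ≤ br n ^ (r / 2 - δ - 1 / 2) := br_le_of n (by linarith [P.hrδ])
    have h6 := W_le_ZZ (p := p) (hJa a) y a
    have h7 : 0 ≤ Wf (p a) n (cnt y a) ^ J2 a := zero_le_one.trans (one_le_pow₀ (one_le_W _ _ _))
    have h8 := mul_le_mul h5 h6 h7 (br_rpow_pos n _).le
    have h9 : C1 * C2 a ≤ K := Finset.single_le_sum (f := fun a => C1 * C2 a) (fun a _ => mul_nonneg hC1.le (hC2 a).le) (Finset.mem_univ a)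
    have h10 := mul_le_mul h9 h8 (mul_nonneg (br_rpow_pos n _).le h7) hK0
    calc _ = C1 * C2 a * (br n ^ (ρ - 2 + δ + 1 / 2) * Wf (p a) n (cnt y a) ^ J2 a) := by ring
      _ ≤ _ := h10
      _ = _ := by ring
  have hd2 : ∀ n (y : Fin n → Fin A) a, |dd l (cnt y a) - gb p l n| ≤ (K + C3) * br n ^ ((r - 1) / 2) * ZZ p J y := by
    intro n y a
    have h5 := hd n y a
    have h6 := S.gb_close (h3 n) a
    have h7 : br n ^ (r / 2 - δ - 1 / 2) ≤ br n ^ ((r - 1) / 2) := br_le_of n (by linarith [P.hδ])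
    have h8 := abs_add_le (dd l (cnt y a) - gg p l n a) (gg p l n a - gb p l n)
    rw [sub_add_sub_cancel] at h8
    have h9 : K * br n ^ (r / 2 - δ - 1 / 2) * ZZ p J y ≤ K * br n ^ ((r - 1) / 2) * ZZ p J y :=
      mul_le_mul_of_nonneg_right (mul_le_mul_of_nonneg_left h7 hK0) (by linarith [hz n y])
    have h10 : C3 * br n ^ ((r - 1) / 2) ≤ C3 * br n ^ ((r - 1) / 2) * ZZ p J y :=
      le_mul_of_one_le_right (mul_nonneg hC3.le (br_rpow_pos n _).le) (hz n y)
    have e : (K + C3) * br n ^ ((r - 1) / 2) * ZZ p J y = K * br n ^ ((r - 1) / 2) * ZZ p J y + C3 * br n ^ ((r - 1) / 2) * ZZ p J y := by ring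
    linarith
  refine ⟨2 * C * K * C4 + (K + C3) ^ 2 * C4, by positivity, fun n => ?_⟩
  -- the double expectation
  set E2 : (Fin A → (Fin n → Fin A) → ℝ) → ℝ := fun F => Ex p (fun a => Ex (pw p) (F a)) with hE2
  have E2mono : ∀ F G, (∀ a y, F a y ≤ G a y) → E2 F ≤ E2 G := fun F G hFG =>
    Ex_mono hw _ _ fun a => Ex_mono (hW n) _ _ (hFG a)
  have E2abs : ∀ F, |E2 F| ≤ E2 (fun a y => |F a y|) := fun F =>
    (Ex_abs hw _).trans (Ex_mono hw _ _ fun a => Ex_abs (hW n) _)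
  have E2add : ∀ F G, E2 (fun a y => F a y + G a y) = E2 F + E2 G := fun F G => by
    simp only [hE2, Ex_add]
  have E2mul : ∀ (c : ℝ) F, E2 (fun a y => c * F a y) = c * E2 F := fun c F => by
    simp only [hE2, Ex_mul]
  have E2Z : E2 (fun _ y => ZZ p J y ^ 2) ≤ C4 := by
    simp only [hE2]; rw [Ex_const hw]; exact h4 n
  have e1 : Tv p l (n + 1) = E2 (fun a y => (Xc p l y + (dd l (cnt y a) - gb p l n)) ^ 2) -
      (E2 (fun a y => Xc p l y + (dd l (cnt y a) - gb p l n))) ^ 2 := by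
    unfold Tv
    rw [Vr_shift (hW (n + 1)) _ (Ex (pw p) (fun y : Fin n → Fin A => SS (ee l) y) + gb p l n), Ex_cons, Ex_cons]
    have : ∀ a (y : Fin n → Fin A), SS (ee l) (Fin.cons a y : Fin (n + 1) → Fin A) - (Ex (pw p) (fun y : Fin n → Fin A => SS (ee l) y) + gb p l n)
       = Xc p l y + (dd l (cnt y a) - gb p l n) := fun a y => by
      rw [SS_cons]; unfold Xc dd; ring
    simp only [this, hE2]
  have hX0 : E2 (fun _ y => Xc p l y) = 0 := by
    simp only [hE2]; rw [Ex_const hw, S.Xc_mean]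
  have hXg : E2 (fun a y => Xc p l y * (gg p l n a - gb p l n)) = 0 := by
    have : ∀ a, Ex (pw p) (fun y : Fin n → Fin A => Xc p l y * (gg p l n a - gb p l n)) = 0 := fun a => by
      have e : ∀ y : Fin n → Fin A, Xc p l y * (gg p l n a - gb p l n) = (gg p l n a - gb p l n) * Xc p l y := fun y => mul_comm _ _
      simp only [e]
      rw [Ex_mul, S.Xc_mean, mul_zero]
    simp only [hE2, this]; exact Ex_const hw _
  have e2 : E2 (fun a y => (Xc p l y + (dd l (cnt y a) - gb p l n)) ^ 2) =
      Tv p l n + 2 * E2 (fun a y => Xc p l y * (dd l (cnt y a) - gg p l n a)) + E2 (fun a y => (dd l (cnt y a) - gb p l n) ^ 2) := by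
    have : (fun a (y : Fin n → Fin A) => (Xc p l y + (dd l (cnt y a) - gb p l n)) ^ 2) =
      fun a y => (Xc p l y ^ 2 + (2 * (Xc p l y * (dd l (cnt y a) - gg p l n a)) + 2 * (Xc p l y * (gg p l n a - gb p l n)))) + (dd l (cnt y a) - gb p l n) ^ 2 := by
      funext a y; ring
    rw [this, E2add, E2add, E2add, E2mul, E2mul, hXg]
    have : E2 (fun a y => Xc p l y ^ 2) = Tv p l n := by simp only [hE2]; rw [Ex_const hw]; rfl
    rw [this]; ring
  rw [E2add, hX0, zero_add] at e1
  rw [e2] at e1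
  set F3 := E2 (fun a y => dd l (cnt y a) - gb p l n) with hF3
  set F2 := E2 (fun a y => (dd l (cnt y a) - gb p l n) ^ 2) with hF2
  set F1 := E2 (fun a y => Xc p l y * (dd l (cnt y a) - gg p l n a)) with hF1
  have b1 : |F1| ≤ C * K * C4 * br n ^ (r - δ - 1 / 2) := by
    refine (E2abs _).trans ((E2mono _ (fun a y => (C * K * br n ^ (r - δ - 1 / 2)) * ZZ p J y ^ 2) fun a y => ?_).trans ?_)
    · rw [abs_mul]
      refine (mul_le_mul (hX n y) (hd n y a) (abs_nonneg _) ((abs_nonneg _).trans (hX n y))).trans (le_of_eq ?_)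
      have : br n ^ (r - δ - 1 / 2) = br n ^ (r / 2) * br n ^ (r / 2 - δ - 1 / 2) := by rw [br_mul]; congr 1; ring
      rw [this]; ring
    · rw [E2mul]
      refine (mul_le_mul_of_nonneg_left E2Z (mul_nonneg (mul_nonneg hC.le hK0) (br_rpow_pos n _).le)).trans (le_of_eq (by ring))
  have b2 : F2 ≤ (K + C3) ^ 2 * C4 * br n ^ (r - δ - 1 / 2) := by
    refine (E2mono _ (fun a y => ((K + C3) ^ 2 * br n ^ (r - δ - 1 / 2)) * ZZ p J y ^ 2) fun a y => ?_).trans ?_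
    · have := sq_le_of_abs (hd2 n y a)
      rw [mul_pow, br_sq] at this
      refine this.trans (mul_le_mul_of_nonneg_right (mul_le_mul_of_nonneg_left (br_le_of n ?_) (sq_nonneg _)) (sq_nonneg _))
      linarith [P.hδ4]
    · rw [E2mul]
      refine (mul_le_mul_of_nonneg_left E2Z (mul_nonneg (sq_nonneg _) (br_rpow_pos n _).le)).trans (le_of_eq (by ring))
  have b3 : F3 ^ 2 ≤ F2 := by
    refine (Ex_sq_le hw _).trans (Ex_mono hw _ _ fun a => Ex_sq_le (hW n) _)
  have e3 : Tv p l (n + 1) - Tv p l n = 2 * F1 + (F2 - F3 ^ 2) := by linarith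
  rw [e3]
  refine (abs_add_le _ _).trans ?_
  rw [abs_mul, abs_of_nonneg (by norm_num : (0 : ℝ) ≤ 2), abs_of_nonneg (by linarith : 0 ≤ F2 - F3 ^ 2)]
  have := sq_nonneg F3
  nlinarith

/-- differences of the variance -/
theorem Par.v_diff (P : Par M p ρ l r δ) : ∃ C, 0 < C ∧ ∀ n, |vv l (n + 1) - vv l n| ≤ C * br n ^ (r - δ - 1 / 2) := by
  have S := P.toSys
  obtain ⟨C, hC, h⟩ := P.T_diff
  refine sup_bound (fun a => (S.c1 a).le) S.hp (r - δ - 1 / 2) ?_ (fun n => vv l (n + 1) - vv l n) (M * C) (A + 1) fun n hn => ?_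
  · rw [S.wsum1]; exact S.sum_lt _ (by linarith [P.hrρ, P.hδ4])
  · have h1 := TT_diff (fun _ => (M : ℝ)) p n (vv l)
    have h2 := S.v_rec' (by omega : A < n)
    have h3 := S.v_rec' (by omega : A < n + 1)
    have h4 : vv l (n + 1) - vv l n = TT (fun a => (M : ℝ) * p a) p n (fun k => vv l (k + 1) - vv l k) + M * (Tv p l (n + 1) - Tv p l n) := by
      rw [← h1]; linarith
    have h5 := TT_abs (fun a => (S.c1 a).le) S.hp n (fun k => vv l (k + 1) - vv l k)
    rw [h4]
    refine (abs_add_le _ _).trans (add_le_add h5 ?_)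
    rw [abs_mul, abs_of_pos S.M_pos, mul_assoc]
    exact mul_le_mul_of_nonneg_left (h n) S.M_pos.le

theorem Par.Q_bound (P : Par M p ρ l r δ) : ∃ C, 0 < C ∧ ∀ n, QQ p l n ≤ C * br n ^ (r - 1) := by
  have S := P.toSys
  obtain ⟨C, hC, h⟩ := P.hD
  refine ⟨C ^ 2, by positivity, fun n => ?_⟩
  unfold QQ Vr
  refine (Ex_mono S.hw _ (fun _ => C ^ 2 * br n ^ (r - 1)) fun a => ?_).trans (Ex_const S.hw _).le
  have h1 := S.gb_close (h n) a
  have h2 : |gg p l n a - Ex p (gg p l n)| ≤ C * br n ^ ((r - 1) / 2) := h1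
  have := sq_le_of_abs h2
  rw [br_sq] at this
  convert this using 3; ring

end
end GT

namespace GT

theorem Vr_pos {Ω : Type*} [Fintype Ω] {w : Ω → ℝ} (hw : IsW w) (h0 : ∀ x, 0 < w x) (F : Ω → ℝ) (x y : Ω) (hxy : F x ≠ F y) :
    0 < Vr w F := by
  refine lt_of_le_of_ne (Vr_nonneg hw F) fun h => hxy ?_
  have h1 : ∀ z ∈ Finset.univ, w z • (F z - Ex w F) ^ 2 = 0 :=
    (Finset.sum_eq_zero_iff_of_nonneg fun z _ => mul_nonneg (h0 z).le (sq_nonneg _)).1 h.symm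
  have h2 : ∀ z, F z = Ex w F := fun z => by
    have := h1 z (Finset.mem_univ z)
    rcases mul_eq_zero.1 this with h3 | h3
    · exact absurd h3 (h0 z).ne'
    · exact sub_eq_zero.1 (pow_eq_zero_iff (two_ne_zero) |>.1 h3)
  rw [h2 x, h2 y]

theorem sq_lim (x y : ℕ → ℝ) (C : ℝ) (hx : ∀ᶠ n in atTop, |x n| ≤ C) (h : Tendsto (fun n => y n - x n) atTop (𝓝 0)) :
    Tendsto (fun n => y n ^ 2 - x n ^ 2) atTop (𝓝 0) := by
  have h1 : Tendsto (fun n => (y n - x n) * x n) atTop (𝓝 0) := by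
    refine squeeze_zero_norm' (a := fun n => |y n - x n| * C) ?_ ?_
    · filter_upwards [hx] with n hn
      rw [norm_mul]
      exact mul_le_mul_of_nonneg_left hn (norm_nonneg _)
    · simpa using h.abs.mul_const C
  have h2 := (h.mul h).add (h1.const_mul 2)
  simp only [mul_zero, add_zero] at h2
  refine h2.congr fun n => ?_
  ring

theorem br_o (r δ : ℝ) (hδ : 0 < δ) (C : ℝ) (f : ℕ → ℝ) (h : ∀ᶠ n in atTop, |f n| ≤ C * br n ^ (r - δ)) :
    Tendsto (fun n : ℕ => f n / (n : ℝ) ^ r) atTop (𝓝 0) := by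
  have h1 : Tendsto (fun n : ℕ => C * br n ^ (-δ) * (br n ^ r / (n : ℝ) ^ r)) atTop (𝓝 0) := by
    have := (((tendsto_rpow_neg_atTop hδ).comp tendsto_br).const_mul C).mul (br_div_lim r)
    simpa using this
  refine squeeze_zero_norm' ?_ h1
  filter_upwards [h, eventually_gt_atTop 0] with n hn hn0
  have hn' : (0 : ℝ) < (n : ℝ) ^ r := Real.rpow_pos_of_pos (by exact_mod_cast hn0) r
  rw [Real.norm_eq_abs, abs_div, abs_of_pos hn', ← mul_div_assoc, mul_assoc, br_mul]
  refine div_le_div_of_nonneg_right (hn.trans (le_of_eq ?_)) hn'.le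
  congr 2; ring

section
variable {ι : Type*} {p : ι → ℝ} {h s : ℝ} {f g : ℕ → ℝ} {G H : ℝ → ℝ}

theorem Asy.comb (a : Asy p h s f G) (b : Asy p h s g H) (K : ℝ) :
    Asy p h s (fun n => f n + K * g n) (fun y => G y + K * H y) := by
  refine ⟨a.hh, a.cont.add (continuous_const.mul b.cont), fun y => by rw [a.per, b.per],
    fun i y => by rw [a.perp, b.perp], ?_⟩
  have := a.lim.add (b.lim.const_mul K)
  simp only [mul_zero, add_zero] at this
  refine this.congr fun n => ?_
  ring

theorem Asy.perturb (a : Asy p h s f G) (w : ℕ → ℝ) (hw : Tendsto (fun n : ℕ => w n / (n : ℝ) ^ s) atTop (𝓝 0)) :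
    Asy p h s (fun n => f n + w n) G := by
  refine ⟨a.hh, a.cont, a.per, a.perp, ?_⟩
  have := a.lim.add hw
  simp only [add_zero] at this
  refine this.congr fun n => ?_
  ring

theorem Asy.sq (a : Asy p h s f G) : Asy p h (2 * s + 1) (fun n => n * f n ^ 2) (fun y => G y ^ 2) := by
  refine ⟨a.hh, a.cont.pow 2, fun y => by rw [a.per], fun i y => by rw [a.perp], ?_⟩
  obtain ⟨B, hB, hG⟩ := per_bdd G h a.hh a.cont a.per
  have := sq_lim (fun n : ℕ => G (Real.log n)) (fun n => f n / (n : ℝ) ^ s) B (Eventually.of_forall fun n => hG _) a.lim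
  refine this.congr' ?_
  filter_upwards [eventually_gt_atTop 0] with n hn
  have hn' : (0 : ℝ) < n := by exact_mod_cast hn
  have h2 : (n : ℝ) ^ (2 * s + 1) = ((n : ℝ) ^ s) ^ 2 * n := by
    rw [Real.rpow_add hn', Real.rpow_one, ← Real.rpow_natCast, ← Real.rpow_mul hn'.le]
    congr 2; push_cast; ring
  have h3 : (0 : ℝ) < (n : ℝ) ^ s := Real.rpow_pos_of_pos hn' s
  rw [h2]
  field_simp
end

section
variable {M A : ℕ} {p : Fin A → ℝ} {ρ : ℝ} {l : ℕ → Measure ℝ} {r δ : ℝ}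

theorem Sys.T_pos (S : Sys M p ρ l) (n : ℕ) (hn : A + 2 ≤ n) : 0 < Tv p l n := by
  obtain ⟨k, rfl⟩ : ∃ k, n = k + 1 := ⟨n - 1, by omega⟩
  have hA := S.hA
  set a0 : Fin A := ⟨0, by omega⟩
  set a1 : Fin A := ⟨1, by omega⟩
  have h01 : a0 ≠ a1 := by simp [a0, a1]
  set y0 : Fin k → Fin A := fun _ => a0
  refine Vr_pos (isW_pw S.hw) (fun x => Finset.prod_pos fun i _ => (S.hp _).1) _ (Fin.cons a0 y0 : Fin (k + 1) → Fin A) (Fin.cons a1 y0) ?_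
  rw [SS_cons, SS_cons]
  have c0 : cnt y0 a0 = k := by simp [cnt, y0]
  have c1 : cnt y0 a1 = 0 := by simp [cnt, y0, h01]
  rw [c0, c1]
  have h2 := S.d_pos k (by omega)
  have h3 := S.d_zero
  unfold dd at h2 h3
  intro h
  linarith

theorem Sys.v_nonneg (S : Sys M p ρ l) (n : ℕ) : 0 ≤ vv l n := mV_nonneg _

theorem Sys.T_nonneg (S : Sys M p ρ l) (n : ℕ) : 0 ≤ Tv p l n := Vr_nonneg (isW_pw S.hw) _

theorem Sys.v_lower (S : Sys M p ρ l) : ∃ k, 0 < k ∧ ∀ n, A + 2 ≤ n → k * br n ^ ρ ≤ vv l n := by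
  have := S.ne
  have h0 : ∀ n, 0 ≤ TT (fun _ => (M : ℝ)) p n (vv l) := fun n =>
    Finset.sum_nonneg fun a _ => mul_nonneg S.M_pos.le (Bn_nonneg (S.hp a).1.le (S.hp a).2.le n _ fun k _ => S.v_nonneg k)
  refine lower_bound S.c0 S.hp ρ (by rw [S.wsum]; exact S.hρ) (vv l) (A + 2) S.v_nonneg (fun n hn => ?_) fun n hn => ?_
  · rw [S.v_rec' (by omega)]
    have := mul_pos S.M_pos (S.T_pos n hn)
    linarith [h0 n]
  · have h1 := S.v_rec' (by omega : A < n)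
    have := mul_nonneg S.M_pos.le (S.T_nonneg n)
    linarith

theorem Sys.par_unif (S : Sys M p ρ l) (hu : ∀ a b, p a = p b) : Par M p ρ l ρ ((2 - ρ) / 4) := by
  have h1 := S.ρ_lt
  have h2 := S.ρ_ge
  refine ⟨S, le_rfl, by linarith, by linarith, by linarith, 1, one_pos, fun n a b => ?_⟩
  unfold gg
  rw [hu a b, sub_self, abs_zero, one_mul]
  exact (br_rpow_pos n _).le

theorem Sys.gg_bound (S : Sys M p ρ l) : ∃ C, 0 < C ∧ ∀ n a, |gg p l n a| ≤ C * br n ^ (ρ - 1) := by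
  obtain ⟨C, hC, h⟩ := S.d_bound
  refine ⟨C, hC, fun n a => (h _).trans (mul_le_mul_of_nonneg_left ?_ hC.le)⟩
  refine Real.rpow_le_rpow (br_pos _).le (br_mono ?_) (by linarith [S.ρ_ge])
  exact fl_le_n (S.hp a).1.le (S.hp a).2.le n

theorem Sys.par_gen (S : Sys M p ρ l) : Par M p ρ l (2 * ρ - 1) (1 / 4) := by
  have h1 := S.ρ_lt
  have h2 := S.ρ_ge
  obtain ⟨C, hC, h⟩ := S.gg_bound
  refine ⟨S, by linarith, by norm_num, le_rfl, by linarith, 2 * C, by positivity, fun n a b => ?_⟩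
  have e : (2 * ρ - 1 - 1) / 2 = ρ - 1 := by ring
  rw [e]
  have := abs_sub (gg p l n a) (gg p l n b)
  linarith [h n a, h n b]

/-- Uniform case -/
theorem Sys.v_asy_unif (S : Sys M p ρ l) {h : ℝ} (R : RenH p h) (hu : ∀ a b, p a = p b) :
    ∃ G, Asy p h ρ (vv l) G ∧ ∀ y, 0 < G y := by
  have P := S.par_unif hu
  obtain ⟨C1, hC1, h1⟩ := P.T_bound
  obtain ⟨C2, hC2, h2⟩ := P.v_diff
  have hQ : ∀ n, QQ p l n = 0 := fun n => by
    have := S.ne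
    obtain ⟨a0⟩ := this
    have e : gg p l n = fun _ => gg p l n a0 := by funext a; unfold gg; rw [hu a a0]
    unfold QQ
    rw [e, Vr_eq S.hw]
    have e2 := Ex_const S.hw (gg p l n a0 ^ 2)
    have e3 := Ex_const S.hw (gg p l n a0)
    rw [e2, e3, sub_self]
  have hMC : 0 < M * C1 := mul_pos S.M_pos hC1
  obtain ⟨G, a⟩ := R.ren (fun _ => (M : ℝ)) S.c0 ρ ((2 - ρ) / 4) (M * C1 + C2) (A + 1) (vv l)
    (by rw [S.wsum]; exact S.hρ) P.hδ (by positivity)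
    (fun n hn => by
      have h3 := (h1 n).2
      rw [hQ, mul_zero, sub_zero] at h3
      rw [S.v_rec' (by omega : A < n), add_sub_cancel_left, abs_mul, abs_of_pos S.M_pos]
      have := mul_le_mul_of_nonneg_left h3 S.M_pos.le
      have := mul_nonneg hC2.le (br_rpow_pos n (ρ - (2 - ρ) / 4)).le
      linarith)
    (fun n => (h2 n).trans (mul_le_mul_of_nonneg_right (by linarith) (br_rpow_pos n _).le))
  obtain ⟨k, hk, h3⟩ := S.v_lower
  exact ⟨G, a, fun y => lt_of_lt_of_le hk (a.pos k hk _ h3 y)⟩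

/-- the auxiliary sequence `n d_n^2` -/
noncomputable def Dn (l : ℕ → Measure ℝ) (n : ℕ) : ℝ := n * dd l n ^ 2

theorem Sys.D_diff (S : Sys M p ρ l) : ∃ C, 0 < C ∧ ∀ n, |Dn l (n + 1) - Dn l n| ≤ C * br n ^ (2 * ρ - 7 / 4) := by
  obtain ⟨C1, hC1, h1⟩ := S.d2_bound (1 / 4) (by norm_num)
  obtain ⟨C2, hC2, h2⟩ := S.d_bound
  have hρ := S.ρ_ge
  have hρ2 := S.ρ_lt
  set C3 := C2 * 2 ^ (ρ - 1) with hC3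
  have hC30 : 0 < C3 := by positivity
  have h3 : ∀ n, |dd l (n + 1)| ≤ C3 * br n ^ (ρ - 1) := fun n => by
    refine (h2 (n + 1)).trans ?_
    rw [hC3, mul_assoc, ← Real.mul_rpow (by norm_num) (br_pos n).le]
    refine mul_le_mul_of_nonneg_left (Real.rpow_le_rpow (br_pos _).le ?_ (by linarith)) hC2.le
    have : (0 : ℝ) ≤ n := by positivity
    unfold br; push_cast; linarith
  refine ⟨C3 ^ 2 + C1 * (C2 + C3), by positivity, fun n => ?_⟩
  have e : Dn l (n + 1) - Dn l n = dd l (n + 1) ^ 2 + n * ((dd l (n + 1) - dd l n) * (dd l (n + 1) + dd l n)) := by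
    unfold Dn; push_cast; ring
  rw [e]
  have b1 : |dd l (n + 1) ^ 2| ≤ C3 ^ 2 * br n ^ (2 * ρ - 7 / 4) := by
    rw [abs_of_nonneg (sq_nonneg _)]
    have := sq_le_of_abs (c := C3) (h3 n)
    rw [br_sq] at this
    exact this.trans (mul_le_mul_of_nonneg_left (br_le_of n (by linarith)) (sq_nonneg _))
  have b2 : |dd l (n + 1) + dd l n| ≤ (C2 + C3) * br n ^ (ρ - 1) := by
    have := abs_add_le (dd l (n + 1)) (dd l n)
    linarith [h2 n, h3 n]
  have b3 : |(n : ℝ) * ((dd l (n + 1) - dd l n) * (dd l (n + 1) + dd l n))| ≤ C1 * (C2 + C3) * br n ^ (2 * ρ - 7 / 4) := by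
    rw [abs_mul, abs_mul, abs_of_nonneg (by positivity : (0 : ℝ) ≤ n)]
    have hn : (n : ℝ) ≤ br n ^ (1 : ℝ) := by rw [Real.rpow_one]; unfold br; linarith
    have := mul_le_mul hn (mul_le_mul (h1 n) b2 (abs_nonneg _) (mul_nonneg hC1.le (br_rpow_pos n _).le)) (by positivity) (br_rpow_pos n _).le
    refine this.trans (le_of_eq ?_)
    have : br n ^ (2 * ρ - 7 / 4) = br n ^ (1 : ℝ) * (br n ^ (ρ - 2 + 1 / 4) * br n ^ (ρ - 1)) := by
      rw [br_mul, br_mul]; congr 1; ring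
    rw [this]; ring
  have := abs_add_le (dd l (n + 1) ^ 2) (n * ((dd l (n + 1) - dd l n) * (dd l (n + 1) + dd l n)))
  linarith

theorem Sys.D_TT (S : Sys M p ρ l) : ∃ C, 0 < C ∧ ∀ n, |TT (fun _ => (M : ℝ)) p n (Dn l) - M * (n * Ex p (fun a => gg p l n a ^ 2))| ≤
    C * br n ^ (2 * ρ - 1 - 1 / 4) := by
  obtain ⟨C1, hC1, h1⟩ := S.D_diff
  obtain ⟨C2, hC2, h2⟩ := S.gg_bound
  have hρ := S.ρ_ge
  choose C3 hC3 h3 using fun a => Bn_smooth (S.hp a).1 (S.hp a).2.le (2 * ρ - 7 / 4)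
  have key : ∀ n a, |Bn (p a) n (Dn l) - n * p a * gg p l n a ^ 2| ≤ (C1 * C3 a + C2 ^ 2) * br n ^ (2 * ρ - 1 - 1 / 4) := by
    intro n a
    have h4 := h3 a (Dn l) C1 hC1.le h1 n
    have e : (2 * ρ - 7 / 4 + 1 / 2) = 2 * ρ - 1 - 1 / 4 := by ring
    rw [e] at h4
    have h5 : |Dn l (fl (p a) n) - n * p a * gg p l n a ^ 2| ≤ C2 ^ 2 * br n ^ (2 * ρ - 1 - 1 / 4) := by
      have e : Dn l (fl (p a) n) - n * p a * gg p l n a ^ 2 = ((fl (p a) n : ℝ) - n * p a) * gg p l n a ^ 2 := by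
        unfold Dn gg; ring
      rw [e, abs_mul, abs_of_nonneg (sq_nonneg (gg p l n a))]
      have h6 := sq_le_of_abs (c := C2) (h2 n a)
      rw [br_sq] at h6
      have h7 : |(fl (p a) n : ℝ) - n * p a| ≤ 1 := by
        have a1 := fl_le (S.hp a).1.le n
        have a2 := lt_fl (p := p a) n
        rw [abs_le]; constructor <;> linarith
      have h8 : C2 ^ 2 * br n ^ (2 * (ρ - 1)) ≤ C2 ^ 2 * br n ^ (2 * ρ - 1 - 1 / 4) :=
        mul_le_mul_of_nonneg_left (br_le_of n (by linarith)) (sq_nonneg _)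
      have := mul_le_mul h7 (h6.trans h8) (sq_nonneg _) zero_le_one
      linarith
    have := abs_add_le (Bn (p a) n (Dn l) - Dn l (fl (p a) n)) (Dn l (fl (p a) n) - n * p a * gg p l n a ^ 2)
    rw [sub_add_sub_cancel] at this
    linarith
  have hs : 0 ≤ ∑ a, M * (C1 * C3 a + C2 ^ 2) := Finset.sum_nonneg fun a _ => by have := hC3 a; positivity
  refine ⟨∑ a, M * (C1 * C3 a + C2 ^ 2) + 1, by linarith, fun n => ?_⟩
  have e : TT (fun _ => (M : ℝ)) p n (Dn l) - M * (n * Ex p (fun a => gg p l n a ^ 2)) =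
      ∑ a, M * (Bn (p a) n (Dn l) - n * p a * gg p l n a ^ 2) := by
    unfold TT Ex
    rw [Finset.mul_sum, Finset.mul_sum, ← Finset.sum_sub_distrib]
    refine Finset.sum_congr rfl fun a _ => ?_
    simp only [smul_eq_mul]; ring
  rw [e]
  have : |∑ a, M * (Bn (p a) n (Dn l) - n * p a * gg p l n a ^ 2)| ≤ ∑ a, M * (C1 * C3 a + C2 ^ 2) * br n ^ (2 * ρ - 1 - 1 / 4) := by
    refine (Finset.abs_sum_le_sum_abs _ _).trans (Finset.sum_le_sum fun a _ => ?_)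
    rw [abs_mul, abs_of_pos S.M_pos]
    exact (mul_le_mul_of_nonneg_left (key n a) S.M_pos.le).trans (le_of_eq (by ring))
  rw [← Finset.sum_mul] at this
  linarith [br_rpow_pos n (2 * ρ - 1 - 1 / 4)]

theorem Sys.d_gb (S : Sys M p ρ l) : ∃ C, 0 < C ∧ ∀ n, A < n → |dd l n - M * gb p l n| ≤ C * br n ^ (ρ - 1 - 1 / 4) := by
  obtain ⟨C1, hC1, h1⟩ := S.d2_bound (1 / 4) (by norm_num)
  choose C3 hC3 h3 using fun a => Bn_smooth (S.hp a).1 (S.hp a).2.le (ρ - 2 + 1 / 4)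
  have hs : 0 ≤ ∑ a, M * p a * (C1 * C3 a) := Finset.sum_nonneg fun a _ => by
    have := hC3 a; have := (S.hp a).1; positivity
  refine ⟨∑ a, M * p a * (C1 * C3 a) + 1, by linarith, fun n hn => ?_⟩
  have h2 := S.d_rec n
  rw [bbe_big S.hM1 S.hA (by omega), bbe_big S.hM1 S.hA hn, sub_self, add_zero] at h2
  have e : dd l n - M * gb p l n = ∑ a, M * p a * (Bn (p a) n (dd l) - gg p l n a) := by
    rw [h2]; unfold TT gb Ex
    rw [Finset.mul_sum, ← Finset.sum_sub_distrib]
    refine Finset.sum_congr rfl fun a _ => ?_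
    simp only [smul_eq_mul]; ring
  rw [e]
  have : |∑ a, M * p a * (Bn (p a) n (dd l) - gg p l n a)| ≤ ∑ a, M * p a * (C1 * C3 a) * br n ^ (ρ - 1 - 1 / 4) := by
    refine (Finset.abs_sum_le_sum_abs _ _).trans (Finset.sum_le_sum fun a _ => ?_)
    rw [abs_mul, abs_of_pos (S.c1 a), mul_assoc (_ * _)]
    refine mul_le_mul_of_nonneg_left ?_ (S.c1 a).le
    have := h3 a (dd l) C1 hC1.le h1 n
    have e9 : ρ - 2 + 1 / 4 + 1 / 2 = ρ - 1 - 1 / 4 := by ring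
    rw [e9] at this
    exact this
  rw [← Finset.sum_mul] at this
  linarith [br_rpow_pos n (ρ - 1 - 1 / 4)]

theorem Sys.QQ_eq (S : Sys M p ρ l) (n : ℕ) : QQ p l n = Ex p (fun a => gg p l n a ^ 2) - gb p l n ^ 2 :=
  Vr_eq S.hw _

/-- the case `ρ = 1` -/
theorem Sys.v_asy_one (S : Sys M p ρ l) {h : ℝ} (R : RenH p h) (h1 : ρ = 1) :
    ∃ G, Asy p h (2 * ρ - 1) (vv l) G ∧ ∀ y, 0 < G y := by
  have hM := S.M_one h1
  have P := S.par_gen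
  obtain ⟨C1, hC1, h1'⟩ := P.T_bound
  obtain ⟨C2, hC2, h2⟩ := P.v_diff
  obtain ⟨C3, hC3, h3⟩ := S.D_diff
  obtain ⟨C4, hC4, h4⟩ := S.D_TT
  obtain ⟨C5, hC5, h5⟩ := S.d_gb
  obtain ⟨C6, hC6, h6⟩ := S.d_bound
  obtain ⟨G, a⟩ := S.d_asy R
  have a2 := a.sq
  have er : 2 * (ρ - 1) + 1 = 2 * ρ - 1 := by ring
  rw [er] at a2
  obtain ⟨Gu, au⟩ := R.ren (fun _ => (M : ℝ)) S.c0 (2 * ρ - 1) (1 / 4) (C1 + C2 + C3 + C4 + C5 * (C5 + 2 * C6)) (A + 1) (fun n => vv l n + Dn l n)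
    (by rw [S.wsum, h1]; have := S.hρ; rw [h1] at this; convert this using 4; norm_num) (by norm_num) (by positivity)
    (fun n hn => by
      have b1 := (h1' n).2
      have b2 := h4 n
      have b3 := h5 n (by omega)
      have b4 := h6 n
      rw [hM, one_mul] at b3
      have hMz : ∀ z : ℝ, (M : ℝ) * z = z := fun z => by rw [hM, one_mul]
      rw [hMz] at b2
      have e : vv l n + Dn l n - TT (fun _ => (M : ℝ)) p n (fun n => vv l n + Dn l n) =
         (Tv p l n - n * QQ p l n) + (-(TT (fun _ => (M : ℝ)) p n (Dn l) - n * Ex p (fun a => gg p l n a ^ 2))) +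
          n * ((dd l n - gb p l n) * (2 * dd l n - (dd l n - gb p l n))) := by
        rw [TT_add, S.QQ_eq, S.v_rec' (by omega : A < n)]; unfold Dn; rw [hM]; ring
      have b5 : |(n : ℝ) * ((dd l n - gb p l n) * (2 * dd l n - (dd l n - gb p l n)))| ≤ C5 * (C5 + 2 * C6) * br n ^ (2 * ρ - 1 - 1 / 4) := by
        rw [abs_mul, abs_mul, abs_of_nonneg (by positivity : (0 : ℝ) ≤ n)]
        have hn : (n : ℝ) ≤ br n ^ (1 : ℝ) := by rw [Real.rpow_one]; unfold br; linarith
        have b6 : |2 * dd l n - (dd l n - gb p l n)| ≤ (C5 + 2 * C6) * br n ^ (ρ - 1) := by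
          have := abs_sub (2 * dd l n) (dd l n - gb p l n)
          rw [abs_mul, abs_of_pos (by norm_num : (0 : ℝ) < 2)] at this
          have b7 : br n ^ (ρ - 1 - 1 / 4) ≤ br n ^ (ρ - 1) := br_le_of n (by linarith)
          have := mul_le_mul_of_nonneg_left b7 hC5.le
          linarith
        have := mul_le_mul hn (mul_le_mul b3 b6 (abs_nonneg _) ((abs_nonneg _).trans b3)) (by positivity) (br_rpow_pos n _).le
        refine this.trans (le_of_eq ?_)
        have : br n ^ (2 * ρ - 1 - 1 / 4) = br n ^ (1 : ℝ) * (br n ^ (ρ - 1 - 1 / 4) * br n ^ (ρ - 1)) := by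
          rw [br_mul, br_mul]; congr 1; ring
        rw [this]; ring
      rw [e]
      refine (abs_add_le _ _).trans ?_
      have b8 := abs_add_le (Tv p l n - n * QQ p l n) (-(TT (fun _ => (M : ℝ)) p n (Dn l) - n * Ex p (fun a => gg p l n a ^ 2)))
      rw [abs_neg] at b8
      have hb := br_rpow_pos n (2 * ρ - 1 - 1 / 4)
      have hb2 := mul_nonneg hC2.le hb.le
      have hb3 := mul_nonneg hC3.le hb.le
      linarith)
    (fun n => by
      have b1 := h2 n
      have b2 := h3 n
      have e : 2 * ρ - 7 / 4 = 2 * ρ - 1 - 1 / 4 - 1 / 2 := by ring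
      rw [e] at b2
      have e2 : vv l (n + 1) + Dn l (n + 1) - (vv l n + Dn l n) = (vv l (n + 1) - vv l n) + (Dn l (n + 1) - Dn l n) := by ring
      rw [e2]
      refine (abs_add_le _ _).trans ?_
      have := br_rpow_pos n (2 * ρ - 1 - 1 / 4 - 1 / 2)
      have : 0 ≤ (C1 + C4 + C5 * (C5 + 2 * C6)) * br n ^ (2 * ρ - 1 - 1 / 4 - 1 / 2) := by positivity
      linarith)
  have av := au.comb a2 (-1)
  have av' : Asy p h (2 * ρ - 1) (vv l) (fun y => Gu y + -1 * G y ^ 2) := by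
    convert av using 1
    funext n; unfold Dn; ring
  obtain ⟨k, hk, h7⟩ := S.v_lower
  refine ⟨_, av', fun y => lt_of_lt_of_le hk (av'.pos k hk (A + 2) (fun n hn => ?_) y)⟩
  have := h7 n hn
  have e : 2 * ρ - 1 = ρ := by linarith
  rwa [e]

/-- the case `ρ > 1`, non-uniform -/
theorem Sys.v_asy_gen (S : Sys M p ρ l) {h : ℝ} (R : RenH p h) (h1 : 1 < ρ) (hu : ¬ ∀ a b, p a = p b) :
    ∃ G, Asy p h (2 * ρ - 1) (vv l) G ∧ ∀ y, 0 < G y := by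
  have P := S.par_gen
  have hw := S.hw
  obtain ⟨G, a⟩ := S.d_asy R
  have a2 := a.sq
  have er : 2 * (ρ - 1) + 1 = 2 * ρ - 1 := by ring
  rw [er] at a2
  obtain ⟨k, hk, hlow⟩ := S.d_lower
  have hG : ∀ y, 0 < G y := fun y => lt_of_lt_of_le hk (a.pos k hk _ hlow y)
  set γ : Fin A → ℝ := fun a => p a ^ (ρ - 1) with hγ
  set σ := Ex p (fun a => γ a ^ 2) with hσ
  have hM := S.M_pos
  have hEγ : Ex p γ = 1 / M := by
    have : Ex p γ = ∑ a, p a ^ ρ := Finset.sum_congr rfl fun a _ => by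
      simp only [smul_eq_mul, hγ]
      rw [Real.rpow_sub_one (S.hp a).1.ne']; field_simp [(S.hp a).1.ne']
    rw [this, eq_div_iff hM.ne', mul_comm]; exact S.hρ
  have hσ1 : M * σ < 1 := by
    have : σ = ∑ a, p a ^ (2 * ρ - 1) := Finset.sum_congr rfl fun a _ => by
      simp only [smul_eq_mul, hγ]
      have e : 2 * ρ - 1 = 1 + ((ρ - 1) + (ρ - 1)) := by ring
      rw [e, Real.rpow_add (S.hp a).1, Real.rpow_add (S.hp a).1, Real.rpow_one]; ring
    rw [this]; exact S.sum_lt _ (by linarith)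
  have hσ2 : 0 < σ - (1 / M) ^ 2 := by
    have := Vr_eq hw γ
    rw [hEγ] at this
    rw [← this]
    push Not at hu
    obtain ⟨x, y, hxy⟩ := hu
    refine Vr_pos hw (fun a => (S.hp a).1) γ x y fun e => hxy ?_
    exact (Real.rpow_left_inj (S.hp x).1.le (S.hp y).1.le (by linarith)).1 e
  set K := M * (σ - (1 / M) ^ 2) / (1 - M * σ) with hK
  have hK0 : 0 < K := div_pos (mul_pos hM hσ2) (by linarith)
  have hKe : K * (1 - M * σ) = M * (σ - (1 / M) ^ 2) := div_mul_cancel₀ _ (by linarith)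
  -- scaled quantities
  set x : ℕ → ℝ := fun n => dd l n / (n : ℝ) ^ (ρ - 1) with hx
  obtain ⟨Cx, hCx, hxb⟩ := a.ev_bound
  have hq : ∀ i, Tendsto (fun n : ℕ => gg p l n i / (n : ℝ) ^ (ρ - 1) - γ i * x n) atTop (𝓝 0) := fun i => by
    refine (a.fl_lim i (S.hp i).1).congr fun n => ?_
    simp only [hγ, hx, gg]; ring
  have A4 : Tendsto (fun n : ℕ => Ex p (fun i => (gg p l n i / (n : ℝ) ^ (ρ - 1)) ^ 2) - σ * x n ^ 2) atTop (𝓝 0) := by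
    have h2 : ∀ i, Tendsto (fun n : ℕ => (gg p l n i / (n : ℝ) ^ (ρ - 1)) ^ 2 - (γ i * x n) ^ 2) atTop (𝓝 0) := fun i =>
      sq_lim _ _ (γ i * Cx) (hxb.mono fun n hn => by
        have : 0 ≤ γ i := Real.rpow_nonneg (S.hp i).1.le _
        rw [abs_mul, abs_of_nonneg this]
        exact mul_le_mul_of_nonneg_left hn this) (hq i)
    have h3 : Tendsto (fun n : ℕ => ∑ i, p i * ((gg p l n i / (n : ℝ) ^ (ρ - 1)) ^ 2 - (γ i * x n) ^ 2)) atTop (𝓝 (∑ i : Fin A, p i * 0)) :=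
      tendsto_finsetSum _ fun i _ => (h2 i).const_mul (p i)
    simp only [mul_zero, Finset.sum_const_zero] at h3
    refine h3.congr fun n => ?_
    rw [hσ]; unfold Ex
    rw [Finset.sum_mul, ← Finset.sum_sub_distrib]
    refine Finset.sum_congr rfl fun i _ => ?_
    simp only [smul_eq_mul]; ring
  have A5 : Tendsto (fun n : ℕ => (gb p l n / (n : ℝ) ^ (ρ - 1)) ^ 2 - (1 / M * x n) ^ 2) atTop (𝓝 0) := by
    refine sq_lim _ _ (1 / M * Cx) (hxb.mono fun n hn => by
        have : 0 ≤ 1 / (M : ℝ) := by positivity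
        rw [abs_mul, abs_of_nonneg this]
        exact mul_le_mul_of_nonneg_left hn this) ?_
    have h3 : Tendsto (fun n : ℕ => ∑ i, p i * (gg p l n i / (n : ℝ) ^ (ρ - 1) - γ i * x n)) atTop (𝓝 (∑ i : Fin A, p i * 0)) :=
      tendsto_finsetSum _ fun i _ => (hq i).const_mul (p i)
    simp only [mul_zero, Finset.sum_const_zero] at h3
    refine h3.congr fun n => ?_
    rw [← hEγ]; unfold gb Ex
    rw [Finset.sum_mul, Finset.sum_div, ← Finset.sum_sub_distrib]
    refine Finset.sum_congr rfl fun i _ => ?_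
    simp only [smul_eq_mul]; ring
  obtain ⟨C1, hC1, hT⟩ := P.T_bound
  obtain ⟨C4, hC4, hD⟩ := S.D_TT
  have A1 := br_o (2 * ρ - 1) (1 / 4) (by norm_num) C1 _ (Eventually.of_forall fun n => (hT n).2)
  have A3 := br_o (2 * ρ - 1) (1 / 4) (by norm_num) C4 _ (Eventually.of_forall hD)
  have tot : Tendsto (fun n : ℕ => (M * Tv p l n - K * (Dn l n - TT (fun _ => (M : ℝ)) p n (Dn l))) / (n : ℝ) ^ (2 * ρ - 1)) atTop (𝓝 0) := by
    have := (((A1.const_mul (M : ℝ)).add (A3.const_mul K)).add (A4.const_mul ((M : ℝ) + K * M))).sub (A5.const_mul (M : ℝ))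
    simp only [mul_zero, add_zero, sub_zero] at this
    refine this.congr' ?_
    filter_upwards [eventually_gt_atTop 0] with n hn
    have hn' : (0 : ℝ) < n := by exact_mod_cast hn
    have h2 : (n : ℝ) ^ (2 * ρ - 1) = ((n : ℝ) ^ (ρ - 1)) ^ 2 * n := by
      have e : 2 * ρ - 1 = ((ρ - 1) + (ρ - 1)) + 1 := by ring
      rw [e, Real.rpow_add hn', Real.rpow_add hn', Real.rpow_one]; ring
    have h3 : (0 : ℝ) < (n : ℝ) ^ (ρ - 1) := Real.rpow_pos_of_pos hn' _
    have e4 : Ex p (fun i => (gg p l n i / (n : ℝ) ^ (ρ - 1)) ^ 2) = Ex p (fun i => gg p l n i ^ 2) / ((n : ℝ) ^ (ρ - 1)) ^ 2 := by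
      unfold Ex; rw [Finset.sum_div]
      refine Finset.sum_congr rfl fun i _ => ?_
      simp only [smul_eq_mul]; ring
    rw [e4, h2, S.QQ_eq]
    have e5 : K * x n ^ 2 = K * (M * σ) * x n ^ 2 + M * (σ - (1 / M) ^ 2) * x n ^ 2 := by
      rw [← hKe]; ring
    have e6 : K * (Dn l n / (((n : ℝ) ^ (ρ - 1)) ^ 2 * n)) = K * x n ^ 2 := by
      simp only [hx]; unfold Dn; field_simp
    have e7 : ∀ u v : ℝ, (M * u - K * (Dn l n - v)) / (((n : ℝ) ^ (ρ - 1)) ^ 2 * n) =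
      M * (u / (((n : ℝ) ^ (ρ - 1)) ^ 2 * n)) + K * (v / (((n : ℝ) ^ (ρ - 1)) ^ 2 * n)) - K * (Dn l n / (((n : ℝ) ^ (ρ - 1)) ^ 2 * n)) := fun u v => by ring
    rw [e7, e6, e5]
    set N := (n : ℝ) ^ (ρ - 1)
    have e8 : ∀ u, n * u / (N ^ 2 * n) = u / N ^ 2 := fun u => by field_simp
    rw [sub_div, sub_div, e8, sub_div, ← mul_div_assoc', e8]
    ring
  -- comparison
  have hr1 : ∑ i, (M : ℝ) * p i ^ (2 * ρ - 1) < 1 := by rw [S.wsum]; exact S.sum_lt _ (by linarith)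
  have hw0 := small_bound (fun a => (S.c0 a).le) S.hp (2 * ρ - 1) hr1 (fun n => vv l n - K * Dn l n) (fun ε hε => by
    have h2 := tot.abs
    rw [abs_zero] at h2
    obtain ⟨n0, h3⟩ := eventually_atTop.1 ((h2.eventually (gt_mem_nhds hε)).and (eventually_gt_atTop A))
    refine ⟨n0, fun n hn => ?_⟩
    obtain ⟨h4, h5⟩ := h3 n hn
    have hn' : (0 : ℝ) < n := by exact_mod_cast (by omega : 0 < n)
    have h6 : 0 < (n : ℝ) ^ (2 * ρ - 1) := Real.rpow_pos_of_pos hn' _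
    rw [abs_div, abs_of_pos h6, div_lt_iff₀ h6] at h4
    have h7 : (n : ℝ) ^ (2 * ρ - 1) ≤ br n ^ (2 * ρ - 1) :=
      Real.rpow_le_rpow hn'.le (by unfold br; linarith) (by linarith)
    have e : vv l n - K * Dn l n = TT (fun _ => (M : ℝ)) p n (fun n => vv l n - K * Dn l n) +
       (M * Tv p l n - K * (Dn l n - TT (fun _ => (M : ℝ)) p n (Dn l))) := by
      rw [TT_sub, TT_mul, S.v_rec' h5]; ring
    rw [e]
    refine (abs_add_le _ _).trans (add_le_add (TT_abs (fun a => (S.c0 a).le) S.hp n _) (h4.le.trans (mul_le_mul_of_nonneg_left h7 hε.le))))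
  have hw1 : Tendsto (fun n : ℕ => (vv l n - K * Dn l n) / (n : ℝ) ^ (2 * ρ - 1)) atTop (𝓝 0) := by
    have := hw0.mul (br_div_lim (2 * ρ - 1))
    rw [zero_mul] at this
    refine this.congr fun n => ?_
    exact div_mul_div_cancel₀ (br_rpow_pos n _).ne'
  have zero : Asy p h (2 * ρ - 1) (fun _ => 0) (fun _ => 0) := by
    refine ⟨a.hh, continuous_const, fun _ => rfl, fun _ _ => rfl, ?_⟩
    simp
  have av := (zero.comb a2 K).perturb _ hw1
  have av' : Asy p h (2 * ρ - 1) (vv l) (fun y => 0 + K * G y ^ 2) := by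
    convert av using 1
    funext n; unfold Dn; ring
  refine ⟨_, av', fun y => ?_⟩
  have := hG y
  positivity

end
end GT

namespace GT

variable {M A : ℕ} {p : Fin A → ℝ} {ρ : ℝ} {l : ℕ → Measure ℝ} {r δ : ℝ}

theorem Sys.cm_cent (S : Sys M p ρ l) {n : ℕ} (hn : A < n) (x : Fin M → Fin n → Fin A) :
    cm (ee l) x - ee l n = ∑ m, Xc p l (x m) := by
  have e : ee l n = ∑ m : Fin M, Ex (pw p) (fun y : Fin n → Fin A => SS (ee l) y) := by
    rw [S.e_eq n]
    have : (fun x : Fin M → Fin n → Fin A => cm (ee l) x) = fun x => ∑ m, SS (ee l) (x m) := by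
      funext x; exact S.cm_eq hn x
    rw [this, Ex_sum]
    exact Finset.sum_congr rfl fun m _ => Ex_pw_one (isW_pw S.hw) m _
  rw [S.cm_eq hn, e, ← Finset.sum_sub_distrib]
  rfl

theorem Ex_sum_pw {Ω : Type*} [Fintype Ω] {w : Ω → ℝ} (hw : IsW w) (f : Ω → ℝ) :
    Ex (pw w) (fun x : Fin M → Ω => ∑ m, f (x m)) = M * Ex w f := by
  rw [Ex_sum]
  rw [Finset.sum_congr rfl fun m _ => Ex_pw_one hw m f]
  simp

/-- all absolute moments of `Xc` -/
theorem Par.X_mom (P : Par M p ρ l r δ) (k : ℕ) : ∃ C, 0 < C ∧ ∀ n,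
    Ex (pw p) (fun y : Fin n → Fin A => |Xc p l y| ^ (k + 1)) ≤ C * (br n ^ (r / 2)) ^ (k + 1) := by
  obtain ⟨C, hC, J, h⟩ := P.lin
  obtain ⟨C2, hC2, h2⟩ := ZZ_pow_mom P.hw P.hp J k
  refine ⟨C ^ (k + 1) * C2, by positivity, fun n => ?_⟩
  have : Ex (pw p) (fun y : Fin n → Fin A => |Xc p l y| ^ (k + 1)) ≤
      Ex (pw p) (fun y : Fin n → Fin A => (C * br n ^ (r / 2)) ^ (k + 1) * ZZ p J y ^ (k + 1)) := by
    refine Ex_mono (isW_pw P.hw) _ _ fun y => ?_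
    rw [← mul_pow]
    exact pow_le_pow_left₀ (abs_nonneg _) (h n y).2.2 _
  rw [Ex_mul] at this
  have hb := br_rpow_pos n (r / 2)
  refine this.trans ((mul_le_mul_of_nonneg_left (h2 n) (by positivity)).trans (le_of_eq ?_))
  rw [mul_pow]; ring

theorem Par.k_bound (P : Par M p ρ l r δ) {Cv : ℝ} (hv : ∀ n, |vv l n| ≤ Cv * br n ^ r) :
    ∃ C, 0 < C ∧ ∀ n, kk l n ≤ C * br n ^ (2 * r) := by
  have hr := P.hrρ
  have hρ1 := P.ρ_ge
  have hlt := P.sum_lt (2 * r) (by linarith)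
  have hCv : 0 ≤ Cv := by
    have h1 := (abs_nonneg _).trans (hv 0)
    exact nonneg_of_mul_nonneg_left h1 (br_rpow_pos 0 r)
  obtain ⟨η, hη, hη1⟩ := exists_eta _ hlt
  obtain ⟨K, hK, hK4⟩ := pow4_le η hη
  obtain ⟨CX, hCX, hX⟩ := P.X_mom 3
  have hc : ∀ i : Fin A, 0 ≤ (1 + η) * (M : ℝ) := fun _ => by positivity
  have hbr : ∀ n, (br n ^ (r / 2)) ^ 4 = br n ^ (2 * r) := fun n => by
    rw [← Real.rpow_mul_natCast (br_pos n).le]; congr 1; push_cast; ring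
  obtain ⟨C, hC, h⟩ := sup_bound (c := fun _ => (1 + η) * (M : ℝ)) hc P.hp (2 * r)
    (by
      have : ∑ i, (1 + η) * (M : ℝ) * p i ^ (2 * r) = (1 + η) * (M * ∑ i, p i ^ (2 * r)) := by
        rw [Finset.mul_sum, Finset.mul_sum]; exact Finset.sum_congr rfl fun i _ => by ring
      rw [this]; exact hη1) (kk l)
    ((1 + η) * (3 * ((M * A) * Cv) ^ 2) + K * ((M : ℝ) ^ 3 * (M * CX))) (A + 1)
    (fun n hn => by
      have hn : A < n := hn
      have h1 := step_four (M := M) P.hw l P.gd n η K hη hK4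
      rw [← P.st n] at h1
      rw [abs_of_nonneg (show 0 ≤ kk l n from mK_nonneg _)]
      refine h1.trans ?_
      rw [Ex_add, Ex_mul, Ex_add, Ex_mul, Ex_mul]
      have h2 : Ex (pw (pw p)) (fun x : Fin M → Fin n → Fin A => ∑ q : Fin M × Fin A, mK (l (cnt (x q.1) q.2))) = TT (fun _ => (M : ℝ)) p n (kk l) :=
        Ex_cnts P.hw n (kk l)
      have h3 : Ex (pw (pw p)) (fun x : Fin M → Fin n → Fin A => (∑ q : Fin M × Fin A, mV (l (cnt (x q.1) q.2))) ^ 2) ≤ ((M * A) * Cv) ^ 2 * br n ^ (2 * r) := by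
        rw [← br_sq, ← mul_pow]
        rw [← Ex_const (isW_pw (ι := Fin M) (isW_pw (ι := Fin n) P.hw)) (((M * A) * Cv * br n ^ r) ^ 2)]
        refine Ex_mono (isW_pw (isW_pw P.hw)) _ _ fun x => ?_
        have h4 : ∀ q : Fin M × Fin A, mV (l (cnt (x q.1) q.2)) ≤ Cv * br n ^ r := fun q => by
          refine (le_abs_self _).trans ((hv _).trans (mul_le_mul_of_nonneg_left ?_ hCv))
          exact Real.rpow_le_rpow (br_pos _).le (br_mono (cnt_le _ _)) (by linarith)
        have h5 := Finset.sum_le_sum fun q (_ : q ∈ Finset.univ) => h4 q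
        simp only [Finset.sum_const, Finset.card_univ, Fintype.card_prod, Fintype.card_fin, nsmul_eq_mul] at h5
        push_cast at h5
        refine pow_le_pow_left₀ (Finset.sum_nonneg fun q _ => mV_nonneg _) (h5.trans (le_of_eq (by ring))) 2
      have h6 : Ex (pw (pw p)) (fun x : Fin M → Fin n → Fin A => (cm (fun n => mE (l n)) x - mE (l n)) ^ 4) ≤ (M : ℝ) ^ 3 * (M * CX) * br n ^ (2 * r) := by
        have h7 : ∀ x : Fin M → Fin n → Fin A, (cm (fun n => mE (l n)) x - mE (l n)) ^ 4 ≤ (M : ℝ) ^ 3 * ∑ m, |Xc p l (x m)| ^ 4 := fun x => by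
          have e := P.toSys.cm_cent hn x
          change (cm (ee l) x - ee l n) ^ 4 ≤ _
          rw [e]
          have h8 := pow_sum_le_card_mul_sum_pow (s := Finset.univ) (f := fun m => |Xc p l (x m)|) (fun m _ => abs_nonneg _) 3
          simp only [Finset.card_univ, Fintype.card_fin] at h8
          refine le_trans ?_ h8
          rw [← Even.pow_abs (by decide : Even 4)]
          exact pow_le_pow_left₀ (abs_nonneg _) (Finset.abs_sum_le_sum_abs _ _) 4
        refine (Ex_mono (isW_pw (isW_pw P.hw)) _ _ h7).trans ?_
        rw [Ex_mul, Ex_sum_pw (isW_pw P.hw) (fun y : Fin n → Fin A => |Xc p l y| ^ 4)]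
        have := hX n
        norm_num at this
        rw [hbr n] at this
        have hM0 := P.M_pos.le
        calc (M : ℝ) ^ 3 * (M * _) ≤ (M : ℝ) ^ 3 * (M * (CX * br n ^ (2 * r))) := by gcongr
          _ = _ := by ring
      rw [h2]
      have h9 : TT (fun _ => (1 + η) * (M : ℝ)) p n (fun k => |kk l k|) = (1 + η) * TT (fun _ => (M : ℝ)) p n (kk l) := by
        unfold TT; rw [Finset.mul_sum]
        refine Finset.sum_congr rfl fun i _ => ?_
        have : (fun k => |kk l k|) = kk l := by funext k; exact abs_of_nonneg (mK_nonneg _)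
        rw [this]; ring
      rw [h9]
      have h10 := mul_le_mul_of_nonneg_left h6 hK
      have h11 := mul_le_mul_of_nonneg_left h3 (by positivity : 0 ≤ (1 + η) * 3)
      linarith)
  exact ⟨C, hC, fun n => (le_abs_self _).trans (h n)⟩

end GT

namespace GT

theorem eI_norm (x : ℝ) : ‖Complex.exp (x * Complex.I)‖ = 1 := Complex.norm_exp_ofReal_mul_I x

theorem eI_lip (x y : ℝ) : ‖Complex.exp (x * Complex.I) - Complex.exp (y * Complex.I)‖ ≤ |x - y| := by
  have e : Complex.exp (x * Complex.I) - Complex.exp (y * Complex.I) =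
      Complex.exp (y * Complex.I) * (Complex.exp (Complex.I * ((x - y : ℝ) : ℂ)) - 1) := by
    rw [mul_sub, ← Complex.exp_add, mul_one]; congr 2; push_cast; ring
  rw [e, norm_mul, eI_norm, one_mul]
  exact Real.norm_exp_I_mul_ofReal_sub_one_le

theorem eI_taylor (x : ℝ) : ‖Complex.exp (x * Complex.I) - (1 + x * Complex.I - (x : ℂ) ^ 2 / 2)‖ ≤ 4 * |x| ^ 3 := by
  have hx : ‖(x : ℂ) * Complex.I‖ = |x| := by simp
  rcases le_total |x| 1 with h | h
  · have h1 := Complex.exp_bound (x := (x : ℂ) * Complex.I) (by rw [hx]; exact h) (n := 3) (by norm_num)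
    rw [hx] at h1
    have e : ∑ m ∈ Finset.range 3, ((x : ℂ) * Complex.I) ^ m / (m.factorial : ℂ) = 1 + x * Complex.I - (x : ℂ) ^ 2 / 2 := by
      simp [Finset.sum_range_succ, Nat.factorial, mul_pow]; ring
    rw [e] at h1
    refine h1.trans ?_
    have : (0 : ℝ) ≤ |x| ^ 3 := by positivity
    norm_num [Nat.factorial]
    linarith
  · have h1 : ‖Complex.exp (x * Complex.I) - (1 + x * Complex.I - (x : ℂ) ^ 2 / 2)‖ ≤ 1 + (1 + |x| + |x| ^ 2 / 2) := by
      refine (norm_sub_le _ _).trans ?_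
      rw [eI_norm]
      gcongr
      refine (norm_sub_le _ _).trans (add_le_add ((norm_add_le _ _).trans ?_) ?_)
      · rw [hx]; simp
      · rw [norm_div, norm_pow]; simp
    refine h1.trans ?_
    nlinarith [mul_nonneg (sub_nonneg.2 h) (sub_nonneg.2 h), mul_nonneg (mul_nonneg (sub_nonneg.2 h) (sub_nonneg.2 h)) (abs_nonneg x), mul_nonneg (sub_nonneg.2 h) (abs_nonneg x)]

theorem en_lip {a b : ℝ} (ha : 0 ≤ a) (hb : 0 ≤ b) : |Real.exp (-a) - Real.exp (-b)| ≤ |a - b| := by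
  wlog h : a ≤ b generalizing a b
  · rw [abs_sub_comm, abs_sub_comm a b]; exact this hb ha (le_of_not_ge h)
  have h1 : Real.exp (-b) ≤ Real.exp (-a) := Real.exp_le_exp.2 (by linarith)
  rw [abs_of_nonneg (by linarith), abs_of_nonpos (by linarith)]
  have h2 : Real.exp (-b) = Real.exp (-a) * Real.exp (-(b - a)) := by rw [← Real.exp_add]; congr 1; ring
  have h3 := Real.add_one_le_exp (-(b - a))
  have h4 : Real.exp (-a) ≤ 1 := Real.exp_le_one_iff.2 (by linarith)
  have h5 := Real.exp_pos (-a)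
  have h6 : Real.exp (-(b - a)) ≤ 1 := Real.exp_le_one_iff.2 (by linarith)
  rw [h2]
  nlinarith

theorem en_taylor {t : ℝ} (ht : 0 ≤ t) : |Real.exp (-t) - (1 - t)| ≤ t ^ 2 := by
  have h1 := Real.add_one_le_exp (-t)
  rw [abs_of_nonneg (by linarith)]
  have h2 := Real.add_one_le_exp t
  have h3 : Real.exp (-t) * Real.exp t = 1 := by rw [← Real.exp_add]; simp
  have h4 := Real.exp_pos (-t)
  nlinarith [pow_nonneg ht 3, mul_le_mul_of_nonneg_left h2 h4.le, sq_nonneg t]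

theorem prod_diff {ι : Type*} (s : Finset ι) (f g : ι → ℂ) (hf : ∀ i, ‖f i‖ ≤ 1) (hg : ∀ i, ‖g i‖ ≤ 1) :
    ‖∏ i ∈ s, f i - ∏ i ∈ s, g i‖ ≤ ∑ i ∈ s, ‖f i - g i‖ := by
  classical
  induction s using Finset.induction_on with
  | empty => simp
  | insert a s ha ih =>
    rw [Finset.prod_insert ha, Finset.prod_insert ha, Finset.sum_insert ha]
    have e : f a * ∏ i ∈ s, f i - g a * ∏ i ∈ s, g i = (f a - g a) * ∏ i ∈ s, f i + g a * (∏ i ∈ s, f i - ∏ i ∈ s, g i) := by ring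
    rw [e]
    refine (norm_add_le _ _).trans (add_le_add ?_ ?_)
    · rw [norm_mul]
      refine mul_le_of_le_one_right (norm_nonneg _) ?_
      rw [norm_prod]
      exact Finset.prod_le_one (fun i _ => norm_nonneg _) fun i _ => hf i
    · rw [norm_mul]
      exact (mul_le_of_le_one_left (norm_nonneg _) (hg a)).trans ih

theorem pow_diff (m : ℕ) (z w : ℂ) (hz : ‖z‖ ≤ 1) (hw : ‖w‖ ≤ 1) : ‖z ^ m - w ^ m‖ ≤ m * ‖z - w‖ := by
  have := prod_diff (Finset.range m) (fun _ => z) (fun _ => w) (fun _ => hz) (fun _ => hw)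
  simpa using this

/-- real Gaussian factor as complex number -/
noncomputable def gs (t : ℝ) : ℂ := ((Real.exp (-t) : ℝ) : ℂ)

theorem gs_norm {t : ℝ} (ht : 0 ≤ t) : ‖gs t‖ ≤ 1 := by
  unfold gs
  rw [Complex.norm_real, Real.norm_eq_abs, abs_of_pos (Real.exp_pos _)]
  exact Real.exp_le_one_iff.2 (by linarith)

theorem gs_lip {a b : ℝ} (ha : 0 ≤ a) (hb : 0 ≤ b) : ‖gs a - gs b‖ ≤ |a - b| := by
  unfold gs
  rw [← Complex.ofReal_sub, Complex.norm_real]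
  exact en_lip ha hb

theorem gs_taylor {t : ℝ} (ht : 0 ≤ t) : ‖gs t - (1 - t)‖ ≤ t ^ 2 := by
  unfold gs
  have : ((Real.exp (-t) : ℝ) : ℂ) - (1 - t) = ((Real.exp (-t) - (1 - t) : ℝ) : ℂ) := by push_cast; ring
  rw [this, Complex.norm_real]
  exact en_taylor ht

theorem gs_add (a b : ℝ) : gs (a + b) = gs a * gs b := by
  unfold gs; rw [← Complex.ofReal_mul, ← Real.exp_add]; congr 2; ring

theorem gs_sum {ι : Type*} (s : Finset ι) (f : ι → ℝ) : gs (∑ i ∈ s, f i) = ∏ i ∈ s, gs (f i) := by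
  unfold gs; rw [← Complex.ofReal_prod, ← Real.exp_sum, Finset.sum_neg_distrib]

theorem gs_mul (m : ℕ) (a : ℝ) : gs (m * a) = gs a ^ m := by
  have := gs_sum (Finset.range m) (fun _ => a)
  simpa using this

end GT

namespace GT

theorem Ex_ofReal {Ω : Type*} [Fintype Ω] {w : Ω → ℝ} (f : Ω → ℝ) :
    Ex w (fun x => ((f x : ℝ) : ℂ)) = ((Ex w f : ℝ) : ℂ) := by
  unfold Ex
  push_cast
  exact Finset.sum_congr rfl fun i _ => by simp

/-- second order expansion of a finite characteristic function -/
theorem Ex_taylor {Ω : Type*} [Fintype Ω] {w : Ω → ℝ} (hw : IsW w) (f : Ω → ℝ) (h0 : Ex w f = 0) (θ D : ℝ)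
    (hD : ∀ x, |f x| ≤ D) :
    ‖Ex w (fun x => Complex.exp ((θ * f x : ℝ) * Complex.I)) - gs (θ ^ 2 * Ex w (fun x => f x ^ 2) / 2)‖ ≤
      4 * |θ| ^ 3 * D ^ 3 + θ ^ 4 * D ^ 4 := by
  set Q := Ex w (fun x => f x ^ 2) with hQ
  have hQ0 : 0 ≤ Q := Ex_nonneg hw _ fun x => sq_nonneg _
  have hQD : Q ≤ D ^ 2 := by
    rw [← Ex_const hw (D ^ 2)]
    refine Ex_mono hw _ _ fun x => ?_
    rw [← sq_abs]; exact pow_le_pow_left₀ (abs_nonneg _) (hD x) 2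
  have e1 : Ex w (fun x => (1 + ((θ * f x : ℝ) : ℂ) * Complex.I - ((θ * f x : ℝ) : ℂ) ^ 2 / 2)) = 1 - ((θ ^ 2 * Q / 2 : ℝ) : ℂ) := by
    have e2 : ∀ x, (1 + ((θ * f x : ℝ) : ℂ) * Complex.I - ((θ * f x : ℝ) : ℂ) ^ 2 / 2) =
        1 + (θ * Complex.I) * ((f x : ℝ) : ℂ) - (θ ^ 2 / 2) * ((f x ^ 2 : ℝ) : ℂ) := fun x => by push_cast; ring
    simp only [e2]
    rw [Ex_sub, Ex_add, Ex_const hw, Ex_mulc, Ex_mulc, Ex_ofReal, Ex_ofReal, h0, ← hQ]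
    push_cast; ring
  have h1 : ‖Ex w (fun x => Complex.exp ((θ * f x : ℝ) * Complex.I)) - (1 - ((θ ^ 2 * Q / 2 : ℝ) : ℂ))‖ ≤ 4 * |θ| ^ 3 * D ^ 3 := by
    rw [← e1, ← Ex_sub]
    refine (Ex_norm hw _).trans ?_
    rw [← Ex_const hw (4 * |θ| ^ 3 * D ^ 3)]
    refine Ex_mono hw _ _ fun x => (eI_taylor _).trans ?_
    rw [abs_mul, mul_pow]
    have := pow_le_pow_left₀ (abs_nonneg _) (hD x) 3
    have := mul_le_mul_of_nonneg_left this (by positivity : 0 ≤ 4 * |θ| ^ 3)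
    linarith
  have h2 := gs_taylor (t := θ ^ 2 * Q / 2) (by positivity)
  have h3 : (θ ^ 2 * Q / 2) ^ 2 ≤ θ ^ 4 * D ^ 4 := by
    have h4 : Q ^ 2 ≤ D ^ 4 := by
      calc Q ^ 2 ≤ (D ^ 2) ^ 2 := pow_le_pow_left₀ hQ0 hQD 2
        _ = D ^ 4 := by ring
    have := mul_le_mul_of_nonneg_left h4 (by positivity : 0 ≤ θ ^ 4)
    have h5 : 0 ≤ θ ^ 4 * Q ^ 2 := by positivity
    have h6 : (θ ^ 2 * Q / 2) ^ 2 = θ ^ 4 * Q ^ 2 / 4 := by ring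
    linarith
  have h7 := norm_sub_le_norm_sub_add_norm_sub (Ex w (fun x => Complex.exp ((θ * f x : ℝ) * Complex.I))) (1 - ((θ ^ 2 * Q / 2 : ℝ) : ℂ)) (gs (θ ^ 2 * Q / 2))
  rw [norm_sub_rev] at h2
  linarith

/-- centred characteristic function -/
noncomputable def cf (l : ℕ → Measure ℝ) (θ : ℝ) (n : ℕ) : ℂ :=
  Complex.exp ((-(θ * ee l n) : ℝ) * Complex.I) * charFun (l n) θ

noncomputable def Dl (l : ℕ → Measure ℝ) (θ : ℝ) (n : ℕ) : ℝ := ‖cf l θ n - gs (θ ^ 2 * vv l n / 2)‖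

variable {M A : ℕ} {p : Fin A → ℝ} {ρ : ℝ} {l : ℕ → Measure ℝ} {r δ : ℝ}

theorem Sys.cf_norm (S : Sys M p ρ l) (θ : ℝ) (n : ℕ) : ‖cf l θ n‖ ≤ 1 := by
  have := (S.gd n).prob
  unfold cf
  rw [norm_mul, eI_norm, one_mul]
  exact norm_charFun_le_one θ

theorem cf_int (l : ℕ → Measure ℝ) (θ : ℝ) (n : ℕ) : cf l θ n = ∫ x, Complex.exp ((θ * (x - ee l n) : ℝ) * Complex.I) ∂(l n) := by
  unfold cf
  rw [charFun_apply_real, ← integral_const_mul]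
  refine integral_congr_ae (Eventually.of_forall fun x => ?_)
  simp only
  rw [← Complex.exp_add]; congr 1; push_cast; ring

theorem Sys.apriori (S : Sys M p ρ l) (θ : ℝ) (n : ℕ) (a : ℝ) (ha : 0 < a) :
    Dl l θ n ≤ 4 * |θ| ^ 3 * ((a * vv l n + kk l n / a) / 2) + θ ^ 4 * vv l n ^ 2 := by
  have hpr := (S.gd n).prob
  have hm : MemLp (fun x => x - ee l n) 4 (l n) := (S.gd n).cent _
  have i1 : Integrable (fun x => x - ee l n) (l n) := by simpa using int_pow hm 1 (by norm_num)
  have i2 : Integrable (fun x => (x - ee l n) ^ 2) (l n) := int_pow hm 2 (by norm_num)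
  have i4 : Integrable (fun x => (x - ee l n) ^ 4) (l n) := int_pow hm 4 (by norm_num)
  have hv0 := S.v_nonneg n
  have m1 : ∫ x, (x - ee l n) ∂(l n) = 0 := by
    have i0 : Integrable (fun x => x) (l n) := by simpa using int_pow (S.gd n).mem 1 (by norm_num)
    rw [integral_sub i0 (integrable_const _)]
    simp [ee, mE]
  have ie : Integrable (fun x => Complex.exp ((θ * (x - ee l n) : ℝ) * Complex.I)) (l n) := by
    refine Integrable.mono' (integrable_const 1) (by fun_prop) (Eventually.of_forall fun y => ?_)
    rw [eI_norm]
  have e2 : ∀ x, (1 + ((θ * (x - ee l n) : ℝ) : ℂ) * Complex.I - ((θ * (x - ee l n) : ℝ) : ℂ) ^ 2 / 2) =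
        1 + (θ * Complex.I) * ((x - ee l n : ℝ) : ℂ) - (θ ^ 2 / 2) * (((x - ee l n) ^ 2 : ℝ) : ℂ) := fun x => by push_cast; ring
  have j1 : Integrable (fun x => (θ * Complex.I) * ((x - ee l n : ℝ) : ℂ)) (l n) := i1.ofReal.const_mul _
  have j2 : Integrable (fun x => ((θ : ℂ) ^ 2 / 2) * (((x - ee l n) ^ 2 : ℝ) : ℂ)) (l n) := i2.ofReal.const_mul _
  have j3 : Integrable (fun x => 1 + (θ * Complex.I) * ((x - ee l n : ℝ) : ℂ)) (l n) := (integrable_const _).add j1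
  have j4 : Integrable (fun x => 1 + (θ * Complex.I) * ((x - ee l n : ℝ) : ℂ) - ((θ : ℂ) ^ 2 / 2) * (((x - ee l n) ^ 2 : ℝ) : ℂ)) (l n) := j3.sub j2
  have e1 : ∫ x, (1 + ((θ * (x - ee l n) : ℝ) : ℂ) * Complex.I - ((θ * (x - ee l n) : ℝ) : ℂ) ^ 2 / 2) ∂(l n) = 1 - ((θ ^ 2 * vv l n / 2 : ℝ) : ℂ) := by
    simp only [e2]
    rw [integral_sub j3 j2, integral_add (integrable_const _) j1, integral_const_mul, integral_const_mul,
      integral_complex_ofReal, integral_complex_ofReal, m1]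
    have : ∫ x, (x - ee l n) ^ 2 ∂(l n) = vv l n := rfl
    rw [this]
    simp; ring
  have h1 : ‖cf l θ n - (1 - ((θ ^ 2 * vv l n / 2 : ℝ) : ℂ))‖ ≤ 4 * |θ| ^ 3 * ((a * vv l n + kk l n / a) / 2) := by
    rw [← e1, cf_int]
    simp only [e2]
    rw [← integral_sub ie j4]
    have ib : Integrable (fun x => 4 * |θ| ^ 3 * ((a * (x - ee l n) ^ 2 + (x - ee l n) ^ 4 / a) / 2)) (l n) :=
      (((i2.const_mul a).add (i4.div_const a)).div_const 2).const_mul _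
    refine (norm_integral_le_of_norm_le ib (Eventually.of_forall fun x => ?_)).trans (le_of_eq ?_)
    · rw [← e2]
      refine (eI_taylor _).trans ?_
      rw [abs_mul, mul_pow, ← mul_assoc]
      refine mul_le_mul_of_nonneg_left ?_ (by positivity)
      set y := x - ee l n
      have hy : |y| ^ 2 = y ^ 2 := sq_abs y
      have hy4 : y ^ 4 = |y| ^ 4 := (Even.pow_abs (by decide : Even 4) y).symm
      rw [hy4, ← hy]
      have h0 := abs_nonneg y
      rw [le_div_iff₀ (by norm_num : (0 : ℝ) < 2)]
      have h2 : a * |y| ^ 2 + |y| ^ 4 / a - |y| ^ 3 * 2 = |y| ^ 2 * (a - |y|) ^ 2 / a := by field_simp; ring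
      have h3 : 0 ≤ |y| ^ 2 * (a - |y|) ^ 2 / a := by positivity
      linarith
    · have s : Integrable (fun x => a * (x - ee l n) ^ 2) (l n) := i2.const_mul a
      have s' : Integrable (fun x => (x - ee l n) ^ 4 / a) (l n) := i4.div_const a
      rw [integral_const_mul, integral_div, integral_add s s', integral_const_mul, integral_div]
      rfl
  have h2 := gs_taylor (t := θ ^ 2 * vv l n / 2) (by positivity)
  have h7 := norm_sub_le_norm_sub_add_norm_sub (cf l θ n) (1 - ((θ ^ 2 * vv l n / 2 : ℝ) : ℂ)) (gs (θ ^ 2 * vv l n / 2))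
  rw [norm_sub_rev] at h2
  have h5 : 0 ≤ θ ^ 4 * vv l n ^ 2 := by positivity
  have h6 : (θ ^ 2 * vv l n / 2) ^ 2 = θ ^ 4 * vv l n ^ 2 / 4 := by ring
  unfold Dl
  linarith

theorem Sys.cf_rec (S : Sys M p ρ l) (θ : ℝ) (n : ℕ) :
    cf l θ n = Ex (pw (pw p)) (fun x : Fin M → Fin n → Fin A =>
      Complex.exp ((θ * (cm (ee l) x - ee l n) : ℝ) * Complex.I) * ∏ q : Fin M × Fin A, cf l θ (cnt (x q.1) q.2)) := by
  unfold cf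
  have h := step_char (M := M) S.hw l (fun n => (S.gd n).prob) n θ
  rw [← S.st n] at h
  rw [h, ← Ex_mulc]
  congr 1
  funext x
  rw [Finset.prod_mul_distrib, ← Complex.exp_sum, ← mul_assoc, ← mul_assoc, ← Complex.exp_add, ← Complex.exp_add]
  congr 2
  unfold cm
  rw [← Finset.sum_mul]
  push_cast
  rw [Finset.sum_neg_distrib, ← Finset.mul_sum]
  ring

end GT

namespace GT

variable {M A : ℕ} {p : Fin A → ℝ} {ρ : ℝ} {l : ℕ → Measure ℝ} {r δ : ℝ}

theorem Ex_dev {Ω : Type*} [Fintype Ω] {w : Ω → ℝ} (hw : IsW w) (F : Ω → ℝ) (c : ℝ) :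
    Ex w (fun x => |F x - Ex w F|) ≤ 2 * Ex w (fun x => |F x - c|) := by
  have h1 : |c - Ex w F| ≤ Ex w (fun x => |F x - c|) := by
    have h2 := Ex_abs hw (fun x => F x - c)
    rw [Ex_sub, Ex_const hw] at h2
    rwa [abs_sub_comm]
  have h3 : Ex w (fun x => |F x - Ex w F|) ≤ Ex w (fun x => |F x - c| + |c - Ex w F|) :=
    Ex_mono hw _ _ fun x => abs_sub_le _ _ _
  rw [Ex_add, Ex_const hw] at h3
  linarith

theorem Ex_powc {Ω : Type*} [Fintype Ω] {w : Ω → ℝ} (m : ℕ) (f : Ω → ℂ) :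
    Ex (pw w) (fun x : Fin m → Ω => ∏ i, f (x i)) = Ex w f ^ m := by
  have h := Ex_pw_prod (w := w) (fun _ : Fin m => f)
  rw [Finset.prod_const, Finset.card_univ, Fintype.card_fin] at h
  exact h

theorem Par.V_close (P : Par M p ρ l r δ) : ∃ C, 0 < C ∧ ∀ n,
    Ex (pw (pw p)) (fun x : Fin M → Fin n → Fin A => |∑ q : Fin M × Fin A, vv l (cnt (x q.1) q.2) - TT (fun _ => (M : ℝ)) p n (vv l)|) ≤
      C * br n ^ (r - δ) := by
  obtain ⟨K, hK, hd⟩ := P.v_diff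
  choose C hC J h using fun a => smooth1 (P.hp a).1 (P.hp a).2.le (r - δ - 1 / 2)
  choose C2 hC2 h2 using Bn_W
  have hs : 0 ≤ ∑ q : Fin M × Fin A, K * C q.2 * C2 (J q.2) := Finset.sum_nonneg fun q _ => by
    have := hC q.2; have := hC2 (J q.2); positivity
  refine ⟨2 * ∑ q : Fin M × Fin A, K * C q.2 * C2 (J q.2) + 1, by linarith, fun n => ?_⟩
  have hW := isW_pw (ι := Fin M) (isW_pw (ι := Fin n) P.hw)
  rw [← Ex_cnts P.hw n (vv l)]
  refine (Ex_dev hW _ (∑ q : Fin M × Fin A, vv l (fl (p q.2) n))).trans ?_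
  have e : r - δ - 1 / 2 + 1 / 2 = r - δ := by ring
  have h3 : ∀ x : Fin M → Fin n → Fin A, |∑ q : Fin M × Fin A, vv l (cnt (x q.1) q.2) - ∑ q : Fin M × Fin A, vv l (fl (p q.2) n)| ≤
      ∑ q : Fin M × Fin A, K * C q.2 * br n ^ (r - δ) * Wf (p q.2) n (cnt (x q.1) q.2) ^ J q.2 := fun x => by
    rw [← Finset.sum_sub_distrib]
    refine (Finset.abs_sum_le_sum_abs _ _).trans (Finset.sum_le_sum fun q _ => ?_)
    have := h q.2 (vv l) K hK.le hd n _ (cnt_le (x q.1) q.2)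
    rw [e] at this
    linarith
  have h4 := Ex_mono hW _ _ h3
  rw [Ex_sum] at h4
  have h5 : ∑ q : Fin M × Fin A, Ex (pw (pw p)) (fun x : Fin M → Fin n → Fin A => K * C q.2 * br n ^ (r - δ) * Wf (p q.2) n (cnt (x q.1) q.2) ^ J q.2) ≤
      ∑ q : Fin M × Fin A, K * C q.2 * C2 (J q.2) * br n ^ (r - δ) := by
    refine Finset.sum_le_sum fun q _ => ?_
    rw [Ex_mul, Ex_pw_one (isW_pw P.hw) q.1 (fun y : Fin n → Fin A => Wf (p q.2) n (cnt y q.2) ^ J q.2),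
      Ex_cnt P.hw q.2 n (fun N => Wf (p q.2) n N ^ J q.2)]
    have := h2 (J q.2) (p q.2) (P.hp _).1.le (P.hp _).2.le n
    have hc := hC q.2
    have hb := br_rpow_pos n (r - δ)
    have := mul_le_mul_of_nonneg_left this (by positivity : 0 ≤ K * C q.2 * br n ^ (r - δ))
    linarith
  rw [← Finset.sum_mul] at h5
  linarith [br_rpow_pos n (r - δ)]

set_option maxHeartbeats 1000000 in
theorem Par.z_close (P : Par M p ρ l r δ) : ∃ C, 0 < C ∧ ∀ (n : ℕ) (θ w : ℝ), w = |θ| * br n ^ (r / 2) →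
    ‖Ex (pw p) (fun y : Fin n → Fin A => Complex.exp ((θ * Xc p l y : ℝ) * Complex.I)) - gs (θ ^ 2 * Tv p l n / 2)‖ ≤
      C * (w + w ^ 2 + w ^ 3 + w ^ 4) * br n ^ (-δ) := by
  obtain ⟨C1, hC1, J, hlin⟩ := P.lin
  obtain ⟨C2, hC2, hZ⟩ := ZZ_mom P.hw P.hp J
  obtain ⟨CT, hCT, hT⟩ := P.T_bound
  obtain ⟨CD, hCD, hD⟩ := P.hD
  have hδ := P.hδ
  have hδ4 := P.hδ4
  refine ⟨C1 * C2 + CT + 4 * CD ^ 3 + CD ^ 4, by positivity, fun n θ w hw => ?_⟩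
  have hW := isW_pw (ι := Fin n) P.hw
  have hb0 := br_rpow_pos n (-δ)
  have hbr := br_rpow_pos n (r / 2)
  have hw0 : 0 ≤ w := by rw [hw]; positivity
  set b := br n ^ (-δ) with hb
  set c := br n ^ (-(1 / 2) : ℝ) with hc
  have hc0 : 0 < c := br_rpow_pos n _
  have hcb : c ≤ b := br_le_of n (by linarith)
  have hc1 : c ≤ 1 := by
    have : c ≤ br n ^ (0 : ℝ) := br_le_of n (by norm_num)
    simpa using this
  have hcn : (n : ℝ) * c ^ 2 ≤ 1 := by
    have h1 : (n : ℝ) ≤ br n := by unfold br; linarith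
    have h2 : br n * c ^ 2 = 1 := by
      rw [hc, br_sq]; norm_num
      rw [Real.rpow_neg_one, mul_inv_cancel₀ (br_pos n).ne']
    have := mul_le_mul_of_nonneg_right h1 (sq_nonneg c)
    linarith
  have q1 : Ex (pw p) (fun y : Fin n → Fin A => |Xc p l y - Lc p l y|) ≤ C1 * br n ^ (r / 2 - δ) * C2 := by
    have : Ex (pw p) (fun y : Fin n → Fin A => |Xc p l y - Lc p l y|) ≤ Ex (pw p) (fun y : Fin n → Fin A => C1 * br n ^ (r / 2 - δ) * ZZ p J y) :=
      Ex_mono hW _ _ fun y => (hlin n y).1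
    rw [Ex_mul] at this
    exact this.trans (mul_le_mul_of_nonneg_left (hZ n) (mul_nonneg hC1.le (br_rpow_pos n _).le))
  have s1 : ‖Ex (pw p) (fun y : Fin n → Fin A => Complex.exp ((θ * Xc p l y : ℝ) * Complex.I)) -
      Ex (pw p) (fun y : Fin n → Fin A => Complex.exp ((θ * Lc p l y : ℝ) * Complex.I))‖ ≤ C1 * C2 * w * b := by
    rw [← Ex_sub]
    refine (Ex_norm hW _).trans ?_
    have : Ex (pw p) (fun y : Fin n → Fin A => ‖Complex.exp ((θ * Xc p l y : ℝ) * Complex.I) - Complex.exp ((θ * Lc p l y : ℝ) * Complex.I)‖) ≤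
        Ex (pw p) (fun y : Fin n → Fin A => |θ| * |Xc p l y - Lc p l y|) := by
      refine Ex_mono hW _ _ fun y => (eI_lip _ _).trans (le_of_eq ?_)
      rw [← mul_sub, abs_mul]
    rw [Ex_mul] at this
    refine this.trans ((mul_le_mul_of_nonneg_left q1 (abs_nonneg θ)).trans (le_of_eq ?_))
    have : br n ^ (r / 2 - δ) = br n ^ (r / 2) * b := by rw [hb, br_mul]; congr 1
    rw [this, hw]; ring
  have s2 : ‖Ex (pw p) (fun y : Fin n → Fin A => Complex.exp ((θ * Lc p l y : ℝ) * Complex.I)) - gs (n * (θ ^ 2 * QQ p l n / 2))‖ ≤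
      (4 * CD ^ 3 * w ^ 3 + CD ^ 4 * w ^ 4) * b := by
    have e1 : Ex (pw p) (fun y : Fin n → Fin A => Complex.exp ((θ * Lc p l y : ℝ) * Complex.I)) =
        Ex p (fun a => Complex.exp ((θ * (gg p l n a - gb p l n) : ℝ) * Complex.I)) ^ n := by
      have : (fun y : Fin n → Fin A => Complex.exp ((θ * Lc p l y : ℝ) * Complex.I)) =
          fun y => ∏ i, (fun a => Complex.exp ((θ * (gg p l n a - gb p l n) : ℝ) * Complex.I)) (y i) := by
        funext y
        rw [← Complex.exp_sum, ← Finset.sum_mul, ← Complex.ofReal_sum, ← Finset.mul_sum]; rfl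
      rw [this]; exact Ex_powc n (fun a => Complex.exp ((θ * (gg p l n a - gb p l n) : ℝ) * Complex.I))
    rw [e1, gs_mul]
    have hQ0 : 0 ≤ QQ p l n := Vr_nonneg P.hw _
    refine (pow_diff n _ _ ?_ (gs_norm (by positivity))).trans ?_
    · refine (Ex_norm P.hw _).trans ?_
      simp only [eI_norm]
      rw [Ex_const P.hw]
    · have h0 : Ex p (fun a => gg p l n a - gb p l n) = 0 := by
        rw [Ex_sub, Ex_const P.hw]; exact sub_self _
      have h1 := Ex_taylor P.hw (fun a => gg p l n a - gb p l n) h0 θ _ (P.gb_close (hD n))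
      have h2 : (CD * br n ^ ((r - 1) / 2)) = CD * (br n ^ (r / 2) * c) := by rw [hc, br_mul]; congr 2; ring
      rw [h2] at h1
      have h3 : 4 * |θ| ^ 3 * (CD * (br n ^ (r / 2) * c)) ^ 3 + θ ^ 4 * (CD * (br n ^ (r / 2) * c)) ^ 4 = 4 * CD ^ 3 * w ^ 3 * c ^ 3 + CD ^ 4 * w ^ 4 * c ^ 4 := by
        rw [hw, ← Even.pow_abs (by decide : Even 4) θ]; ring
      rw [h3] at h1
      have h4 := mul_le_mul_of_nonneg_left h1 (by positivity : (0 : ℝ) ≤ n)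
      refine h4.trans ?_
      have h5 : n * (4 * CD ^ 3 * w ^ 3 * c ^ 3 + CD ^ 4 * w ^ 4 * c ^ 4) = (n * c ^ 2) * (4 * CD ^ 3 * w ^ 3 * c + CD ^ 4 * w ^ 4 * (c * c)) := by ring
      rw [h5]
      have h6 : 0 ≤ 4 * CD ^ 3 * w ^ 3 * c + CD ^ 4 * w ^ 4 * (c * c) := by positivity
      refine (mul_le_of_le_one_left h6 hcn).trans ?_
      have h7 : c * c ≤ b := by nlinarith
      have h8 := mul_le_mul_of_nonneg_left hcb (by positivity : 0 ≤ 4 * CD ^ 3 * w ^ 3)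
      have h9 := mul_le_mul_of_nonneg_left h7 (by positivity : 0 ≤ CD ^ 4 * w ^ 4)
      linarith
  have s3 : ‖gs (n * (θ ^ 2 * QQ p l n / 2)) - gs (θ ^ 2 * Tv p l n / 2)‖ ≤ CT * w ^ 2 * b := by
    have hQ0 : 0 ≤ QQ p l n := Vr_nonneg P.hw _
    have hT0 := P.T_nonneg n
    refine (gs_lip (by positivity) (by positivity)).trans ?_
    have e : n * (θ ^ 2 * QQ p l n / 2) - θ ^ 2 * Tv p l n / 2 = -(θ ^ 2 / 2 * (Tv p l n - n * QQ p l n)) := by ring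
    rw [e, abs_neg, abs_mul, abs_of_nonneg (by positivity : 0 ≤ θ ^ 2 / 2)]
    have h1 := mul_le_mul_of_nonneg_left (hT n).2 (by positivity : 0 ≤ θ ^ 2 / 2)
    have h2 : br n ^ (r - δ) = (br n ^ (r / 2)) ^ 2 * b := by rw [hb, br_sq, br_mul]; congr 1; ring
    rw [h2] at h1
    have h3 : CT * w ^ 2 * b = 2 * (θ ^ 2 / 2 * (CT * ((br n ^ (r / 2)) ^ 2 * b))) := by rw [hw, mul_pow, sq_abs]; ring
    have h4 : 0 ≤ θ ^ 2 / 2 * (CT * ((br n ^ (r / 2)) ^ 2 * b)) := by positivity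
    linarith
  have t1 := norm_sub_le_norm_sub_add_norm_sub (Ex (pw p) (fun y : Fin n → Fin A => Complex.exp ((θ * Xc p l y : ℝ) * Complex.I)))
    (Ex (pw p) (fun y : Fin n → Fin A => Complex.exp ((θ * Lc p l y : ℝ) * Complex.I))) (gs (θ ^ 2 * Tv p l n / 2))
  have t2 := norm_sub_le_norm_sub_add_norm_sub (Ex (pw p) (fun y : Fin n → Fin A => Complex.exp ((θ * Lc p l y : ℝ) * Complex.I)))
    (gs (n * (θ ^ 2 * QQ p l n / 2))) (gs (θ ^ 2 * Tv p l n / 2))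
  have t3 : C1 * C2 * w + ((4 * CD ^ 3 * w ^ 3 + CD ^ 4 * w ^ 4) + CT * w ^ 2) ≤ (C1 * C2 + CT + 4 * CD ^ 3 + CD ^ 4) * (w + w ^ 2 + w ^ 3 + w ^ 4) := by
    have : 0 ≤ C1 * C2 * (w ^ 2 + w ^ 3 + w ^ 4) + CT * (w + w ^ 3 + w ^ 4) + 4 * CD ^ 3 * (w + w ^ 2 + w ^ 4) + CD ^ 4 * (w + w ^ 2 + w ^ 3) := by positivity
    linarith
  have t4 := mul_le_mul_of_nonneg_right t3 hb0.le
  linarith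

set_option maxHeartbeats 1000000 in
/-- the basic recursive inequality for `Dl` -/
theorem Par.D_rec (P : Par M p ρ l r δ) : ∃ C, 0 < C ∧ ∀ (n : ℕ) (θ w : ℝ), A < n → w = |θ| * br n ^ (r / 2) →
    Dl l θ n ≤ TT (fun _ => (M : ℝ)) p n (Dl l θ) + C * (w + w ^ 2 + w ^ 3 + w ^ 4) * br n ^ (-δ) := by
  obtain ⟨C1, hC1, h1⟩ := P.V_close
  obtain ⟨C2, hC2, h2⟩ := P.z_close
  have hM := P.M_pos
  refine ⟨C1 + M * C2, by positivity, fun n θ w hn hw => ?_⟩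
  have hW := isW_pw (ι := Fin M) (isW_pw (ι := Fin n) P.hw)
  have hbr := br_rpow_pos n (r / 2)
  have hw0 : 0 ≤ w := by rw [hw]; positivity
  have hb0 := br_rpow_pos n (-δ)
  set E : (Fin M → Fin n → Fin A) → ℂ := fun x => Complex.exp ((θ * (cm (ee l) x - ee l n) : ℝ) * Complex.I) with hE
  set V : (Fin M → Fin n → Fin A) → ℝ := fun x => ∑ q : Fin M × Fin A, vv l (cnt (x q.1) q.2) with hV
  set F : (Fin M → Fin n → Fin A) → ℂ := fun x => ∏ q : Fin M × Fin A, cf l θ (cnt (x q.1) q.2) with hF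
  set m := TT (fun _ => (M : ℝ)) p n (vv l) with hm
  have hV0 : ∀ x, 0 ≤ V x := fun x => Finset.sum_nonneg fun q _ => P.v_nonneg _
  have hEV : Ex (pw (pw p)) V = m := Ex_cnts P.hw n (vv l)
  have hm0 : 0 ≤ m := by rw [← hEV]; exact Ex_nonneg hW _ hV0
  have hT0 := P.T_nonneg n
  have s1 : ‖Ex (pw (pw p)) (fun x => E x * F x) - Ex (pw (pw p)) (fun x => E x * gs (θ ^ 2 * V x / 2))‖ ≤ TT (fun _ => (M : ℝ)) p n (Dl l θ) := by
    rw [← Ex_sub, ← Ex_cnts P.hw n (Dl l θ)]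
    refine (Ex_norm hW _).trans (Ex_mono hW _ _ fun x => ?_)
    rw [← mul_sub, norm_mul, hE, eI_norm, one_mul]
    have e : gs (θ ^ 2 * V x / 2) = ∏ q : Fin M × Fin A, gs (θ ^ 2 * vv l (cnt (x q.1) q.2) / 2) := by
      rw [← gs_sum, ← Finset.sum_div, ← Finset.mul_sum]
    rw [e]
    refine prod_diff _ _ _ (fun q => P.cf_norm θ _) fun q => gs_norm ?_
    have := P.v_nonneg (cnt (x q.1) q.2)
    positivity
  have s2 : ‖Ex (pw (pw p)) (fun x => E x * gs (θ ^ 2 * V x / 2)) - Ex (pw (pw p)) (fun x => E x * gs (θ ^ 2 * m / 2))‖ ≤ C1 * w ^ 2 * br n ^ (-δ) := by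
    rw [← Ex_sub]
    refine (Ex_norm hW _).trans ?_
    have h3 : Ex (pw (pw p)) (fun x => ‖E x * gs (θ ^ 2 * V x / 2) - E x * gs (θ ^ 2 * m / 2)‖) ≤ Ex (pw (pw p)) (fun x => θ ^ 2 / 2 * |V x - m|) := by
      refine Ex_mono hW _ _ fun x => ?_
      rw [← mul_sub, norm_mul, hE, eI_norm, one_mul]
      have := hV0 x
      refine (gs_lip (by positivity) (by positivity)).trans (le_of_eq ?_)
      have e : θ ^ 2 * V x / 2 - θ ^ 2 * m / 2 = θ ^ 2 / 2 * (V x - m) := by ring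
      rw [e, abs_mul, abs_of_nonneg (by positivity : 0 ≤ θ ^ 2 / 2)]
    rw [Ex_mul] at h3
    have h4 := mul_le_mul_of_nonneg_left (h1 n) (by positivity : 0 ≤ θ ^ 2 / 2)
    have h5 : br n ^ (r - δ) = (br n ^ (r / 2)) ^ 2 * br n ^ (-δ) := by rw [br_sq, br_mul]; congr 1; ring
    rw [h5] at h4
    have h6 : C1 * w ^ 2 * br n ^ (-δ) = 2 * (θ ^ 2 / 2 * (C1 * ((br n ^ (r / 2)) ^ 2 * br n ^ (-δ)))) := by rw [hw, mul_pow, sq_abs]; ring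
    have h7 : 0 ≤ θ ^ 2 / 2 * (C1 * ((br n ^ (r / 2)) ^ 2 * br n ^ (-δ))) := by positivity
    linarith
  have hz1 : ‖Ex (pw p) (fun y : Fin n → Fin A => Complex.exp ((θ * Xc p l y : ℝ) * Complex.I))‖ ≤ 1 := by
    refine (Ex_norm (isW_pw P.hw) _).trans ?_
    simp only [eI_norm]
    rw [Ex_const (isW_pw P.hw)]
  have s3 : ‖Ex (pw (pw p)) (fun x => E x * gs (θ ^ 2 * m / 2)) - gs (θ ^ 2 * vv l n / 2)‖ ≤ M * (C2 * (w + w ^ 2 + w ^ 3 + w ^ 4) * br n ^ (-δ)) := by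
    have e1 : Ex (pw (pw p)) (fun x => E x * gs (θ ^ 2 * m / 2)) =
        gs (θ ^ 2 * m / 2) * Ex (pw p) (fun y : Fin n → Fin A => Complex.exp ((θ * Xc p l y : ℝ) * Complex.I)) ^ M := by
      have e2 : (fun x => E x * gs (θ ^ 2 * m / 2)) = fun x => gs (θ ^ 2 * m / 2) * ∏ i, (fun (y : Fin n → Fin A) => Complex.exp ((θ * Xc p l y : ℝ) * Complex.I)) (x i) := by
        funext x
        rw [mul_comm]; congr 1
        rw [← Complex.exp_sum, ← Finset.sum_mul, ← Complex.ofReal_sum, ← Finset.mul_sum, hE]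
        simp only [P.cm_cent hn]
      rw [e2, Ex_mulc]; congr 1; exact Ex_powc M (fun y : Fin n → Fin A => Complex.exp ((θ * Xc p l y : ℝ) * Complex.I))
    have e3 : gs (θ ^ 2 * vv l n / 2) = gs (θ ^ 2 * m / 2) * gs (θ ^ 2 * Tv p l n / 2) ^ M := by
      rw [← gs_mul, ← gs_add, P.v_rec' hn]; congr 1; ring
    rw [e1, e3, ← mul_sub, norm_mul]
    refine (mul_le_of_le_one_left (norm_nonneg _) (gs_norm (by positivity))).trans ?_
    refine (pow_diff M _ _ hz1 (gs_norm (by positivity))).trans ?_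
    exact mul_le_mul_of_nonneg_left (h2 n θ w hw) hM.le
  have t1 := norm_sub_le_norm_sub_add_norm_sub (Ex (pw (pw p)) (fun x => E x * F x)) (Ex (pw (pw p)) (fun x => E x * gs (θ ^ 2 * V x / 2))) (gs (θ ^ 2 * vv l n / 2))
  have t2 := norm_sub_le_norm_sub_add_norm_sub (Ex (pw (pw p)) (fun x => E x * gs (θ ^ 2 * V x / 2))) (Ex (pw (pw p)) (fun x => E x * gs (θ ^ 2 * m / 2))) (gs (θ ^ 2 * vv l n / 2))
  have e0 : Dl l θ n = ‖Ex (pw (pw p)) (fun x => E x * F x) - gs (θ ^ 2 * vv l n / 2)‖ := by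
    unfold Dl; rw [P.cf_rec θ n]
  rw [e0]
  have t3 : 0 ≤ C1 * (w + w ^ 3 + w ^ 4) * br n ^ (-δ) := by positivity
  linarith

end GT

namespace GT

variable {M A : ℕ} {p : Fin A → ℝ} {ρ : ℝ} {l : ℕ → Measure ℝ} {r δ : ℝ}

theorem Par.D_apriori (P : Par M p ρ l r δ) {Cv : ℝ} (hv : ∀ n, |vv l n| ≤ Cv * br n ^ r) :
    ∃ C, 0 < C ∧ ∀ (n : ℕ) (θ w : ℝ), w = |θ| * br n ^ (r / 2) → Dl l θ n ≤ C * (w ^ 3 + w ^ 4) := by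
  obtain ⟨Ck, hCk, hk⟩ := P.k_bound hv
  have hCv : 0 ≤ Cv := by
    have h1 := (abs_nonneg _).trans (hv 0)
    exact nonneg_of_mul_nonneg_left h1 (br_rpow_pos 0 r)
  refine ⟨2 * (Cv + Ck) + Cv ^ 2, by positivity, fun n θ w hw => ?_⟩
  set a := br n ^ (r / 2) with ha
  have ha0 : 0 < a := br_rpow_pos n _
  have e1 : br n ^ r = a ^ 2 := by rw [ha, br_sq]; congr 1; ring
  have e2 : br n ^ (2 * r) = a ^ 4 := by rw [← br_sq, e1]; ring
  have h1 := P.apriori θ n a ha0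
  have hv1 := (le_abs_self _).trans (hv n)
  have hk1 := hk n
  rw [e1] at hv1
  rw [e2] at hk1
  have hv0 := P.v_nonneg n
  have h2 : kk l n / a ≤ Ck * a ^ 3 := by
    rw [div_le_iff₀ ha0]; linarith
  have h3 : a * vv l n ≤ a * (Cv * a ^ 2) := mul_le_mul_of_nonneg_left hv1 ha0.le
  have h4 : vv l n ^ 2 ≤ (Cv * a ^ 2) ^ 2 := pow_le_pow_left₀ hv0 hv1 2
  have h5 := mul_le_mul_of_nonneg_left (by linarith : (a * vv l n + kk l n / a) / 2 ≤ (Cv + Ck) / 2 * a ^ 3) (by positivity : 0 ≤ 4 * |θ| ^ 3)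
  have h6 := mul_le_mul_of_nonneg_left h4 (by positivity : 0 ≤ θ ^ 4)
  have h7 : (2 * (Cv + Ck) + Cv ^ 2) * (w ^ 3 + w ^ 4) = 4 * |θ| ^ 3 * ((Cv + Ck) / 2 * a ^ 3) + θ ^ 4 * (Cv * a ^ 2) ^ 2 + (Cv ^ 2 * w ^ 3 + 2 * (Cv + Ck) * w ^ 4) := by
    have : w ^ 4 = θ ^ 4 * a ^ 4 := by rw [hw, mul_pow, Even.pow_abs (by decide : Even 4)]
    have h3 : w ^ 3 = |θ| ^ 3 * a ^ 3 := by rw [hw, mul_pow]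
    rw [this, h3]; ring
  have hw0 : 0 ≤ w := by rw [hw]; positivity
  have h8 : 0 ≤ Cv ^ 2 * w ^ 3 + 2 * (Cv + Ck) * w ^ 4 := by positivity
  linarith

set_option maxHeartbeats 1000000 in
theorem Par.D_small (P : Par M p ρ l r δ) {Cv : ℝ} (hv : ∀ n, |vv l n| ≤ Cv * br n ^ r) (K ε : ℝ) (hK : 0 < K) (hε : 0 < ε) :
    ∃ θ0, 0 < θ0 ∧ ∀ θ, |θ| < θ0 → ∀ n, |θ| * br n ^ (r / 2) ≤ K → Dl l θ n ≤ ε := by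
  obtain ⟨C0, hC0, h0⟩ := P.D_apriori hv
  obtain ⟨C3, hC3, h3⟩ := P.D_rec
  have hc : ∀ i : Fin A, 0 ≤ (fun _ : Fin A => (M : ℝ)) i := fun _ => P.M_pos.le
  obtain ⟨C4, hC4, h4⟩ := TT_rpow hc P.hp r
  obtain ⟨C5, hC5, h5⟩ := TT_rpow hc P.hp (2 * r)
  have hr1 : 1 ≤ r := P.ρ_ge.trans P.hrρ
  have hl1 : ∑ i, (M : ℝ) * p i ^ r ≤ 1 := by
    rw [P.wsum]
    rcases P.hrρ.eq_or_lt with h | h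
    · rw [← h]; exact P.hρ.le
    · exact (P.sum_lt r h).le
  have hl2 : ∑ i, (M : ℝ) * p i ^ (2 * r) < 1 := by
    rw [P.wsum]; exact P.sum_lt _ (by linarith [P.hrρ, P.ρ_ge])
  set κ := 1 - ∑ i, (M : ℝ) * p i ^ (2 * r) with hκ
  have hκ0 : 0 < κ := by linarith
  set α := ε / (K ^ 2 + K ^ 4) with hα
  have hα0 : 0 < α := by positivity
  obtain ⟨w0, hw00, hw01, hw0⟩ : ∃ w0 : ℝ, 0 < w0 ∧ w0 ≤ 1 ∧ 2 * C0 * w0 ≤ α := by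
    refine ⟨min 1 (α / (2 * C0)), lt_min one_pos (by positivity), min_le_left _ _, ?_⟩
    have := min_le_right (1 : ℝ) (α / (2 * C0))
    rw [le_div_iff₀ (by positivity)] at this
    linarith
  set Cs := (α * C4 + α * C5 + 4 * C3) / w0 ^ 3 with hCs
  obtain ⟨n1, hn1⟩ := br_small δ P.hδ Cs (α * κ) (by positivity)
  set n2 := n1 + A + 2 with hn2
  refine ⟨w0 / br n2 ^ (r / 2), div_pos hw00 (br_rpow_pos _ _), fun θ hθ n hn => ?_⟩
  set w : ℕ → ℝ := fun n => |θ| * br n ^ (r / 2) with hw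
  have hwn : ∀ n, 0 ≤ w n := fun n => mul_nonneg (abs_nonneg _) (br_rpow_pos _ _).le
  have hw2 : ∀ n, w n ^ 2 = θ ^ 2 * br n ^ r := fun n => by
    simp only [hw]; rw [mul_pow, sq_abs, br_sq]; congr 2; ring
  have hw4 : ∀ n, w n ^ 4 = θ ^ 4 * br n ^ (2 * r) := fun n => by
    have : w n ^ 4 = (w n ^ 2) ^ 2 := by ring
    rw [this, hw2, mul_pow, br_sq]; ring
  have hlow : ∀ n, w n ≤ w0 → Dl l θ n ≤ α * w n ^ 2 + α * w n ^ 4 := fun n h => by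
    have h1 := h0 n θ (w n) rfl
    have h2 := hwn n
    have h6 : w n ^ 4 ≤ w n ^ 3 := by
      have : w n ^ 3 * w n ≤ w n ^ 3 * 1 := mul_le_mul_of_nonneg_left (h.trans hw01) (by positivity)
      linarith [this, (by ring : w n ^ 3 * w n = w n ^ 4)]
    have h7 : C0 * (w n ^ 3 + w n ^ 4) ≤ C0 * (w n ^ 3 + w n ^ 3) := by gcongr
    have h8 : 2 * C0 * w n ≤ α := (mul_le_mul_of_nonneg_left h (by positivity)).trans hw0
    have h9 := mul_le_mul_of_nonneg_right h8 (by positivity : 0 ≤ w n ^ 2)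
    have h10 : C0 * (w n ^ 3 + w n ^ 3) = 2 * C0 * w n * w n ^ 2 := by ring
    have h11 : 0 ≤ α * w n ^ 4 := by positivity
    linarith
  have hbig : ∀ n, w0 ≤ w n → n2 ≤ n := fun n h => by
    by_contra hlt
    push Not at hlt
    have h1 : br n ^ (r / 2) ≤ br n2 ^ (r / 2) := Real.rpow_le_rpow (br_pos _).le (br_mono hlt.le) (by linarith)
    have h2 : |θ| * br n2 ^ (r / 2) < w0 := (lt_div_iff₀ (br_rpow_pos _ _)).1 hθ
    have h6 := mul_le_mul_of_nonneg_left h1 (abs_nonneg θ)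
    have : w n = |θ| * br n ^ (r / 2) := rfl
    linarith
  have main : ∀ n, Dl l θ n ≤ α * w n ^ 2 + α * w n ^ 4 := by
    by_cases hex : ∃ n, w0 ≤ w n
    · classical
      set n0 := Nat.find hex with hn0
      have hge : ∀ n, n0 ≤ n → w0 ≤ w n := fun n h => by
        have h1 := Nat.find_spec hex
        refine h1.trans (mul_le_mul_of_nonneg_left ?_ (abs_nonneg _))
        exact Real.rpow_le_rpow (br_pos _).le (br_mono h) (by linarith)
      have hlt : ∀ n, n < n0 → w n ≤ w0 := fun n h => (not_le.1 (Nat.find_min hex h)).le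
      refine GT.cmp hc P.hp (Dl l θ) (fun n => α * w n ^ 2 + α * w n ^ 4)
        (fun n => C3 * (w n + w n ^ 2 + w n ^ 3 + w n ^ 4) * br n ^ (-δ)) n0 ?_ ?_ ?_ ?_
      · intro n h
        have := hbig n (hge n h)
        exact P.self n (by omega)
      · intro n h
        have := hbig n (hge n h)
        exact h3 n θ (w n) (by omega) rfl
      · intro n h
        have hg := hge n h
        have hb := hbig n hg
        have hs := hn1 n (by omega)
        have e : TT (fun _ => (M : ℝ)) p n (fun n => α * w n ^ 2 + α * w n ^ 4) =
            α * θ ^ 2 * TT (fun _ => (M : ℝ)) p n (fun k => br k ^ r) + α * θ ^ 4 * TT (fun _ => (M : ℝ)) p n (fun k => br k ^ (2 * r)) := by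
          rw [← TT_mul, ← TT_mul, ← TT_add]
          congr 1; funext k; rw [hw2, hw4]; ring
        rw [e]
        set b := br n ^ (-δ) with hbdef
        have hb0 : 0 < b := br_rpow_pos _ _
        set c := br n ^ (-(1 / 2) : ℝ) with hcdef
        have hcb : c ≤ b := br_le_of n (by linarith [P.hδ4])
        have f1 : br n ^ (r - 1 / 2) = br n ^ r * c := by rw [hcdef, br_mul]; congr 1
        have f2 : br n ^ (2 * r - 1 / 2) = br n ^ (2 * r) * c := by rw [hcdef, br_mul]; congr 1
        have g1 := (abs_le.1 (h4 n)).2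
        have g2 := (abs_le.1 (h5 n)).2
        rw [f1] at g1
        rw [f2] at g2
        have hr0 := br_rpow_pos n r
        have h2r0 := br_rpow_pos n (2 * r)
        have k1 : TT (fun _ => (M : ℝ)) p n (fun k => br k ^ r) ≤ br n ^ r * (1 + C4 * b) := by
          have i1 := mul_le_mul_of_nonneg_right hl1 hr0.le
          have i2 := mul_le_mul_of_nonneg_left hcb (by positivity : 0 ≤ C4 * br n ^ r)
          linarith
        have k2 : TT (fun _ => (M : ℝ)) p n (fun k => br k ^ (2 * r)) ≤ br n ^ (2 * r) * (1 - κ + C5 * b) := by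
          have i2 := mul_le_mul_of_nonneg_left hcb (by positivity : 0 ≤ C5 * br n ^ (2 * r))
          have i3 : ∑ i, (M : ℝ) * p i ^ (2 * r) = 1 - κ := by rw [hκ]; ring
          rw [i3] at g2
          linarith
        have k3 := mul_le_mul_of_nonneg_left k1 (by positivity : 0 ≤ α * θ ^ 2)
        have k4 := mul_le_mul_of_nonneg_left k2 (by positivity : 0 ≤ α * θ ^ 4)
        have k5 : α * θ ^ 2 * (br n ^ r * (1 + C4 * b)) = α * w n ^ 2 * (1 + C4 * b) := by rw [hw2]; ring
        have k6 : α * θ ^ 4 * (br n ^ (2 * r) * (1 - κ + C5 * b)) = α * w n ^ 4 * (1 - κ + C5 * b) := by rw [hw4]; ring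
        have hx0 := hwn n
        set x := w n with hx
        have q : w0 ^ 3 ≤ x ^ 3 := pow_le_pow_left₀ hw00.le hg 3
        have q3 : w0 ^ 3 * x ^ 4 ≤ x ^ 4 := mul_le_of_le_one_left (by positivity) (pow_le_one₀ hw00.le hw01)
        have qa : ∀ j k : ℕ, j + k = 3 → w0 ^ 3 * x ^ (j + 1) ≤ x ^ 4 := fun j k hjk => by
          have i1 : w0 ^ k ≤ x ^ k := pow_le_pow_left₀ hw00.le hg k
          have i2 : w0 ^ j ≤ 1 := pow_le_one₀ hw00.le hw01
          have i3 : w0 ^ 3 = w0 ^ j * w0 ^ k := by rw [← pow_add, hjk]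
          have i4 : x ^ 4 = x ^ k * x ^ (j + 1) := by rw [← pow_add]; congr 1; omega
          rw [i3, i4]
          refine mul_le_mul_of_nonneg_right ?_ (by positivity)
          exact (mul_le_of_le_one_left (by positivity) i2).trans i1
        have q0 := qa 0 3 rfl
        have q1 := qa 1 2 rfl
        have q2 := qa 2 1 rfl
        norm_num at q0 q1 q2
        have L1 : α * C4 * x ^ 2 + α * C5 * x ^ 4 + C3 * (x + x ^ 2 + x ^ 3 + x ^ 4) ≤ Cs * x ^ 4 := by
          have hCs2 : Cs * w0 ^ 3 = α * C4 + α * C5 + 4 * C3 := by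
            rw [hCs]; exact div_mul_cancel₀ _ (by positivity)
          refine le_of_mul_le_mul_right ?_ (by positivity : 0 < w0 ^ 3)
          have hCs3 : Cs * x ^ 4 * w0 ^ 3 = (α * C4 + α * C5 + 4 * C3) * x ^ 4 := by
            rw [← hCs2]; ring
          rw [hCs3]
          have j1 := mul_le_mul_of_nonneg_left q1 (by positivity : 0 ≤ α * C4)
          have j2 := mul_le_mul_of_nonneg_left q3 (by positivity : 0 ≤ α * C5)
          have j3 := mul_le_mul_of_nonneg_left (add_le_add (add_le_add (add_le_add q0 q1) q2) q3) hC3.le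
          linarith
        have L2 := mul_le_mul_of_nonneg_right L1 hb0.le
        have L3 := mul_le_mul_of_nonneg_right hs (by positivity : 0 ≤ x ^ 4)
        linarith
      · intro n h
        exact hlow n (hlt n h)
    · push Not at hex
      exact fun n => hlow n (hex n).le
  refine (main n).trans ?_
  have h2 : w n ^ 2 ≤ K ^ 2 := pow_le_pow_left₀ (hwn n) hn 2
  have h4 : w n ^ 4 ≤ K ^ 4 := pow_le_pow_left₀ (hwn n) hn 4
  have h6 : α * (K ^ 2 + K ^ 4) = ε := by rw [hα]; field_simp
  have := mul_le_mul_of_nonneg_left (add_le_add h2 h4) hα0.le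
  linarith

end GT

namespace GT

theorem per_low (G : ℝ → ℝ) (h : ℝ) (hh : 0 < h) (hG : Continuous G) (hp : ∀ y, G (y + h) = G y) (h0 : ∀ y, 0 < G y) :
    ∃ B, 0 < B ∧ ∀ y, B ≤ G y := by
  have hper : Function.Periodic G h := hp
  obtain ⟨z, hz, H⟩ := isCompact_Icc.exists_isMinOn (s := Set.Icc 0 h) ⟨0, le_refl _, hh.le⟩ hG.continuousOn
  refine ⟨G z, h0 z, fun y => ?_⟩
  obtain ⟨x, hx, e⟩ := hper.exists_mem_Ico₀ hh y
  rw [e]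
  exact H ⟨hx.1, hx.2.le⟩

section
variable {ι : Type*} {p : ι → ℝ} {h s : ℝ} {f : ℕ → ℝ} {G : ℝ → ℝ}

theorem Asy.low (a : Asy p h s f G) (h0 : ∀ y, 0 < G y) :
    ∃ k, 0 < k ∧ ∀ᶠ n : ℕ in atTop, k * br n ^ s ≤ f n := by
  obtain ⟨B, hB, H⟩ := per_low G h a.hh a.cont a.per h0
  refine ⟨B / 4, by positivity, ?_⟩
  have h1 := a.lim.eventually (lt_mem_nhds (by linarith : -(B / 2) < 0))
  have h2 := (br_div_lim s).eventually (gt_mem_nhds (by norm_num : (1 : ℝ) < 2))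
  filter_upwards [h1, h2, eventually_gt_atTop 0] with n h3 h4 hn
  have hn0 : (0 : ℝ) < (n : ℝ) ^ s := Real.rpow_pos_of_pos (by exact_mod_cast hn) s
  rw [div_lt_iff₀ hn0] at h4
  have h5 : B / 2 ≤ f n / (n : ℝ) ^ s := by linarith [H (Real.log n)]
  rw [le_div_iff₀ hn0] at h5
  have := mul_le_mul_of_nonneg_left h4.le (by positivity : 0 ≤ B / 4)
  linarith

theorem Asy.out (a : Asy p h s f G) (h0 : ∀ y, 0 < G y) :
    Continuous (fun x => G (h * x)) ∧ (∀ x, G (h * (x + 1)) = G (h * x)) ∧ (∀ x, 0 < G (h * x)) ∧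
    ∃ e : ℕ → ℝ, Tendsto e atTop (𝓝 0) ∧ ∀ᶠ n : ℕ in atTop,
      f n = G (h * Real.logb (Real.exp h) n) * (n : ℝ) ^ s * (1 + e n) := by
  have hh := a.hh
  refine ⟨a.cont.comp (continuous_const.mul continuous_id), fun x => ?_, fun x => h0 _,
    fun n => (f n / (n : ℝ) ^ s - G (Real.log n)) / G (Real.log n), ?_, ?_⟩
  · rw [mul_add, mul_one, a.per]
  · obtain ⟨B, hB, H⟩ := per_low G h a.hh a.cont a.per h0
    have h1 := a.lim.abs.div_const B
    rw [abs_zero, zero_div] at h1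
    refine squeeze_zero_norm (fun n => ?_) h1
    rw [norm_div, Real.norm_eq_abs, Real.norm_eq_abs, abs_of_pos (h0 _)]
    exact div_le_div_of_nonneg_left (abs_nonneg _) hB (H _)
  · filter_upwards [eventually_gt_atTop 0] with n hn
    have hn0 : (0 : ℝ) < (n : ℝ) ^ s := Real.rpow_pos_of_pos (by exact_mod_cast hn) s
    have e : h * Real.logb (Real.exp h) n = Real.log n := by
      unfold Real.logb; rw [Real.log_exp]; field_simp
    rw [e]
    have := h0 (Real.log n)
    field_simp
    ring
end

variable {M A : ℕ} {p : Fin A → ℝ} {ρ : ℝ} {l : ℕ → Measure ℝ} {r δ h : ℝ} {G : ℝ → ℝ}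

theorem br_tendsto (s : ℝ) (hs : 0 < s) : Tendsto (fun n : ℕ => br n ^ s) atTop atTop := by
  refine (tendsto_rpow_atTop hs).comp ?_
  unfold br
  exact tendsto_atTop_add_const_right _ _ tendsto_natCast_atTop_atTop

theorem Par.cf_lim (P : Par M p ρ l r δ) (a : Asy p h r (vv l) G) (h0 : ∀ y, 0 < G y) (t : ℝ) :
    Tendsto (fun n => cf l (t / √(vv l n)) n) atTop (𝓝 (gs (t ^ 2 / 2))) := by
  obtain ⟨k, hk, hlow⟩ := a.low h0
  obtain ⟨Cv, hCv, hv⟩ := a.bound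
  have hr : 0 < r := by linarith [P.hrρ, P.toSys.ρ_ge]
  have hvinf : Tendsto (vv l) atTop atTop :=
    tendsto_atTop_mono' _ hlow ((br_tendsto r hr).const_mul_atTop hk)
  have hθ : Tendsto (fun n => t / √(vv l n)) atTop (𝓝 0) :=
    (Real.tendsto_sqrt_atTop.comp hvinf).const_div_atTop t
  rw [Metric.tendsto_atTop']
  intro ε hε
  obtain ⟨θ0, hθ0, H⟩ := P.D_small hv (|t| / √k + 1) (ε / 2) (by positivity) (by positivity)
  have h1 := hθ.abs.eventually (gt_mem_nhds (by rwa [abs_zero] : |(0 : ℝ)| < θ0))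
  obtain ⟨N, hN⟩ := eventually_atTop.1 (h1.and (hlow.and (hvinf.eventually_gt_atTop 0)))
  refine ⟨N, fun n hn => ?_⟩
  obtain ⟨h2, h3, h4⟩ := hN n hn.le
  have hs : 0 < √(vv l n) := Real.sqrt_pos.2 h4
  have h5 := H _ h2 n ?_
  · unfold Dl at h5
    have e : (t / √(vv l n)) ^ 2 * vv l n / 2 = t ^ 2 / 2 := by
      rw [div_pow, Real.sq_sqrt h4.le]; field_simp
    rw [e] at h5
    rw [dist_eq_norm]
    linarith
  · have h6 : √k * br n ^ (r / 2) ≤ √(vv l n) := by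
      have := Real.sqrt_le_sqrt h3
      rw [Real.sqrt_mul hk.le] at this
      have e : √(br n ^ r) = br n ^ (r / 2) := by
        rw [Real.sqrt_eq_rpow, ← Real.rpow_mul (br_pos n).le]; congr 1; ring
      rwa [e] at this
    have h7 : |t / √(vv l n)| * br n ^ (r / 2) ≤ |t| / √k := by
      rw [abs_div, abs_of_pos hs, div_mul_eq_mul_div, div_le_div_iff₀ hs (Real.sqrt_pos.2 hk), mul_assoc]
      refine mul_le_mul_of_nonneg_left ?_ (abs_nonneg _)
      linarith
    linarith

/-- normalised law -/
theorem Par.clt (P : Par M p ρ l r δ) (a : Asy p h r (vv l) G) (h0 : ∀ y, 0 < G y) (f : BoundedContinuousFunction ℝ ℝ) :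
    Tendsto (fun n => ∫ x, f ((x - ee l n) / √(vv l n)) ∂(l n)) atTop (𝓝 (∫ x, f x ∂(gaussianReal 0 1))) := by
  have hpr : ∀ n, IsProbabilityMeasure (l n) := fun n => (P.gd n).prob
  have hm : ∀ n, Measurable (fun x : ℝ => (x - ee l n) / √(vv l n)) := fun n => by fun_prop
  have hpr' : ∀ n, IsProbabilityMeasure ((l n).map (fun x : ℝ => (x - ee l n) / √(vv l n))) :=
    fun n => Measure.isProbabilityMeasure_map (hm n).aemeasurable
  let Q : ℕ → ProbabilityMeasure ℝ := fun n => ⟨(l n).map (fun x : ℝ => (x - ee l n) / √(vv l n)), hpr' n⟩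
  let Q0 : ProbabilityMeasure ℝ := ⟨gaussianReal 0 1, inferInstance⟩
  have key : Tendsto Q atTop (𝓝 Q0) := by
    rw [ProbabilityMeasure.tendsto_iff_tendsto_charFun]
    intro t
    have e0 : charFun (Q0 : Measure ℝ) t = gs (t ^ 2 / 2) := by
      change charFun (gaussianReal 0 1) t = _
      rw [charFun_gaussianReal, gs]
      push_cast
      congr 1
      simp
    rw [e0]
    refine (P.cf_lim a h0 t).congr fun n => ?_
    change _ = charFun ((l n).map (fun x : ℝ => (x - ee l n) / √(vv l n))) t
    rw [charFun_apply_real, integral_map (hm n).aemeasurable (by fun_prop), cf_int]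
    refine integral_congr_ae (Eventually.of_forall fun x => ?_)
    simp only
    congr 1
    push_cast
    ring
  rw [ProbabilityMeasure.tendsto_iff_forall_integral_tendsto] at key
  refine (key f).congr fun n => ?_
  change ∫ x, f x ∂((l n).map (fun x : ℝ => (x - ee l n) / √(vv l n))) = _
  rw [integral_map (hm n).aemeasurable (by fun_prop)]

end GT

namespace GT

theorem sys_nu {M A : ℕ} {p : Fin A → ℝ} {ρ : ℝ} (μL : Measure (List (Fin M) → Fin A)) [IsProbabilityMeasure μL]
    (hM1 : 1 ≤ M) (hA : 2 ≤ A) (hw : IsW p) (hp : ∀ a, 0 < p a ∧ p a < 1) (hM : (M : ℝ) * ∑ a, p a ^ 2 < 1)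
    (hρ : (M : ℝ) * ∑ a, p a ^ ρ = 1) (hμL : IsLabelingMeasure p μL) : Sys M p ρ (nu μL) :=
  ⟨hM1, hA, hw, hp, hM, hρ, nu_gd hw hp hM hμL ⟨0, by omega⟩, nu_step hw hp hM hμL ⟨0, by omega⟩, nu_small⟩

theorem fin_unif {A : ℕ} (p : Fin A → ℝ) (hs : ∑ j, p j = 1) :
    (∀ j, p j = 1 / (A : ℝ)) ↔ ∀ a b, p a = p b := by
  refine ⟨fun h a b => by rw [h a, h b], fun h j => ?_⟩
  have h1 : ∑ i, p i = ∑ i : Fin A, p j := Finset.sum_congr rfl fun i _ => h i j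
  rw [hs, Finset.sum_const, Finset.card_univ, Fintype.card_fin, nsmul_eq_mul] at h1
  have hA : (A : ℝ) ≠ 0 := by
    rintro h0; rw [h0, zero_mul] at h1; exact one_ne_zero h1
  field_simp
  linarith

theorem Sys.v_asy {M A : ℕ} {p : Fin A → ℝ} {ρ : ℝ} {l : ℕ → Measure ℝ} (S : Sys M p ρ l) {h : ℝ} (R : RenH p h)
    (hu : ¬ ∀ a b, p a = p b) : ∃ G, Asy p h (2 * ρ - 1) (vv l) G ∧ ∀ y, 0 < G y := by
  rcases eq_or_lt_of_le S.ρ_ge with h1 | h1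
  · exact S.v_asy_one R h1.symm
  · exact S.v_asy_gen R h1 hu

end GT

/-- **Mean, variance and CLT for the number of leaves of a G-trie** (Theorem 3). -/
theorem gtrie_leaves_asymptotics
    {M A : ℕ} (hM : 1 ≤ M) (hA : 2 ≤ A)
    (p : Fin A → ℝ) (hp0 : ∀ j, 0 < p j) (hp1 : ∀ j, p j < 1)
    (hpsum : ∑ j, p j = 1)
    (hnonexp : ∑ j, (p j) ^ 2 < 1 / (M : ℝ))
    (ρ : ℝ) (hρ : ∑ j, (p j) ^ ρ = 1 / (M : ℝ))
    (μL : Measure (List (Fin M) → Fin A)) [IsProbabilityMeasure μL]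
    (hμL : IsLabelingMeasure p μL)
    (μ : (n : ℕ) → Measure (Fin n → List (Fin M) → Fin A))
    (hμ : ∀ n, μ n = Measure.pi fun _ => μL)
    (EL VL : ℕ → ℝ)
    (hEL : ∀ n, EL n = ∫ Ls, leafCount Ls ∂(μ n))
    (hVL : ∀ n, VL n = variance (fun Ls => leafCount Ls) (μ n)) :
    ∃ a : ℝ, 1 < a ∧
    ∃ HE HV : ℝ → ℝ,
      Continuous HE ∧ (∀ x, HE (x + 1) = HE x) ∧ (∀ x, 0 < HE x) ∧
      Continuous HV ∧ (∀ x, HV (x + 1) = HV x) ∧ (∀ x, 0 < HV x) ∧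
      (∃ e : ℕ → ℝ, Tendsto e atTop (𝓝 0) ∧
        ∀ᶠ n : ℕ in atTop, EL n = HE (Real.logb a n) * (n : ℝ) ^ ρ * (1 + e n)) ∧
      ((∀ j, p j = 1 / (A : ℝ)) →
        ∃ e : ℕ → ℝ, Tendsto e atTop (𝓝 0) ∧
          ∀ᶠ n : ℕ in atTop, VL n = HV (Real.logb a n) * (n : ℝ) ^ ρ * (1 + e n)) ∧
      ((¬ ∀ j, p j = 1 / (A : ℝ)) →
        ∃ e : ℕ → ℝ, Tendsto e atTop (𝓝 0) ∧
          ∀ᶠ n : ℕ in atTop,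
            VL n = HV (Real.logb a n) * (n : ℝ) ^ (2 * ρ - 1) * (1 + e n)) ∧
      ∀ f : BoundedContinuousFunction ℝ ℝ,
        Tendsto (fun n => ∫ Ls, f ((leafCount Ls - EL n) / Real.sqrt (VL n)) ∂(μ n)) atTop
          (𝓝 (∫ x, f x ∂(gaussianReal 0 1))) := by
  have hM0 : (0 : ℝ) < M := by exact_mod_cast hM
  have hw : GT.IsW p := ⟨fun j => (hp0 j).le, hpsum⟩
  have hp : ∀ a, 0 < p a ∧ p a < 1 := fun a => ⟨hp0 a, hp1 a⟩
  have hM2 : (M : ℝ) * ∑ a, p a ^ 2 < 1 := by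
    rw [lt_div_iff₀ hM0] at hnonexp; linarith
  have hρ2 : (M : ℝ) * ∑ a, p a ^ ρ = 1 := by rw [hρ]; field_simp
  have S : GT.Sys M p ρ (GT.nu μL) := GT.sys_nu μL hM hA hw hp hM2 hρ2 hμL
  have hne := S.ne
  have a0 : Fin A := ⟨0, by omega⟩
  have hae : ∀ n, AEMeasurable (fun L : Fin n → List (Fin M) → Fin A => leafCount L) (Measure.pi fun _ : Fin n => μL) :=
    fun n => (GT.leaf_ae hw hp hM2 hμL a0 n).2.1
  have hE : ∀ n, EL n = GT.ee (GT.nu μL) n := fun n => by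
    rw [hEL, hμ]
    unfold GT.ee GT.mE GT.nu
    rw [integral_map (hae n) (by fun_prop)]
  have hV : ∀ n, VL n = GT.vv (GT.nu μL) n := fun n => by
    rw [hVL, hμ, variance_eq_integral (hae n)]
    unfold GT.vv GT.mV GT.mE GT.nu
    rw [integral_map (hae n) (by fun_prop), integral_map (hae n) (by fun_prop)]
  have hI : ∀ (f : BoundedContinuousFunction ℝ ℝ) n, ∫ Ls, f ((leafCount Ls - EL n) / Real.sqrt (VL n)) ∂(μ n) =
      ∫ x, f ((x - GT.ee (GT.nu μL) n) / Real.sqrt (GT.vv (GT.nu μL) n)) ∂(GT.nu μL n) := fun f n => by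
    rw [hμ, hE, hV]
    have hn : GT.nu μL n = Measure.map (fun L : Fin n → List (Fin M) → Fin A => leafCount L) (Measure.pi fun _ => μL) := rfl
    generalize GT.ee (GT.nu μL) n = e
    generalize GT.vv (GT.nu μL) n = v
    rw [hn, integral_map (hae n) (by fun_prop)]
  obtain ⟨h, R⟩ := GT.exists_renH p hp
  obtain ⟨GE, aE, pE⟩ := S.e_asy R
  obtain ⟨cE, perE, posE, eE⟩ := aE.out pE
  have hunif := GT.fin_unif p hpsum
  refine ⟨Real.exp h, Real.one_lt_exp_iff.2 R.hh, fun x => GE (h * x), ?_⟩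
  simp only [hI]
  simp only [hE, hV]
  by_cases hu : ∀ j, p j = 1 / (A : ℝ)
  · obtain ⟨GV, aV, pV⟩ := S.v_asy_unif R (hunif.1 hu)
    obtain ⟨cV, perV, posV, eV⟩ := aV.out pV
    exact ⟨fun x => GV (h * x), cE, perE, posE, cV, perV, posV, eE, fun _ => eV, fun hn => absurd hu hn,
      fun f => (S.par_unif (hunif.1 hu)).clt aV pV f⟩
  · obtain ⟨GV, aV, pV⟩ := S.v_asy R (fun h => hu (hunif.2 h))
    obtain ⟨cV, perV, posV, eV⟩ := aV.out pV
    exact ⟨fun x => GV (h * x), cE, perE, posE, cV, perV, posV, eE, fun hn => absurd hn hu, fun _ => eV,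
      fun f => S.par_gen.clt aV pV f⟩
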